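/- (Enhanced Pólya–Szegő–type estimate.) Let N ≥ 2, 0 < s < 1 and 1 ≤ q < 2*_s := 2N/(N−2s). There exists a constant C₁ > 0, depending only on N and s, with the following property: for every open bounded set Ω ⊆ ℝ^N of positive measure admitting a first minimizer u for λ_{s,q}(Ω), setting U(x,z) = (P_z ∗ u)(x), E_{t,z} = {x ∈ ℝ^N : U(x,z) > t} and μ_z(t) = |E_{t,z}|, for every open ball B ⊆ ℝ^N with |B| = |Ω| one has λ_{s,q}(Ω) − λ_{s,q}(B) ≥ C₁ ∫₀^∞ z^{1−2s} ( ∫₀^∞ A(E_{t,z})² μ_z(t)^{2(N−1)/N} / (−μ_z'(t)) dt ) dz, where μ_z'(t) denotes the derivative of the non-increasing function t ↦ μ_z(t) (which exists for almost every t), with the convention that the integrand is taken to be 0 at points t where μ_z is not differentiable or where μ_z'(t) = 0, and with the convention A(E_{t,z}) = 0 when |E_{t,z}| = 0. -/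

import Mathlib

open MeasureTheory Filter
open scoped ENNReal NNReal Topology FourierTransform RealInnerProductSpace

noncomputable section

/-- Euclidean space ℝ^N -/
abbrev Eu (N : ℕ) := EuclideanSpace ℝ (Fin N)

/-- Squared Gagliardo seminorm `[u]_{W^{s,2}}²`, as an extended nonnegative real. -/
def gagliardoSq (N : ℕ) (s : ℝ) (u : Eu N → ℝ) : ℝ≥0∞ :=
  ∫⁻ x, ∫⁻ y, ENNReal.ofReal (|u x - u y| ^ 2 / ‖x - y‖ ^ ((N : ℝ) + 2 * s))

/-- Squared Gagliardo seminorm, as a real number. -/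
def gagliardoSqR (N : ℕ) (s : ℝ) (u : Eu N → ℝ) : ℝ :=
  (gagliardoSq N s u).toReal

/-- The sharp fractional Poincaré–Sobolev constant
`λ_{s,q}(Ω) = inf { [u]_{W^{s,2}}² : u ∈ C_c^∞(Ω), ‖u‖_{L^q(Ω)} = 1 }`. -/
def sobolevConst (N : ℕ) (s q : ℝ) (Ω : Set (Eu N)) : ℝ :=
  sInf { c : ℝ | ∃ u : Eu N → ℝ, ContDiff ℝ (⊤ : ℕ∞) u ∧ HasCompactSupport u ∧
    tsupport u ⊆ Ω ∧ (∫ x in Ω, |u x| ^ q) = 1 ∧ c = gagliardoSqR N s u }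

/-- The Fraenkel asymmetry `A(Ω)`. -/
def asym (N : ℕ) (Ω : Set (Eu N)) : ℝ :=
  sInf { c : ℝ | ∃ (x₀ : Eu N) (r : ℝ), 0 < r ∧
    volume (Metric.ball x₀ r) = volume Ω ∧
    c = (volume (symmDiff Ω (Metric.ball x₀ r))).toReal / (volume Ω).toReal }

/-- The normalizing constant `β_{N,s}`. -/
def betaC (N : ℕ) (s : ℝ) : ℝ :=
  (∫ x : Eu N, ((1 : ℝ) + ‖x‖ ^ 2) ^ (-((N : ℝ) + 2 * s) / 2))⁻¹

/-- The Poisson kernel `P_z(x) = β_{N,s} z^{2s} (z² + |x|²)^{-(N+2s)/2}`. -/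
def poisson (N : ℕ) (s z : ℝ) (x : Eu N) : ℝ :=
  betaC N s * z ^ (2 * s) * ((z ^ 2 + ‖x‖ ^ 2) ^ (-((N : ℝ) + 2 * s) / 2))

/-- The Caffarelli–Silvestre extension `U(x,z) = (P_z ∗ u)(x)`. -/
def csExt (N : ℕ) (s : ℝ) (u : Eu N → ℝ) (x : Eu N) (z : ℝ) : ℝ :=
  ∫ y, poisson N s z (x - y) * u y

/-- A first minimizer for `λ_{s,q}(Ω)`: a nonnegative measurable function, vanishing a.e.
outside `Ω`, with unit `L^q` norm, realizing the infimum, and positive inside `Ω`. -/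
def IsFirstMinimizer (N : ℕ) (s q : ℝ) (Ω : Set (Eu N)) (u : Eu N → ℝ) : Prop :=
  Measurable u ∧ (∀ x, 0 ≤ u x) ∧ (∀ᵐ x, x ∉ Ω → u x = 0) ∧
  (∫ x in Ω, u x ^ q) = 1 ∧ gagliardoSqR N s u = sobolevConst N s q Ω ∧
  ∀ x ∈ Ω, 0 < u x

/-- The level `T` from (4.1): `T = sup { t > 0 : |{u > t}| ≥ |Ω| (1 - A(Ω)/9) }`. -/
def levelT (N : ℕ) (Ω : Set (Eu N)) (u : Eu N → ℝ) : ℝ :=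
  sSup { t : ℝ | 0 < t ∧
    volume Ω * ENNReal.ofReal (1 - asym N Ω / 9) ≤ volume {x | t < u x} }


/-- The distribution function `μ_z(t) = |{x : U(x,z) > t}|` of the horizontal level sets
of the Caffarelli–Silvestre extension. -/
def distFn (N : ℕ) (s : ℝ) (u : Eu N → ℝ) (z t : ℝ) : ℝ :=
  (volume {x | t < csExt N s u x z}).toReal

open ENNReal (ofReal ofReal_mul ofReal_add ofReal_le_ofReal ofReal_of_nonpos ofReal_le_one
  ofReal_ne_top toReal_pos ofReal_toReal toReal_nonneg ofReal_one ofReal_zero toReal_ofReal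
  ofReal_le_ofReal_iff toReal_mono toReal_mul toReal tendsto_ofReal ofReal_pow mul_top
  ofReal_lt_top ofReal_sub mul_lt_top)
open Real (norm_eq_abs sq_sqrt sqrt_nonneg rpow_nonneg rpow_pos_of_pos lt_sqrt sqrt_pos
  sqrt_eq_rpow rpow_natCast rpow_mul rpow_one div_rpow rpow_sub mul_rpow inv_rpow rpow_neg rpow_add
  rpow_zero dist_eq rpow_le_rpow sqrt_mul sqrt_sq zero_rpow rpow_le_one norm_of_nonneg sqrt_le_left
  volume_Ioo rpow_two one_rpow)
open Set (indicator_of_mem indicator_of_notMem Ioc indicator univ mem_preimage Icc Iic Iio Ioi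
  mem_setOf_eq Ici mem_Ici uIcc uIcc_of_le inter_comm sdiff_subset compl_Iic mem_inter_iff
  inter_subset_left inter_assoc Ioo mem_iUnion Ico)
open Metric (closedBall mem_closedBall ball measure_ball_pos ball_subset_ball mem_ball)
open Function (comp_def comp comp_apply uncurry)
open intervalIntegral (integral_of_le integral_hasDerivAt_right integral_Iic_sub_Iic
  integral_add_adjacent_intervals)
open MeasureTheory.Measure (addHaar_smul restrict_apply)

section

local notation "vol" => Measure.real volume

variable {N n : ℕ} {s z t r c σ δ : ℝ} {L : ℝ≥0} {E F : Set (Eu N)} {f g : Eu N → ℝ} {x y : Eu N}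
  {i j : Fin N} {J : Finset (Fin N)}

/-! ### Splitting off the first coordinate -/

/-- The point of `ℝ^{n+1}` with first coordinate `t` and remaining coordinates `y`. -/
def consE (t : ℝ) (y : Eu n) : Eu (n + 1) := WithLp.toLp 2 (Fin.cons t y.ofLp)

@[simp] lemma consE_zero (t : ℝ) (y : Eu n) : consE t y 0 = t := rfl

@[simp] lemma consE_succ (t : ℝ) (y : Eu n) (i : Fin n) : consE t y i.succ = y i := rfl

/-- Forget the first coordinate. -/
def tailE (x : Eu (n + 1)) : Eu n := WithLp.toLp 2 (fun i => x i.succ)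

@[simp] lemma tailE_apply (x : Eu (n + 1)) (i : Fin n) : tailE x i = x i.succ := rfl

@[simp] lemma tailE_consE (t : ℝ) (y : Eu n) : tailE (consE t y) = y := by ext i; simp

@[simp] lemma consE_tailE (x : Eu (n + 1)) : consE (x 0) (tailE x) = x := by
  ext i; refine Fin.cases ?_ (fun i => ?_) i <;> simp

lemma norm_sq_consE (t : ℝ) (y : Eu n) : ‖consE t y‖ ^ 2 = t ^ 2 + ‖y‖ ^ 2 := by
  simp [EuclideanSpace.norm_sq_eq, Fin.sum_univ_succ]

lemma consE_sub (t t' : ℝ) (y y' : Eu n) : consE t y - consE t' y' = consE (t - t') (y - y') := by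
  ext i; refine Fin.cases ?_ (fun i => ?_) i <;> simp

lemma consE_add (t t' : ℝ) (y y' : Eu n) : consE t y + consE t' y' = consE (t + t') (y + y') := by
  ext i; refine Fin.cases ?_ (fun i => ?_) i <;> simp

/-- The inclusion of the last `n` coordinates. -/
def incE (n : ℕ) : Eu n →ₗᵢ[ℝ] Eu (n + 1) where
  toFun y := consE 0 y
  map_add' x y := by simp [consE_add]
  map_smul' c x := by ext i; refine Fin.cases ?_ (fun i => ?_) i <;> simp
  norm_map' x := by have h := norm_sq_consE 0 x; simp_all

lemma incE_apply (y : Eu n) : incE n y = consE 0 y := rfl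

/-- The first basis vector. -/
def eZero (n : ℕ) : Eu (n + 1) := consE 1 0

lemma consE_eq (t : ℝ) (y : Eu n) : consE t y = t • eZero n + incE n y := by
  ext i; refine Fin.cases ?_ (fun i => ?_) i <;> simp [eZero, incE_apply]

lemma norm_eZero (n : ℕ) : ‖eZero n‖ = 1 := by
  have h1 : (0 : ℝ) ≤ ‖consE (n := n) 1 0‖ := norm_nonneg _
  rw [eZero, ← sq_eq_sq₀ h1 zero_le_one]; simpa using norm_sq_consE (n := n) 1 0

lemma continuous_consE : Continuous (fun p : ℝ × Eu n => consE p.1 p.2) := by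
  simp_rw [consE_eq]; fun_prop

lemma continuous_tailE : Continuous (tailE : Eu (n + 1) → Eu n) := by
  unfold tailE
  exact (PiLp.continuous_toLp 2 _).comp (by fun_prop)

/-- `ℝ × ℝ^n ≃ ℝ^{n+1}` as measurable spaces. -/
def consEquiv (n : ℕ) : ℝ × Eu n ≃ᵐ Eu (n + 1) where
  toFun p := consE p.1 p.2
  invFun x := (x 0, tailE x)
  left_inv p := by simp
  right_inv x := by simp
  measurable_toFun := continuous_consE.measurable
  measurable_invFun := by
    refine Measurable.prodMk ?_ continuous_tailE.measurable
    exact (by fun_prop : Continuous fun x : Eu (n + 1) => x 0).measurable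

lemma measurePreserving_consEquiv (n : ℕ) : MeasurePreserving (consEquiv n) volume volume := by
  have h1 : MeasurePreserving (fun p : ℝ × Eu n => (p.1, p.2.ofLp)) volume volume :=
    (MeasurePreserving.id volume).prod (PiLp.volume_preserving_ofLp (Fin n))
  have h4 : MeasurePreserving (fun p : ℝ × Eu n => (Fin.cons p.1 p.2.ofLp : Fin (n + 1) → ℝ))
      volume volume := by
    have e : (fun p : ℝ × Eu n => (Fin.cons p.1 p.2.ofLp : Fin (n + 1) → ℝ)) =
        (⇑(MeasurableEquiv.piFinSuccAbove (fun _ : Fin (n + 1) => ℝ) 0).symm ∘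
          fun p : ℝ × Eu n => (p.1, p.2.ofLp)) := by measurability
    rw [e]; exact ((volume_preserving_piFinSuccAbove (fun _ : Fin (n + 1) => ℝ) 0).symm).comp h1
  exact (PiLp.volume_preserving_toLp (Fin (n + 1))).comp h4

lemma lintegral_consE {f : Eu (n + 1) → ℝ≥0∞} (hf : Measurable f) :
    ∫⁻ x, f x = ∫⁻ t, ∫⁻ y, f (consE t y) := by
  rw [← (measurePreserving_consEquiv n).lintegral_comp hf]
  exact lintegral_prod _ (hf.comp (consEquiv n).measurable).aemeasurable

lemma ae_consE {p : Eu (n + 1) → Prop} (hp : ∀ᵐ x, p x) : ∀ᵐ t : ℝ, ∀ᵐ y : Eu n, p (consE t y) := by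
  exact Measure.ae_ae_of_ae_prod ((measurePreserving_consEquiv n).quasiMeasurePreserving.ae hp)

lemma ae_of_ae_zero {p : ℝ → Prop} (hp : ∀ᵐ t, p t) : ∀ᵐ x : Eu (n + 1), p (x 0) := by
  have h1 : ∀ᵐ q : ℝ × Eu n, p q.1 := Measure.quasiMeasurePreserving_fst.ae hp
  exact (measurePreserving_consEquiv n).symm.quasiMeasurePreserving.ae h1

lemma volume_consE {E : Set (Eu (n + 1))} (hE : MeasurableSet E) :
    volume E = ∫⁻ t, volume (consE t ⁻¹' E) := by
  rw [← lintegral_indicator_one hE, lintegral_consE (by fun_prop (disch := assumption))]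
  congr 1; ext t
  rw [← lintegral_indicator_one]
  · rfl
  · exact (continuous_consE.comp (Continuous.prodMk_right t)).measurable hE

lemma measurable_volume_slice {E : Set (Eu (n + 1))} (hE : MeasurableSet E) :
    Measurable fun t => volume (consE t ⁻¹' E) := by
  have := measurable_measure_prodMk_left (ν := (volume : Measure (Eu n)))
    ((consEquiv n).measurable hE)
  exact this

lemma measurableSet_slice {E : Set (Eu (n + 1))} (hE : MeasurableSet E) (t : ℝ) :
    MeasurableSet (consE t ⁻¹' E) :=
  (continuous_consE.comp (Continuous.prodMk_right t)).measurable hE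

/-! ### Relaxed perimeter -/

/-- Total variation of a Lipschitz function. -/
def gradE (g : Eu N → ℝ) : ℝ≥0∞ := ∫⁻ x, ‖fderiv ℝ g x‖ₑ

/-- Admissible competitors: Lipschitz, compactly supported, with values in `[0,1]`. -/
structure Adm (g : Eu N → ℝ) : Prop where
  lip : ∃ L, LipschitzWith L g
  supp : HasCompactSupport g
  nonneg : ∀ x, 0 ≤ g x
  le_one : ∀ x, g x ≤ 1

/-- `L¹` distance from a function to an indicator. -/
def errE (g : Eu N → ℝ) (E : Set (Eu N)) : ℝ≥0∞ := ∫⁻ x, ‖g x - E.indicator 1 x‖ₑ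

/-- Relaxed perimeter. -/
def per (E : Set (Eu N)) : ℝ≥0∞ :=
  ⨆ (ε : ℝ≥0∞) (_ : 0 < ε), ⨅ (g : Eu N → ℝ) (_ : Adm g ∧ errE g E ≤ ε), gradE g

lemma per_le_liminf {g : ℕ → Eu N → ℝ} (hg : ∀ k, Adm (g k))
    (h : Tendsto (fun k => errE (g k) E) atTop (𝓝 0)) :
    per E ≤ liminf (fun k => gradE (g k)) atTop := by
  refine iSup₂_le fun ε hε => ?_
  refine le_liminf_of_le (by isBoundedDefault) ?_
  filter_upwards [h.eventually (ge_mem_nhds hε)] with k hk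
  exact iInf₂_le (g k) ⟨hg k, hk⟩

lemma exists_gradE_le (hE : per E ≠ ⊤) {ε : ℝ≥0∞} (hε : 0 < ε)
    {δ : ℝ≥0∞} (hδ : δ ≠ 0) : ∃ g, Adm g ∧ errE g E ≤ ε ∧ gradE g ≤ per E + δ := by
  have h1 : (⨅ (g : Eu N → ℝ) (_ : Adm g ∧ errE g E ≤ ε), gradE g) < per E + δ :=
    (le_iSup₂ (f := fun (ε : ℝ≥0∞) (_ : 0 < ε) =>
      ⨅ (g : Eu N → ℝ) (_ : Adm g ∧ errE g E ≤ ε), gradE g) ε hε).trans_lt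
      (ENNReal.lt_add_right hE hδ)
  simp only [iInf_lt_iff] at h1
  grind

lemma exists_seq_gradE (hE : per E ≠ ⊤) :
    ∃ g : ℕ → Eu N → ℝ, (∀ k, Adm (g k)) ∧ (∀ k, errE (g k) E ≤ (2⁻¹ : ℝ≥0∞) ^ k) ∧
      ∀ k, gradE (g k) ≤ per E + (2⁻¹ : ℝ≥0∞) ^ k := by
  have hp : ∀ k : ℕ, (0 : ℝ≥0∞) < (2⁻¹ : ℝ≥0∞) ^ k := fun k =>
    pos_iff_ne_zero.2 (pow_ne_zero _ (by simp))
  choose g h1 h2 h3 using fun k : ℕ => exists_gradE_le hE (hp k) (hp k).ne'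
  exact ⟨g, h1, h2, h3⟩

lemma Adm.continuous (hg : Adm g) : Continuous g := by obtain ⟨L, hL⟩ := hg.lip; exact hL.continuous

lemma Adm.integrable (hg : Adm g) : Integrable g :=
  hg.continuous.integrable_of_hasCompactSupport hg.supp

lemma Adm.ae_differentiableAt (hg : Adm g) : ∀ᵐ x, DifferentiableAt ℝ g x := by
  obtain ⟨L, hL⟩ := hg.lip; exact hL.ae_differentiableAt

lemma integrable_of_bdd_tsupport {F : Type*} [NormedAddCommGroup F] {f : Eu N → F}
    (hm : AEStronglyMeasurable f) {C : ℝ} (hC : ∀ x, ‖f x‖ ≤ C) {K : Set (Eu N)}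
    (hK : IsCompact K) (hf : ∀ x ∉ K, f x = 0) : Integrable f := by
  have h : IntegrableOn f K := by
    refine Measure.integrableOn_of_bounded (M := C) hK.measure_lt_top.ne hm ?_
    exact .of_forall fun x => hC x
  rwa [integrableOn_iff_integrable_of_support_subset] at h
  intro x hx
  by_contra hxK
  exact hx (hf x hxK)

lemma Adm.fderiv_eq_zero (x : Eu N) (hx : x ∉ tsupport g) : fderiv ℝ g x = 0 := by
  by_contra h
  exact hx (support_fderiv_subset ℝ h)

lemma Adm.integrable_fderiv (hg : Adm g) : Integrable (fderiv ℝ g) := by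
  obtain ⟨L, hL⟩ := hg.lip
  refine integrable_of_bdd_tsupport (measurable_fderiv ℝ g).aestronglyMeasurable (C := L)
    (fun x => norm_fderiv_le_of_lipschitz ℝ hL) hg.supp fun x hx => Adm.fderiv_eq_zero x hx

lemma Adm.gradE_eq (hg : Adm g) : gradE g = ofReal (∫ x, ‖fderiv ℝ g x‖) := by
  rw [ofReal_integral_norm_eq_lintegral_enorm hg.integrable_fderiv]; rfl

lemma Adm.slice {g : Eu (n + 1) → ℝ} (hg : Adm g) (t : ℝ) : Adm fun y => g (consE t y) := by
  obtain ⟨L, hL⟩ := hg.lip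
  have hi : Isometry (fun y : Eu n => consE t y) := by
    refine Isometry.of_dist_eq fun x y => ?_
    rw [dist_eq_norm, consE_sub, sub_self, ← incE_apply, (incE n).norm_map, dist_eq_norm]
  refine ⟨⟨L, ?_⟩, ?_, fun y => hg.nonneg _, fun y => hg.le_one _⟩
  · simpa [comp_def] using hL.comp hi.lipschitz
  · exact hg.supp.comp_isClosedEmbedding hi.isClosedEmbedding

/-- The difference quotient in the first direction converges in `L¹` sense against bounded
weights. -/
lemma Adm.tendsto_diffquot {g : Eu (n + 1) → ℝ} (hg : Adm g) {σ : ℝ → ℝ}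
    (hσm : Measurable σ) (hσ : ∀ t, |σ t| ≤ 1) {h : ℕ → ℝ} (hh : ∀ k, 0 < h k)
    (hh1 : ∀ k, h k ≤ 1) (hh0 : Tendsto h atTop (𝓝 0)) :
    Tendsto (fun k => ∫ x : Eu (n + 1), σ (x 0) * ((g (x + h k • eZero n) - g x) / h k)) atTop
      (𝓝 (∫ x, σ (x 0) * fderiv ℝ g x (eZero n))) := by
  obtain ⟨L, hL⟩ := hg.lip; obtain ⟨R, hR⟩ := hg.supp.isBounded.subset_closedBall 0
  refine tendsto_integral_of_dominated_convergence
    ((closedBall 0 (R + 1)).indicator fun _ => (L : ℝ)) ?_ ?_ ?_ ?_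
  · intro k; have := hg.continuous
    exact ((hσm.comp (by fun_prop)).mul (by fun_prop : Continuous fun x : Eu (n + 1) =>
      (g (x + h k • eZero n) - g x) / h k).measurable).aestronglyMeasurable
  · rw [integrable_indicator_iff measurableSet_closedBall]
    exact integrableOn_const measure_closedBall_lt_top.ne
  · intro k; refine .of_forall fun x => ?_; by_cases hx : x ∈ closedBall 0 (R + 1)
    · rw [indicator_of_mem hx, norm_mul, norm_div, norm_eq_abs (h k), abs_of_pos (hh k)]
      have h1 : ‖g (x + h k • eZero n) - g x‖ ≤ L * h k := by
        have := hL.dist_le_mul (x + h k • eZero n) x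
        rwa [dist_eq_norm, dist_eq_norm, add_sub_cancel_left, norm_smul, norm_eZero, mul_one,
          norm_eq_abs (h k), abs_of_pos (hh k)] at this
      calc ‖σ (x 0)‖ * (‖g (x + h k • eZero n) - g x‖ / h k) ≤ 1 * L := by
            refine mul_le_mul (hσ _) ?_ (div_nonneg (norm_nonneg _) (hh k).le) zero_le_one
            rwa [div_le_iff₀ (hh k)]
        _ = L := one_mul _
    · rw [indicator_of_notMem hx]; have hx' : R + 1 < ‖x‖ := by simpa using hx
      have e1 : g x = 0 := by
        by_contra hne; have := hR (subset_tsupport g hne); simp at this; linarith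
      have e2 : g (x + h k • eZero n) = 0 := by
        by_contra hne
        have := hR (subset_tsupport g hne); simp only [mem_closedBall, dist_zero_right] at this
        have h2 : ‖x‖ ≤ ‖x + h k • eZero n‖ + ‖h k • eZero n‖ := by
          simpa using norm_sub_le (x + h k • eZero n) (h k • eZero n)
        rw [norm_smul, norm_eZero, mul_one, norm_eq_abs, abs_of_pos (hh k)] at h2; linarith [hh1 k]
      simp [e1, e2]
  · filter_upwards [hg.ae_differentiableAt] with x hx; refine Tendsto.const_mul _ ?_
    have h2 := (hx.hasFDerivAt.hasLineDerivAt (eZero n)).tendsto_slope_zero_right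
    have h3 : Tendsto h atTop (𝓝[>] 0) := tendsto_nhdsWithin_iff.2 ⟨hh0, .of_forall fun k => hh k⟩
    refine (h2.comp h3).congr fun k => ?_; simp [div_eq_inv_mul]

lemma integral_consE {f : Eu (n + 1) → ℝ} (hf : Integrable f) :
    ∫ x, f x = ∫ t, ∫ y, f (consE t y) := by
  rw [← (measurePreserving_consEquiv n).integral_comp']
  refine integral_prod _ ?_
  exact (measurePreserving_consEquiv n).integrable_comp_of_integrable hf

/-- Integral of the slice. -/
def sliceInt (g : Eu (n + 1) → ℝ) (t : ℝ) : ℝ := ∫ y, g (consE t y)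

lemma norm_le_norm_consE (t : ℝ) (y : Eu n) : ‖y‖ ≤ ‖consE t y‖ := by
  have h := norm_sq_consE t y
  refine le_of_sq_le_sq ?_ (norm_nonneg _)
  nlinarith [sq_nonneg t]

lemma Adm.continuous_sliceInt {g : Eu (n + 1) → ℝ} (hg : Adm g) : Continuous (sliceInt g) := by
  obtain ⟨R, hR⟩ := hg.supp.isBounded.subset_closedBall 0
  refine continuous_of_dominated (F := fun t y => g (consE t y))
    (bound := (closedBall 0 R).indicator fun _ => (1 : ℝ)) ?_ ?_ ?_ ?_
  · exact fun t => (hg.slice t).continuous.aestronglyMeasurable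
  · refine fun t => .of_forall fun y => ?_; by_cases hy : y ∈ closedBall 0 R
    · rw [indicator_of_mem hy, norm_eq_abs, abs_of_nonneg (hg.nonneg _)]; exact hg.le_one _
    · rw [indicator_of_notMem hy, norm_le_zero_iff]
      by_contra hne; have h1 := hR (subset_tsupport g hne)
      simp only [mem_closedBall, dist_zero_right] at h1 hy; linarith [norm_le_norm_consE t y]
  · rw [integrable_indicator_iff measurableSet_closedBall]
    exact integrableOn_const measure_closedBall_lt_top.ne
  · exact .of_forall fun y => hg.continuous.comp (continuous_consE.comp (Continuous.prodMk_left y))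

lemma add_eZero_zero (x : Eu (n + 1)) (h : ℝ) : (x + h • eZero n) 0 = x 0 + h := by simp [eZero]

lemma measurable_of_eq_sub_jump {τ σ : ℝ → ℝ} (hτ : Monotone τ) {j t₀ : ℝ}
    (hσ : ∀ t, σ t = τ t - if t₀ < t then j else 0) : Measurable σ := by
  rw [funext hσ]
  exact hτ.measurable.sub (Measurable.ite measurableSet_Ioi measurable_const measurable_const)

lemma Adm.slice_parts {g : Eu (n + 1) → ℝ} (hg : Adm g) {τ σ : ℝ → ℝ}
    (hτ : Monotone τ) {j t₀ : ℝ} (hσ : ∀ t, σ t = τ t - if t₀ < t then j else 0)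
    (hσ1 : ∀ t, |σ t| ≤ 1) :
    ∫⁻ x : Eu (n + 1), ofReal (deriv τ (x 0)) * ofReal (g x) ≤
      ofReal (-(∫ x, σ (x 0) * fderiv ℝ g x (eZero n)) + j * sliceInt g t₀) := by
  have hσm := measurable_of_eq_sub_jump hτ hσ
  have hx0 : Measurable fun x : Eu (n + 1) => x 0 := by fun_prop
  set h : ℕ → ℝ := fun k => 1 / ((k : ℝ) + 1) with hh_def
  have hh : ∀ k, 0 < h k := fun k => by positivity
  have hh1 : ∀ k, h k ≤ 1 := fun k => by
    rw [hh_def]; simp only; rw [div_le_one (by positivity)]; linarith [(Nat.cast_nonneg k : (0:ℝ) ≤ k)]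
  have hh0 : Tendsto h atTop (𝓝 0) := tendsto_one_div_add_atTop_nhds_zero_nat
  have hh0' : Tendsto h atTop (𝓝[>] 0) := tendsto_nhdsWithin_iff.2 ⟨hh0, .of_forall fun k => hh k⟩
  have hI := hg.tendsto_diffquot hσm hσ1 hh hh1 hh0
  have hgi := hg.integrable
  have bddmul : ∀ (f : ℝ → ℝ), Measurable f → (∃ C, ∀ t, |f t| ≤ C) →
      Integrable fun x : Eu (n + 1) => f (x 0) * g x := by
    rintro f hf ⟨C, hC⟩
    exact hgi.bdd_mul (hf.comp hx0).aestronglyMeasurable (.of_forall fun x => hC (x 0))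
  have hτσ : ∀ t, τ t = σ t + if t₀ < t then j else 0 := fun t => by rw [hσ]; ring
  have hτb : ∀ t, |τ t| ≤ 1 + |j| := fun t => by grind
  -- summation by parts for difference quotients
  have hparts : ∀ k, (∫ x : Eu (n + 1), (τ (x 0) - τ (x 0 - h k)) / h k * g x) =
      -(∫ x : Eu (n + 1), σ (x 0) * ((g (x + h k • eZero n) - g x) / h k)) +
        j * ((h k)⁻¹ * ∫ t in t₀..(t₀ + h k), sliceInt g t) := by
    intro k; have e1 : ∫ x : Eu (n + 1), σ (x 0) * g (x + h k • eZero n) =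
        ∫ x : Eu (n + 1), σ (x 0 - h k) * g x := by
      rw [← integral_add_right_eq_self (fun x : Eu (n + 1) => σ (x 0 - h k) * g x) (h k • eZero n)]
      simp only [add_eZero_zero, add_sub_cancel_right]
    have i1 : Integrable fun x : Eu (n + 1) => σ (x 0) * g x := bddmul σ hσm ⟨1, hσ1⟩
    have i2 : Integrable fun x : Eu (n + 1) => σ (x 0 - h k) * g x :=
      bddmul (fun t => σ (t - h k)) (hσm.comp (by fun_prop)) ⟨1, fun t => hσ1 _⟩
    have i3 : Integrable fun x : Eu (n + 1) => σ (x 0) * g (x + h k • eZero n) := by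
      have := i2.comp_add_right (h k • eZero n)
      simpa only [add_eZero_zero, add_sub_cancel_right] using this
    have e2 : ∫ x : Eu (n + 1), σ (x 0) * ((g (x + h k • eZero n) - g x) / h k) =
        (h k)⁻¹ * ((∫ x : Eu (n + 1), σ (x 0 - h k) * g x) - ∫ x : Eu (n + 1), σ (x 0) * g x) := by
      rw [← e1, ← integral_sub i3 i1, ← integral_const_mul]; congr 1; ext x; field_simp
    have e3 : ∫ t in t₀..(t₀ + h k), sliceInt g t =
        ∫ x : Eu (n + 1), (Ioc t₀ (t₀ + h k)).indicator 1 (x 0) * g x := by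
      rw [integral_consE (bddmul _ (measurable_one.indicator measurableSet_Ioc) ⟨1, fun t => by
        by_cases ht : t ∈ Ioc t₀ (t₀ + h k) <;> simp [ht]⟩),
        integral_of_le (by linarith [hh k]),
        ← integral_indicator measurableSet_Ioc]
      congr 1; ext t; simp only [consE_zero, integral_const_mul]
      by_cases ht : t ∈ Ioc t₀ (t₀ + h k) <;> simp [ht, sliceInt]
    have i4 : Integrable fun x : Eu (n + 1) => (Ioc t₀ (t₀ + h k)).indicator 1 (x 0) * g x :=
      bddmul _ (measurable_one.indicator measurableSet_Ioc) ⟨1, fun t => by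
        by_cases ht : t ∈ Ioc t₀ (t₀ + h k) <;> simp [ht]⟩
    have i5 : Integrable fun x : Eu (n + 1) => σ (x 0) * g x - σ (x 0 - h k) * g x := i1.sub i2
    rw [e2, e3, ← mul_neg, neg_sub, ← integral_sub i1 i2, mul_left_comm, ← mul_add,
      ← integral_const_mul, ← integral_add i5 (i4.const_mul j), ← integral_const_mul]
    congr 1; ext x; have : τ (x 0) - τ (x 0 - h k) = σ (x 0) - σ (x 0 - h k) +
        j * (Ioc t₀ (t₀ + h k)).indicator 1 (x 0) := by
      rw [hτσ, hτσ (x 0 - h k)]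
      have := hh k; by_cases h1 : t₀ < x 0 <;> by_cases h2 : x 0 ≤ t₀ + h k
      · simp [indicator, h1, h2, show ¬ (t₀ < x 0 - h k) by linarith]; ring
      · simp [indicator, h1, h2, show (t₀ < x 0 - h k) by linarith]
      · simp [indicator, h1, h2]
      · linarith
    rw [this]; field_simp
  have hw : Tendsto (fun k => (h k)⁻¹ * ∫ t in t₀..(t₀ + h k), sliceInt g t) atTop
      (𝓝 (sliceInt g t₀)) := by
    have hd : HasDerivAt (fun u => ∫ t in t₀..u, sliceInt g t) (sliceInt g t₀) t₀ :=
      integral_hasDerivAt_right (by simp)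
        hg.continuous_sliceInt.stronglyMeasurable.stronglyMeasurableAtFilter
        hg.continuous_sliceInt.continuousAt
    have := hd.tendsto_slope_zero_right.comp hh0'; simpa [comp_def] using this
  have hlim : Tendsto (fun k => ∫ x : Eu (n + 1), (τ (x 0) - τ (x 0 - h k)) / h k * g x) atTop
      (𝓝 (-(∫ x, σ (x 0) * fderiv ℝ g x (eZero n)) + j * sliceInt g t₀)) := by
    simp_rw [hparts]; exact hI.neg.add (hw.const_mul j)
  have hquot : ∀ k t, 0 ≤ (τ t - τ (t - h k)) / h k := fun k t =>
    div_nonneg (sub_nonneg.2 (hτ (by linarith [hh k]))) (hh k).le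
  have hdm : ∀ k, Measurable fun t => (τ t - τ (t - h k)) / h k := fun k =>
    (hτ.measurable.sub (hτ.measurable.comp (by fun_prop))).div_const _
  have hlint : ∀ k, ∫⁻ x : Eu (n + 1), ofReal ((τ (x 0) - τ (x 0 - h k)) / h k * g x) =
      ofReal (∫ x : Eu (n + 1), (τ (x 0) - τ (x 0 - h k)) / h k * g x) := by
    intro k; rw [ofReal_integral_eq_lintegral_ofReal]
    · refine bddmul (fun t => (τ t - τ (t - h k)) / h k) (hdm k) ⟨2 * (1 + |j|) / h k, fun t => ?_⟩
      rw [abs_div, abs_of_pos (hh k)]; have := hh k; gcongr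
      calc _ ≤ |τ t| + |τ (t - h k)| := abs_sub _ _
        _ ≤ _ := by linarith [hτb t, hτb (t - h k)]
    · exact .of_forall fun x => mul_nonneg (hquot k _) (hg.nonneg x)
  have hae : ∀ᵐ x : Eu (n + 1), ofReal (deriv τ (x 0)) * ofReal (g x) ≤
      liminf (fun k => ofReal ((τ (x 0) - τ (x 0 - h k)) / h k * g x)) atTop := by
    filter_upwards [ae_of_ae_zero hτ.ae_differentiableAt] with x hx
    have h1 : Tendsto (fun k => (τ (x 0) - τ (x 0 - h k)) / h k) atTop (𝓝 (deriv τ (x 0))) := by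
      have h2 := hx.hasDerivAt.tendsto_slope_zero_left
      have h3 : Tendsto (fun k => -h k) atTop (𝓝[<] 0) :=
        tendsto_nhdsWithin_iff.2 ⟨by simpa using hh0.neg, .of_forall fun k => by simpa using hh k⟩
      refine (h2.comp h3).congr fun k => ?_
      have := (hh k).ne'; simp only [comp, smul_eq_mul, ← sub_eq_add_neg]; field_simp; ring
    have h4 := (ENNReal.continuous_ofReal.tendsto _).comp (h1.mul_const (g x))
    rw [← ofReal_mul hτ.deriv_nonneg]; exact h4.liminf_eq.ge
  calc _ ≤ ∫⁻ x : Eu (n + 1),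
        liminf (fun k => ofReal ((τ (x 0) - τ (x 0 - h k)) / h k * g x)) atTop :=
        lintegral_mono_ae hae
    _ ≤ liminf (fun k => ∫⁻ x : Eu (n + 1),
        ofReal ((τ (x 0) - τ (x 0 - h k)) / h k * g x)) atTop := by
        refine lintegral_liminf_le fun k => ?_
        exact (((hdm k).comp hx0).mul hg.continuous.measurable).ennreal_ofReal
    _ = _ := by simp_rw [hlint]; exact ((ENNReal.continuous_ofReal.tendsto _).comp hlim).liminf_eq

lemma enn_le_liminf_add (u v : ℕ → ℝ≥0∞) :
    liminf u atTop + liminf v atTop ≤ liminf (fun k => u k + v k) atTop := by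
  simp only [liminf_eq_iSup_iInf_of_nat]
  rw [ENNReal.iSup_add_iSup_of_monotone]
  · refine iSup_mono fun n => ?_
    refine le_iInf₂ fun k hk => ?_; exact add_le_add (iInf₂_le k hk) (iInf₂_le k hk)
  · exact fun a b hab => le_iInf₂ fun k hk => iInf₂_le k (hab.trans hk)
  · exact fun a b hab => le_iInf₂ fun k hk => iInf₂_le k (hab.trans hk)

lemma sqrt_mul_norm_comp_incE_le (L : Eu (n + 1) →L[ℝ] ℝ) (hσ : |σ| ≤ 1) :
    √(1 - σ ^ 2) * ‖L.comp (incE n).toContinuousLinearMap‖ ≤ ‖L‖ + σ * L (eZero n) := by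
  have h1 : 0 ≤ 1 - σ ^ 2 := by simp_all
  have key : ∀ y : Eu n, ‖y‖ ≤ 1 → √(1 - σ ^ 2) * L (incE n y) ≤ ‖L‖ + σ * L (eZero n) := by
    intro y hy; have h2 : ‖consE (-σ) (√(1 - σ ^ 2) • y)‖ ≤ 1 := by
      rw [← sq_le_one_iff₀ (norm_nonneg _), norm_sq_consE, norm_smul, mul_pow, norm_eq_abs,
        sq_abs, sq_sqrt h1]
      have : ‖y‖ ^ 2 ≤ 1 := (sq_le_one_iff₀ (norm_nonneg _)).2 hy; nlinarith
    have h3 := (le_abs_self _).trans (L.le_opNorm (consE (-σ) (√(1 - σ ^ 2) • y)))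
    have h4 : ‖L‖ * ‖consE (-σ) (√(1 - σ ^ 2) • y)‖ ≤ ‖L‖ :=
      mul_le_of_le_one_right (norm_nonneg _) h2
    rw [consE_eq] at h3 h4; simp only [map_add, map_smul, smul_eq_mul] at h3 h4; linarith
  have hB : 0 ≤ ‖L‖ + σ * L (eZero n) := by simpa using key 0 (by simp)
  rcases eq_or_lt_of_le (sqrt_nonneg (1 - σ ^ 2)) with h0 | h0
  · rw [← h0, zero_mul]; exact hB
  rw [mul_comm, ← le_div_iff₀ h0]
  refine ContinuousLinearMap.opNorm_le_of_unit_norm (div_nonneg hB h0.le) fun y hy => ?_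
  rw [le_div_iff₀ h0, mul_comm, norm_eq_abs]
  change √(1 - σ ^ 2) * |L (incE n y)| ≤ _
  rcases abs_cases (L (incE n y)) with ⟨h, -⟩ | ⟨h, -⟩
  · rw [h]; exact key y hy.le
  · rw [h, ← map_neg, ← map_neg]; exact key (-y) (by rw [norm_neg, hy])

lemma Adm.gradE_slice_ae {g : Eu (n + 1) → ℝ} (hg : Adm g) :
    ∀ᵐ t : ℝ, gradE (fun y => g (consE t y)) =
      ∫⁻ y, ‖(fderiv ℝ g (consE t y)).comp (incE n).toContinuousLinearMap‖ₑ := by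
  filter_upwards [ae_consE hg.ae_differentiableAt] with t ht
  refine lintegral_congr_ae ?_
  filter_upwards [ht] with y hy
  have h1 : HasFDerivAt (fun y : Eu n => consE t y) (incE n).toContinuousLinearMap y := by
    have : (fun y : Eu n => consE t y) = fun y => t • eZero n + (incE n).toContinuousLinearMap y := by
      funext y; exact consE_eq t y
    rw [this]; exact (ContinuousLinearMap.hasFDerivAt _).const_add _
  have h2 : HasFDerivAt (fun y => g (consE t y)) _ y := hy.hasFDerivAt.comp y h1
  rw [h2.fderiv]

lemma measurable_fderiv_comp_incE (g : Eu (n + 1) → ℝ) :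
    Measurable fun x => ‖(fderiv ℝ g x).comp (incE n).toContinuousLinearMap‖ := by
  have : Continuous fun L : Eu (n + 1) →L[ℝ] ℝ => ‖L.comp (incE n).toContinuousLinearMap‖ := by
    fun_prop
  exact this.measurable.comp (measurable_fderiv ℝ g)

lemma Adm.aemeasurable_gradE_slice {g : Eu (n + 1) → ℝ} (hg : Adm g) :
    AEMeasurable fun t : ℝ => gradE (fun y => g (consE t y)) := by
  refine AEMeasurable.congr ?_ (hg.gradE_slice_ae.mono fun t ht => ht.symm)
  refine Measurable.aemeasurable ?_
  refine Measurable.lintegral_prod_right' (f := fun p : ℝ × Eu n =>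
    ‖(fderiv ℝ g (consE p.1 p.2)).comp (incE n).toContinuousLinearMap‖ₑ) ?_
  simp_rw [← ofReal_norm]
  exact ((measurable_fderiv_comp_incE g).comp continuous_consE.measurable).ennreal_ofReal

lemma Adm.slice_single {g : Eu (n + 1) → ℝ} (hg : Adm g) {τ σ : ℝ → ℝ}
    (hτ : Monotone τ) {j t₀ : ℝ} (hσ : ∀ t, σ t = τ t - if t₀ < t then j else 0)
    (hσ1 : ∀ t, |σ t| ≤ 1) (hj : 0 ≤ j) :
    (∫⁻ t, (ofReal √(1 - σ t ^ 2) * gradE (fun y => g (consE t y)) +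
      ofReal (deriv τ t) * ofReal (sliceInt g t))) ≤
      gradE g + ofReal j * ofReal (sliceInt g t₀) := by
  have hσm := measurable_of_eq_sub_jump hτ hσ
  have hx0 : Measurable fun x : Eu (n + 1) => x 0 := by fun_prop
  set D : Eu (n + 1) → ℝ := fun x => √(1 - σ (x 0) ^ 2) *
    ‖(fderiv ℝ g x).comp (incE n).toContinuousLinearMap‖ with hD
  have hsq : Measurable fun t => √(1 - σ t ^ 2) := by fun_prop
  have hDm : Measurable D := (hsq.comp hx0).mul (measurable_fderiv_comp_incE g)
  have hparts := hg.slice_parts hτ hσ hσ1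
  set I := ∫ x, σ (x 0) * fderiv ℝ g x (eZero n) with hI
  have hgi := hg.integrable_fderiv
  have hie : Integrable fun x : Eu (n + 1) => σ (x 0) * fderiv ℝ g x (eZero n) := by
    refine (hgi.apply_continuousLinearMap (eZero n)).bdd_mul
      (hσm.comp hx0).aestronglyMeasurable (.of_forall fun x => hσ1 (x 0))
  have hD1 : ∀ x, D x ≤ ‖fderiv ℝ g x‖ + σ (x 0) * fderiv ℝ g x (eZero n) :=
    fun x => sqrt_mul_norm_comp_incE_le _ (hσ1 _)
  have hD2 : ∀ x, D x ≤ ‖fderiv ℝ g x‖ := fun x => by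
    have h1 := hD1 x
    have h2 := sqrt_mul_norm_comp_incE_le (fderiv ℝ g x) (σ := -σ (x 0)) (by simpa using hσ1 _)
    simp only [even_two, Even.neg_pow] at h2; linarith
  have hDi : Integrable D := hgi.norm.mono' hDm.aestronglyMeasurable
    (.of_forall fun x => by rw [norm_eq_abs, abs_of_nonneg (by positivity)]; exact hD2 x)
  have e1 : ∫⁻ t, ofReal √(1 - σ t ^ 2) * gradE (fun y => g (consE t y)) = ofReal (∫ x, D x) := by
    rw [ofReal_integral_eq_lintegral_ofReal hDi (.of_forall fun x => by positivity),
      lintegral_consE hDm.ennreal_ofReal]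
    refine lintegral_congr_ae ?_
    filter_upwards [hg.gradE_slice_ae] with t ht; rw [ht, ← lintegral_const_mul]
    · congr 1; ext y; rw [← ofReal_norm, ← ofReal_mul (sqrt_nonneg _)]; rfl
    · simp_rw [← ofReal_norm]; exact ((measurable_fderiv_comp_incE g).comp
        (continuous_consE.comp (Continuous.prodMk_right t)).measurable).ennreal_ofReal
  have e2 : ∫⁻ t, ofReal (deriv τ t) * ofReal (sliceInt g t) =
      ∫⁻ x : Eu (n + 1), ofReal (deriv τ (x 0)) * ofReal (g x) := by
    have hm : Measurable fun x : Eu (n + 1) => ofReal (deriv τ (x 0)) * ofReal (g x) :=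
      ((measurable_deriv τ).comp hx0).ennreal_ofReal.mul hg.continuous.measurable.ennreal_ofReal
    rw [lintegral_consE hm]; congr 1; ext t; simp only [consE_zero]
    rw [lintegral_const_mul _ (hg.slice t).continuous.measurable.ennreal_ofReal,
      ← ofReal_integral_eq_lintegral_ofReal (hg.slice t).integrable
        (.of_forall fun y => hg.nonneg _)]
    rfl
  have hm : AEMeasurable fun t => ofReal √(1 - σ t ^ 2) * gradE fun y => g (consE t y) :=
    hsq.ennreal_ofReal.aemeasurable.mul hg.aemeasurable_gradE_slice
  rw [lintegral_add_left' hm, e1, e2, hg.gradE_eq, ← ofReal_mul hj]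
  have hV : 0 ≤ sliceInt g t₀ := integral_nonneg fun y => hg.nonneg _
  have hDn : 0 ≤ ∫ x, D x := integral_nonneg fun x => by positivity
  refine (add_le_add le_rfl hparts).trans ?_
  rw [← ofReal_add (integral_nonneg fun x => norm_nonneg _) (by positivity)]
  have m1 : ∫ x, D x ≤ (∫ x, ‖fderiv ℝ g x‖) + I := by
    rw [hI, ← integral_add hgi.norm hie]; exact integral_mono hDi (hgi.norm.add hie) hD1
  have m2 : ∫ x, D x ≤ ∫ x, ‖fderiv ℝ g x‖ := integral_mono hDi hgi.norm hD2
  have := mul_nonneg hj hV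
  rcases le_total 0 (-I + j * sliceInt g t₀) with h | h
  · rw [← ofReal_add hDn h]; exact ofReal_le_ofReal (by linarith)
  · rw [ofReal_of_nonpos h, add_zero]; exact ofReal_le_ofReal (by linarith)

/-- The slicing inequality. -/
lemma slice_ineq {E : Set (Eu (n + 1))} (hE : MeasurableSet E) :
    ∀ᵐ t₀ : ℝ, ∀ (τ σ : ℝ → ℝ) (j : ℝ), Monotone τ → 0 ≤ j →
      (∀ t, σ t = τ t - if t₀ < t then j else 0) → (∀ t, |σ t| ≤ 1) →
      ∫⁻ t, (ofReal √(1 - σ t ^ 2) * per (consE t ⁻¹' E) +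
        ofReal (deriv τ t) * volume (consE t ⁻¹' E)) ≤
      per E + ofReal j * volume (consE t₀ ⁻¹' E) := by
  by_cases hP : per E = ⊤
  · simp_all
  obtain ⟨g, hg, herr, hgr⟩ := exists_seq_gradE hP
  have herrm : ∀ k, Measurable fun x => ‖g k x - E.indicator 1 x‖ₑ := fun k =>
    ((hg k).continuous.measurable.sub (measurable_one.indicator hE)).enorm
  have hslice : ∀ k, ∫⁻ t, errE (fun y => g k (consE t y)) (consE t ⁻¹' E) = errE (g k) E := by
    intro k; rw [errE, lintegral_consE (herrm k)]; rfl
  have hslm : ∀ k, Measurable fun t => errE (fun y => g k (consE t y)) (consE t ⁻¹' E) := fun k =>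
    Measurable.lintegral_prod_right' (f := fun p : ℝ × Eu n =>
      ‖g k (consE p.1 p.2) - E.indicator 1 (consE p.1 p.2)‖ₑ)
      ((herrm k).comp continuous_consE.measurable)
  have hsum : ∫⁻ t, ∑' k, errE (fun y => g k (consE t y)) (consE t ⁻¹' E) ≠ ⊤ := by
    rw [lintegral_tsum fun k => (hslm k).aemeasurable]
    refine ne_top_of_le_ne_top ?_ (ENNReal.tsum_le_tsum fun k => (hslice k).le.trans (herr k))
    rw [ENNReal.tsum_geometric]; simp
  have hae : ∀ᵐ t, Tendsto (fun k => errE (fun y => g k (consE t y)) (consE t ⁻¹' E)) atTop (𝓝 0) := by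
    filter_upwards [ae_lt_top (Measurable.tsum hslm) hsum] with t ht
    exact ENNReal.tendsto_atTop_zero_of_tsum_ne_top ht.ne
  have hsl k t : ofReal (sliceInt (g k) t) = ∫⁻ y, ofReal (g k (consE t y)) :=
    ofReal_integral_eq_lintegral_ofReal ((hg k).slice t).integrable (.of_forall fun y => (hg k).nonneg _)
  have hvol1 : ∀ k t, ofReal (sliceInt (g k) t) ≤
      volume (consE t ⁻¹' E) + errE (fun y => g k (consE t y)) (consE t ⁻¹' E) := by
    intro k t; rw [hsl, ← lintegral_indicator_one (measurableSet_slice hE t), errE,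
      ← lintegral_add_left (measurable_one.indicator (measurableSet_slice hE t))]
    refine lintegral_mono fun y => ?_
    rw [← ofReal_norm, norm_eq_abs]; by_cases hy : y ∈ consE t ⁻¹' E
    · simp only [indicator_of_mem hy, Pi.one_apply]
      exact (ofReal_le_one.2 ((hg k).le_one _)).trans le_self_add
    · simp [indicator_of_notMem hy, zero_add, sub_zero, le_abs_self]
  have hvol2 : ∀ k t, volume (consE t ⁻¹' E) ≤
      ofReal (sliceInt (g k) t) + errE (fun y => g k (consE t y)) (consE t ⁻¹' E) := by
    intro k t; rw [hsl, ← lintegral_indicator_one (measurableSet_slice hE t), errE,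
      ← lintegral_add_left ((hg k).slice t).continuous.measurable.ennreal_ofReal]
    refine lintegral_mono fun y => ?_
    rw [← ofReal_norm, norm_eq_abs, ← ofReal_add ((hg k).nonneg _) (abs_nonneg _)]
    by_cases hy : y ∈ consE t ⁻¹' E
    · simp only [indicator_of_mem hy, Pi.one_apply]
      rw [ENNReal.one_le_ofReal]; linarith [neg_abs_le (g k (consE t y) - 1)]
    · simp only [indicator_of_notMem hy, zero_le]
  filter_upwards [hae] with t₀ ht₀ τ σ j hτ hj hσ hσ1; have hσm := measurable_of_eq_sub_jump hτ hσ
  have hsq : Measurable fun t => √(1 - σ t ^ 2) := by fun_prop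
  calc _ ≤ ∫⁻ t, liminf (fun k => ofReal √(1 - σ t ^ 2) * gradE (fun y => g k (consE t y)) +
      ofReal (deriv τ t) * ofReal (sliceInt (g k) t)) atTop := by
        refine lintegral_mono_ae ?_
        filter_upwards [hae] with t ht; refine le_trans (add_le_add ?_ ?_) (enn_le_liminf_add _ _)
        · rw [ENNReal.liminf_const_mul_of_ne_top ofReal_ne_top]
          gcongr; exact per_le_liminf (fun k => (hg k).slice t) ht
        · rw [ENNReal.liminf_const_mul_of_ne_top ofReal_ne_top]
          gcongr; rw [← ENNReal.liminf_add_of_right_tendsto_zero ht]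
          exact le_liminf_of_le (by isBoundedDefault) (.of_forall fun k => hvol2 k t)
    _ ≤ liminf (fun k => ∫⁻ t, (ofReal √(1 - σ t ^ 2) * gradE (fun y => g k (consE t y)) +
      ofReal (deriv τ t) * ofReal (sliceInt (g k) t))) atTop := by
        refine lintegral_liminf_le' fun k => ?_
        refine (hsq.ennreal_ofReal.aemeasurable.mul (hg k).aemeasurable_gradE_slice).add ?_
        exact ((measurable_deriv τ).ennreal_ofReal.mul
          (hg k).continuous_sliceInt.measurable.ennreal_ofReal).aemeasurable
    _ ≤ liminf (fun k => (per E + (2⁻¹ : ℝ≥0∞) ^ k) + ofReal j * (volume (consE t₀ ⁻¹' E) +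
          errE (fun y => g k (consE t₀ y)) (consE t₀ ⁻¹' E))) atTop := by
        refine liminf_le_liminf (.of_forall fun k => ?_)
        refine ((hg k).slice_single hτ hσ hσ1 hj).trans ?_; gcongr
        · exact hgr k
        · exact hvol1 k t₀
    _ = _ := by
        refine Tendsto.liminf_eq ?_
        have h1 : Tendsto (fun k : ℕ => per E + (2⁻¹ : ℝ≥0∞) ^ k) atTop (𝓝 (per E + 0)) :=
          (ENNReal.tendsto_pow_atTop_nhds_zero_of_lt_one (by simp)).const_add _
        have h2 := (ht₀.const_add (volume (consE t₀ ⁻¹' E)))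
        simpa using h1.add (ENNReal.Tendsto.const_mul (a := ofReal j) h2 (Or.inr ofReal_ne_top))

/-! ### Balls and the one-dimensional transport -/

/-- Volume of the unit ball. -/
def omegaB (n : ℕ) : ℝ := (volume (ball (0 : Eu n) 1)).toReal

lemma omegaB_pos (n : ℕ) : 0 < omegaB n :=
  toReal_pos (measure_ball_pos _ _ one_pos).ne' measure_ball_lt_top.ne

lemma volume_ball_eu (x : Eu n) (hr : 0 < r) : volume (ball x r) = ofReal (omegaB n * r ^ n) := by
  rw [Measure.addHaar_ball_of_pos volume x hr, finrank_euclideanSpace_fin, mul_comm,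
    ofReal_mul (omegaB_pos n).le, omegaB, ofReal_toReal measure_ball_lt_top.ne]

lemma omegaB_zero : omegaB 0 = 1 := by
  have h : ball (0 : Eu 0) 1 = univ := by ext x; simp [Subsingleton.elim x 0]
  have h1 := (PiLp.volume_preserving_toLp (Fin 0)).measure_preimage
    (s := univ) MeasurableSet.univ.nullMeasurableSet
  rw [omegaB, h, ← h1, Set.preimage_univ, volume_pi]
  simp

/-- Cross-sectional profile of the unit ball of `ℝ^{n+1}`. -/
def vB (n : ℕ) (S : ℝ) : ℝ := omegaB n * (max 0 (1 - S ^ 2)) ^ ((n : ℝ) / 2)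

lemma continuous_vB (n : ℕ) : Continuous (vB n) := by
  unfold vB
  refine continuous_const.mul (Continuous.rpow_const (by fun_prop) fun x => Or.inr (by positivity))

lemma vB_nonneg (n : ℕ) (S : ℝ) : 0 ≤ vB n S :=
  mul_nonneg (omegaB_pos n).le (rpow_nonneg (le_max_left _ _) _)

lemma vB_pos (n : ℕ) {S : ℝ} (hS : |S| < 1) : 0 < vB n S := by
  have : 0 < 1 - S ^ 2 := by have := (sq_lt_one_iff_abs_lt_one S).2 hS; linarith
  refine mul_pos (omegaB_pos n) (rpow_pos_of_pos (lt_max_of_lt_right this) _)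

lemma slice_ball (R t : ℝ) : consE (n := n) t ⁻¹' ball 0 R =
    if |t| < R then ball 0 √(R ^ 2 - t ^ 2) else ∅ := by
  ext y
  rw [mem_preimage, mem_ball_zero_iff]
  have h := norm_sq_consE t y
  split_ifs with ht
  · rw [mem_ball_zero_iff, lt_sqrt (norm_nonneg _)]
    rw [← sq_lt_sq₀ (norm_nonneg _) ((abs_nonneg t).trans ht.le)]
    constructor <;> intro <;> linarith
  · simp only [Set.mem_empty_iff_false, iff_false, not_lt]
    push Not at ht
    refine ht.trans (abs_le_of_sq_le_sq ?_ (norm_nonneg _)); nlinarith [sq_nonneg ‖y‖]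

lemma volume_slice_ball (ht : |t| < 1) :
    volume (consE (n := n) t ⁻¹' ball 0 1) = ofReal (vB n t) := by
  have h : 0 < 1 - t ^ 2 := by have := (sq_lt_one_iff_abs_lt_one t).2 ht; linarith
  rw [slice_ball, if_pos ht, one_pow, volume_ball_eu _ (sqrt_pos.2 h), vB, max_eq_right h.le,
    sqrt_eq_rpow, ← rpow_natCast, ← rpow_mul h.le]
  congr 3; ring

lemma omegaB_succ (n : ℕ) : omegaB (n + 1) = ∫ S in (-1)..1, vB n S := by
  rw [omegaB, volume_consE measurableSet_ball, integral_of_le (by norm_num),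
    integral_eq_lintegral_of_nonneg_ae (.of_forall fun S => vB_nonneg n S)
      (continuous_vB n).aestronglyMeasurable, ← lintegral_indicator measurableSet_Ioc]
  congr 1
  refine lintegral_congr_ae ?_
  filter_upwards [(by simp [ae_iff] : ∀ᵐ t : ℝ, t ≠ 1)] with t ht1
  by_cases ht : |t| < 1
  · rw [volume_slice_ball ht, indicator_of_mem]; rw [abs_lt] at ht; exact ⟨ht.1, ht.2.le⟩
  · rw [slice_ball, if_neg ht, measure_empty, indicator_of_notMem]; grind

/-- Normalised cumulative volume of the unit ball. -/
def PhiB (n : ℕ) (S : ℝ) : ℝ := (∫ x in (-1)..S, vB n x) / omegaB (n + 1)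

lemma hasDerivAt_PhiB (n : ℕ) (S : ℝ) : HasDerivAt (PhiB n) (vB n S / omegaB (n + 1)) S :=
  (integral_hasDerivAt_right ((continuous_vB n).intervalIntegrable _ _)
    (continuous_vB n).stronglyMeasurable.stronglyMeasurableAtFilter
    (continuous_vB n).continuousAt).div_const _

lemma continuous_PhiB (n : ℕ) : Continuous (PhiB n) :=
  continuous_iff_continuousAt.2 fun S => (hasDerivAt_PhiB n S).continuousAt

lemma PhiB_neg_one (n : ℕ) : PhiB n (-1) = 0 := by simp [PhiB]

lemma PhiB_one (n : ℕ) : PhiB n 1 = 1 := by rw [PhiB, ← omegaB_succ, div_self (omegaB_pos _).ne']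

lemma strictMonoOn_PhiB (n : ℕ) : StrictMonoOn (PhiB n) (Icc (-1) 1) := by
  refine strictMonoOn_of_deriv_pos (convex_Icc _ _) (continuous_PhiB n).continuousOn fun S hS => ?_
  rw [interior_Icc] at hS
  rw [(hasDerivAt_PhiB n S).deriv]
  exact div_pos (vB_pos n (abs_lt.2 hS)) (omegaB_pos _)

/-- Monotone transport of a density on the line onto the profile of the unit ball. -/
lemma exists_transport (n : ℕ) {v : ℝ → ℝ} (hv : Integrable v) (hv0 : ∀ t, 0 ≤ v t)
    (hm : 0 < ∫ t, v t) :
    ∃ T : ℝ → ℝ, Monotone T ∧ (∀ t, T t ∈ Icc (-1 : ℝ) 1) ∧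
      (∀ t, PhiB n (T t) = (∫ x in Iic t, v x) / ∫ x, v x) ∧
      ∀ᵐ t, DifferentiableAt ℝ T t ∧
        v t = (∫ x, v x) / omegaB (n + 1) * vB n (T t) * deriv T t := by
  set m := ∫ t, v t with hm_def; set V : ℝ → ℝ := fun t => ∫ x in Iic t, v x with hV
  have hV0 : ∀ t, 0 ≤ V t := fun t => integral_nonneg fun x => hv0 x
  have hVm : ∀ t, V t ≤ m := fun t => setIntegral_le_integral hv (.of_forall hv0)
  have hVmono : Monotone V := fun a b hab => setIntegral_mono_set hv.integrableOn
    (.of_forall hv0) (HasSubset.Subset.eventuallyLE (Set.Iic_subset_Iic.2 hab))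
  have hex : ∀ t, ∃ S ∈ Icc (-1 : ℝ) 1, PhiB n S = V t / m := by
    intro t
    have := intermediate_value_Icc (by norm_num : (-1 : ℝ) ≤ 1) (continuous_PhiB n).continuousOn
    rw [PhiB_neg_one, PhiB_one] at this
    exact this ⟨div_nonneg (hV0 t) hm.le, (div_le_one hm).2 (hVm t)⟩
  choose T hT1 hT2 using hex; have hTm : Monotone T := fun a b hab => by
    rw [← (strictMonoOn_PhiB n).le_iff_le (hT1 a) (hT1 b), hT2, hT2]
    exact div_le_div_of_nonneg_right (hVmono hab) hm.le
  refine ⟨T, hTm, hT1, hT2, ?_⟩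
  filter_upwards [hTm.ae_differentiableAt, LocallyIntegrable.ae_hasDerivAt_integral hv.locallyIntegrable] with t h1 h2
  refine ⟨h1, ?_⟩; have h3 : HasDerivAt V (v t) t := by
    have h4 : V = fun x => V 0 + ∫ t in (0 : ℝ)..x, v t := by
      funext x
      have := integral_Iic_sub_Iic (μ := volume) (f := v) (a := 0) (b := x) hv.integrableOn
        hv.integrableOn
      simp only [hV]; linarith
    rw [h4]; exact (h2 0).const_add _
  have h5 : HasDerivAt (fun t => PhiB n (T t)) (vB n (T t) / omegaB (n + 1) * deriv T t) t :=
    (hasDerivAt_PhiB n (T t)).comp t h1.hasDerivAt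
  have h6 : HasDerivAt (fun t => PhiB n (T t)) (v t / m) t := by
    have : (fun t => PhiB n (T t)) = fun t => V t / m := funext hT2; rw [this]; exact h3.div_const _
  have h7 := h5.unique h6; grind

/-- Isoperimetric constant. -/
def isoK (n : ℕ) : ℝ := n * omegaB n ^ (1 / (n : ℝ))

lemma isoK_nonneg (n : ℕ) : 0 ≤ isoK n :=
  mul_nonneg (Nat.cast_nonneg _) (rpow_nonneg (omegaB_pos n).le _)

/-- Scaling factor in the transport inequality: inverse radius of the ball of volume `m`. -/
def kapB (N : ℕ) (m : ℝ) : ℝ := (omegaB N / m) ^ (1 / (N : ℝ))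

lemma kapB_pos (N : ℕ) {m : ℝ} (hm : 0 < m) : 0 < kapB N m :=
  rpow_pos_of_pos (div_pos (omegaB_pos N) hm) _

lemma kapB_pow (hN : N ≠ 0) {m : ℝ} (hm : 0 < m) : kapB N m ^ N = omegaB N / m := by
  rw [kapB, ← rpow_natCast, ← rpow_mul (div_pos (omegaB_pos N) hm).le,
    one_div_mul_cancel (by exact_mod_cast hN), rpow_one]

lemma isoK_mul_rpow (hN : N ≠ 0) {m : ℝ} (hm : 0 < m) :
    isoK N * m ^ (((N : ℝ) - 1) / N) = N * kapB N m * m := by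
  have hN' : (N : ℝ) ≠ 0 := by exact_mod_cast hN
  rw [isoK, kapB, div_rpow (omegaB_pos N).le hm.le,
    show ((N : ℝ) - 1) / N = 1 - 1 / N by field_simp, rpow_sub hm, rpow_one]
  ring

/-- The identity behind the transport inequality. -/
lemma transport_identity (hn : n ≠ 0) {m v S d : ℝ} (hm : 0 < m) (hv : 0 < v)
    (hS : S ∈ Icc (-1 : ℝ) 1) (hd : 0 ≤ d)
    (h : v = m / omegaB (n + 1) * vB n S * d) :
    0 < d ∧ 0 < vB n S ∧ √(1 - S ^ 2) * (isoK n * v ^ (((n : ℝ) - 1) / n)) =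
      kapB (n + 1) m * v * (n * (d / kapB (n + 1) m) ^ (-(1 / (n : ℝ)))) ∧
      v = kapB (n + 1) m ^ (-(n : ℤ)) * vB n S * (d / kapB (n + 1) m) := by
  have hn' : (n : ℝ) ≠ 0 := by exact_mod_cast hn
  set k := kapB (n + 1) m with hk; have hkp : 0 < k := kapB_pos _ hm
  have hkN : k ^ (n + 1) = omegaB (n + 1) / m := kapB_pow (by simp) hm
  have hd0 : d ≠ 0 := by rintro rfl; simp at h; linarith
  have hdp : 0 < d := lt_of_le_of_ne hd hd0.symm
  have hB0 : vB n S ≠ 0 := by intro h0; rw [h0] at h; simp at h; linarith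
  have hBp : 0 < vB n S := lt_of_le_of_ne (vB_nonneg n S) hB0.symm
  have hS2 : 0 ≤ 1 - S ^ 2 := by nlinarith [hS.1, hS.2]
  have e1 : √(1 - S ^ 2) * omegaB n ^ (1 / (n : ℝ)) = vB n S ^ (1 / (n : ℝ)) := by
    rw [vB, max_eq_right hS2, mul_rpow (omegaB_pos n).le (rpow_nonneg hS2 _),
      ← rpow_mul hS2, sqrt_eq_rpow, mul_comm]
    congr 2; field_simp
  have hω := omegaB_pos (n + 1); have hv2 : v = k ^ (-(n : ℤ)) * vB n S * (d / k) := by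
    have : m / omegaB (n + 1) = (k ^ (n + 1))⁻¹ := by rw [hkN, inv_div]
    rw [h, this, pow_succ, zpow_neg, zpow_natCast]; field_simp
  refine ⟨hdp, hBp, ?_, hv2⟩; have e2 : vB n S = v * k ^ n * (d / k)⁻¹ := by grind
  have hyp : 0 < d / k := div_pos hdp hkp
  have e3 : vB n S ^ (1 / (n : ℝ)) = v ^ (1 / (n : ℝ)) * k * (d / k) ^ (-(1 / (n : ℝ))) := by
    rw [e2, mul_rpow (by positivity) (by positivity), mul_rpow hv.le (by positivity),
      inv_rpow hyp.le, rpow_neg hyp.le, ← rpow_natCast, ← rpow_mul hkp.le,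
      mul_one_div_cancel hn', rpow_one]
  have e4 : v ^ (1 / (n : ℝ)) * v ^ (((n : ℝ) - 1) / n) = v := by
    rw [← rpow_add hv, show 1 / (n : ℝ) + ((n : ℝ) - 1) / n = 1 by field_simp; ring, rpow_one]
  calc _ = n * (√(1 - S ^ 2) * omegaB n ^ (1 / (n : ℝ))) * v ^ (((n : ℝ) - 1) / n) := by
        rw [isoK]; ring
    _ = k * (v ^ (1 / (n : ℝ)) * v ^ (((n : ℝ) - 1) / n)) * (n * (d / k) ^ (-(1 / (n : ℝ)))) := by
        rw [e1, e3]; ring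
    _ = _ := by rw [e4]

lemma amgm_transport (hn : n ≠ 0) {y : ℝ} (hy : 0 < y) :
    (n : ℝ) + 1 ≤ n * y ^ (-(1 / (n : ℝ))) + y := by
  have hn' : (n : ℝ) ≠ 0 := by exact_mod_cast hn
  set w := y ^ (1 / (n : ℝ)) with hw
  have hwp : 0 < w := rpow_pos_of_pos hy _
  have hyw : y = w ^ n := by
    rw [hw, ← rpow_natCast, ← rpow_mul hy.le, one_div_mul_cancel hn', rpow_one]
  rw [rpow_neg hy.le, ← hw]
  have hb := one_add_mul_le_pow (a := w - 1) (by linarith) n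
  rw [add_sub_cancel] at hb
  rw [hyw]
  have h2 : 2 ≤ w⁻¹ + w := by
    have : w⁻¹ + w - 2 = (w - 1) ^ 2 / w := by field_simp; ring
    have h3 : 0 ≤ (w - 1) ^ 2 / w := by positivity
    linarith
  nlinarith [(Nat.cast_nonneg n : (0 : ℝ) ≤ n)]

/-! ### Isoperimetric inequality and cuts -/

/-- Volume of a slice, as a real number. -/
def sliceVol (E : Set (Eu (n + 1))) (t : ℝ) : ℝ := (volume (consE t ⁻¹' E)).toReal

lemma sliceVol_nonneg (E : Set (Eu (n + 1))) (t : ℝ) : 0 ≤ sliceVol E t := toReal_nonneg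

lemma ae_slice_lt_top {E : Set (Eu (n + 1))} (hE : MeasurableSet E) (hf : volume E ≠ ⊤) :
    ∀ᵐ t : ℝ, volume (consE t ⁻¹' E) < ⊤ :=
  ae_lt_top (measurable_volume_slice hE) (by rwa [← volume_consE hE])

lemma integrable_sliceVol {E : Set (Eu (n + 1))} (hE : MeasurableSet E)
    (hf : volume E ≠ ⊤) : Integrable (sliceVol E) :=
  integrable_toReal_of_lintegral_ne_top (measurable_volume_slice hE).aemeasurable
    (by rwa [← volume_consE hE])

lemma integral_sliceVol {E : Set (Eu (n + 1))} (hE : MeasurableSet E)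
    (hf : volume E ≠ ⊤) : ∫ t, sliceVol E t = (volume E).toReal := by
  rw [volume_consE hE, ← integral_toReal (measurable_volume_slice hE).aemeasurable
    (ae_slice_lt_top hE hf)]
  rfl

/-- The isoperimetric inequality in dimension `n`. -/
def IsoBasic (n : ℕ) : Prop := ∀ E : Set (Eu n), MeasurableSet E → 0 < volume E → volume E ≠ ⊤ →
  ofReal (isoK n * (volume E).toReal ^ (((n : ℝ) - 1) / n)) ≤ per E

lemma eu_zero_volume (F : Set (Eu 0)) : (volume F).toReal = 0 ∨ (volume F).toReal = 1 := by
  rcases F.eq_empty_or_nonempty with h | ⟨x, hx⟩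
  · left; simp [h]
  · right; have h1 : F = univ := Set.eq_univ_of_forall fun y => by rwa [Subsingleton.elim y x]
    have h2 : ball (0 : Eu 0) 1 = univ := by ext x; simp [Subsingleton.elim x 0]
    rw [h1, ← h2]; exact omegaB_zero

lemma transport_pointwise (hI : IsoBasic n) {F : Set (Eu n)} (hF : MeasurableSet F)
    (hFf : volume F ≠ ⊤) {m S d : ℝ} (hm : 0 < m) (hS : S ∈ Icc (-1 : ℝ) 1) (hd : 0 ≤ d)
    (h : (volume F).toReal = m / omegaB (n + 1) * vB n S * d) :
    ofReal ((n + 1) * kapB (n + 1) m * (volume F).toReal) ≤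
      ofReal √(1 - S ^ 2) * per F + ofReal d * volume F := by
  rcases eq_or_lt_of_le (toReal_nonneg (a := volume F)) with h0 | hv
  · rw [← h0]; simp
  rcases eq_or_ne n 0 with rfl | hn
  · have h1 : (volume F).toReal = 1 := by
      rcases eu_zero_volume F with h1 | h1
      · linarith
      · exact h1
    have h2 : volume F = 1 := by rw [← ofReal_toReal hFf, h1, ofReal_one]
    rw [h1] at h ⊢; have h3 : d = kapB 1 m := by
      grind [vB, omegaB_zero, Nat.cast_zero, zero_div, rpow_zero, zero_add, kapB, Nat.cast_one, div_one, rpow_one]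
    rw [h2, h3]; simp
  · obtain ⟨hdp, hBp, hid, -⟩ := transport_identity hn hm hv hS hd h; have hk := kapB_pos (n + 1) hm
    calc _ ≤ ofReal (√(1 - S ^ 2) * (isoK n * (volume F).toReal ^ (((n : ℝ) - 1) / n)) +
          d * (volume F).toReal) := by
          refine ofReal_le_ofReal ?_
          rw [hid]
          have := amgm_transport hn (div_pos hdp hk)
          have e : d * (volume F).toReal = kapB (n + 1) m * (volume F).toReal *
            (d / kapB (n + 1) m) := by field_simp
          rw [e, ← mul_add]
          nlinarith [mul_le_mul_of_nonneg_left this (mul_pos hk hv).le]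
      _ = ofReal √(1 - S ^ 2) * ofReal (isoK n * (volume F).toReal ^ (((n : ℝ) - 1) / n))
          + ofReal d * volume F := by
          rw [ofReal_add, ofReal_mul (sqrt_nonneg _), ofReal_mul hd, ofReal_toReal hFf]
          · exact mul_nonneg (sqrt_nonneg _) (mul_nonneg (isoK_nonneg n) (rpow_nonneg hv.le _))
          · exact mul_nonneg hd hv.le
      _ ≤ _ := by gcongr; exact hI F hF (pos_iff_ne_zero.2 fun h => by simp [h] at hv) hFf

lemma isoBasic_succ (hI : IsoBasic n) : IsoBasic (n + 1) := by
  intro E hE hpos hf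
  set m := (volume E).toReal with hm_def
  have hm : 0 < m := toReal_pos hpos.ne' hf
  have hvi := integral_sliceVol hE hf
  obtain ⟨T, hT1, hT2, -, hT4⟩ := exists_transport n (integrable_sliceVol hE hf)
    (sliceVol_nonneg E) (by rw [hvi]; exact hm)
  rw [hvi] at hT4
  obtain ⟨t₀, ht₀⟩ := (slice_ineq hE).exists
  have h1 := ht₀ T T 0 hT1 le_rfl (fun t => by simp) (fun t => abs_le.2 (hT2 t))
  simp only [ofReal_zero, zero_mul, add_zero] at h1
  refine le_trans ?_ h1
  rw [isoK_mul_rpow (by simp) hm]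
  calc _ = ofReal (∫ t, (n + 1) * kapB (n + 1) m * sliceVol E t) := by
        rw [integral_const_mul, hvi]; push_cast; rfl
    _ = ∫⁻ t, ofReal ((n + 1) * kapB (n + 1) m * sliceVol E t) := by
        rw [ofReal_integral_eq_lintegral_ofReal ((integrable_sliceVol hE hf).const_mul _)]
        have := kapB_pos (n + 1) hm
        exact .of_forall fun t => mul_nonneg (by positivity) (sliceVol_nonneg E t)
    _ ≤ _ := by
        refine lintegral_mono_ae ?_; filter_upwards [hT4, ae_slice_lt_top hE hf] with t ht hft
        exact transport_pointwise hI (measurableSet_slice hE t) hft.ne hm (hT2 t)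
          hT1.deriv_nonneg ht.2

lemma isoBasic_zero : IsoBasic 0 := by intro E hE h1 h2; simp [isoK]

lemma isoBasic (n : ℕ) : IsoBasic n := by
  induction n with
  | zero => exact isoBasic_zero
  | succ n ih => exact isoBasic_succ ih

/-- Cutting a set by a hyperplane. -/
lemma cut_ineq {E : Set (Eu (n + 1))} (hE : MeasurableSet E) (hf : volume E ≠ ⊤) :
    ∀ᵐ t₀ : ℝ, 0 < ∫ t in Iio t₀, sliceVol E t → 0 < ∫ t in Ioi t₀, sliceVol E t →
      ofReal (isoK (n + 1) * ((∫ t in Iio t₀, sliceVol E t) ^ ((n : ℝ) / (n + 1)) +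
          (∫ t in Ioi t₀, sliceVol E t) ^ ((n : ℝ) / (n + 1)))) ≤
      per E + ofReal 2 * volume (consE t₀ ⁻¹' E) := by
  filter_upwards [slice_ineq hE] with t₀ ht₀ hm₁ hm₂
  have hvi := integrable_sliceVol hE hf; set v₁ := (Iio t₀).indicator (sliceVol E) with hv₁
  set v₂ := (Ioi t₀).indicator (sliceVol E) with hv₂
  have e₁ : ∫ t in Iio t₀, sliceVol E t = ∫ t, v₁ t := (integral_indicator measurableSet_Iio).symm
  have e₂ : ∫ t in Ioi t₀, sliceVol E t = ∫ t, v₂ t := (integral_indicator measurableSet_Ioi).symm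
  rw [e₁] at hm₁ ⊢; rw [e₂] at hm₂ ⊢; set m₁ := ∫ t, v₁ t with hm₁d
  set m₂ := ∫ t, v₂ t with hm₂d; have i₁ : Integrable v₁ := hvi.indicator measurableSet_Iio
  have i₂ : Integrable v₂ := hvi.indicator measurableSet_Ioi
  have n₁ : ∀ t, 0 ≤ v₁ t := fun t => Set.indicator_nonneg (fun t _ => sliceVol_nonneg E t) t
  have n₂ : ∀ t, 0 ≤ v₂ t := fun t => Set.indicator_nonneg (fun t _ => sliceVol_nonneg E t) t
  obtain ⟨T, hT1, hT2, hT3, hT4⟩ := exists_transport n i₁ n₁ hm₁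
  obtain ⟨R, hR1, hR2, hR3, hR4⟩ := exists_transport n i₂ n₂ hm₂
  rw [← hm₁d] at hT4 hT3; rw [← hm₂d] at hR4 hR3
  have hTge : ∀ t, t₀ ≤ t → T t = 1 := fun t ht => by
    refine (strictMonoOn_PhiB n).injOn (hT2 t) (by norm_num) ?_
    rw [hT3, PhiB_one, hm₁d, div_eq_one_iff_eq hm₁.ne', ← integral_indicator measurableSet_Iic]
    congr 1; ext x; by_cases hx : x < t₀
    · rw [indicator_of_mem (by exact (hx.le.trans ht))]
    · simp [hv₁, indicator, hx]
  have hRle : ∀ t, t ≤ t₀ → R t = -1 := fun t ht => by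
    refine (strictMonoOn_PhiB n).injOn (hR2 t) (by norm_num) ?_
    rw [hR3, PhiB_neg_one, div_eq_zero_iff]; left; rw [setIntegral_eq_zero_of_forall_eq_zero]
    intro x hx; simp only [hv₂, Set.indicator_apply_eq_zero]; grind
  set τ : ℝ → ℝ := fun t => T t + R t + 1 with hτ
  set σ : ℝ → ℝ := fun t => τ t - if t₀ < t then 2 else 0 with hσ
  have hσ1 : ∀ t, t ≤ t₀ → σ t = T t := fun t ht => by grind
  have hσ2 : ∀ t, t₀ < t → σ t = R t := fun t ht => by grind
  have h1 := ht₀ τ σ 2 ((hT1.add hR1).add_const 1) (by norm_num) (fun t => rfl) (fun t => by grind)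
  refine le_trans ?_ h1; have p₁ := kapB_pos (n + 1) hm₁
  have p₂ := kapB_pos (n + 1) hm₂; have q₁ := isoK_mul_rpow (N := n + 1) (by simp) hm₁
  have q₂ := isoK_mul_rpow (N := n + 1) (by simp) hm₂
  push_cast at q₁ q₂; rw [add_sub_cancel_right] at q₁ q₂
  have hsum : Integrable fun t => (n + 1) * kapB (n + 1) m₁ * v₁ t +
    (n + 1) * kapB (n + 1) m₂ * v₂ t := (i₁.const_mul _).add (i₂.const_mul _)
  calc _ = ofReal (∫ t, ((n + 1) * kapB (n + 1) m₁ * v₁ t +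
            (n + 1) * kapB (n + 1) m₂ * v₂ t)) := by
        rw [integral_add (i₁.const_mul _) (i₂.const_mul _), integral_const_mul, integral_const_mul,
          mul_add, q₁, q₂]
    _ = ∫⁻ t, ofReal ((n + 1) * kapB (n + 1) m₁ * v₁ t + (n + 1) * kapB (n + 1) m₂ * v₂ t) := by
        rw [ofReal_integral_eq_lintegral_ofReal hsum]
        exact .of_forall fun t => add_nonneg (mul_nonneg (by positivity) (n₁ t))
          (mul_nonneg (by positivity) (n₂ t))
    _ ≤ _ := by
        refine lintegral_mono_ae ?_; have hne : ∀ᵐ t : ℝ, t ≠ t₀ := by simp [ae_iff]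
        filter_upwards [hT4, hR4, ae_slice_lt_top hE hf, hne] with t ht ht' hft htne
        have hder : deriv τ t = deriv T t + deriv R t := by
          rw [hτ, deriv_add_const]; exact deriv_add ht.1 ht'.1
        rw [hder]; rcases lt_or_gt_of_ne htne with hlt | hgt
        · have a1 : v₁ t = sliceVol E t := indicator_of_mem (by exact hlt) _
          have a2 : v₂ t = 0 := indicator_of_notMem (by simp [hlt.le]) _
          rw [a2, mul_zero, add_zero, hσ1 t hlt.le, a1]; rw [a1] at ht
          refine (transport_pointwise (isoBasic n) (measurableSet_slice hE t) hft.ne hm₁ (hT2 t)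
            hT1.deriv_nonneg ht.2).trans ?_
          gcongr; linarith [hR1.deriv_nonneg (x := t)]
        · have a1 : v₁ t = 0 := indicator_of_notMem (by simp [hgt.le]) _
          have a2 : v₂ t = sliceVol E t := indicator_of_mem (by exact hgt) _
          rw [a1, mul_zero, zero_add, hσ2 t hgt, a2]; rw [a2] at ht'
          refine (transport_pointwise (isoBasic n) (measurableSet_slice hE t) hft.ne hm₂ (hR2 t)
            hR1.deriv_nonneg ht'.2).trans ?_
          gcongr; linarith [hT1.deriv_nonneg (x := t)]

/-! ### Coordinate reflections and folding -/

/-- The reflection in the hyperplane `x i = 0`. -/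
def reflE (i : Fin N) : Eu N ≃ₗᵢ[ℝ] Eu N := LinearIsometryEquiv.piLpCongrRight 2 fun k =>
    if k = i then LinearIsometryEquiv.neg ℝ else LinearIsometryEquiv.refl ℝ ℝ

lemma reflE_apply (i : Fin N) (x : Eu N) (k : Fin N) :
    reflE i x k = if k = i then -x k else x k := by
  simp only [reflE, LinearIsometryEquiv.piLpCongrRight_apply]
  split_ifs <;> simp

@[simp] lemma reflE_same (i : Fin N) (x : Eu N) : reflE i x i = -x i := by simp [reflE_apply]

lemma reflE_ne {i k : Fin N} (h : k ≠ i) (x : Eu N) : reflE i x k = x k := by simp [reflE_apply, h]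

@[simp] lemma reflE_reflE (i : Fin N) (x : Eu N) : reflE i (reflE i x) = x := by
  ext k; rw [reflE_apply, reflE_apply]; split_ifs <;> simp

/-- Folding onto the half space `0 ≤ σ * x i`. -/
def foldE (σ : ℝ) (i : Fin N) (x : Eu N) : Eu N :=
  WithLp.toLp 2 fun k => if k = i then σ * |x k| else x k

lemma foldE_apply (σ : ℝ) (i : Fin N) (x : Eu N) (k : Fin N) :
    foldE σ i x k = if k = i then σ * |x k| else x k := rfl

lemma foldE_of_nonneg (hσ : σ ^ 2 = 1) (h : 0 ≤ σ * x i) : foldE σ i x = x := by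
  ext k
  rw [foldE_apply]
  split_ifs with hk
  · subst hk; rcases sq_eq_one_iff.1 hσ with rfl | rfl
    · grind
    · rw [abs_of_nonpos (by linarith)]; ring
  · rfl

lemma foldE_reflE (σ : ℝ) (i : Fin N) (x : Eu N) : foldE σ i (reflE i x) = foldE σ i x := by
  ext k; rw [foldE_apply, foldE_apply, reflE_apply]; split_ifs <;> simp

lemma lipschitz_foldE (hσ : σ ^ 2 = 1) (i : Fin N) : LipschitzWith 1 (foldE (N := N) σ i) := by
  refine LipschitzWith.of_dist_le_mul fun x y => ?_
  rw [NNReal.coe_one, one_mul, EuclideanSpace.dist_eq, EuclideanSpace.dist_eq]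
  refine Real.sqrt_le_sqrt (Finset.sum_le_sum fun k _ => ?_)
  rw [foldE_apply, foldE_apply]
  split_ifs
  · rw [dist_eq, dist_eq, ← mul_sub, abs_mul, mul_pow, sq_abs σ, hσ, one_mul]
    exact pow_le_pow_left₀ (abs_nonneg _) (abs_abs_sub_abs_le_abs_sub _ _) 2
  · rfl

/-- The open half space `0 < σ * x i`. -/
def halfE (σ : ℝ) (i : Fin N) : Set (Eu N) := {x | 0 < σ * x i}

lemma isOpen_halfE (σ : ℝ) (i : Fin N) : IsOpen (halfE (N := N) σ i) :=
  isOpen_lt continuous_const (by fun_prop)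

lemma measurable_apply_eu (i : Fin N) : Measurable fun x : Eu N => x i := by fun_prop

lemma volume_hyper (i : Fin N) (t : ℝ) : volume {x : Eu N | x i = t} = 0 := by
  have h := (EuclideanSpace.volume_preserving_symm_measurableEquiv_toLp (Fin N)).symm
  have h1 : {x : Eu N | x i = t} =
      (MeasurableEquiv.toLp 2 (Fin N → ℝ)).symm ⁻¹' {x : Fin N → ℝ | x i = t} := rfl
  rw [h1, (EuclideanSpace.volume_preserving_symm_measurableEquiv_toLp (Fin N)).measure_preimage_equiv]
  exact Measure.pi_hyperplane (α := fun _ : Fin N => ℝ) (fun _ => volume) i t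

lemma measurePreserving_reflE (i : Fin N) :
    MeasurePreserving (reflE (N := N) i) := (reflE i).measurePreserving

lemma lintegral_halfE (hσ : σ ^ 2 = 1) (i : Fin N) {F : Eu N → ℝ≥0∞}
    (hF : ∀ x, F (reflE i x) = F x) : ∫⁻ x, F x = 2 * ∫⁻ x in halfE σ i, F x := by
  have h0 : σ ≠ 0 := by rintro rfl; norm_num at hσ
  have h1 : ((halfE σ i)ᶜ : Set (Eu N)) =ᵐ[volume] (reflE i ⁻¹' halfE σ i : Set (Eu N)) := by
    have : ∀ᵐ x : Eu N, x i ≠ 0 := by rw [ae_iff]; simpa using volume_hyper i 0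
    filter_upwards [this] with x hx; apply propext; change ¬ (0 < σ * x i) ↔ 0 < σ * reflE i x i
    rw [reflE_same, not_lt, mul_neg, neg_pos, le_iff_lt_or_eq]; simp [h0, hx]
  rw [← lintegral_add_compl F (isOpen_halfE σ i).measurableSet, Measure.restrict_congr_set h1, two_mul]
  congr 1
  rw [← (measurePreserving_reflE i).setLIntegral_comp_preimage_emb
    (reflE i).toHomeomorph.measurableEmbedding F]
  have h2 : (reflE i ⁻¹' (reflE i ⁻¹' halfE σ i) : Set (Eu N)) = halfE σ i := by ext x; simp
  simp_all

lemma Adm.fold (hg : Adm g) (hσ : σ ^ 2 = 1) (i : Fin N) : Adm fun x => g (foldE σ i x) := by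
  obtain ⟨L, hL⟩ := hg.lip
  refine ⟨⟨L, by simpa [comp_def] using hL.comp (lipschitz_foldE hσ i)⟩, ?_,
    fun _ => hg.nonneg _, fun _ => hg.le_one _⟩
  have hn : ∀ x : Eu N, ‖foldE σ i x‖ = ‖x‖ := fun x => by
    rw [EuclideanSpace.norm_eq, EuclideanSpace.norm_eq]
    congr 1; refine Finset.sum_congr rfl fun k _ => ?_; rw [foldE_apply]; split_ifs
    · measurability
    · rfl
  obtain ⟨R, hR⟩ := hg.supp.isBounded.subset_closedBall 0
  refine HasCompactSupport.of_support_subset_isCompact (isCompact_closedBall 0 R) fun x hx => ?_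
  have := hR (subset_tsupport g hx)
  simpa [hn] using this

lemma Adm.gradE_fold (hσ : σ ^ 2 = 1) (i : Fin N) :
    gradE (fun x => g (foldE σ i x)) = 2 * ∫⁻ x in halfE σ i, ‖fderiv ℝ g x‖ₑ := by
  rw [gradE, lintegral_halfE hσ i]
  · congr 1; refine setLIntegral_congr_fun (isOpen_halfE σ i).measurableSet fun x hx => ?_
    have : (fun x => g (foldE σ i x)) =ᶠ[𝓝 x] g := by
      filter_upwards [(isOpen_halfE σ i).mem_nhds hx] with y hy
      rw [foldE_of_nonneg hσ (le_of_lt hy)]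
    simp only [this.fderiv_eq]
  · intro x; have h1 : (fun x => g (foldE σ i x)) = (fun x => g (foldE σ i x)) ∘ reflE i := by
      ext y; simp [foldE_reflE]
    have h2 := (reflE i).toContinuousLinearEquiv.comp_right_fderiv
      (f := fun x => g (foldE σ i x)) (x := x)
    rw [← enorm_norm, ← enorm_norm (fderiv ℝ _ x)]; congr 1
    conv_rhs => rw [h1]
    have h3 : fderiv ℝ ((fun x => g (foldE σ i x)) ∘ ⇑(reflE i)) x =
      (fderiv ℝ (fun x => g (foldE σ i x)) (reflE i x)).comp
        ((reflE i).toContinuousLinearEquiv : Eu N →L[ℝ] Eu N) := h2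
    rw [h3]; exact (ContinuousLinearMap.opNorm_comp_linearIsometryEquiv _ (reflE i)).symm

lemma errE_fold_le (hσ : σ ^ 2 = 1) (i : Fin N) :
    errE (fun x => g (foldE σ i x)) (foldE σ i ⁻¹' E) ≤ 2 * errE g E := by
  have h : ∀ x, ‖g (foldE σ i x) - (foldE σ i ⁻¹' E).indicator 1 x‖ₑ =
      ‖g (foldE σ i x) - E.indicator 1 (foldE σ i x)‖ₑ := fun x => rfl
  rw [errE, lintegral_halfE hσ i]
  · gcongr; refine (le_of_eq ?_).trans (setLIntegral_le_lintegral (halfE σ i) _)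
    refine setLIntegral_congr_fun (isOpen_halfE σ i).measurableSet fun x hx => ?_
    rw [h, foldE_of_nonneg hσ (le_of_lt hx)]
  · intro x; rw [h, h, foldE_reflE]

lemma per_fold_le (E : Set (Eu N)) (i : Fin N) :
    per (foldE 1 i ⁻¹' E) + per (foldE (-1) i ⁻¹' E) ≤ 2 * per E := by
  by_cases hE : per E = ⊤
  · rw [hE]; simp
  obtain ⟨g, hg, he, hp⟩ := exists_seq_gradE hE
  have hz : Tendsto (fun k : ℕ => (2⁻¹ : ℝ≥0∞) ^ k) atTop (𝓝 0) :=
    ENNReal.tendsto_pow_atTop_nhds_zero_of_lt_one (by simp)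
  have herr : ∀ σ : ℝ, σ ^ 2 = 1 →
      Tendsto (fun k => errE (fun x => g k (foldE σ i x)) (foldE σ i ⁻¹' E)) atTop (𝓝 0) := by
    intro σ hσ; refine tendsto_of_tendsto_of_tendsto_of_le_of_le tendsto_const_nhds
      (?_ : Tendsto (fun k : ℕ => 2 * (2⁻¹ : ℝ≥0∞) ^ k) atTop (𝓝 0)) (fun _ => zero_le)
      fun k => (errE_fold_le hσ i).trans (mul_le_mul_right (he k) _)
    simpa using ENNReal.Tendsto.const_mul hz (Or.inr (by simp : (2 : ℝ≥0∞) ≠ ⊤))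
  have s1 : (1 : ℝ) ^ 2 = 1 := by norm_num
  have s2 : (-1 : ℝ) ^ 2 = 1 := by norm_num
  have h2 := per_le_liminf (fun k => (hg k).fold s2 i) (herr (-1) s2)
  have hsum : ∀ k, gradE (fun x => g k (foldE 1 i x)) + gradE (fun x => g k (foldE (-1) i x)) ≤
      2 * (per E + (2⁻¹ : ℝ≥0∞) ^ k) := by
    intro k; rw [Adm.gradE_fold s1, Adm.gradE_fold s2, ← mul_add]
    refine mul_le_mul_right (le_trans (b := gradE (g k)) ?_ (hp k)) _
    rw [← lintegral_union (isOpen_halfE (-1) i).measurableSet]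
    · exact setLIntegral_le_lintegral _ _
    · rw [Set.disjoint_left]; intro x hx hx'; simp only [halfE, mem_setOf_eq] at hx hx'; linarith
  have hlim : Tendsto (fun k : ℕ => 2 * (per E + (2⁻¹ : ℝ≥0∞) ^ k)) atTop (𝓝 (2 * per E)) := by
    simpa using ENNReal.Tendsto.const_mul (hz.const_add (per E)) (Or.inr (by simp : (2 : ℝ≥0∞) ≠ ⊤))
  calc _ ≤ _ := add_le_add (per_le_liminf (fun k => (hg k).fold s1 i) (herr 1 s1)) h2
    _ ≤ liminf (fun k => gradE (fun x => g k (foldE 1 i x)) +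
        gradE (fun x => g k (foldE (-1) i x))) atTop := enn_le_liminf_add _ _
    _ ≤ liminf (fun k : ℕ => 2 * (per E + (2⁻¹ : ℝ≥0∞) ^ k)) atTop :=
        liminf_le_liminf (.of_forall hsum)
    _ = _ := hlim.liminf_eq

lemma per_translate_le (E : Set (Eu N)) (a : Eu N) : per ((fun x => x + a) ⁻¹' E) ≤ per E := by
  refine iSup₂_le fun ε hε => ?_
  refine le_trans ?_ (le_iSup₂ ε hε)
  refine le_iInf₂ fun g hg => ?_
  refine (iInf₂_le (f := fun g (_ : Adm g ∧ errE g ((fun x => x + a) ⁻¹' E) ≤ ε) => gradE g)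
    (fun x => g (x + a)) ⟨?_, ?_⟩).trans ?_
  · obtain ⟨L, hL⟩ := hg.1.lip; refine ⟨⟨L, ?_⟩, ?_, fun _ => hg.1.nonneg _, fun _ => hg.1.le_one _⟩
    · simpa [comp_def] using hL.comp (isometry_add_right a).lipschitz
    · exact hg.1.supp.comp_homeomorph (Homeomorph.addRight a)
  · refine (le_of_eq ?_).trans hg.2
    exact lintegral_add_right_eq_self (fun x => ‖g x - E.indicator 1 x‖ₑ) a
  · simp only [gradE, fderiv_comp_add_right]
    exact (lintegral_add_right_eq_self (fun x => ‖fderiv ℝ g x‖ₑ) a).le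

/-! ### One-dimensional comparison -/

lemma ofReal_integral_le_lintegral {α : Type*} [MeasurableSpace α] {μ : Measure α} {f : α → ℝ}
    (hf : Integrable f μ) : ofReal (∫ x, f x ∂μ) ≤ ∫⁻ x, ofReal (f x) ∂μ := by
  calc ofReal (∫ x, f x ∂μ) ≤ ofReal (∫ x, max (f x) 0 ∂μ) :=
        ofReal_le_ofReal (integral_mono hf hf.pos_part fun x => le_max_left _ _)
    _ = ∫⁻ x, ofReal (max (f x) 0) ∂μ :=
        ofReal_integral_eq_lintegral_ofReal hf.pos_part (.of_forall fun x => le_max_right _ _)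
    _ = _ := lintegral_congr fun x => by simp

lemma mono_compare {a H : ℝ → ℝ} (ha : Monotone a) (ha0 : a 0 = 0) (hH : Continuous H)
    (hH0 : ∀ t, 0 ≤ H t) (hHa : AntitoneOn H (Ici 0)) {s : ℝ} (hs : 0 ≤ s) :
    ∫⁻ t in Ioc 0 s, ofReal (H (a t) - H t) ≤
      ∫⁻ t in Ioc 0 s, ofReal (H (a t) * (1 - deriv a t)) := by
  set b : ℝ → ℝ := fun t => min (a t) t with hb_def
  have hb : Monotone b := ha.min monotone_id
  have hb0 : b 0 = 0 := by simp [hb_def, ha0]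
  have hbn : ∀ t, 0 ≤ t → 0 ≤ b t := fun t ht => hb0 ▸ hb ht
  set G : ℝ → ℝ := fun t => ∫ x in (0 : ℝ)..t, H x with hG_def
  have hG : ∀ t, HasDerivAt G (H t) t := fun t => hH.integral_hasStrictDerivAt 0 t |>.hasDerivAt
  have hGm : Monotone G := monotone_of_deriv_nonneg (fun t => (hG t).differentiableAt)
    fun t => by rw [(hG t).deriv]; exact hH0 t
  have hGb : Monotone (G ∘ b) := hGm.comp hb
  have hdb : ∀ᵐ t, DifferentiableAt ℝ b t := hb.ae_differentiableAt
  have hder : ∀ᵐ t, deriv (G ∘ b) t = H (b t) * deriv b t := by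
    filter_upwards [hdb] with t ht; exact ((hG (b t)).comp t ht.hasDerivAt).deriv
  have i1 : IntervalIntegrable (fun t => H (b t)) volume 0 s := by
    refine IntervalIntegrable.mono_fun' (g := fun _ => H 0) intervalIntegrable_const
      (hH.measurable.comp hb.measurable).aestronglyMeasurable ?_
    rw [Set.uIoc_of_le hs]; refine (ae_restrict_mem measurableSet_Ioc).mono fun t ht => ?_
    beta_reduce; rw [norm_eq_abs, abs_of_nonneg (hH0 _)]
    exact hHa (mem_Ici.2 le_rfl) (hbn t ht.1.le) (hbn t ht.1.le)
  have i2 : IntervalIntegrable (fun t => H (b t) * deriv b t) volume 0 s := by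
    refine ((hGb.monotoneOn _).intervalIntegrable_deriv (a := 0) (b := s)).congr_ae ?_
    exact ae_restrict_of_ae hder
  have h1 : ∫ t in (0 : ℝ)..s, H (b t) * deriv b t ≤ ∫ t in (0 : ℝ)..s, H t := by
    have h2 := (hGb.monotoneOn (uIcc 0 s)).intervalIntegral_deriv_mem_uIcc
    have h3 : (G ∘ b) 0 ≤ (G ∘ b) s := hGb hs; rw [uIcc_of_le (by linarith)] at h2
    have h4 : ∫ t in (0 : ℝ)..s, deriv (G ∘ b) t = ∫ t in (0 : ℝ)..s, H (b t) * deriv b t :=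
      intervalIntegral.integral_congr_ae (hder.mono fun t ht _ => ht)
    have h5 : (G ∘ b) 0 = 0 := by simp [hb0, hG_def]
    have h6 : (G ∘ b) s ≤ G s := hGm (min_le_right _ _); grind
  have h2 : ∫ t in (0 : ℝ)..s, (H (b t) - H t) ≤
      ∫ t in (0 : ℝ)..s, (H (b t) - H (b t) * deriv b t) := by
    rw [intervalIntegral.integral_sub i1 (hH.intervalIntegrable _ _),
      intervalIntegral.integral_sub i1 i2]
    linarith
  rw [integral_of_le hs, integral_of_le hs] at h2
  calc _ ≤ ∫⁻ t in Ioc 0 s, ofReal (H (b t) - H t) := by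
        refine setLIntegral_mono' measurableSet_Ioc fun t ht => ?_
        rcases le_total (a t) t with h | h
        · simp [hb_def, min_eq_left h]
        · rw [ofReal_of_nonpos]
          · simp
          · have := hHa (mem_Ici.2 ht.1.le) (mem_Ici.2 (ht.1.le.trans h)) h; linarith
    _ = ofReal (∫ t in Ioc 0 s, (H (b t) - H t)) := by
        rw [ofReal_integral_eq_lintegral_ofReal]
        · exact (i1.sub (hH.intervalIntegrable _ _)).1
        · refine (ae_restrict_mem measurableSet_Ioc).mono fun t ht => ?_
          exact sub_nonneg.2 (hHa (hbn t ht.1.le) (mem_Ici.2 ht.1.le) (min_le_right _ _))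
    _ ≤ ofReal (∫ t in Ioc 0 s, (H (b t) - H (b t) * deriv b t)) := ofReal_le_ofReal h2
    _ ≤ ∫⁻ t in Ioc 0 s, ofReal (H (b t) - H (b t) * deriv b t) :=
        ofReal_integral_le_lintegral (i1.sub i2).1
    _ ≤ _ := by
        refine lintegral_mono_ae (ae_restrict_of_ae ?_)
        filter_upwards [ha.ae_differentiableAt, hdb] with t ht htb
        rcases lt_trichotomy (a t) t with h | h | h
        · have e : b =ᶠ[𝓝 t] a := by
            filter_upwards [ht.continuousAt.eventually_lt continuousAt_id h] with y hy
            exact min_eq_left (le_of_lt hy)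
          rw [e.deriv_eq, e.self_of_nhds, mul_sub, mul_one]
        · have e : deriv b t = 1 := by
            have hm : IsLocalMin (fun y => y - b y) t := by refine .of_forall fun y => ?_; grind
            have := hm.deriv_eq_zero
            rw [deriv_fun_sub differentiableAt_fun_id htb, deriv_id''] at this; linarith
          rw [e]; simp
        · have e : b =ᶠ[𝓝 t] id := by
            filter_upwards [continuousAt_id.eventually_lt ht.continuousAt h] with y hy
            exact min_eq_right (le_of_lt hy)
          rw [e.deriv_eq, deriv_id]; simp

lemma vB_antitoneOn (n : ℕ) : AntitoneOn (vB n) (Ici 0) := by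
  intro x hx y hy hxy
  unfold vB
  have hx : 0 ≤ x := hx
  have := omegaB_pos n
  gcongr

lemma PhiB_tail {T : ℝ} (hT0 : 0 ≤ T) (hT1 : T ≤ 1) :
    omegaB n / omegaB (n + 1) * ((1 - T ^ 2) / 4) ^ ((n : ℝ) / 2 + 1) ≤ 1 - PhiB n T := by
  have hi : ∀ a b, IntervalIntegrable (vB n) volume a b := fun a b =>
    (continuous_vB n).intervalIntegrable a b
  have hn := omegaB_pos n
  set e := 1 - T ^ 2 with he
  have he0 : 0 ≤ e := by nlinarith
  have h0 : 1 - PhiB n T = (∫ x in T..1, vB n x) / omegaB (n + 1) := by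
    have h := PhiB_one n; rw [PhiB] at h
    rw [PhiB, ← intervalIntegral.integral_interval_sub_left (hi (-1) 1) (hi (-1) T), sub_div, h]
  set c := (T + 1) / 2 with hc
  have h1 : ∫ x in T..c, vB n c ≤ ∫ x in T..c, vB n x := by
    refine intervalIntegral.integral_mono_on (by linarith) intervalIntegrable_const (hi _ _)
      fun x hx => ?_
    exact vB_antitoneOn n (mem_Ici.2 (hT0.trans hx.1)) (mem_Ici.2 (by linarith)) hx.2
  have h2 : 0 ≤ ∫ x in c..1, vB n x :=
    intervalIntegral.integral_nonneg (by linarith) fun x _ => vB_nonneg n x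
  have h3 : ∫ x in T..1, vB n x = (∫ x in T..c, vB n x) + ∫ x in c..1, vB n x :=
    (integral_add_adjacent_intervals (hi _ _) (hi _ _)).symm
  rw [intervalIntegral.integral_const, smul_eq_mul] at h1
  have h4 : omegaB n * (e / 4) ^ ((n : ℝ) / 2) ≤ vB n c := by
    unfold vB
    have : e / 4 ≤ max 0 (1 - c ^ 2) := le_max_of_le_right (by rw [he, hc]; nlinarith); gcongr
  have h5 : e / 4 ≤ c - T := by rw [he, hc]; nlinarith
  have h6 : (e / 4) ^ ((n : ℝ) / 2 + 1) = (e / 4) * (e / 4) ^ ((n : ℝ) / 2) := by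
    rw [Real.rpow_add_of_nonneg (by positivity) (by positivity) zero_le_one, rpow_one]; ring
  rw [h0, h6, div_mul_eq_mul_div, div_le_div_iff_of_pos_right (omegaB_pos (n + 1)), h3]
  calc omegaB n * (e / 4 * (e / 4) ^ ((n : ℝ) / 2))
      = e / 4 * (omegaB n * (e / 4) ^ ((n : ℝ) / 2)) := by ring
    _ ≤ (c - T) * vB n c := mul_le_mul h5 h4 (by positivity) (by linarith)
    _ ≤ _ := by linarith

/-- Near the tip, the density of the ball is controlled by a power of the tail mass. -/
lemma exists_vB_tail (n : ℕ) : ∃ C : ℝ, 0 < C ∧ ∀ T : ℝ, 0 ≤ T → T ≤ 1 →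
    vB n T * √(vB n T) ≤ C * (1 - PhiB n T) ^ ((n : ℝ) / (n + 1)) := by
  have hω := omegaB_pos (n + 1); have hn := omegaB_pos n
  set p := (n : ℝ) / 2 + 1; set β := (n : ℝ) / (n + 1); have hβ : 0 ≤ β := by positivity
  set k := (omegaB n / omegaB (n + 1) * (1 / 4) ^ p) ^ β with hk; have hk0 : 0 < k := by positivity
  refine ⟨omegaB n * √(omegaB n) / k, by positivity, fun T hT0 hT1 => ?_⟩
  set e := 1 - T ^ 2 with he; have he0 : 0 ≤ e := by nlinarith
  have he1 : e ≤ 1 := by nlinarith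
  have h1 : k * e ^ (p * β) ≤ (1 - PhiB n T) ^ β := by
    refine le_trans (le_of_eq ?_) (rpow_le_rpow (by positivity) (PhiB_tail hT0 hT1) hβ)
    rw [hk, rpow_mul he0, ← mul_rpow (by positivity) (by positivity), mul_assoc,
      ← mul_rpow (by positivity) he0]
    congr 3; ring
  have h2 : vB n T * √(vB n T) = omegaB n * √(omegaB n) * e ^ ((n : ℝ) / 2 + n / 4) := by
    rw [vB, max_eq_right he0, sqrt_mul hn.le, sqrt_eq_rpow (_ ^ _), ← rpow_mul he0,
      Real.rpow_add_of_nonneg he0 (by positivity) (by positivity)]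
    grind
  have h3 : e ^ ((n : ℝ) / 2 + n / 4) ≤ e ^ (p * β) := by
    refine Real.rpow_le_rpow_of_exponent_ge_of_imp he0 he1 ?_ ?_
    · have h4 : p * β = (n : ℝ) * (n + 2) / (2 * (n + 1)) := by simp only [p, β]; field_simp
      rw [h4, div_le_iff₀ (by positivity)]; rcases Nat.eq_zero_or_pos n with h | h
      · simp [h]
      · have : (1 : ℝ) ≤ n := by exact_mod_cast h
        nlinarith
    · grind
  rw [h2, div_mul_eq_mul_div, le_div_iff₀ hk0]
  calc _ = omegaB n * √(omegaB n) * (k * e ^ ((n : ℝ) / 2 + n / 4)) := by ring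
    _ ≤ omegaB n * √(omegaB n) * (k * e ^ (p * β)) := by gcongr
    _ ≤ _ := by gcongr

/-! ### Pointwise inequalities for the transport deficit -/

/-- `x = y^{-1/n}`. -/
lemma psi_bounds (hn : n ≠ 0) {y : ℝ} (hy : 0 < y) :
    max 0 (1 - y) ^ 2 ≤ n * (n * y ^ (-(1 / (n : ℝ))) + y - (n + 1)) ∧
    ∀ l : ℝ, 0 < l → 1 - y⁻¹ ≤ n * (l * (n * y ^ (-(1 / (n : ℝ))) + y - (n + 1)) + l⁻¹) := by
  set x := y ^ (-(1 / (n : ℝ))) with hx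
  have hx0 : 0 < x := rpow_pos_of_pos hy _; have hn0 : (0 : ℝ) < n := by positivity
  have hn1 : (1 : ℝ) ≤ n := by exact_mod_cast Nat.one_le_iff_ne_zero.2 hn
  have hxn : x ^ n = y⁻¹ := by
    rw [hx, ← rpow_natCast, ← rpow_mul hy.le, ← Real.rpow_neg_one]; congr 1; field_simp
  have hyx : y = (x⁻¹) ^ n := by rw [inv_pow, hxn, inv_inv]
  have hψ := amgm_transport hn hy; rw [← hx] at hψ; constructor
  · rcases le_total 1 y with h | h
    · rw [max_eq_left (by linarith)]; nlinarith
    rw [max_eq_right (by linarith)]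
    have hx1 : 1 ≤ x := Real.one_le_rpow_of_pos_of_le_one_of_nonpos hy h (by
      rw [neg_nonpos]; positivity)
    have hq1 : x⁻¹ ≤ 1 := inv_le_one_of_one_le₀ hx1; have hq0 : 0 < x⁻¹ := by positivity
    have hB : 1 + (n : ℝ) * (x⁻¹ - 1) ≤ y := by
      rw [hyx]; have := one_add_mul_le_pow (a := x⁻¹ - 1) (by linarith) n; simpa using this
    set q := x⁻¹ with hq; have hxq : x = q⁻¹ := by simp [hq]
    have h1 : 1 - y ≤ n * (1 - q) := by linarith
    have h2 : n * (1 - q) ^ 2 ≤ n * x + y - (n + 1) := by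
      have : 1 + (1 - q) + (1 - q) ^ 2 ≤ x := by
        rw [hxq, ← one_div, le_div_iff₀ hq0]
        have : (1 + (1 - q) + (1 - q) ^ 2) * q = 1 - (1 - q) ^ 3 := by ring
        rw [this]; have : 0 ≤ (1 - q) ^ 3 := pow_nonneg (by linarith) 3; linarith
      nlinarith
    calc (1 - y) ^ 2 ≤ (n * (1 - q)) ^ 2 := by gcongr
      _ = n * (n * (1 - q) ^ 2) := by ring
      _ ≤ _ := by gcongr
  · intro l hl; have hli : 0 < l⁻¹ := by positivity
    have hnn : 0 ≤ l * (n * x + y - (n + 1)) := mul_nonneg hl.le (by linarith)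
    rcases le_total y 1 with h | h
    · have : 1 ≤ y⁻¹ := (one_le_inv₀ hy).2 h
      have : (0 : ℝ) ≤ n * (l * (n * x + y - (n + 1)) + l⁻¹) := by positivity
      linarith
    have hx1 : x ≤ 1 := Real.rpow_le_one_of_one_le_of_nonpos h (by rw [neg_nonpos]; positivity)
    have hB : 1 + (n : ℝ) * (x - 1) ≤ y⁻¹ := by
      rw [← hxn]; have := one_add_mul_le_pow (a := x - 1) (by linarith) n; simpa using this
    have hB' : 1 + (n : ℝ) * (x⁻¹ - 1) ≤ y := by
      rw [hyx]; have : 0 < x⁻¹ := by positivity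
      have := one_add_mul_le_pow (a := x⁻¹ - 1) (by linarith) n; simpa using this
    have h2 : (1 - x) ^ 2 ≤ n * x + y - (n + 1) := by
      have h3 : (1 - x) ^ 2 ≤ x + x⁻¹ - 2 := by
        have : x + x⁻¹ - 2 = (1 - x) ^ 2 * x⁻¹ := by field_simp; ring
        rw [this]; exact le_mul_of_one_le_right (sq_nonneg _) ((one_le_inv₀ hx0).2 hx1)
      have h4 : 0 ≤ x + x⁻¹ - 2 := (sq_nonneg _).trans h3; nlinarith
    have h5 : 1 - x ≤ l * (1 - x) ^ 2 + l⁻¹ := by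
      have : 0 ≤ l * ((1 - x) - l⁻¹) ^ 2 := by positivity
      have e : l * ((1 - x) - l⁻¹) ^ 2 = l * (1 - x) ^ 2 - 2 * (1 - x) + l⁻¹ := by field_simp; ring
      rw [e] at this; linarith
    calc 1 - y⁻¹ ≤ n * (1 - x) := by linarith
      _ ≤ n * (l * (1 - x) ^ 2 + l⁻¹) := by gcongr
      _ ≤ _ := by gcongr

/-! ### Asymmetry -/

lemma bddBelow_asym (F : Set (Eu N)) : BddBelow { c : ℝ | ∃ (x₀ : Eu N) (r : ℝ), 0 < r ∧
    volume (ball x₀ r) = volume F ∧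
    c = (volume (symmDiff F (ball x₀ r))).toReal / (volume F).toReal } :=
  ⟨0, by rintro c ⟨x, r, -, -, rfl⟩; positivity⟩

lemma volume_symmDiff_of_eq {F B : Set (Eu N)} (hF : MeasurableSet F)
    (hB : MeasurableSet B) (h : volume B = volume F) (hf : volume F ≠ ⊤) :
    vol (symmDiff F B) = 2 * vol (F \ B) := by
  have hf' : volume B ≠ ⊤ := h ▸ hf
  rw [measureReal_symmDiff_eq hF hB hf hf', two_mul]
  congr 1
  have h1 := measureReal_inter_add_diff (μ := volume) (s := F) hB hf
  have h2 := measureReal_inter_add_diff (μ := volume) (s := B) hF hf'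
  have h3 : vol B = vol F := by simp [measureReal_def, h]
  rw [inter_comm] at h2
  linarith

lemma asym_le (hF : MeasurableSet F) (hf : volume F ≠ ⊤)
    (hr : 0 < r) (h : volume (ball x r) = volume F) :
    asym N F ≤ 2 * vol (F \ ball x r) / vol F := by
  refine csInf_le (bddBelow_asym F) ⟨x, r, hr, h, ?_⟩
  rw [← volume_symmDiff_of_eq hF measurableSet_ball h hf]; rfl

lemma asym_nonneg (F : Set (Eu N)) : 0 ≤ asym N F :=
  Real.sInf_nonneg (by rintro c ⟨x, r, -, -, rfl⟩; positivity)

/-- The radius of a ball of volume `m`. -/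
def radB (N : ℕ) (m : ℝ) : ℝ := (kapB N m)⁻¹

lemma radB_pos (N : ℕ) {m : ℝ} (hm : 0 < m) : 0 < radB N m := inv_pos.2 (kapB_pos N hm)

lemma volume_ball_radB (hN : N ≠ 0) {m : ℝ} (hm : 0 < m) (x : Eu N) :
    volume (ball x (radB N m)) = ofReal m := by
  rw [volume_ball_eu x (radB_pos N hm), radB, inv_pow, kapB_pow hN hm]
  congr 1
  have := omegaB_pos N
  field_simp

lemma eq_radB (hN : N ≠ 0) {m : ℝ} (hm : 0 < m) (hr : 0 < r)
    (h : volume (ball x r) = ofReal m) : r = radB N m := by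
  rw [← volume_ball_radB hN hm x, volume_ball_eu x hr, volume_ball_eu x (radB_pos N hm)] at h
  have hω := omegaB_pos N
  have h1 := radB_pos N hm
  rw [ENNReal.ofReal_eq_ofReal_iff (by positivity) (by positivity)] at h
  exact (pow_left_inj₀ hr.le h1.le hN).1 (mul_left_cancel₀ hω.ne' h)

lemma asym_le_two (hN : N ≠ 0) (hF : MeasurableSet F)
    (h0 : 0 < volume F) (hf : volume F ≠ ⊤) : asym N F ≤ 2 := by
  have hm : 0 < (volume F).toReal := toReal_pos h0.ne' hf
  have h := volume_ball_radB hN hm 0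
  rw [ofReal_toReal hf] at h
  refine (asym_le hF hf (radB_pos N hm) h).trans ?_
  refine (div_le_iff₀ hm).2 ?_
  have := measureReal_mono (μ := volume) (s₂ := F)
    (sdiff_subset : F \ ball 0 (radB N (volume F).toReal) ⊆ F) hf
  simp only [measureReal_def] at this ⊢
  linarith

lemma ball_inter_subset_mid (x x' : Eu N) (r : ℝ) :
    ball x r ∩ ball x' r ⊆ ball ((2 : ℝ)⁻¹ • (x + x')) r := by
  rintro y ⟨h1, h2⟩
  rw [mem_ball_iff_norm] at *
  have e : y - (2 : ℝ)⁻¹ • (x + x') = (2 : ℝ)⁻¹ • ((y - x) + (y - x')) := by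
    rw [← sub_eq_zero]; module
  rw [e, norm_smul]
  have := norm_add_le (y - x) (y - x')
  norm_num; linarith

/-- Recentering a ball with respect to a symmetry of the set. -/
lemma sdiff_ball_mid_le (e : Eu N ≃ₗᵢ[ℝ] Eu N)
    (he : ∀ x, e x ∈ F ↔ x ∈ F) (hf : volume F ≠ ⊤) (x : Eu N) (r : ℝ) :
    vol (F \ ball ((2 : ℝ)⁻¹ • (x + e x)) r) ≤ 2 * vol (F \ ball x r) := by
  have h1 : F \ ball ((2 : ℝ)⁻¹ • (x + e x)) r ⊆ (F \ ball x r) ∪ (F \ ball (e x) r) := by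
    intro y hy; by_contra h; simp only [Set.mem_union, Set.mem_sdiff, not_or, not_and, not_not] at h
    exact hy.2 (ball_inter_subset_mid x (e x) r ⟨h.1 hy.1, h.2 hy.1⟩)
  have h2 : vol (F \ ball (e x) r) = vol (F \ ball x r) := by
    have h3 : e ⁻¹' (F \ ball (e x) r) = F \ ball x r := by ext y; simp [he]
    rw [← h3, measureReal_def, measureReal_def]
    exact congrArg _ (e.measurePreserving.measure_preimage_emb
      e.toHomeomorph.measurableEmbedding _).symm
  have hfin : ∀ B : Set (Eu N), volume (F \ B) ≠ ⊤ := fun B =>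
    ((measure_mono sdiff_subset).trans_lt hf.lt_top).ne
  calc _ ≤ vol ((F \ ball x r) ∪ (F \ ball (e x) r)) :=
        measureReal_mono h1 (measure_union_lt_top (hfin _).lt_top (hfin _).lt_top).ne
    _ ≤ _ := measureReal_union_le _ _
    _ = _ := by rw [h2]; ring

lemma sdiff_ball_zero_le (hF : MeasurableSet F)
    (hs : ∀ x, -x ∈ F ↔ x ∈ F) (hf : volume F ≠ ⊤) (hr : 0 < r)
    (hv : volume (ball (0 : Eu N) r) = volume F) :
    vol (F \ ball 0 r) ≤ asym N F * vol F := by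
  have h0 : 0 < volume F := hv ▸ measure_ball_pos _ _ hr
  have hm : 0 < vol F := toReal_pos h0.ne' hf
  rw [← div_le_iff₀ hm]
  refine le_csInf ⟨_, 0, r, hr, hv, rfl⟩ ?_
  rintro c ⟨x, r', hr', hv', rfl⟩
  have hrr : volume (ball (0 : Eu N) r') = volume (ball (0 : Eu N) r) := by
    simp_all [volume_ball_eu _ hr']
  have h1 := volume_symmDiff_of_eq hF measurableSet_ball hv' hf
  have h2 := sdiff_ball_mid_le (LinearIsometryEquiv.neg ℝ) (fun x => by simpa using hs x) hf x r'
  simp only [LinearIsometryEquiv.coe_neg, add_neg_cancel, smul_zero] at h2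
  have h3 : ball (0 : Eu N) r = ball 0 r' := by
    rcases Nat.eq_zero_or_pos N with rfl | hN
    · ext y; simp [Subsingleton.elim y 0, hr, hr']
    · congr 1; rw [volume_ball_eu _ hr', volume_ball_eu _ hr] at hrr; have hω := omegaB_pos N
      rw [ENNReal.ofReal_eq_ofReal_iff (by positivity) (by positivity)] at hrr
      exact ((pow_left_inj₀ hr'.le hr.le hN.ne').1 (mul_left_cancel₀ hω.ne' hrr)).symm
  rw [h3]
  have h4 : (volume (symmDiff F (ball x r'))).toReal = vol (symmDiff F (ball x r')) := rfl
  have h5 : (volume F).toReal = vol F := rfl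
  rw [h4, h5, h1]
  gcongr

/-- Symmetry in the coordinates belonging to `J`. -/
def SymE (J : Finset (Fin N)) (E : Set (Eu N)) : Prop :=
  ∀ x x' : Eu N, (∀ k ∈ J, |x k| = |x' k|) → (∀ k ∉ J, x k = x' k) → (x ∈ E ↔ x' ∈ E)

lemma SymE.fold (h : SymE J E) (σ : ℝ) (i : Fin N) : SymE (insert i J) (foldE σ i ⁻¹' E) := by
  intro x x' h1 h2
  refine h _ _ (fun k hk => ?_) fun k hk => ?_
  · grind [foldE_apply]
  · rw [foldE_apply, foldE_apply]
    split_ifs with hki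
    · rw [h1 k (by simp [hki])]
    · exact h2 k (by simp [hki, hk])

lemma SymE.reflE (h : SymE J E) (hi : i ∈ J) (x : Eu N) : reflE i x ∈ E ↔ x ∈ E := by
  refine h _ _ (fun k _ => ?_) fun k hk => ?_
  · rw [reflE_apply]; split_ifs <;> simp
  · rw [reflE_ne (by rintro rfl; exact hk hi)]

lemma SymE.slice_neg {E : Set (Eu (n + 1))} (h : SymE Finset.univ E) (t : ℝ) (y : Eu n) :
    -y ∈ consE t ⁻¹' E ↔ y ∈ consE t ⁻¹' E := by
  refine h _ _ (fun k _ => ?_) (by simp)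
  refine Fin.cases ?_ (fun i => ?_) k <;> simp

lemma SymE.slice_even {E : Set (Eu (n + 1))} (h : SymE Finset.univ E) (t : ℝ) :
    consE (n := n) (-t) ⁻¹' E = consE t ⁻¹' E := by
  ext y
  refine h _ _ (fun k _ => ?_) (by simp)
  refine Fin.cases ?_ (fun i => ?_) k <;> simp

/-- The quantitative isoperimetric inequality in dimension `n`, with constant `c`. -/
def IsoQ (n : ℕ) (c : ℝ) : Prop := ∀ E : Set (Eu n), MeasurableSet E → 0 < volume E →
  volume E ≠ ⊤ → ofReal (isoK n * vol E ^ (((n : ℝ) - 1) / n) * (1 + c * asym n E ^ 2)) ≤ per E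

lemma PhiB_zero (n : ℕ) : PhiB n 0 = 1 / 2 := by
  have hi : ∀ a b, IntervalIntegrable (vB n) volume a b :=
    fun a b => (continuous_vB n).intervalIntegrable _ _
  have h1 := PhiB_one n
  rw [PhiB, ← integral_add_adjacent_intervals (hi (-1) 0) (hi 0 1), add_div] at h1
  have h2 : ∫ x in (0 : ℝ)..1, vB n x = ∫ x in (-1 : ℝ)..0, vB n x := by
    have := intervalIntegral.integral_comp_neg (a := 0) (b := 1) (vB n)
    rw [neg_zero] at this; rw [← this]; simp [vB]
  rw [h2] at h1
  rw [PhiB]; linarith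

/-- Volume of the slices of the ball of radius `κ⁻¹`. -/
def vBR (n : ℕ) (κ t : ℝ) : ℝ := κ ^ (-(n : ℤ)) * vB n (κ * t)

lemma vBR_nonneg (n : ℕ) {κ : ℝ} (hκ : 0 < κ) (t : ℝ) : 0 ≤ vBR n κ t :=
  mul_nonneg (by positivity) (vB_nonneg _ _)

lemma continuous_vBR (n : ℕ) (κ : ℝ) : Continuous (vBR n κ) :=
  continuous_const.mul ((continuous_vB n).comp (by fun_prop))

lemma vBR_antitoneOn (n : ℕ) {κ : ℝ} (hκ : 0 < κ) : AntitoneOn (vBR n κ) (Ici 0) := by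
  intro a ha b hb hab
  refine mul_le_mul_of_nonneg_left (vB_antitoneOn n (mul_nonneg hκ.le ha) (mul_nonneg hκ.le hb)
    (mul_le_mul_of_nonneg_left hab hκ.le)) (by positivity)

lemma volume_slice_ball_inv (hn : n ≠ 0) {κ : ℝ} (hκ : 0 < κ) (t : ℝ) :
    vol (consE (n := n) t ⁻¹' ball 0 κ⁻¹) = vBR n κ t := by
  rw [slice_ball]
  have hsq : |t| < κ⁻¹ ↔ 0 < 1 - (κ * t) ^ 2 := by
    rw [sub_pos, sq_lt_one_iff_abs_lt_one, abs_mul, abs_of_pos hκ, ← lt_div_iff₀' hκ, one_div]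
  split_ifs with h
  · have h1 := hsq.1 h; have e : κ⁻¹ ^ 2 - t ^ 2 = κ⁻¹ ^ 2 * (1 - (κ * t) ^ 2) := by field_simp
    have h2 : 0 < κ⁻¹ ^ 2 - t ^ 2 := by rw [e]; positivity
    rw [measureReal_def, volume_ball_eu _ (sqrt_pos.2 h2), toReal_ofReal
      (mul_nonneg (omegaB_pos n).le (by positivity)), vBR, vB, max_eq_right h1.le, e,
      sqrt_mul (by positivity), sqrt_sq (by positivity), mul_pow,
      sqrt_eq_rpow, ← rpow_natCast (_ ^ _), ← rpow_mul h1.le]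
    rw [zpow_neg, zpow_natCast, inv_pow, show 1 / 2 * (n : ℝ) = n / 2 by ring]; ring
  · rw [hsq, not_lt] at h; rw [vBR, vB, max_eq_left h, zero_rpow (by positivity)]; simp

lemma slice_sdiff_le (hn : n ≠ 0) {F : Set (Eu n)} (hF : MeasurableSet F)
    (hs : ∀ x, -x ∈ F ↔ x ∈ F) (hv : 0 < volume F) (hf : volume F ≠ ⊤) {κ : ℝ} (hκ : 0 < κ)
    (t : ℝ) :
    vol (F \ consE t ⁻¹' ball 0 κ⁻¹) ≤ asym n F * vol F + max 0 (vol F - vBR n κ t) := by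
  have hm : 0 < vol F := toReal_pos hv.ne' hf
  set r := radB n (vol F)
  have hr : 0 < r := radB_pos n hm
  have hvr : volume (ball (0 : Eu n) r) = volume F := by
    rw [volume_ball_radB hn hm]; exact ofReal_toReal hf
  have h1 := sdiff_ball_zero_le hF hs hf hr hvr
  have h2 := volume_slice_ball_inv hn hκ t
  set B := consE (n := n) t ⁻¹' ball 0 κ⁻¹ with hB
  have hBm : MeasurableSet B := measurableSet_slice measurableSet_ball t
  have hvr' : vol (ball (0 : Eu n) r) = vol F := by rw [measureReal_def, hvr, measureReal_def]
  have hb : volume (ball (0 : Eu n) r) ≠ ⊤ := measure_ball_lt_top.ne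
  have h3 : vol (ball 0 r \ B) ≤ max 0 (vol F - vBR n κ t) := by
    have hcases : B ⊆ ball 0 r ∨ ball 0 r ⊆ B := by
      rw [hB, slice_ball]
      split_ifs
      · exact (le_total _ _).imp (fun h => ball_subset_ball h) (fun h => ball_subset_ball h)
      · left; simp
    rcases hcases with h | h
    · simp [measureReal_sdiff h hBm, h2, hvr']

    · rw [Set.sdiff_eq_empty.2 h]; simp
  have h4 : F \ B ⊆ (F \ ball 0 r) ∪ (ball 0 r \ B) := by grind
  calc _ ≤ _ := measureReal_mono h4 (measure_union_lt_top
        ((measure_mono sdiff_subset).trans_lt hf.lt_top)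
        ((measure_mono sdiff_subset).trans_lt hb.lt_top)).ne
    _ ≤ _ := measureReal_union_le _ _
    _ ≤ _ := by linarith

/-- The integrand of the stability estimate for the transport proof. -/
def gapF (n : ℕ) (c v y a : ℝ) : ℝ :=
  v * (n * y ^ (-(1 / (n : ℝ))) + y - (n + 1)) + c * (n * v * y ^ (-(1 / (n : ℝ))) * a ^ 2)

lemma gapF_nonneg (hn : n ≠ 0) {c v y a : ℝ} (hc : 0 ≤ c) (hv : 0 ≤ v) (hy : 0 < y) :
    0 ≤ gapF n c v y a := by
  have := amgm_transport hn hy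
  unfold gapF
  have : 0 ≤ v * (n * y ^ (-(1 / (n : ℝ))) + y - (n + 1)) := mul_nonneg hv (by linarith)
  positivity

lemma gapF_bound (hn : n ≠ 0) {c v y a w l : ℝ} (hc : 0 < c) (hv : 0 < v)
    (hy : 0 < y) (hw : v = w * y) (hl : 0 < l) :
    a * v + max 0 (v - w) ≤ l * (1 / c + n) * gapF n c v y a + l⁻¹ * (n + 1) * (v + v * y) ∧
    w * (1 - y) ≤ l * n * gapF n c v y a + l⁻¹ * (v * (y⁻¹ * y⁻¹)) := by
  obtain ⟨hp1, hp2⟩ := psi_bounds hn hy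
  have ham := amgm_transport hn hy
  have hn1 : (1 : ℝ) ≤ n := by exact_mod_cast Nat.one_le_iff_ne_zero.2 hn
  set x := y ^ (-(1 / (n : ℝ))) with hx
  have hx0 : 0 < x := rpow_pos_of_pos hy _
  have hxi : x⁻¹ ≤ 1 + y := by
    rw [hx, rpow_neg hy.le, inv_inv]; rcases le_total y 1 with h | h
    · linarith [rpow_le_one hy.le h (by positivity : 0 ≤ 1 / (n : ℝ))]
    · have := Real.rpow_le_rpow_of_exponent_le h (by rw [div_le_one (by linarith)]; exact hn1 :
        1 / (n : ℝ) ≤ 1)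
      rw [rpow_one] at this; linarith
  set ψ := n * x + y - (n + 1) with hψ
  have hF1 : v * ψ ≤ gapF n c v y a := by
    unfold gapF; rw [← hx, ← hψ]; have : 0 ≤ c * (n * v * x * a ^ 2) := by positivity
    linarith
  have hF2 : v * x * a ^ 2 ≤ 1 / c * gapF n c v y a := by
    unfold gapF; rw [← hx, ← hψ]
    rw [mul_add, ← mul_assoc (1 / c) c, one_div_mul_cancel hc.ne', one_mul]
    have h1 : 0 ≤ 1 / c * (v * ψ) := by positivity
    have h2 : 0 ≤ v * x * a ^ 2 := by positivity
    nlinarith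
  constructor
  · have e1 : a ≤ l * (x * a ^ 2) + l⁻¹ * x⁻¹ := by
      have : 0 ≤ (l * x * a - 1) ^ 2 / (l * x) := by positivity
      have e : (l * x * a - 1) ^ 2 / (l * x) = l * (x * a ^ 2) - 2 * a + l⁻¹ * x⁻¹ := by
        field_simp; ring
      by_cases ha : 0 ≤ a
      · linarith
      · have : 0 ≤ l * (x * a ^ 2) + l⁻¹ * x⁻¹ := by positivity
        linarith
    have e2 : a * v ≤ l * (1 / c * gapF n c v y a) + l⁻¹ * (v + v * y) := by
      calc a * v ≤ (l * (x * a ^ 2) + l⁻¹ * x⁻¹) * v := mul_le_mul_of_nonneg_right e1 hv.le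
        _ = l * (v * x * a ^ 2) + l⁻¹ * (v * x⁻¹) := by ring
        _ ≤ l * (1 / c * gapF n c v y a) + l⁻¹ * (v * (1 + y)) := by gcongr
        _ = _ := by ring
    have e3 : v - w ≤ n * (l * gapF n c v y a + l⁻¹ * v) := by
      rw [(by rw [hw]; field_simp : v - w = v * (1 - y⁻¹))]
      calc v * (1 - y⁻¹) ≤ v * (n * (l * ψ + l⁻¹)) := mul_le_mul_of_nonneg_left (hp2 l hl) hv.le
        _ = n * (l * (v * ψ) + l⁻¹ * v) := by ring
        _ ≤ _ := by gcongr
    have hFn : 0 ≤ gapF n c v y a := (mul_nonneg hv.le (by linarith : 0 ≤ ψ)).trans hF1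
    have e4 : max 0 (v - w) ≤ n * (l * gapF n c v y a + l⁻¹ * v) := max_le (by positivity) e3
    have : 0 ≤ l⁻¹ * n * (v * y) := by positivity
    linarith
  · have e : w = v * y⁻¹ := by rw [hw]; field_simp
    set p := max 0 (1 - y); have h1 : 1 - y ≤ p := le_max_right _ _
    have hp0 : 0 ≤ p := le_max_left _ _; have e1 : y⁻¹ * p ≤ l * p ^ 2 + l⁻¹ * (y⁻¹ * y⁻¹) := by
      have : 0 ≤ (l * p - y⁻¹) ^ 2 / l := by positivity
      have e : (l * p - y⁻¹) ^ 2 / l = l * p ^ 2 - 2 * (y⁻¹ * p) + l⁻¹ * (y⁻¹ * y⁻¹) := by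
        field_simp; ring
      have : 0 ≤ y⁻¹ * p := by positivity
      linarith
    calc w * (1 - y) ≤ v * (y⁻¹ * p) := by
          rw [e, mul_assoc]; gcongr
      _ ≤ v * (l * p ^ 2 + l⁻¹ * (y⁻¹ * y⁻¹)) := by gcongr
      _ ≤ v * (l * (n * ψ) + l⁻¹ * (y⁻¹ * y⁻¹)) := by gcongr
      _ = l * n * (v * ψ) + l⁻¹ * (v * (y⁻¹ * y⁻¹)) := by ring
      _ ≤ _ := by gcongr

lemma transport_pointwise_gap (hn : n ≠ 0) (hc : 0 < c) (hI : IsoQ n c)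
    {F : Set (Eu n)} (hF : MeasurableSet F)
    (hFf : volume F ≠ ⊤) {m S d : ℝ} (hm : 0 < m) (hS : S ∈ Icc (-1 : ℝ) 1) (hd : 0 ≤ d)
    (h : vol F = m / omegaB (n + 1) * vB n S * d) :
    ofReal (gapF n c (vol F) (d / kapB (n + 1) m) (asym n F)) + ofReal ((n + 1) * vol F) ≤
      ofReal (kapB (n + 1) m)⁻¹ * (ofReal √(1 - S ^ 2) * per F + ofReal d * volume F) := by
  rcases eq_or_lt_of_le (measureReal_nonneg (μ := volume) (s := F)) with h0 | hv
  · rw [← h0]; simp [gapF]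
  obtain ⟨hdp, hBp, hid, -⟩ := transport_identity hn hm hv hS hd h
  have hk := kapB_pos (n + 1) hm
  set κ := kapB (n + 1) m
  set v := vol F with hv_def
  set a := asym n F
  have hy : 0 < d / κ := div_pos hdp hk
  have hFv : volume F = ofReal v := (ofReal_toReal hFf).symm
  rw [← ofReal_add (gapF_nonneg hn hc.le hv.le hy) (by positivity)]
  have hiso := hI F hF (by rw [hFv]; simpa using hv) hFf
  rw [← hv_def] at hiso
  have hK := isoK_nonneg n
  calc _ = ofReal (κ⁻¹ * (√(1 - S ^ 2) * (isoK n * v ^ (((n : ℝ) - 1) / n) * (1 + c * a ^ 2)) +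
          d * v)) := by
        congr 1; rw [← mul_assoc, hid, gapF]; field_simp; ring
    _ = ofReal κ⁻¹ * (ofReal √(1 - S ^ 2) *
        ofReal (isoK n * v ^ (((n : ℝ) - 1) / n) * (1 + c * a ^ 2)) + ofReal d * volume F) := by
        rw [hFv, ← ofReal_mul (by positivity), ← ofReal_mul hd,
          ← ofReal_add (by positivity) (by positivity), ← ofReal_mul (by positivity)]
    _ ≤ _ := by gcongr

lemma lintegral_gapF_le (hn : n ≠ 0) (hc : 0 < c) (hI : IsoQ n c)
    {E : Set (Eu (n + 1))} (hE : MeasurableSet E) (hpos : 0 < volume E) (hf : volume E ≠ ⊤)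
    (hδ : 0 ≤ δ) (hper : per E ≤ ofReal ((n + 1) * kapB (n + 1) (vol E) * vol E * (1 + δ)))
    {T : ℝ → ℝ} (hT1 : Monotone T) (hT2 : ∀ t, T t ∈ Icc (-1 : ℝ) 1)
    (hT4 : ∀ᵐ t, sliceVol E t = vol E / omegaB (n + 1) * vB n (T t) * deriv T t) :
    (∫⁻ t, ofReal (gapF n c (sliceVol E t) (deriv T t / kapB (n + 1) (vol E))
      (asym n (consE t ⁻¹' E)))) ≤ ofReal ((n + 1) * vol E * δ) ∧
    (∫⁻ t, ofReal (sliceVol E t * (deriv T t / kapB (n + 1) (vol E)))) ≤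
      ofReal ((n + 1) * vol E * (1 + δ)) := by
  set m := vol E with hm_def
  have hm : 0 < m := toReal_pos hpos.ne' hf
  have hk := kapB_pos (n + 1) hm
  set κ := kapB (n + 1) m
  obtain ⟨t₀, ht₀⟩ := (slice_ineq hE).exists
  have h1 := ht₀ T T 0 hT1 le_rfl (fun t => by simp) (fun t => abs_le.2 (hT2 t))
  simp only [ofReal_zero, zero_mul, add_zero] at h1
  have hmeas : Measurable fun t => ofReal ((n + 1) * sliceVol E t) :=
    ((measurable_volume_slice hE).ennreal_toReal.const_mul _).ennreal_ofReal
  have hvint : ∫⁻ t, ofReal ((n + 1) * sliceVol E t) = ofReal ((n + 1) * m) := by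
    rw [← ofReal_integral_eq_lintegral_ofReal ((integrable_sliceVol hE hf).const_mul _)
      (.of_forall fun t => mul_nonneg (by positivity) (sliceVol_nonneg E t)),
      integral_const_mul, integral_sliceVol hE hf]
    rfl
  have hκI : ofReal κ⁻¹ * ∫⁻ t, (ofReal √(1 - T t ^ 2) * per (consE t ⁻¹' E) +
      ofReal (deriv T t) * volume (consE t ⁻¹' E)) ≤
      ofReal ((n + 1) * m * (1 + δ)) := by
    calc _ ≤ ofReal κ⁻¹ * ofReal ((n + 1) * κ * m * (1 + δ)) := by
          gcongr; exact h1.trans hper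
      _ = _ := by rw [← ofReal_mul (by positivity)]; congr 1; field_simp
  rw [← lintegral_const_mul' _ _ ofReal_ne_top] at hκI
  constructor
  · have h2 : (∫⁻ t, ofReal (gapF n c (sliceVol E t) (deriv T t / κ)
        (asym n (consE t ⁻¹' E)))) + ofReal ((n + 1) * m) ≤
        ofReal ((n + 1) * m * (1 + δ)) := by
      rw [← hvint, ← lintegral_add_right _ hmeas]; refine le_trans (lintegral_mono_ae ?_) hκI
      filter_upwards [hT4, ae_slice_lt_top hE hf] with t ht hft
      exact transport_pointwise_gap hn hc hI (measurableSet_slice hE t) hft.ne hm (hT2 t)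
        hT1.deriv_nonneg ht
    rw [show (n + 1) * m * (1 + δ) = (n + 1) * m * δ + (n + 1) * m by ring,
      ofReal_add (by positivity) (by positivity)] at h2
    exact (ENNReal.add_le_add_iff_right ofReal_ne_top).1 h2
  · refine le_trans (lintegral_mono_ae ?_) hκI; filter_upwards [ae_slice_lt_top hE hf] with t hft
    have e : volume (consE t ⁻¹' E) = ofReal (sliceVol E t) := (ofReal_toReal hft.ne).symm
    rw [e, ← ofReal_mul hT1.deriv_nonneg, mul_add]
    refine le_add_left ?_; rw [← ofReal_mul (by positivity)]; grind

/-- Concavity gain of the power `n/(n+1)`. -/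
lemma rpow_cut_gain (hn : n ≠ 0) : ∃ c : ℝ, 0 < c ∧ ∀ μ : ℝ, 0 ≤ μ → μ ≤ 1 / 2 →
    c * μ ^ ((n : ℝ) / (n + 1)) ≤ (1 - μ) ^ ((n : ℝ) / (n + 1)) + μ ^ ((n : ℝ) / (n + 1)) - 1 := by
  set β := (n : ℝ) / (n + 1) with hβ; have hn' : (0 : ℝ) < n := by positivity
  have hβ0 : 0 < β := by positivity
  have hβ1 : β < 1 := by rw [hβ, div_lt_one (by positivity)]; linarith
  refine ⟨1 - (1 / 2) ^ (1 - β), sub_pos.2 (Real.rpow_lt_one (by norm_num) (by norm_num)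
    (by linarith)), fun μ h0 h1 => ?_⟩
  have a1 : 1 - μ ≤ (1 - μ) ^ β := by
    have := Real.rpow_le_rpow_of_exponent_ge' (by linarith : 0 ≤ 1 - μ) (by linarith) hβ0.le hβ1.le
    rwa [rpow_one] at this
  have a2 : μ ≤ μ ^ β * (1 / 2) ^ (1 - β) := by
    rcases eq_or_lt_of_le h0 with rfl | hp
    · rw [zero_rpow hβ0.ne']; simp
    · calc μ = μ ^ β * μ ^ (1 - β) := by rw [← rpow_add hp]; simp
        _ ≤ _ := by gcongr
  linarith

lemma lintegral_even {G : ℝ → ℝ≥0∞} (hG : ∀ t, G (-t) = G t) :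
    ∫⁻ t, G t = 2 * ∫⁻ t in Ioi 0, G t := by
  have h1 : ∫⁻ t in Iio 0, G t = ∫⁻ t in Ioi 0, G t := by
    have h := (Measure.measurePreserving_neg (volume : Measure ℝ)).setLIntegral_comp_preimage_emb
      (Homeomorph.neg ℝ).measurableEmbedding G (Ioi 0)
    simp_all
  rw [← lintegral_add_compl G (measurableSet_Ioi (a := (0 : ℝ))), Set.compl_Ioi,
    Measure.restrict_congr_set Iio_ae_eq_Iic.symm, h1, two_mul]

lemma transport_lower (hn : n ≠ 0) : ∃ c₁ C : ℝ, 0 < c₁ ∧ 0 < C ∧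
    ∀ E : Set (Eu (n + 1)), MeasurableSet E → 0 < volume E → volume E ≠ ⊤ →
    ∀ δ : ℝ, 0 ≤ δ → per E ≤ ofReal ((n + 1) * kapB (n + 1) (vol E) * vol E * (1 + δ)) →
    ∀ T : ℝ → ℝ, Monotone T → (∀ t, T t ∈ Icc (-1 : ℝ) 1) →
    (∀ t, PhiB n (T t) = (∫ x in Iic t, sliceVol E x) / vol E) →
    (∀ᵐ t, sliceVol E t = vol E / omegaB (n + 1) * vB n (T t) * deriv T t) →
    ∀ᵐ t, 0 ≤ T t → 0 < 1 - PhiB n (T t) → 2 * δ ≤ c₁ * (1 - PhiB n (T t)) ^ ((n : ℝ) / (n + 1)) →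
      0 < sliceVol E t ∧ vB n (T t) ≤ C * (deriv T t / kapB (n + 1) (vol E)) ^ 2 := by
  obtain ⟨c₁, hc₁, hgain⟩ := rpow_cut_gain hn
  obtain ⟨Ct, hCt, htail⟩ := exists_vB_tail n
  have hω := omegaB_pos (n + 1)
  refine ⟨c₁, (4 * Ct / ((n + 1) * omegaB (n + 1) * c₁)) ^ 2, hc₁, by positivity, ?_⟩
  intro E hE hpos hf δ hδ hper T hT1 hT2 hT3 hT4
  set m := vol E with hm_def
  have hm : 0 < m := toReal_pos hpos.ne' hf
  have hk := kapB_pos (n + 1) hm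
  have hkp : kapB (n + 1) m ^ (n + 1) = omegaB (n + 1) / m := kapB_pow (by simp) hm
  set κ := kapB (n + 1) m with hκ
  set β := (n : ℝ) / (n + 1) with hβ
  have hβ0 : 0 ≤ β := by positivity
  filter_upwards [hT4, ae_slice_lt_top hE hf, cut_ineq hE hf] with t ht hft hcut h0 hμ0 hμδ
  have hvi := integrable_sliceVol hE hf
  have hΦ : 1 / 2 ≤ PhiB n (T t) := by
    rw [← PhiB_zero n]; exact (strictMonoOn_PhiB n).monotoneOn (by norm_num) (hT2 t) h0
  set μ := 1 - PhiB n (T t) with hμ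
  have hΦμ : PhiB n (T t) = 1 - μ := by rw [hμ]; ring
  have hIic : ∫ x in Iic t, sliceVol E x = (1 - μ) * m := by
    have := hT3 t; rw [hΦμ] at this; field_simp at this; linarith
  have hIoi : ∫ x in Ioi t, sliceVol E x = μ * m := by
    have h := integral_add_compl (measurableSet_Iic (a := t)) hvi
    rw [compl_Iic, hIic, integral_sliceVol hE hf] at h; change _ = m at h; linarith
  rw [← integral_Iic_eq_integral_Iio, hIic, hIoi] at hcut
  have hμ2 : μ ≤ 1 / 2 := by linarith
  have hcut' := (hcut (by nlinarith) (by positivity)).trans (add_le_add_left hper _)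
  have hv0 := sliceVol_nonneg E t
  rw [show volume (consE t ⁻¹' E) = ofReal (sliceVol E t) from
    (ofReal_toReal hft.ne).symm, ← ofReal_mul (by norm_num),
    ← ofReal_add (by positivity) (by positivity),
    ofReal_le_ofReal_iff (by positivity), mul_rpow (by linarith) hm.le,
    mul_rpow hμ0.le hm.le, ← add_mul, mul_comm _ (m ^ β), ← mul_assoc] at hcut'
  have hiso := isoK_mul_rpow (N := n + 1) (by simp) hm
  push_cast at hiso
  rw [add_sub_cancel_right, ← hβ, ← hκ] at hiso
  rw [hiso] at hcut'
  have hg := hgain μ hμ0.le hμ2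
  set p := μ ^ β with hp
  have hp0 : 0 < p := rpow_pos_of_pos hμ0 _
  have hM : 0 < (n + 1) * κ * m := by positivity
  have hv : (n + 1) * κ * m * (c₁ * p) / 4 ≤ sliceVol E t := by
    have : c₁ * p / 2 ≤ (1 - μ) ^ β + p - 1 - δ := by linarith
    nlinarith [mul_le_mul_of_nonneg_left this hM.le]
  have hvpos : 0 < sliceVol E t := lt_of_lt_of_le (by positivity) hv
  refine ⟨hvpos, ?_⟩
  obtain ⟨hdp, hBp, -, hvw⟩ := transport_identity hn hm hvpos (hT2 t) hT1.deriv_nonneg ht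
  rw [← hκ] at hvw
  set y := deriv T t / κ with hy
  have hy0 : 0 < y := div_pos hdp hk
  set V := vB n (T t) with hV
  have htl := htail (T t) h0 (hT2 t).2
  rw [← hμ, ← hp, ← hV] at htl
  have h5 : (n + 1) * omegaB (n + 1) * (c₁ * p) / 4 ≤ V * y := by
    rw [hvw] at hv; have e : κ * m = κ ^ (-(n : ℤ)) * omegaB (n + 1) := by
      have : omegaB (n + 1) = κ ^ (n + 1) * m := by rw [hkp]; field_simp
      rw [this, zpow_neg, zpow_natCast, pow_succ]; field_simp
    have hz : 0 < κ ^ (-(n : ℤ)) := by positivity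
    refine le_of_mul_le_mul_left ?_ hz
    calc _ = (n + 1) * (κ * m) * (c₁ * p) / 4 := by rw [e]; ring
      _ ≤ _ := by linarith
  have h6 : √V ≤ 4 * Ct / ((n + 1) * omegaB (n + 1) * c₁) * y := by
    have hb : 0 < (n + 1) * omegaB (n + 1) * c₁ := by positivity
    rw [div_mul_eq_mul_div, le_div_iff₀ hb]; refine le_of_mul_le_mul_left ?_ hBp
    calc V * (√V * ((n + 1) * omegaB (n + 1) * c₁))
        = V * √V * ((n + 1) * omegaB (n + 1) * c₁) := by ring
      _ ≤ Ct * p * ((n + 1) * omegaB (n + 1) * c₁) := by gcongr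
      _ = 4 * Ct * ((n + 1) * omegaB (n + 1) * (c₁ * p) / 4) := by ring
      _ ≤ 4 * Ct * (V * y) := by gcongr
      _ = _ := by ring
  calc V = √V ^ 2 := (sq_sqrt hBp.le).symm
    _ ≤ (4 * Ct / ((n + 1) * omegaB (n + 1) * c₁) * y) ^ 2 := by gcongr
    _ = _ := by ring

/-- Integral bound for the one-sided slices of a symmetric set of small deficit. -/
lemma symmetric_core (hn : n ≠ 0) (hc : 0 < c)
    {E : Set (Eu (n + 1))} (hE : MeasurableSet E) (hpos : 0 < volume E) (hf : volume E ≠ ⊤)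
    (hsym : SymE Finset.univ E)
    (hδ : 0 ≤ δ) (hδ1 : δ ≤ 1) {T : ℝ → ℝ} (hT1 : Monotone T)
    (hT2 : ∀ t, T t ∈ Icc (-1 : ℝ) 1) (hT0 : T 0 = 0)
    (hT4 : ∀ᵐ t, sliceVol E t = vol E / omegaB (n + 1) * vB n (T t) * deriv T t)
    (hA : (∫⁻ t, ofReal (gapF n c (sliceVol E t) (deriv T t / kapB (n + 1) (vol E))
      (asym n (consE t ⁻¹' E)))) ≤ ofReal ((n + 1) * vol E * δ))
    (hB : (∫⁻ t, ofReal (sliceVol E t * (deriv T t / kapB (n + 1) (vol E)))) ≤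
      ofReal ((n + 1) * vol E * (1 + δ)))
    {C s l : ℝ} (hC : 0 < C) (hs : 0 < s) (hl : 0 < l)
    (hlow : ∀ᵐ t, t ∈ Ioc 0 s → 0 < sliceVol E t ∧
        vB n (T t) ≤ C * (deriv T t / kapB (n + 1) (vol E)) ^ 2) :
    ∫⁻ t in Ioc 0 s, ofReal (sliceVol (E \ ball 0 (kapB (n + 1) (vol E))⁻¹) t) ≤
    ofReal (vol E * (l * δ * ((1 / c + 2 * n) * (n + 1)) +
      l⁻¹ * (2 * (n + 1) ^ 2 + (n + 1) + C / omegaB (n + 1)))) := by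
  set m := vol E with hm_def; have hm : 0 < m := toReal_pos hpos.ne' hf
  have hk := kapB_pos (n + 1) hm; set κ := kapB (n + 1) m with hκ; have hω := omegaB_pos (n + 1)
  set v := sliceVol E with hv; set y : ℝ → ℝ := fun t => deriv T t / κ with hy
  set G : ℝ → ℝ := fun t => gapF n c (v t) (y t) (asym n (consE t ⁻¹' E)) with hG
  have hvm : Measurable v := (measurable_volume_slice hE).ennreal_toReal
  have hym : Measurable y := (measurable_deriv T).div_const κ
  have hv0 : ∀ t, 0 ≤ v t := sliceVol_nonneg E
  have hy0 : ∀ t, 0 ≤ y t := fun t => div_nonneg hT1.deriv_nonneg hk.le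
  have hvint : ∫⁻ t, ofReal (v t) = ofReal m := by
    rw [← ofReal_integral_eq_lintegral_ofReal (integrable_sliceVol hE hf)
      (.of_forall hv0), integral_sliceVol hE hf]
    rfl
  set w : ℝ → ℝ := fun t => vBR n κ (T t / κ) with hw
  have hwe : ∀ t, w t = κ ^ (-(n : ℤ)) * vB n (T t) := fun t => by
    simp [hw, vBR, mul_div_cancel₀ _ hk.ne']
  have hpt : ∀ᵐ t, t ∈ Ioc 0 s → sliceVol (E \ ball 0 κ⁻¹) t ≤ l * (1 / c + n) * G t +
        l⁻¹ * (n + 1) * (v t + v t * y t) + max 0 (w t - vBR n κ t) ∧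
      w t * (1 - y t) ≤ l * n * G t + l⁻¹ * C * κ ^ (-(n : ℤ)) * y t ∧ 0 ≤ G t := by
    filter_upwards [hlow, hT4, ae_slice_lt_top hE hf] with t ht h4 hft hts
    obtain ⟨hvt, hVy⟩ := ht hts
    obtain ⟨hdp, hBp, -, hvw⟩ := transport_identity hn hm hvt (hT2 t) hT1.deriv_nonneg h4
    have hyt : 0 < y t := div_pos hdp hk; have hvw' : v t = w t * y t := by rw [hwe]; exact hvw
    obtain ⟨b1, b2⟩ := gapF_bound (a := asym n (consE t ⁻¹' E)) hn hc hvt hyt hvw' hl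
    refine ⟨?_, b2.trans ?_, gapF_nonneg hn hc.le hvt.le hyt⟩
    · have h1 := slice_sdiff_le hn (measurableSet_slice hE t) (hsym.slice_neg t)
        (pos_iff_ne_zero.2 fun h => by simp [hv, sliceVol, h] at hvt) hft.ne hk t
      have h2 : max 0 (v t - vBR n κ t) ≤ max 0 (v t - w t) + max 0 (w t - vBR n κ t) := by
        refine max_le (by positivity) ?_
        linarith [le_max_right 0 (v t - w t), le_max_right 0 (w t - vBR n κ t)]
      change _ ≤ asym n (consE t ⁻¹' E) * v t + max 0 (v t - vBR n κ t) at h1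
      calc _ ≤ _ := h1
        _ ≤ _ := by linarith
    · have : v t * ((y t)⁻¹ * (y t)⁻¹) ≤ C * κ ^ (-(n : ℤ)) * y t := by
        rw [hvw', hwe]; have hz : 0 < κ ^ (-(n : ℤ)) := by positivity
        calc _ = κ ^ (-(n : ℤ)) * (vB n (T t) * (y t)⁻¹) := by field_simp
          _ ≤ κ ^ (-(n : ℤ)) * (C * (y t) ^ 2 * (y t)⁻¹) := by gcongr
          _ = _ := by field_simp
      have h3 := mul_le_mul_of_nonneg_left this (inv_pos.2 hl).le; linarith
  have hvy : Measurable fun t => ofReal (l⁻¹ * (n + 1) * (v t + v t * y t)) :=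
    ((hvm.add (hvm.mul hym)).const_mul _).ennreal_ofReal
  have hwm : Measurable fun t => ofReal (w t - vBR n κ t) :=
    (((continuous_vBR n κ).measurable.comp (hT1.measurable.div_const κ)).sub
      (continuous_vBR n κ).measurable).ennreal_ofReal
  have hyC : Measurable fun t => ofReal (l⁻¹ * C * κ ^ (-(n : ℤ)) * y t) :=
    (hym.const_mul _).ennreal_ofReal
  have hGi : ∀ k : ℝ, 0 ≤ k → ∫⁻ t in Ioc 0 s, ofReal (k * G t) ≤
      ofReal (k * ((n + 1) * m * δ)) := by
    intro k hk0; simp_rw [ofReal_mul hk0]; rw [lintegral_const_mul' _ _ ofReal_ne_top]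
    gcongr; exact (setLIntegral_le_lintegral _ _).trans hA
  have hvyi : ∫⁻ t in Ioc 0 s, ofReal (l⁻¹ * (n + 1) * (v t + v t * y t)) ≤
      ofReal (l⁻¹ * (n + 1) * (m + (n + 1) * m * (1 + δ))) := by
    simp_rw [ofReal_mul (by positivity : 0 ≤ l⁻¹ * ((n : ℝ) + 1))]
    rw [lintegral_const_mul' _ _ ofReal_ne_top]
    gcongr; refine (setLIntegral_le_lintegral _ _).trans ?_
    simp_rw [fun t => ofReal_add (hv0 t) (mul_nonneg (hv0 t) (hy0 t))]
    rw [lintegral_add_left hvm.ennreal_ofReal, hvint, ofReal_add hm.le (by positivity)]; gcongr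
  have hTi : ∫⁻ t in Ioc 0 s, ofReal (deriv T t) ≤ 1 := by
    have hTm' : MonotoneOn T (uIcc 0 s) := hT1.monotoneOn _
    have h1 := hTm'.intervalIntegral_deriv_mem_uIcc; have h2 := hTm'.intervalIntegrable_deriv
    rw [intervalIntegrable_iff_integrableOn_Ioc_of_le hs.le] at h2
    rw [← ofReal_integral_eq_lintegral_ofReal h2 (.of_forall fun t => hT1.deriv_nonneg),
      ← integral_of_le hs.le, ← ofReal_one]
    refine ofReal_le_ofReal ?_; rw [uIcc_of_le (sub_nonneg.2 (hT1 hs.le))] at h1; grind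
  have hyCi : ∫⁻ t in Ioc 0 s, ofReal (l⁻¹ * C * κ ^ (-(n : ℤ)) * y t) ≤
      ofReal (l⁻¹ * (C / omegaB (n + 1)) * m) := by
    have e : ∀ t, l⁻¹ * C * κ ^ (-(n : ℤ)) * y t =
        l⁻¹ * (C / omegaB (n + 1)) * m * deriv T t := fun t => by
      have : omegaB (n + 1) = κ ^ (n + 1) * m := by rw [kapB_pow (by simp) hm]; field_simp
      rw [this, hy, zpow_neg, zpow_natCast, pow_succ]; field_simp
    simp_rw [e, ofReal_mul (by positivity : 0 ≤ l⁻¹ * (C / omegaB (n + 1)) * m)]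
    rw [lintegral_const_mul' _ _ ofReal_ne_top]
    calc _ ≤ _ := mul_le_mul_right hTi _
      _ = _ := by rw [mul_one]
  have hcmp : ∫⁻ t in Ioc 0 s, ofReal (w t - vBR n κ t) ≤ ofReal (l * n * ((n + 1) * m * δ)) +
      ofReal (l⁻¹ * (C / omegaB (n + 1)) * m) := by
    have hmono : Monotone fun t => T t / κ := fun a b h => div_le_div_of_nonneg_right (hT1 h) hk.le
    refine (mono_compare hmono (by simp [hT0]) (continuous_vBR n κ) (vBR_nonneg n hk)
      (vBR_antitoneOn n hk) hs.le).trans ?_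
    calc _ ≤ ∫⁻ t in Ioc 0 s, (ofReal (l * n * G t) +
          ofReal (l⁻¹ * C * κ ^ (-(n : ℤ)) * y t)) := by
          refine setLIntegral_mono_ae' measurableSet_Ioc ?_
          filter_upwards [hpt] with t ht hts
          obtain ⟨-, h2, h3⟩ := ht hts
          rw [deriv_div_const, ← ofReal_add (by positivity) (mul_nonneg (by positivity) (hy0 t))]
          exact ofReal_le_ofReal h2
      _ = _ := lintegral_add_right _ hyC
      _ ≤ _ := add_le_add (hGi _ (by positivity)) hyCi
  calc _ ≤ ∫⁻ t in Ioc 0 s, (ofReal (l * (1 / c + n) * G t) +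
        ofReal (l⁻¹ * (n + 1) * (v t + v t * y t)) + ofReal (w t - vBR n κ t)) := by
        refine setLIntegral_mono_ae' measurableSet_Ioc ?_
        filter_upwards [hpt] with t ht hts
        obtain ⟨h1, -, h3⟩ := ht hts
        have hnn : 0 ≤ v t + v t * y t := add_nonneg (hv0 t) (mul_nonneg (hv0 t) (hy0 t))
        have e : ofReal (w t - vBR n κ t) = ofReal (max 0 (w t - vBR n κ t)) := by
          rw [ENNReal.ofReal_max]; simp
        rw [e, ← ofReal_add (by positivity) (by positivity),
          ← ofReal_add (by positivity) (by positivity)]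
        exact ofReal_le_ofReal h1
    _ = _ := by rw [lintegral_add_right _ hwm, lintegral_add_right _ hvy]
    _ ≤ _ := add_le_add (add_le_add (hGi _ (by positivity)) hvyi) hcmp
    _ ≤ _ := by
        rw [← ofReal_add (by positivity) (by positivity),
          ← ofReal_add (by positivity) (by positivity),
          ← ofReal_add (by positivity) (by positivity)]
        refine ofReal_le_ofReal ?_; have h1 : l⁻¹ * ((n : ℝ) + 1) * (m + (n + 1) * m * (1 + δ)) ≤
            l⁻¹ * (n + 1) * (m + (n + 1) * m * (1 + 1)) := by gcongr
        grind

theorem symmetric_stability (hn : n ≠ 0) (hc : 0 < c) (hI : IsoQ n c) :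
    ∃ C δ₀ : ℝ, 0 < C ∧ 0 < δ₀ ∧ ∀ E : Set (Eu (n + 1)), MeasurableSet E → 0 < volume E →
    volume E ≠ ⊤ → SymE Finset.univ E → ∀ δ : ℝ, 0 < δ → δ ≤ δ₀ → per E ≤ ofReal
      ((n + 1) * kapB (n + 1) (vol E) * vol E * (1 + δ)) →
    vol (E \ ball 0 (radB (n + 1) (vol E))) ≤ C * √δ * vol E := by
  obtain ⟨c₁, C, hc₁, hC, hlow⟩ := transport_lower hn
  set β := (n : ℝ) / (n + 1) with hβ
  have hn1 : (1 : ℝ) ≤ n := by exact_mod_cast Nat.one_le_iff_ne_zero.2 hn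
  have hβ1 : β ≤ 1 := by rw [hβ, div_le_one (by positivity)]; linarith
  have hω := omegaB_pos (n + 1)
  set K := (2 / c₁) ^ (1 / β) with hK
  have hK0 : 0 < K := rpow_pos_of_pos (by positivity) _
  set D : ℝ := (1 / c + 2 * n) * (n + 1) + (2 * (n + 1) ^ 2 + (n + 1) + C / omegaB (n + 1)) with hD
  have hD0 : 0 < D := by positivity
  refine ⟨2 * (D + K), min 1 (1 / (16 * K ^ 2)), by positivity, by positivity, ?_⟩
  intro E hE hpos hf hsym δ hδ hδ0 hper
  have hδ1 : δ ≤ 1 := hδ0.trans (min_le_left _ _)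
  have hδK : K * √δ ≤ 1 / 4 := by
    have h1 := Real.sqrt_le_sqrt (hδ0.trans (min_le_right _ _))
    rw [show 1 / (16 * K ^ 2) = (1 / (4 * K)) ^ 2 by field_simp; norm_num,
      sqrt_sq (by positivity)] at h1
    calc _ ≤ K * (1 / (4 * K)) := by gcongr
      _ = _ := by field_simp
  have hsq : 0 < √δ := sqrt_pos.2 hδ
  have hvi := integrable_sliceVol hE hf
  have hmi := integral_sliceVol hE hf
  change _ = vol E at hmi
  set m := vol E with hm_def
  have hm : 0 < m := toReal_pos hpos.ne' hf
  obtain ⟨T, hT1, hT2, hT3, hT4⟩ := exists_transport n hvi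
    (sliceVol_nonneg E) (by rw [hmi]; exact hm)
  rw [hmi] at hT4 hT3
  have hT4' : ∀ᵐ t, sliceVol E t = m / omegaB (n + 1) * vB n (T t) * deriv T t := by
    filter_upwards [hT4] with t ht using ht.2
  have heven : ∀ t, sliceVol E (-t) = sliceVol E t := fun t => by
    rw [sliceVol, hsym.slice_even, sliceVol]
  have hhalf : ∫ x in Iic 0, sliceVol E x = m / 2 := by
    have h1 := integral_comp_neg_Iic 0 (sliceVol E); simp_rw [heven, neg_zero] at h1
    have h2 := integral_add_compl (measurableSet_Iic (a := (0 : ℝ))) hvi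
    rw [compl_Iic, ← h1, hmi] at h2; linarith
  have hT0 : T 0 = 0 := by
    refine (strictMonoOn_PhiB n).injOn (hT2 0) (by norm_num) ?_
    rw [hT3, hhalf, PhiB_zero]; field_simp
  have hcont : Continuous fun t => PhiB n (T t) := by
    have e : (fun t => PhiB n (T t)) = fun t =>
        ((∫ x in Iic 0, sliceVol E x) + ∫ x in (0 : ℝ)..t, sliceVol E x) / m := by
      funext t; rw [hT3, ← integral_Iic_sub_Iic hvi.integrableOn hvi.integrableOn]; ring
    rw [e]; exact (continuous_const.add (intervalIntegral.continuous_primitive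
      (fun a b => hvi.intervalIntegrable) 0)).div_const m
  obtain ⟨b, hb0, hb⟩ : ∃ b : ℝ, 0 ≤ b ∧ 1 - K * √δ < PhiB n (T b) := by
    have hlim : Tendsto (fun t => PhiB n (T t)) atTop (𝓝 1) := by
      have h1 : Tendsto (fun t => ∫ x in Iic t, sliceVol E x) atTop (𝓝 m) := by
        rw [← hmi]
        have h2 := tendsto_setIntegral_of_monotone (μ := volume) (s := fun t : ℝ => Iic t)
          (f := sliceVol E) (fun t => measurableSet_Iic) (fun a b h => Set.Iic_subset_Iic.2 h)
          hvi.integrableOn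
        rwa [Set.iUnion_Iic, setIntegral_univ] at h2
      have h2 := h1.div_const m; rw [div_self hm.ne'] at h2; exact h2.congr fun t => (hT3 t).symm
    have h3 := (hlim.eventually (lt_mem_nhds (by linarith [mul_pos hK0 hsq] :
      1 - K * √δ < 1))).and (eventually_ge_atTop 0)
    obtain ⟨b, h1, h2⟩ := h3.exists; exact ⟨b, h2, h1⟩
  have hΦ0 : PhiB n (T 0) = 1 / 2 := by rw [hT0, PhiB_zero]
  obtain ⟨s, ⟨hs0, -⟩, hs⟩ := intermediate_value_Icc hb0 hcont.continuousOn
    (show 1 - K * √δ ∈ Icc (PhiB n (T 0)) (PhiB n (T b)) from ⟨by rw [hΦ0]; linarith, hb.le⟩)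
  have hs : PhiB n (T s) = 1 - K * √δ := hs
  have hs0 : 0 < s := by
    rcases eq_or_lt_of_le hs0 with h | h
    · rw [← h, hΦ0] at hs; linarith
    · exact h
  obtain ⟨hA, hB⟩ := lintegral_gapF_le hn hc hI hE hpos hf hδ.le hper hT1 hT2 hT4'
  have hlow' : ∀ᵐ t, t ∈ Ioc 0 s → 0 < sliceVol E t ∧
        vB n (T t) ≤ C * (deriv T t / kapB (n + 1) m) ^ 2 := by
    filter_upwards [hlow E hE hpos hf δ hδ.le hper T hT1 hT2 hT3 hT4'] with t ht hts
    have h1 : K * √δ ≤ 1 - PhiB n (T t) := by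
      have := (strictMonoOn_PhiB n).monotoneOn (hT2 t) (hT2 s) (hT1 hts.2); linarith
    refine ht (hT0 ▸ hT1 hts.1.le) (lt_of_lt_of_le (by positivity) h1) ?_
    have h2 : 2 * δ ≤ c₁ * (K * √δ) ^ β := by
      rw [mul_rpow hK0.le hsq.le, hK, ← rpow_mul (by positivity),
        one_div_mul_cancel (by positivity : 0 < β).ne', rpow_one]
      have h3 : δ ≤ √δ ^ β := by
        rw [sqrt_eq_rpow, ← rpow_mul hδ.le]
        have := Real.rpow_le_rpow_of_exponent_ge hδ hδ1 (show 1 / 2 * β ≤ 1 by linarith)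
        rwa [rpow_one] at this
      calc 2 * δ ≤ 2 * √δ ^ β := by linarith
        _ = _ := by field_simp
    refine h2.trans ?_; gcongr
  have hcore := symmetric_core (l := (√δ)⁻¹) hn hc hE hpos hf hsym hδ.le hδ1 hT1 hT2 hT0 hT4' hA hB
    hC hs0 (inv_pos.2 hsq) hlow'
  rw [(by grind : (√δ)⁻¹ * δ = √δ), inv_inv, ← hm_def] at hcore
  change _ ≤ ofReal (m * (√δ * _ + √δ * _)) at hcore
  rw [← mul_add, ← hD] at hcore
  set B := ball (0 : Eu (n + 1)) (kapB (n + 1) m)⁻¹ with hBdef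
  have hEB : MeasurableSet (E \ B) := hE.diff measurableSet_ball
  have hEBf : volume (E \ B) ≠ ⊤ := ((measure_mono sdiff_subset).trans_lt hf.lt_top).ne
  have htailm : ∫⁻ t in Ioi s, ofReal (sliceVol (E \ B) t) ≤ ofReal (m * (√δ * K)) := by
    have h1 : ∫ t in Ioi s, sliceVol E t = m * (√δ * K) := by
      have h2 := integral_add_compl (measurableSet_Iic (a := s)) hvi
      have h3 := hT3 s; rw [hs] at h3; field_simp at h3; rw [compl_Iic, ← h3, hmi] at h2; linarith
    rw [← h1, ofReal_integral_eq_lintegral_ofReal hvi.integrableOn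
      (.of_forall (sliceVol_nonneg E))]
    refine lintegral_mono_ae (ae_restrict_of_ae ?_)
    filter_upwards [ae_slice_lt_top hE hf] with t ht
    exact ofReal_le_ofReal (toReal_mono ht.ne (measure_mono (Set.preimage_mono sdiff_subset)))
  have hvol : volume (E \ B) ≤ ofReal (2 * (m * (√δ * D) + m * (√δ * K))) := by
    rw [volume_consE hEB]
    have e : ∫⁻ t, volume (consE t ⁻¹' (E \ B)) = ∫⁻ t, ofReal (sliceVol (E \ B) t) := by
      refine lintegral_congr_ae ?_
      filter_upwards [ae_slice_lt_top hEB hEBf] with t ht; exact (ofReal_toReal ht.ne).symm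
    have hev : ∀ t, ofReal (sliceVol (E \ B) (-t)) = ofReal (sliceVol (E \ B) t) := by
      intro t; have : SymE Finset.univ (E \ B) := by
        intro x x' h1 h2
        rw [Set.mem_sdiff, Set.mem_sdiff, hsym x x' h1 h2, hBdef, mem_ball_zero_iff,
          mem_ball_zero_iff]
        have : ‖x‖ = ‖x'‖ := by
          rw [EuclideanSpace.norm_eq, EuclideanSpace.norm_eq]; congr 1
          refine Finset.sum_congr rfl fun k hk => ?_; rw [norm_eq_abs, norm_eq_abs, h1 k hk]
        rw [this]
      rw [sliceVol, this.slice_even, sliceVol]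
    rw [e, lintegral_even hev, ofReal_mul (by norm_num), ofReal_add (by positivity) (by positivity)]
    have hsplit : Ioi (0 : ℝ) = Ioc 0 s ∪ Ioi s := (Set.Ioc_union_Ioi_eq_Ioi hs0.le).symm
    rw [hsplit, lintegral_union measurableSet_Ioi (Set.Ioc_disjoint_Ioi le_rfl)]
    simp only [ENNReal.ofReal_ofNat]; gcongr
  have := toReal_mono ofReal_ne_top hvol
  rw [toReal_ofReal (by positivity)] at this
  calc _ ≤ _ := this
    _ = _ := by ring

/-- A set split in half by the hyperplane `x i = 0`. -/
def Halved (i : Fin N) (E : Set (Eu N)) : Prop :=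
  ∀ σ : ℝ, σ ^ 2 = 1 → vol (E ∩ halfE σ i) = vol E / 2

lemma volume_halves (i : Fin N) (hf : volume E ≠ ⊤) :
    vol (E ∩ halfE 1 i) + vol (E ∩ halfE (-1) i) = vol E := by
  have h1 := measureReal_inter_add_diff (μ := volume) (s := E)
    (isOpen_halfE (N := N) 1 i).measurableSet hf
  rw [← h1]
  congr 1
  rw [measureReal_def, measureReal_def]
  congr 1
  refine measure_congr ?_
  have h2 : ∀ᵐ x : Eu N, x i ≠ 0 := by rw [ae_iff]; simpa using volume_hyper i 0
  filter_upwards [h2] with x hx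
  refine propext ?_
  change x ∈ E ∩ halfE (-1) i ↔ x ∈ E \ halfE 1 i
  simp only [mem_inter_iff, Set.mem_sdiff, halfE, mem_setOf_eq, one_mul, not_lt]
  refine and_congr_right fun _ => ⟨fun h => by linarith, fun h => ?_⟩
  have := lt_of_le_of_ne h hx
  linarith

lemma halved_of_pos (i : Fin N) (hE : MeasurableSet E)
    (hf : volume E ≠ ⊤) (h : vol (E ∩ halfE 1 i) = vol E / 2) : Halved i E := by
  intro σ hσ
  rcases sq_eq_one_iff.1 hσ with rfl | rfl
  · exact h
  · have := volume_halves i hf; linarith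

/-- The `i`-th coordinate vector. -/
def coordE (i : Fin N) : Eu N := EuclideanSpace.single i 1

@[simp] lemma coordE_same (i : Fin N) : coordE i i = 1 := by simp [coordE]

lemma coordE_ne {i k : Fin N} (h : k ≠ i) : coordE i k = 0 := by simp [coordE, h]

@[simp] lemma norm_coordE (i : Fin N) : ‖coordE i‖ = 1 := by simp [coordE]

lemma abs_apply_le_norm (x : Eu N) (i : Fin N) : |x i| ≤ ‖x‖ := by
  have := PiLp.norm_apply_le x i
  simpa using this

lemma volume_translate (E : Set (Eu N)) (a : Eu N) :
    volume ((fun x => x + a) ⁻¹' E) = volume E := measure_preimage_add_right _ _ _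

lemma exists_halved (i : Fin N) (hE : MeasurableSet E)
    (hf : volume E ≠ ⊤) : ∃ t : ℝ, Halved i ((fun x => x + t • coordE i) ⁻¹' E) := by
  set h : ℝ → ℝ := fun t => ∫ x in E, indicator {x : Eu N | t < x i} (fun _ => (1 : ℝ)) x
    with hh
  have hms : ∀ t : ℝ, MeasurableSet {x : Eu N | t < x i} := fun t =>
    measurableSet_lt measurable_const (measurable_apply_eu i)
  have hval : ∀ t, h t = vol (E ∩ {x : Eu N | t < x i}) := fun t => by
    simp [hh, integral_indicator_const _ (hms t), smul_eq_mul, mul_one, measureReal_restrict_apply (hms t), inter_comm]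
  have hbd : Integrable (fun _ : Eu N => (1 : ℝ)) (volume.restrict E) :=
    integrable_const_iff.2 (Or.inr ⟨by simpa using hf.lt_top⟩)
  have hle : ∀ t x, ‖indicator {x : Eu N | t < x i} (fun _ => (1 : ℝ)) x‖ ≤ 1 := fun t x => by
    rw [Set.indicator_apply]; split_ifs <;> simp
  have hmeas : ∀ t, AEStronglyMeasurable (indicator {x : Eu N | t < x i} (fun _ => (1 : ℝ)))
      (volume.restrict E) := fun t => (measurable_const.indicator (hms t)).aestronglyMeasurable
  have hcont : Continuous h := by
    refine continuous_iff_continuousAt.2 fun t => ?_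
    refine continuousAt_of_dominated (bound := fun _ => 1) (.of_forall hmeas)
      (.of_forall fun s => .of_forall (hle s)) hbd (ae_restrict_of_ae ?_)
    filter_upwards [(by rw [ae_iff]; simpa using volume_hyper i t : ∀ᵐ x : Eu N, x i ≠ t)] with x hx
    rcases lt_or_gt_of_ne hx with hlt | hgt
    · refine (continuousAt_const (y := (0 : ℝ))).congr ?_
      filter_upwards [lt_mem_nhds hlt] with s hs; rw [indicator_of_notMem]; simpa using hs.le
    · refine (continuousAt_const (y := (1 : ℝ))).congr ?_
      filter_upwards [gt_mem_nhds hgt] with s hs; rw [indicator_of_mem]; exact hs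
  have hlim {l : Filter ℝ} [l.IsCountablyGenerated] {c : ℝ}
      (hl : ∀ x : Eu N, ∀ᶠ s in l, indicator {x : Eu N | s < x i} (fun _ => (1 : ℝ)) x = c) :
      Tendsto h l (𝓝 (∫ _ in E, c)) :=
    tendsto_integral_filter_of_dominated_convergence (fun _ => 1) (.of_forall hmeas)
      (.of_forall fun s => .of_forall (hle s)) hbd
      (.of_forall fun x => tendsto_const_nhds.congr' ((hl x).mono fun s hs => hs.symm))
  have htop : Tendsto h atTop (𝓝 0) := by
    simpa using hlim (c := 0) fun x => (eventually_ge_atTop (x i)).mono fun s hs => by simpa using hs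
  have hbot : Tendsto h atBot (𝓝 (vol E)) := by
    simpa using hlim (c := 1) fun x => (eventually_lt_atBot (x i)).mono fun s hs => by simpa using hs
  have key : ∃ t, h t = vol E / 2 := by
    rcases eq_or_lt_of_le (measureReal_nonneg (μ := volume) (s := E)) with h0 | h0
    · refine ⟨0, ?_⟩
      have h1 : h 0 ≤ vol E := by rw [hval]; exact measureReal_mono inter_subset_left hf
      have h2 : 0 ≤ h 0 := by rw [hval]; exact measureReal_nonneg
      linarith
    · obtain ⟨a, ha⟩ := (htop.eventually (gt_mem_nhds (half_pos h0))).exists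
      obtain ⟨b, hb⟩ := (hbot.eventually (lt_mem_nhds (half_lt_self h0))).exists
      exact mem_range_of_exists_le_of_exists_ge hcont ⟨a, ha.le⟩ ⟨b, hb.le⟩
  obtain ⟨t, ht⟩ := key
  refine ⟨t, halved_of_pos i ((measurable_id.add_const _) hE) (by rwa [volume_translate]) ?_⟩
  rw [hval] at ht
  rw [measureReal_def, measureReal_def, volume_translate, ← measureReal_def, ← measureReal_def, ← ht]
  rw [measureReal_def, measureReal_def, ← volume_translate (E ∩ {x : Eu N | t < x i}) (t • coordE i)]
  congr 2
  ext x
  simp [halfE]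

lemma Halved.translate (hij : i ≠ j) (h : Halved i E)
    (t : ℝ) : Halved i ((fun x => x + t • coordE j) ⁻¹' E) := by
  intro σ hσ
  have e1 : vol ((fun x => x + t • coordE j) ⁻¹' E) = vol E := by
    rw [measureReal_def, volume_translate]; rfl
  rw [e1, ← h σ hσ, measureReal_def, measureReal_def,
    ← volume_translate (E ∩ halfE σ i) (t • coordE j)]
  congr 2
  ext x
  simp [halfE, coordE_ne hij]

lemma SymE.translate (h : SymE J E)
    (hi : i ∉ J) (t : ℝ) : SymE J ((fun x => x + t • coordE i) ⁻¹' E) := by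
  intro x x' h1 h2
  refine h _ _ (fun k hk => ?_) fun k hk => ?_
  · have : k ≠ i := fun e => hi (e ▸ hk); simpa [coordE_ne this] using h1 k hk
  · simpa using h2 k hk

lemma measurable_foldE (hσ : σ ^ 2 = 1) (i : Fin N) :
    Measurable (foldE (N := N) σ i) := (lipschitz_foldE hσ i).continuous.measurable

lemma volume_fold_inter (hσ : σ ^ 2 = 1) (i : Fin N) (E : Set (Eu N)) :
    foldE σ i ⁻¹' E ∩ halfE σ i = E ∩ halfE σ i := by
  ext x
  simp only [mem_inter_iff, mem_preimage]
  refine and_congr_left fun hx => ?_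
  rw [foldE_of_nonneg hσ (le_of_lt hx)]

lemma measure_half_of_reflE (hσ : σ ^ 2 = 1) (i : Fin N)
    (hF : MeasurableSet F) (hs : ∀ x, reflE i x ∈ F ↔ x ∈ F) :
    volume F = 2 * volume (F ∩ halfE σ i) := by
  have h := lintegral_halfE hσ i (F := F.indicator 1) (by intro x; by_cases hx : x ∈ F <;> simp_all)
  rw [lintegral_indicator_one hF, setLIntegral_indicator hF] at h
  simpa using h

lemma two_mul_ofReal (a : ℝ) : (2 : ℝ≥0∞) * ofReal a = ofReal (2 * a) := by
  rw [ofReal_mul two_pos.le]; simp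

lemma volume_fold (hσ : σ ^ 2 = 1) (hE : MeasurableSet E) (hf : volume E ≠ ⊤) (h : Halved i E) :
    volume (foldE σ i ⁻¹' E) = volume E := by
  rw [measure_half_of_reflE hσ i (measurable_foldE hσ i hE)
    (fun x => by simp only [mem_preimage, foldE_reflE]), volume_fold_inter hσ]
  have h2 : volume (E ∩ halfE σ i) ≠ ⊤ := ((measure_mono inter_subset_left).trans_lt hf.lt_top).ne
  rw [← ofReal_toReal hf, ← ofReal_toReal h2, ← measureReal_def, ← measureReal_def,
    (h σ hσ), two_mul_ofReal]
  congr 1; ring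

lemma per_fold_deficit (hN : N ≠ 0) (hσ : σ ^ 2 = 1)
    (hE : MeasurableSet E) (hpos : 0 < volume E) (hf : volume E ≠ ⊤) (h : Halved i E)
    (hδ : 0 ≤ δ)
    (hper : per E ≤ ofReal (N * kapB N (vol E) * vol E * (1 + δ))) :
    per (foldE σ i ⁻¹' E) ≤ ofReal (N * kapB N (vol E) * vol E * (1 + 2 * δ)) := by
  have hm : 0 < vol E := toReal_pos hpos.ne' hf
  have hk := kapB_pos N hm
  have hlow : ∀ σ : ℝ, σ ^ 2 = 1 → ofReal (N * kapB N (vol E) * vol E) ≤ per (foldE σ i ⁻¹' E) := by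
    intro σ hσ; have hv := volume_fold hσ hE hf h
    have := isoBasic N _ (measurable_foldE hσ i hE) (by rwa [hv]) (by rwa [hv])
    rw [hv, ← measureReal_def, isoK_mul_rpow hN hm] at this; exact this
  set K := N * kapB N (vol E) * vol E with hK
  have hsum := (per_fold_le E i).trans (mul_le_mul_right hper 2)
  have h2 : (2 : ℝ≥0∞) * ofReal (K * (1 + δ)) = ofReal (K * (1 + 2 * δ)) + ofReal K := by
    rw [← ofReal_add (by positivity) (by positivity : 0 ≤ K), two_mul_ofReal]; congr 1; ring
  rw [h2] at hsum
  rcases sq_eq_one_iff.1 hσ with rfl | rfl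
  · have := (add_le_add_right (hlow (-1) (by norm_num)) (per (foldE 1 i ⁻¹' E))).trans hsum
    exact (ENNReal.add_le_add_iff_right ofReal_ne_top).1 this
  · have := (add_le_add_left (hlow 1 (by norm_num)) (per (foldE (-1) i ⁻¹' E))).trans hsum
    rw [add_comm] at this; exact (ENNReal.add_le_add_iff_right ofReal_ne_top).1 this

lemma one_add_pow_le (N : ℕ) {x : ℝ} (h0 : 0 ≤ x) (h1 : x ≤ 1) :
    (1 + x) ^ N ≤ 1 + (2 ^ N - 1) * x := by
  induction N with
  | zero => simp
  | succ n ih =>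
    have h2 : (1 : ℝ) ≤ 2 ^ n := one_le_pow₀ (by norm_num)
    have h3 : (1 + x) ^ (n + 1) ≤ (1 + (2 ^ n - 1) * x) * (1 + x) := by
      rw [pow_succ]; exact mul_le_mul_of_nonneg_right ih (by positivity)
    have h4 : 0 ≤ (2 ^ n - 1) * (x * (1 - x)) :=
      mul_nonneg (by linarith) (mul_nonneg h0 (by linarith))
    rw [pow_succ 2 n]; nlinarith

lemma volume_ball_sdiff_le (a b : Eu N) {R : ℝ} (hR : 0 < R) (h : dist a b ≤ R) :
    vol (ball a R \ ball b R) ≤ omegaB N * R ^ N * (2 ^ N * (dist a b / R)) := by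
  have hd : 0 ≤ dist a b := dist_nonneg
  have hv : ∀ (x : Eu N) {r : ℝ}, 0 < r → vol (ball x r) = omegaB N * r ^ N := by
    intro x r hr; rw [measureReal_def, volume_ball_eu x hr,
      toReal_ofReal (mul_nonneg (omegaB_pos N).le (by positivity))]
  have h1 : ball a R \ ball b R ⊆ ball b (R + dist a b) \ ball b R := by
    refine Set.sdiff_subset_sdiff_left fun x hx => ?_
    rw [mem_ball] at hx ⊢; linarith [dist_triangle x a b]
  have h2 : vol (ball b (R + dist a b) \ ball b R) =
      omegaB N * (R + dist a b) ^ N - omegaB N * R ^ N := by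
    rw [measureReal_sdiff (ball_subset_ball (by linarith)) measurableSet_ball,
      hv b (by positivity), hv b hR]
  refine (measureReal_mono h1 ?_).trans (h2.le.trans ?_)
  · exact ((measure_mono sdiff_subset).trans_lt measure_ball_lt_top).ne
  · have h4 := one_add_pow_le N (x := dist a b / R) (by positivity) ((div_le_one hR).2 h)
    rw [(by field_simp : R + dist a b = R * (1 + dist a b / R)), mul_pow]
    have h5 : 0 ≤ omegaB N * R ^ N := mul_nonneg (omegaB_pos N).le (by positivity)
    have h6 : 0 ≤ dist a b / R := by positivity
    nlinarith

open Pointwise in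
lemma volume_cone_shell {N : ℕ} (hN : N ≠ 0) {G : Set (Eu N)}
    (hc : ∀ r : ℝ, 0 < r → ∀ y ∈ G, r • y ∈ G) {R η : ℝ} (h0 : 0 < η) (h1 : η < 1) :
    η * vol (G ∩ ball 0 R) ≤ vol {y | y ∈ G ∧ (1 - η) * R ≤ ‖y‖ ∧ ‖y‖ < R} := by
  have hf : volume (G ∩ ball 0 R) ≠ ⊤ :=
    ((measure_mono Set.inter_subset_right).trans_lt measure_ball_lt_top).ne
  set V := G ∩ ball (0 : Eu N) R with hV; have hpos : 0 < 1 - η := by linarith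
  have hsm : vol ((1 - η) • V) = (1 - η) ^ N * vol V := by
    rw [measureReal_def, addHaar_smul, toReal_mul, finrank_euclideanSpace_fin,
      abs_of_nonneg (by positivity), toReal_ofReal (by positivity)]
    rfl
  have hsub : V ⊆ {y | y ∈ G ∧ (1 - η) * R ≤ ‖y‖ ∧ ‖y‖ < R} ∪ (1 - η) • V := by
    rintro y ⟨hy, hyR⟩; rw [mem_ball_zero_iff] at hyR; by_cases h : (1 - η) * R ≤ ‖y‖
    · exact Or.inl ⟨hy, h, hyR⟩
    · right
      refine (Set.mem_smul_set_iff_inv_smul_mem₀ hpos.ne' _ _).2 ⟨hc _ (inv_pos.2 hpos) _ hy, ?_⟩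
      rw [mem_ball_zero_iff, norm_smul, norm_of_nonneg (inv_pos.2 hpos).le, inv_mul_lt_iff₀ hpos]
      exact not_le.1 h
  have hf2 : volume ((1 - η) • V) ≠ ⊤ := by
    rw [addHaar_smul]; exact ENNReal.mul_ne_top ofReal_ne_top hf
  have hf1 : volume {y : Eu N | y ∈ G ∧ (1 - η) * R ≤ ‖y‖ ∧ ‖y‖ < R} ≠ ⊤ :=
    ((measure_mono (fun y hy => (⟨hy.1, mem_ball_zero_iff.2 hy.2.2⟩ : y ∈ V))).trans_lt
      hf.lt_top).ne
  have h2 := (measureReal_mono hsub (measure_union_ne_top hf1 hf2)).trans (measureReal_union_le _ _)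
  rw [hsm] at h2; have h3 : (1 - η) ^ N ≤ 1 - η := pow_le_of_le_one hpos.le (by linarith) hN
  have h4 : 0 ≤ vol V := measureReal_nonneg; nlinarith

lemma inner_coordE (w : Eu N) (i : Fin N) : ⟪w, coordE i⟫ = w i := by
  simp [coordE, EuclideanSpace.inner_single_right]

lemma le_norm_sub_of_shell {w y : Eu N} {R η : ℝ} (hR : 0 < R) (h0 : 0 < η)
    (h1 : η ≤ 1 / 2) (h2 : 26 * η * R ≤ ‖w‖) (hy : (1 - η) * R ≤ ‖y‖)
    (hwy : ‖w‖ * ‖y‖ / 13 ≤ -⟪w, y⟫) : R ≤ ‖y - w‖ := by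
  refine (sq_le_sq₀ hR.le (norm_nonneg _)).1 ?_
  rw [norm_sub_sq_real, real_inner_comm]
  have h5 : 26 * η * R * ((1 - η) * R) ≤ ‖w‖ * ‖y‖ :=
    mul_le_mul h2 hy (mul_nonneg (by linarith) hR.le) (norm_nonneg _)
  have h6 : ((1 - η) * R) ^ 2 ≤ ‖y‖ ^ 2 := pow_le_pow_left₀ (mul_nonneg (by linarith) hR.le) hy 2
  have h7 : 0 ≤ η * (1 - 2 * η) * R ^ 2 :=
    mul_nonneg (mul_nonneg h0.le (by linarith)) (by positivity)
  nlinarith [sq_nonneg ‖w‖, mul_nonneg (mul_nonneg h0.le h0.le) (sq_nonneg R)]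

set_option maxHeartbeats 800000 in
/-- Separation of two balls of equal radius inside a quadrant. -/
lemma ball_sdiff_quadrant (hij : i ≠ j) {σ τ : ℝ} (hσ : σ ^ 2 = 1)
    (hτ : τ ^ 2 = 1) {R : ℝ} (hR : 0 < R) {a b : Eu N} (hai : a i = 0) (haj : -(R / 8) < τ * a j)
    (hab : a ≠ b) (hw : σ * (b - a) i + τ * (b - a) j ≤ 0) {η : ℝ} (h0 : 0 < η) (h1 : η ≤ 1 / 2)
    (h2 : 26 * η * R ≤ dist a b) :
    η * (omegaB N * (R / 48) ^ N) ≤ vol ((ball a R \ ball b R) ∩ (halfE σ i ∩ halfE τ j)) := by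
  have hN : N ≠ 0 := by rintro rfl; exact i.elim0
  have aσ : |σ| = 1 := by rcases sq_eq_one_iff.1 hσ with rfl | rfl <;> simp
  have aτ : |τ| = 1 := by rcases sq_eq_one_iff.1 hτ with rfl | rfl <;> simp
  set w := b - a with hwdef; have hw0 : 0 < ‖w‖ := norm_pos_iff.2 (sub_ne_zero.2 hab.symm)
  set e : Eu N := σ • coordE i + τ • coordE j with he
  have hei : e i = σ := by simp [he, coordE_ne hij]
  have hej : e j = τ := by simp [he, coordE_ne hij.symm]
  have hen : ‖e‖ ≤ 2 := by
    refine (norm_add_le _ _).trans ?_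
    rw [norm_smul, norm_smul, norm_coordE, norm_coordE, norm_eq_abs, norm_eq_abs, aσ, aτ]; norm_num
  have hwe : ⟪w, e⟫ ≤ 0 := by simp_all [inner_add_right, inner_smul_right, inner_coordE]
  set y₀ : Eu N := e - (1 / (4 * ‖w‖)) • w with hy₀; have hwn : ‖(1 / (4 * ‖w‖)) • w‖ = 1 / 4 := by
    rw [norm_smul, norm_of_nonneg (by positivity)]; field_simp
  set G : Set (Eu N) := {y | ‖y‖ / 4 ≤ σ * y i ∧ ‖y‖ / 4 ≤ τ * y j ∧
    ‖w‖ * ‖y‖ / 13 ≤ -⟪w, y⟫} with hG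
  have habs : ∀ (ρ : ℝ), |ρ| = 1 → ∀ (k : Fin N) (v : Eu N), |ρ * v k| ≤ ‖v‖ := by
    intro ρ hρ k v; rw [abs_mul, hρ, one_mul]; exact abs_apply_le_norm v k
  have hball : ball y₀ (1 / 16) ⊆ G := by
    intro y hy; rw [mem_ball, dist_eq_norm] at hy; have hyn : ‖y‖ ≤ 37 / 16 := by
      have := (norm_add_le (e - (1 / (4 * ‖w‖)) • w) (y - y₀)).trans
        (add_le_add_left (norm_sub_le _ _) _)
      rw [← (by rw [hy₀]; abel : y = e - (1 / (4 * ‖w‖)) • w + (y - y₀)), hwn] at this; linarith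
    have hcomp : ∀ (ρ : ℝ), |ρ| = 1 → ∀ (k : Fin N), ρ * e k = 1 → 11 / 16 ≤ ρ * y k := by
      intro ρ hρ k hk; have h4 := abs_le.1 (habs ρ hρ k ((1 / (4 * ‖w‖)) • w)); rw [hwn] at h4
      have h5 : ρ * y k = ρ * e k - ρ * ((1 / (4 * ‖w‖)) • w) k + ρ * (y - y₀) k := by
        rw [hy₀]; simp only [PiLp.sub_apply]; ring
      rw [h5, hk]; linarith [(abs_le.1 (habs ρ hρ k (y - y₀))).1, h4.2]
    refine ⟨?_, ?_, ?_⟩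
    · grind
    · grind
    · have h3 : ⟪w, y⟫ = ⟪w, e⟫ - ‖w‖ / 4 + ⟪w, y - y₀⟫ := by
        have : y = e - (1 / (4 * ‖w‖)) • w + (y - y₀) := by rw [hy₀]; abel
        conv_lhs => rw [this]
        rw [inner_add_right, inner_sub_right, inner_smul_right, real_inner_self_eq_norm_sq]
        congr 2; field_simp
      have h4 := real_inner_le_norm w (y - y₀)
      have h5 : ‖w‖ * ‖y - y₀‖ ≤ ‖w‖ * (1 / 16) := by gcongr
      have h6 : ‖w‖ * ‖y‖ ≤ ‖w‖ * (37 / 16) := by gcongr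
      rw [h3]; linarith
  have hcone : ∀ r : ℝ, 0 < r → ∀ y ∈ G, r • y ∈ G := by
    rintro r hr y ⟨g1, g2, g3⟩; refine ⟨?_, ?_, ?_⟩
    · rw [norm_smul, norm_of_nonneg hr.le, PiLp.smul_apply, smul_eq_mul]; nlinarith
    · rw [norm_smul, norm_of_nonneg hr.le, PiLp.smul_apply, smul_eq_mul]; nlinarith
    · rw [norm_smul, norm_of_nonneg hr.le, inner_smul_right]; nlinarith
  have hGm : MeasurableSet G := by
    refine IsClosed.measurableSet ?_
    have c1 : ∀ k : Fin N, Continuous fun y : Eu N => y k := fun k => by fun_prop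
    have c2 : Continuous fun y : Eu N => ‖y‖ / 4 := by fun_prop
    have c3 : Continuous fun y : Eu N => ‖w‖ * ‖y‖ / 13 := by fun_prop
    have c4 : Continuous fun y : Eu N => -⟪w, y⟫ := by fun_prop
    exact (isClosed_le c2 (continuous_const.mul (c1 i))).inter
      ((isClosed_le c2 (continuous_const.mul (c1 j))).inter (isClosed_le c3 c4))
  have hsub : ball ((R / 3) • y₀) (R / 48) ⊆ G ∩ ball 0 R := by
    intro x hx; have hx1 : (3 / R) • x ∈ ball y₀ (1 / 16) := by
      rw [mem_ball, dist_eq_norm] at hx ⊢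
      have : (3 / R) • x - y₀ = (3 / R) • (x - (R / 3) • y₀) := by
        rw [smul_sub, smul_smul]; have : 3 / R * (R / 3) = 1 := by field_simp
        rw [this, one_smul]
      rw [this, norm_smul, norm_of_nonneg (by positivity)]
      calc 3 / R * _ < 3 / R * (R / 48) := by gcongr
        _ = 1 / 16 := by field_simp; norm_num
    have hxe : x = (R / 3) • ((3 / R) • x) := by
      rw [smul_smul]; have : R / 3 * (3 / R) = 1 := by field_simp
      rw [this, one_smul]
    refine ⟨?_, ?_⟩
    · rw [hxe]; exact hcone _ (by positivity) _ (hball hx1)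
    · rw [mem_ball_zero_iff]; rw [mem_ball, dist_eq_norm] at hx
      have hy0 : ‖y₀‖ ≤ 9 / 4 := by refine (norm_sub_le _ _).trans ?_; rw [hwn]; linarith
      have h3 : ‖x‖ ≤ ‖x - (R / 3) • y₀‖ + ‖(R / 3) • y₀‖ := by
        simpa using norm_add_le (x - (R / 3) • y₀) ((R / 3) • y₀)
      have h4 : ‖(R / 3) • y₀‖ ≤ R / 3 * (9 / 4) := by
        rw [norm_smul, norm_of_nonneg (by positivity)]; gcongr
      linarith
  have hvb : omegaB N * (R / 48) ^ N ≤ vol (G ∩ ball 0 R) := by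
    have h3 : vol (ball ((R / 3) • y₀) (R / 48)) = omegaB N * (R / 48) ^ N := by
      rw [measureReal_def, volume_ball_eu _ (by positivity),
        toReal_ofReal (mul_nonneg (omegaB_pos N).le (by positivity))]
    rw [← h3]; exact measureReal_mono hsub
      ((measure_mono Set.inter_subset_right).trans_lt measure_ball_lt_top).ne
  have hlast : vol {y | y ∈ G ∧ (1 - η) * R ≤ ‖y‖ ∧ ‖y‖ < R} ≤
      vol ((ball a R \ ball b R) ∩ (halfE σ i ∩ halfE τ j)) := by
    have htr : volume ((fun x => x + a) ⁻¹' ((ball a R \ ball b R) ∩ (halfE σ i ∩ halfE τ j))) =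
        volume ((ball a R \ ball b R) ∩ (halfE σ i ∩ halfE τ j)) :=
      volume_translate _ a
    have e1 : vol ((ball a R \ ball b R) ∩ (halfE σ i ∩ halfE τ j)) = vol ((fun x => x + a) ⁻¹'
        ((ball a R \ ball b R) ∩ (halfE σ i ∩ halfE τ j))) := by
      rw [measureReal_def, measureReal_def, htr]
    rw [e1]; refine measureReal_mono ?_ ?_
    · rintro y ⟨⟨g1, g2, g3⟩, hy1, hy2⟩; have hyR : R / 2 ≤ ‖y‖ := by nlinarith
      refine ⟨⟨?_, ?_⟩, ?_, ?_⟩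
      · rw [mem_ball, dist_eq_norm]; simpa using hy2
      · rw [mem_ball, not_lt, dist_eq_norm]; rw [(by rw [hwdef]; abel : y + a - b = y - w)]
        rw [(by rw [dist_comm, dist_eq_norm] : dist a b = ‖w‖)] at h2
        exact le_norm_sub_of_shell hR h0 h1 h2 hy1 g3
      · show 0 < σ * (y + a) i; rw [PiLp.add_apply, hai, add_zero]; linarith
      · show 0 < τ * (y + a) j; rw [PiLp.add_apply, mul_add]; linarith
    · rw [htr]
      exact ((measure_mono (inter_subset_left.trans sdiff_subset)).trans_lt measure_ball_lt_top).ne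
  calc _ ≤ η * vol (G ∩ ball 0 R) := by gcongr
    _ ≤ _ := (volume_cone_shell hN hcone (R := R) h0 (by linarith)).trans hlast

lemma abs_of_sq_one (hσ : σ ^ 2 = 1) : |σ| = 1 := by
  rcases sq_eq_one_iff.1 hσ with rfl | rfl <;> simp

lemma volumeReal_ball (x : Eu N) (hr : 0 < r) : vol (ball x r) = omegaB N * r ^ N := by
  rw [measureReal_def, volume_ball_eu x hr,
    toReal_ofReal (mul_nonneg (omegaB_pos N).le (by positivity))]

lemma volumeReal_translate (E : Set (Eu N)) (a : Eu N) : vol ((fun x => x + a) ⁻¹' E) = vol E := by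
  rw [measureReal_def, volume_translate]; rfl

/-- Centers of two balls that nearly agree inside a quadrant are close. -/
lemma dist_le_of_quadrant (hij : i ≠ j) {σ τ : ℝ} (hσ : σ ^ 2 = 1)
    (hτ : τ ^ 2 = 1) {R : ℝ} (hR : 0 < R) {a b : Eu N} (hai : a i = 0) (hbj : b j = 0)
    (haj : -(R / 8) < τ * a j) (hbi : -(R / 8) < σ * b i) {D : ℝ} (hD : D < 1 / 2)
    (h1 : vol ((ball a R \ ball b R) ∩ (halfE σ i ∩ halfE τ j)) ≤ D * (omegaB N * (R / 48) ^ N))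
    (h2 : vol ((ball b R \ ball a R) ∩ (halfE σ i ∩ halfE τ j)) ≤
      D * (omegaB N * (R / 48) ^ N)) : dist a b ≤ 26 * D * R := by
  by_contra hcon; rw [not_le] at hcon
  have hω : 0 < omegaB N * (R / 48) ^ N := mul_pos (omegaB_pos N) (by positivity)
  have hD0 : 0 ≤ D := by
    by_contra h; have := h1.trans_lt (mul_neg_of_neg_of_pos (not_le.1 h) hω)
    exact absurd measureReal_nonneg this.not_ge
  have hab : a ≠ b := by
    rintro rfl; rw [dist_self] at hcon; have : 0 ≤ 26 * D * R := by positivity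
    linarith
  obtain ⟨η, hη1, hη2, hη3⟩ : ∃ η, D < η ∧ η ≤ 1 / 2 ∧ 26 * η * R ≤ dist a b := by
    refine ⟨min (1 / 2) (dist a b / (26 * R)), lt_min hD ?_, min_le_left _ _, ?_⟩
    · rw [lt_div_iff₀ (by positivity)]; linarith
    · calc 26 * min (1 / 2) (dist a b / (26 * R)) * R ≤ 26 * (dist a b / (26 * R)) * R := by
            gcongr; exact min_le_right _ _
        _ = dist a b := by field_simp
  rcases le_total (σ * (b - a) i + τ * (b - a) j) 0 with h | h
  · have := ball_sdiff_quadrant hij hσ hτ hR hai haj hab h (hD0.trans_lt hη1) hη2 hη3; nlinarith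
  · have := ball_sdiff_quadrant hij.symm hτ hσ hR hbj hbi hab.symm (by
      simp_all) (hD0.trans_lt hη1) hη2 (by rwa [dist_comm])
    rw [inter_comm (halfE τ j)] at this; nlinarith

lemma quadrant_ball_volume (hij : i ≠ j) {σ τ : ℝ} (hσ : σ ^ 2 = 1)
    (hτ : τ ^ 2 = 1) {R : ℝ} (hR : 0 < R) :
    vol (ball (0 : Eu N) R ∩ halfE σ i ∩ halfE τ j) = omegaB N * R ^ N / 4 := by
  have e1 := measure_half_of_reflE hσ i (F := ball (0 : Eu N) R) measurableSet_ball
    (fun x => by rw [mem_ball_zero_iff, mem_ball_zero_iff, (reflE i).norm_map])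
  have e2 := measure_half_of_reflE hτ j (F := ball (0 : Eu N) R ∩ halfE σ i)
    (measurableSet_ball.inter (isOpen_halfE σ i).measurableSet)
    (fun x => by
      simp only [mem_inter_iff, mem_ball_zero_iff, (reflE j).norm_map, halfE,
        mem_setOf_eq, reflE_ne hij])
  rw [e2] at e1
  have e3 := congrArg toReal e1
  rw [toReal_mul, toReal_mul] at e3
  have e4 : (volume (ball (0 : Eu N) R)).toReal = omegaB N * R ^ N := volumeReal_ball 0 hR
  rw [e4] at e3
  simp only [ENNReal.toReal_ofNat] at e3
  rw [measureReal_def]; linarith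

lemma center_of_quadrant (hij : i ≠ j) {σ τ : ℝ} (hσ : σ ^ 2 = 1)
    (hτ : τ ^ 2 = 1) {R : ℝ} (hR : 0 < R) {a : Eu N} (hai : a i = 0)
    (hf : volume E ≠ ⊤)
    (hq : omegaB N * R ^ N / 4 ≤ vol (E ∩ (halfE σ i ∩ halfE τ j)))
    (hE : vol ((E ∩ (halfE σ i ∩ halfE τ j)) \ ball a R) <
      omegaB N * (R / 32) ^ N) : -(R / 8) < τ * a j := by
  by_contra hcon
  rw [not_lt] at hcon
  have aσ := abs_of_sq_one hσ
  have aτ := abs_of_sq_one hτ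
  set Q := ball (0 : Eu N) R ∩ halfE σ i ∩ halfE τ j with hQ
  set y₀ : Eu N := (R / 16) • (σ • coordE i + τ • coordE j) with hy₀
  have hy0n : ‖y₀‖ ≤ R / 16 * 2 := by
    rw [hy₀, norm_smul, norm_of_nonneg (by positivity)]; gcongr; refine (norm_add_le _ _).trans ?_
    rw [norm_smul, norm_smul, norm_coordE, norm_coordE, norm_eq_abs, norm_eq_abs, aσ, aτ]; norm_num
  have hcomp : ∀ y ∈ ball y₀ (R / 32), (0 < σ * y i ∧ 0 < τ * y j ∧ τ * y j < R / 8) := by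
    intro y hy; rw [mem_ball, dist_eq_norm] at hy
    have h1 := (abs_apply_le_norm (y - y₀) i); have h2 := (abs_apply_le_norm (y - y₀) j)
    have h3 : |σ * (y - y₀) i| ≤ ‖y - y₀‖ := by rwa [abs_mul, aσ, one_mul]
    have h4 : |τ * (y - y₀) j| ≤ ‖y - y₀‖ := by rwa [abs_mul, aτ, one_mul]
    rw [PiLp.sub_apply, mul_sub, (by simp [hy₀, coordE_ne hij] : y₀ i = R / 16 * σ)] at h3
    rw [PiLp.sub_apply, mul_sub, (by simp [hy₀, coordE_ne hij.symm] : y₀ j = R / 16 * τ)] at h4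
    rw [(by linear_combination (R / 16) * hσ : σ * (R / 16 * σ) = R / 16)] at h3
    rw [(by linear_combination (R / 16) * hτ : τ * (R / 16 * τ) = R / 16)] at h4
    have h4 := abs_le.1 h4
    exact ⟨by linarith [(abs_le.1 h3).1], by linarith [h4.1], by linarith [h4.2]⟩
  have hsub1 : ball y₀ (R / 32) ⊆ Q := by
    intro y hy; refine ⟨⟨?_, (hcomp y hy).1⟩, (hcomp y hy).2.1⟩; rw [mem_ball, dist_eq_norm] at hy
    rw [mem_ball_zero_iff]; have : ‖y‖ ≤ ‖y - y₀‖ + ‖y₀‖ := by simpa using norm_add_le (y - y₀) y₀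
    linarith
  have hQf : volume Q ≠ ⊤ :=
    ((measure_mono (inter_subset_left.trans inter_subset_left)).trans_lt measure_ball_lt_top).ne
  have hsub2 : (fun x => x + a) ⁻¹' ((E ∩ (halfE σ i ∩ halfE τ j)) ∩ ball a R) ⊆
      Q \ ball y₀ (R / 32) := by
    rintro y ⟨⟨_, h1, h2⟩, h3⟩; have h1 : 0 < σ * (y + a) i := h1
    have h2 : 0 < τ * (y + a) j := h2; rw [PiLp.add_apply, hai, add_zero] at h1
    rw [PiLp.add_apply, mul_add] at h2; have h4 : R / 8 < τ * y j := by linarith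
    refine ⟨⟨⟨?_, h1⟩, show 0 < τ * y j by linarith⟩, fun hy => ?_⟩
    · have h3 : y + a ∈ ball a R := h3
      rw [mem_ball, dist_eq_norm] at h3; rw [mem_ball_zero_iff]; simpa using h3
    · linarith [(hcomp y hy).2.2]
  have h1 := measureReal_mono hsub2 ((measure_mono sdiff_subset).trans_lt hQf.lt_top).ne
  rw [volumeReal_translate, measureReal_sdiff hsub1 measurableSet_ball, hQ,
    quadrant_ball_volume hij hσ hτ hR, volumeReal_ball _ (by positivity)] at h1
  have hf' : volume (E ∩ (halfE σ i ∩ halfE τ j)) ≠ ⊤ :=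
    ((measure_mono inter_subset_left).trans_lt hf.lt_top).ne
  have h2 := measureReal_inter_add_sdiff (μ := volume) (s := E ∩ (halfE σ i ∩ halfE τ j))
    (t := ball a R) measurableSet_ball hf'
  linarith

lemma volumeReal_sdiff_comm {F B : Set (Eu N)} (hF : MeasurableSet F) (hB : MeasurableSet B)
    (h : volume F = volume B) (hf : volume F ≠ ⊤) : vol (B \ F) = vol (F \ B) := by
  have h1 := measureReal_inter_add_sdiff (μ := volume) (s := F) hB hf
  have h2 := measureReal_inter_add_sdiff (μ := volume) (s := B) hF (h ▸ hf)
  rw [inter_comm] at h2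
  have h3 : vol F = vol B := by rw [measureReal_def, h]; rfl
  linarith

lemma mem_fold_iff (hσ : σ ^ 2 = 1) (hx : x ∈ halfE σ i) : x ∈ foldE σ i ⁻¹' E ↔ x ∈ E := by
  rw [mem_preimage, foldE_of_nonneg hσ (le_of_lt hx)]

set_option maxHeartbeats 800000 in
lemma merge_quadrant (hij : i ≠ j) (hE : MeasurableSet E)
    (hpos : 0 < volume E) (hf : volume E ≠ ⊤) (hi : Halved i E)
    (hj : Halved j E) {ε : ℝ} (hε : ε ≤ 1 / (1200 * 48 ^ N)) {a b : ℝ → Eu N}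
    (ha0 : ∀ σ, a σ i = 0) (hb0 : ∀ σ, b σ j = 0)
    (ha : ∀ σ, σ ^ 2 = 1 → vol (foldE σ i ⁻¹' E \ ball (a σ) (radB N (vol E))) ≤ ε * vol E)
    (hb : ∀ σ, σ ^ 2 = 1 → vol (foldE σ j ⁻¹' E \ ball (b σ) (radB N (vol E))) ≤ ε * vol E) :
    vol (E \ ball (a 1) (radB N (vol E))) ≤ (2 + 2 ^ N * (52 * (4 * 48 ^ N))) * ε * vol E := by
  have hN : N ≠ 0 := by rintro rfl; exact i.elim0
  have hm : 0 < vol E := toReal_pos hpos.ne' hf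
  set m := vol E with hmdef; set R := radB N m with hRdef; have hR : 0 < R := radB_pos N hm
  have hball : ∀ x : Eu N, volume (ball x R) = volume E := fun x => by
    rw [volume_ball_radB hN hm x, hmdef, measureReal_def, ofReal_toReal hf]
  have hωm : omegaB N * R ^ N = m := by rw [← volumeReal_ball 0 hR, measureReal_def, hball]; rfl
  have hε0 : 0 ≤ ε := by
    by_contra h; exact absurd measureReal_nonneg
      ((ha 1 (by norm_num)).trans_lt (mul_neg_of_neg_of_pos (not_le.1 h) hm)).not_ge
  set D := 4 * 48 ^ N * ε with hD
  have hD300 : D ≤ 1 / 300 := by rw [le_div_iff₀ (by positivity)] at hε; grind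
  have hD0 : 0 ≤ D := by positivity
  have hDm : D * (omegaB N * (R / 48) ^ N) = 4 * (ε * m) := by rw [← hωm, hD, div_pow]; field_simp
  have hε32 : ε * m < omegaB N * (R / 32) ^ N := by
    rw [← hωm, div_pow]; have h1 : ε * 32 ^ N < 1 := by
      rw [le_div_iff₀ (by positivity)] at hε
      have : (32 : ℝ) ^ N ≤ 48 ^ N := pow_le_pow_left₀ (by norm_num) (by norm_num) N; nlinarith
    have h2 : 0 < omegaB N * R ^ N := by rw [hωm]; exact hm
    rw [mul_div_assoc', lt_div_iff₀ (by positivity)]; nlinarith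
  have hQ : ∀ σ τ : ℝ, MeasurableSet (halfE (N := N) σ i ∩ halfE τ j) := fun σ τ =>
    (isOpen_halfE σ i).measurableSet.inter (isOpen_halfE τ j).measurableSet
  have hfsub : ∀ {S : Set (Eu N)}, S ⊆ E → volume S ≠ ⊤ := fun h =>
    ((measure_mono h).trans_lt hf.lt_top).ne
  -- masses of quadrants
  set q : ℝ → ℝ → ℝ := fun σ τ => vol (E ∩ (halfE σ i ∩ halfE τ j)) with hq
  have hsplit : ∀ (k : Fin N) {S : Set (Eu N)}, volume S ≠ ⊤ →
      vol S = vol (S ∩ halfE 1 k) + vol (S ∩ halfE (-1) k) := by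
    intro k S hS; have h1 := measureReal_inter_add_sdiff (μ := volume) (s := S)
      (isOpen_halfE 1 k).measurableSet hS
    rw [← h1]; congr 1; refine measureReal_congr ?_; have : ∀ᵐ x : Eu N, x k ≠ 0 := by
      have := volume_hyper k 0
      rw [← compl_mem_ae_iff] at this; filter_upwards [this] with x hx using hx
    filter_upwards [this] with x hx; refine propext (and_congr_right fun _ => ?_)
    show ¬ (0 < 1 * x k) ↔ 0 < -1 * x k; rcases lt_or_gt_of_ne hx with h | h
    · grind
    · grind
  have hrow : ∀ σ, σ ^ 2 = 1 → q σ 1 + q σ (-1) = m / 2 := by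
    intro σ hσ; rw [← hi σ hσ, hsplit j (hfsub inter_subset_left), inter_assoc, inter_assoc]
  have hcol : ∀ τ, τ ^ 2 = 1 → q 1 τ + q (-1) τ = m / 2 := by
    intro τ hτ; rw [← hj τ hτ, hsplit i (hfsub inter_subset_left), inter_assoc, inter_assoc,
      inter_comm (halfE τ j), inter_comm (halfE τ j)]
  have n1 : (1 : ℝ) ^ 2 = 1 := by norm_num
  have n2 : (-1 : ℝ) ^ 2 = 1 := by norm_num
  -- comparison of balls inside quadrants
  have hcmp : ∀ σ τ, σ ^ 2 = 1 → τ ^ 2 = 1 →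
      vol ((ball (a σ) R \ ball (b τ) R) ∩ (halfE σ i ∩ halfE τ j)) ≤
        D * (omegaB N * (R / 48) ^ N) ∧
      vol ((ball (b τ) R \ ball (a σ) R) ∩ (halfE σ i ∩ halfE τ j)) ≤
        D * (omegaB N * (R / 48) ^ N) := by
    intro σ τ hσ hτ; have va := volume_fold hσ hE hf hi; have vb := volume_fold hτ hE hf hj
    have ma := measurable_foldE hσ i hE; have mb := measurable_foldE hτ j hE
    have ca := volumeReal_sdiff_comm ma (measurableSet_ball (x := a σ) (ε := R))
      (by rw [va, hball]) (by rwa [va])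
    have cb := volumeReal_sdiff_comm mb (measurableSet_ball (x := b τ) (ε := R))
      (by rw [vb, hball]) (by rwa [vb])
    have hta : ∀ (x : Eu N) (S : Set (Eu N)), volume (ball x R \ S) ≠ ⊤ := fun x S =>
      ((measure_mono sdiff_subset).trans_lt measure_ball_lt_top).ne
    have htf : ∀ (F S : Set (Eu N)), volume F = volume E → volume (F \ S) ≠ ⊤ := fun F S h =>
      ((measure_mono sdiff_subset).trans_lt (h ▸ hf.lt_top)).ne
    have iff_i : ∀ x, x ∈ halfE σ i → (x ∈ foldE σ i ⁻¹' E ↔ x ∈ E) := fun x hx =>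
      mem_fold_iff hσ hx
    have iff_j : ∀ x, x ∈ halfE τ j → (x ∈ foldE τ j ⁻¹' E ↔ x ∈ E) := fun x hx =>
      mem_fold_iff hτ hx
    have ha' := ha σ hσ; have hb' := hb τ hτ; have hεm : 0 ≤ ε * m := by positivity
    rw [hDm]; constructor
    · have hsub : (ball (a σ) R \ ball (b τ) R) ∩ (halfE σ i ∩ halfE τ j) ⊆
          (ball (a σ) R \ foldE σ i ⁻¹' E) ∪ (foldE τ j ⁻¹' E \ ball (b τ) R) := by
        rintro x ⟨⟨h1, h2⟩, h3, h4⟩; by_cases hx : x ∈ E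
        · exact Or.inr ⟨(iff_j x h4).2 hx, h2⟩
        · exact Or.inl ⟨h1, fun h => hx ((iff_i x h3).1 h)⟩
      have := (measureReal_mono hsub (measure_union_ne_top (hta _ _) (htf _ _ vb))).trans
        (measureReal_union_le _ _)
      linarith
    · have hsub : (ball (b τ) R \ ball (a σ) R) ∩ (halfE σ i ∩ halfE τ j) ⊆
          (ball (b τ) R \ foldE τ j ⁻¹' E) ∪ (foldE σ i ⁻¹' E \ ball (a σ) R) := by
        rintro x ⟨⟨h1, h2⟩, h3, h4⟩; by_cases hx : x ∈ E
        · exact Or.inr ⟨(iff_i x h3).2 hx, h2⟩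
        · exact Or.inl ⟨h1, fun h => hx ((iff_j x h4).1 h)⟩
      have := (measureReal_mono hsub (measure_union_ne_top (hta _ _) (htf _ _ va))).trans
        (measureReal_union_le _ _)
      linarith
  have hclose : ∀ σ τ, σ ^ 2 = 1 → τ ^ 2 = 1 → -(R / 8) < τ * a σ j → -(R / 8) < σ * b τ i →
      dist (a σ) (b τ) ≤ 26 * D * R := fun σ τ hσ hτ h1 h2 =>
    dist_le_of_quadrant hij hσ hτ hR (ha0 σ) (hb0 τ) h1 h2 (by linarith) (hcmp σ τ hσ hτ).1
      (hcmp σ τ hσ hτ).2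
  have hmass : ∀ σ τ, σ ^ 2 = 1 → τ ^ 2 = 1 → m / 4 ≤ q σ τ → dist (a σ) (b τ) ≤ 26 * D * R := by
    intro σ τ hσ hτ h; refine hclose σ τ hσ hτ ?_ ?_
    · refine center_of_quadrant hij hσ hτ hR (ha0 σ) hf (by rw [hωm]; exact h) ?_
      refine (measureReal_mono ?_ ?_).trans_lt ((ha σ hσ).trans_lt hε32)
      · rintro x ⟨⟨h1, h2, h3⟩, h4⟩; exact ⟨(mem_fold_iff hσ h2).2 h1, h4⟩
      · exact ((measure_mono sdiff_subset).trans_lt ((volume_fold hσ hE hf hi) ▸ hf.lt_top)).ne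
    · refine center_of_quadrant hij.symm hτ hσ hR (hb0 τ) hf
        (by rw [hωm, inter_comm (halfE τ j)]; exact h) ?_
      refine (measureReal_mono ?_ ?_).trans_lt ((hb τ hτ).trans_lt hε32)
      · rintro x ⟨⟨h1, h2, h3⟩, h4⟩; exact ⟨(mem_fold_iff hτ h2).2 h1, h4⟩
      · exact ((measure_mono sdiff_subset).trans_lt ((volume_fold hτ hE hf hj) ▸ hf.lt_top)).ne
  have hsmall : 26 * D * R < R / 8 := by nlinarith
  have hcoord : ∀ (x y : Eu N) (k : Fin N), y k = 0 → dist x y ≤ 26 * D * R → |x k| < R / 8 := by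
    intro x y k hy h; rw [dist_eq_norm] at h
    have := abs_apply_le_norm (x - y) k; rw [PiLp.sub_apply, hy, sub_zero] at this; linarith
  have hgo : ∀ τ, τ ^ 2 = 1 → m / 4 ≤ q 1 τ → m / 4 ≤ q (-1) (-τ) →
      dist (a 1) (a (-1)) ≤ 52 * D * R := by
    intro τ hτ h1 h2; have hτ' : (-τ) ^ 2 = 1 := by rwa [neg_sq]
    have d1 := hmass 1 τ n1 hτ h1
    have d2 := hmass (-1) (-τ) n2 hτ' h2; have c1 := hcoord _ _ j (hb0 τ) d1
    have c2 := hcoord _ _ i (ha0 (-1)) (by rw [dist_comm]; exact d2)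
    have d3 := hclose 1 (-τ) n1 hτ' (by
      have : |(-τ) * a 1 j| < R / 8 := by rwa [abs_mul, abs_of_sq_one hτ', one_mul]
      exact (abs_lt.1 this).1) (by rw [one_mul]; exact (abs_lt.1 c2).1)
    have := dist_triangle (a 1) (b (-τ)) (a (-1)); rw [dist_comm (b (-τ))] at this; linarith
  have hdist : dist (a 1) (a (-1)) ≤ 52 * D * R := by
    have r1 := hrow 1 n1
    have r2 := hrow (-1) n2; have c1 := hcol 1 n1; rcases le_total (m / 4) (q 1 1) with h | h
    · exact hgo 1 n1 h (by linarith)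
    · exact hgo (-1) n2 (by linarith) (by rw [neg_neg]; linarith)
  have hdist' : dist (a (-1)) (a 1) ≤ R := by rw [dist_comm]; nlinarith
  have hbd := volume_ball_sdiff_le (a (-1)) (a 1) hR hdist'
  have hbd2 : vol (ball (a (-1)) R \ ball (a 1) R) ≤ m * (2 ^ N * (52 * D)) := by
    refine hbd.trans ?_; rw [hωm]; gcongr; rw [dist_comm, div_le_iff₀ hR]; exact hdist
  have hsp := hsplit i (S := E \ ball (a 1) R) (hfsub sdiff_subset)
  have hp : vol ((E \ ball (a 1) R) ∩ halfE 1 i) ≤ ε * m := by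
    refine (measureReal_mono ?_ ?_).trans (ha 1 n1)
    · rintro x ⟨⟨h1, h2⟩, h3⟩; exact ⟨(mem_fold_iff n1 h3).2 h1, h2⟩
    · exact ((measure_mono sdiff_subset).trans_lt ((volume_fold n1 hE hf hi) ▸ hf.lt_top)).ne
  have hn : vol ((E \ ball (a 1) R) ∩ halfE (-1) i) ≤ ε * m + m * (2 ^ N * (52 * D)) := by
    refine ((measureReal_mono (s₂ := (foldE (-1) i ⁻¹' E \ ball (a (-1)) R) ∪
      (ball (a (-1)) R \ ball (a 1) R)) ?_ ?_).trans
      (measureReal_union_le _ _)).trans (add_le_add (ha (-1) n2) hbd2)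
    · rintro x ⟨⟨h1, h2⟩, h3⟩; by_cases hx : x ∈ ball (a (-1)) R
      · exact Or.inr ⟨hx, h2⟩
      · exact Or.inl ⟨(mem_fold_iff n2 h3).2 h1, hx⟩
    · exact measure_union_ne_top ((measure_mono sdiff_subset).trans_lt
          ((volume_fold n2 hE hf hi) ▸ hf.lt_top)).ne
        ((measure_mono sdiff_subset).trans_lt measure_ball_lt_top).ne
  rw [hsp]
  calc _ ≤ ε * m + (ε * m + m * (2 ^ N * (52 * D))) := add_le_add hp hn
    _ = _ := by rw [hD]; ring

/-- Stability of the isoperimetric inequality among sets symmetric in the coordinates of `J`. -/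
def Stab (N : ℕ) (J : Finset (Fin N)) : Prop :=
  ∃ C δ₀ : ℝ, 0 < C ∧ 0 < δ₀ ∧ ∀ E : Set (Eu N), MeasurableSet E → 0 < volume E → volume E ≠ ⊤ →
    SymE J E → ∀ δ, 0 < δ → δ ≤ δ₀ →
    per E ≤ ofReal (N * kapB N (vol E) * vol E * (1 + δ)) →
    ∃ x, vol (E \ ball x (radB N (vol E))) ≤ C * √δ * vol E

lemma stab_univ (hn : n ≠ 0) (hc : 0 < c) (hI : IsoQ n c) : Stab (n + 1) Finset.univ := by
  obtain ⟨C, δ₀, hC, hδ, h⟩ := symmetric_stability hn hc hI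
  refine ⟨C, δ₀, hC, hδ, fun E hE hp hf hs δ h1 h2 h3 => ⟨0, h E hE hp hf hs δ h1 h2 ?_⟩⟩
  push_cast at h3; exact h3

lemma sqrt_two_mul_le (δ : ℝ) : √(2 * δ) ≤ 2 * √δ := by
  rw [sqrt_mul two_pos.le]
  gcongr
  rw [sqrt_le_left two_pos.le]; norm_num

lemma Stab.folded (h : Stab N (insert i J)) :
    ∃ C δ₀ : ℝ, 0 < C ∧ 0 < δ₀ ∧ ∀ E : Set (Eu N), MeasurableSet E → 0 < volume E →
    volume E ≠ ⊤ → SymE J E → Halved i E → ∀ δ, 0 < δ → δ ≤ δ₀ →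
    per E ≤ ofReal (N * kapB N (vol E) * vol E * (1 + δ)) →
    ∀ σ : ℝ, ∃ a : Eu N, a i = 0 ∧ (σ ^ 2 = 1 → vol (foldE σ i ⁻¹' E \
      ball a (radB N (vol E))) ≤ C * √δ * vol E) := by
  obtain ⟨C, δ₀, hC, hδ, h⟩ := h
  have hN : N ≠ 0 := by rintro rfl; exact i.elim0
  refine ⟨4 * C, δ₀ / 2, by positivity, by positivity, fun E hE hp hf hs hi δ h1 h2 h3 σ => ?_⟩
  by_cases hσ : σ ^ 2 = 1
  swap
  · exact ⟨0, by simp, fun h => absurd h hσ⟩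
  have hv := volume_fold hσ hE hf hi
  have hvr : vol (foldE σ i ⁻¹' E) = vol E := by rw [measureReal_def, hv]; rfl
  have hsym := hs.fold σ i
  obtain ⟨x, hx⟩ := h _ (measurable_foldE hσ i hE) (by rwa [hv]) (by rwa [hv]) hsym (2 * δ)
    (by positivity) (by linarith) (by rw [hvr]; exact per_fold_deficit hN hσ hE hp hf hi h1.le h3)
  rw [hvr] at hx
  refine ⟨(2 : ℝ)⁻¹ • (x + reflE i x), by simp, fun _ => ?_⟩
  refine (sdiff_ball_mid_le (reflE i) (hsym.reflE (Finset.mem_insert_self i J))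
    (by rwa [hv]) x _).trans ?_
  have h4 : C * √(2 * δ) * vol E ≤ C * (2 * √δ) * vol E := by
    have := sqrt_two_mul_le δ; have h0 : 0 ≤ vol E := measureReal_nonneg; gcongr
  linarith

lemma near_of_translate (v : Eu N) {R K : ℝ}
    (h : ∃ x, vol ((fun x => x + v) ⁻¹' E \ ball x R) ≤ K) :
    ∃ x, vol (E \ ball x R) ≤ K := by
  obtain ⟨x, hx⟩ := h
  refine ⟨x + v, ?_⟩
  rw [← volumeReal_translate _ v]
  convert hx using 3
  ext y
  simp

lemma sdiff_le_folds {E S : Set (Eu N)} (hE : MeasurableSet E)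
    (hf : volume E ≠ ⊤) (hi : Halved i E) :
    vol (E \ S) ≤ vol (foldE 1 i ⁻¹' E \ S) + vol (foldE (-1) i ⁻¹' E \ S) := by
  have n1 : (1 : ℝ) ^ 2 = 1 := by norm_num
  have n2 : (-1 : ℝ) ^ 2 = 1 := by norm_num
  have hsub : E \ S ⊆ (foldE 1 i ⁻¹' E \ S) ∪ (foldE (-1) i ⁻¹' E \ S) := by
    rintro x ⟨hx, hxS⟩; rcases le_total 0 (x i) with h | h
    · simp_all [mem_preimage, foldE_of_nonneg n1 (by linarith)]
    · simp_all [mem_preimage, foldE_of_nonneg n2 (by linarith)]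
  have hfin : ∀ σ : ℝ, σ ^ 2 = 1 → volume (foldE σ i ⁻¹' E \ S) ≠ ⊤ := fun σ hσ =>
    ((measure_mono sdiff_subset).trans_lt (volume_fold hσ hE hf hi ▸ hf.lt_top)).ne
  exact (measureReal_mono hsub (measure_union_ne_top (hfin 1 n1) (hfin (-1) n2))).trans
    (measureReal_union_le _ _)

/-- Reduction to a set bisected by coordinate hyperplanes. -/
lemma stab_of_centered (v : Eu N) (hE : MeasurableSet E)
    (hper : per E ≤ ofReal (N * kapB N (vol E) * vol E * (1 + δ))) :
    MeasurableSet ((fun x => x + v) ⁻¹' E) ∧ volume ((fun x => x + v) ⁻¹' E) = volume E ∧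
    vol ((fun x => x + v) ⁻¹' E) = vol E ∧
    per ((fun x => x + v) ⁻¹' E) ≤ ofReal (N * kapB N (vol E) * vol E * (1 + δ)) :=
  ⟨(measurable_id.add_const v) hE, volume_translate E v, volumeReal_translate E v,
    (per_translate_le E v).trans hper⟩

lemma stab_insert_univ (hn : n ≠ 0) (hc : 0 < c) (hI : IsoQ n c)
    {J : Finset (Fin (n + 1))} {i : Fin (n + 1)} (hiJ : i ∉ J) (h : insert i J = Finset.univ) :
    Stab (n + 1) J := by
  obtain ⟨C, δ₀, hC, hδ, hst⟩ := symmetric_stability hn hc hI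
  refine ⟨4 * C, δ₀ / 2, by positivity, by positivity, fun E hE hp hf hs δ h1 h2 h3 => ?_⟩
  obtain ⟨t, ht⟩ := exists_halved i hE hf
  obtain ⟨mE, vE, vEr, pE⟩ := stab_of_centered (t • coordE i) hE h3
  refine near_of_translate (t • coordE i) ⟨0, ?_⟩
  set E' := (fun x => x + t • coordE i) ⁻¹' E with hE'
  rw [← vEr] at pE ⊢
  refine (sdiff_le_folds mE (by rwa [vE]) ht).trans ?_
  have key : ∀ σ : ℝ, σ ^ 2 = 1 → vol (foldE σ i ⁻¹' E' \
      ball 0 (radB (n + 1) (vol E'))) ≤ C * (2 * √δ) * vol E' := by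
    intro σ hσ; have hv := volume_fold hσ mE (by rwa [vE]) ht
    have hvr : vol (foldE σ i ⁻¹' E') = vol E' := by rw [measureReal_def, hv]; rfl
    have hsym := (hs.translate hiJ t).fold σ i; rw [h] at hsym
    have := hst _ (measurable_foldE hσ i mE) (by rwa [hv, vE]) (by rwa [hv, vE]) hsym (2 * δ)
      (by positivity) (by linarith) (by
        rw [hvr]
        exact_mod_cast per_fold_deficit n.succ_ne_zero hσ mE (by rwa [vE]) (by rwa [vE]) ht h1.le pE)
    rw [hvr] at this; refine this.trans ?_
    have := sqrt_two_mul_le δ; have h0 : 0 ≤ vol E' := measureReal_nonneg; gcongr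
  linarith [key 1 (by norm_num), key (-1) (by norm_num)]

lemma stab_of_insert_insert (hij : i ≠ j) (hiJ : i ∉ J)
    (hjJ : j ∉ J) (hi : Stab N (insert i J)) (hj : Stab N (insert j J)) : Stab N J := by
  obtain ⟨C₁, δ₁, hC₁, hδ₁, h₁⟩ := hi.folded
  obtain ⟨C₂, δ₂, hC₂, hδ₂, h₂⟩ := hj.folded
  set C := max C₁ C₂ with hCdef
  set ε₀ : ℝ := 1 / (1200 * 48 ^ N) with hε₀
  have hε₀p : 0 < ε₀ := by positivity
  refine ⟨(2 + 2 ^ N * (52 * (4 * 48 ^ N))) * C, min (min δ₁ δ₂) ((ε₀ / C) ^ 2),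
    by positivity, lt_min (lt_min hδ₁ hδ₂) (by positivity), fun E hE hp hf hs δ h1 h2 h3 => ?_⟩
  obtain ⟨t, ht⟩ := exists_halved i hE hf
  obtain ⟨mE, vE, vEr, pE⟩ := stab_of_centered (t • coordE i) hE h3
  refine near_of_translate (t • coordE i) ?_
  set E' := (fun x => x + t • coordE i) ⁻¹' E with hE'
  rw [← vEr] at pE ⊢
  obtain ⟨t', ht'⟩ := exists_halved j mE (by rwa [vE])
  obtain ⟨mE', vE', vEr', pE'⟩ := stab_of_centered (t' • coordE j) mE pE
  refine near_of_translate (t' • coordE j) ?_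
  have hs'' := (hs.translate hiJ t).translate hjJ t'
  have hti := ht.translate hij t'
  set F := (fun x => x + t' • coordE j) ⁻¹' E' with hF
  rw [← vEr'] at pE' ⊢
  have hFp : 0 < volume F := by rwa [vE', vE]
  have hFf : volume F ≠ ⊤ := by rwa [vE', vE]
  have hF0 : 0 ≤ vol F := measureReal_nonneg
  have d1 : δ ≤ δ₁ := h2.trans ((min_le_left _ _).trans (min_le_left _ _))
  have d2 : δ ≤ δ₂ := h2.trans ((min_le_left _ _).trans (min_le_right _ _))
  choose a ha0 ha using h₁ F mE' hFp hFf hs'' hti δ h1 d1 pE'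
  choose b hb0 hb using h₂ F mE' hFp hFf hs'' ht' δ h1 d2 pE'
  have hε : C * √δ ≤ ε₀ := by
    have : √δ ≤ ε₀ / C := by rw [sqrt_le_left (by positivity)]; exact h2.trans (min_le_right _ _)
    rw [le_div_iff₀ (lt_max_of_lt_left hC₁)] at this; linarith
  refine ⟨a 1, (merge_quadrant hij mE' hFp hFf hti ht' hε ha0 hb0 (fun σ hσ => ?_)
    fun σ hσ => ?_).trans_eq (by ring)⟩
  · refine (ha σ hσ).trans ?_; gcongr; exact le_max_left _ _
  · refine (hb σ hσ).trans ?_; gcongr; exact le_max_right _ _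

lemma stab_all (hn : n ≠ 0) (hc : 0 < c) (hI : IsoQ n c) :
    ∀ (k : ℕ) (J : Finset (Fin (n + 1))), (Finset.univ \ J).card = k → Stab (n + 1) J := by
  intro k
  induction k using Nat.strong_induction_on with
  | _ k ih =>
    intro J hJ; rcases Nat.eq_zero_or_pos k with rfl | hk
    · have : J = Finset.univ := by simp_all
      rw [this]; exact stab_univ hn hc hI
    · obtain ⟨i, hi⟩ := Finset.card_pos.1 (hJ ▸ hk)
      have hiJ : i ∉ J := (Finset.mem_sdiff.1 hi).2; by_cases h1 : insert i J = Finset.univ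
      · exact stab_insert_univ hn hc hI hiJ h1
      · obtain ⟨j, hj⟩ : ∃ j, j ∉ insert i J := by grind
        have hji : j ≠ i := fun e => hj (e ▸ Finset.mem_insert_self i J)
        have hjJ : j ∉ J := fun e => hj (Finset.mem_insert_of_mem e)
        have hcard : ∀ l, l ∉ J → (Finset.univ \ insert l J).card < k := by grind
        exact stab_of_insert_insert hji.symm hiJ hjJ (ih _ (hcard i hiJ) _ rfl)
          (ih _ (hcard j hjJ) _ rfl)

/-- The quantitative isoperimetric inequality propagates to the next dimension. -/
lemma IsoQ.succ (hn : n ≠ 0) (hc : 0 < c) (hI : IsoQ n c) : ∃ c', 0 < c' ∧ IsoQ (n + 1) c' := by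
  obtain ⟨C, δ₀, hC, hδ, h⟩ := stab_all hn hc hI _ ∅ rfl
  set c' := min (δ₀ / 8) (1 / (8 * C ^ 2)) with hc'
  refine ⟨c', lt_min (by positivity) (by positivity), fun E hE hp hf => ?_⟩
  have hm : 0 < vol E := toReal_pos hp.ne' hf; have hA2 := asym_le_two (Nat.succ_ne_zero n) hE hp hf
  rw [isoK_mul_rpow (Nat.succ_ne_zero n) hm]; by_contra hcon
  rw [not_le] at hcon; set A := asym (n + 1) E with hA; rcases (asym_nonneg E).eq_or_lt with h0 | h0
  · have := isoBasic (n + 1) E hE hp hf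
    rw [← measureReal_def, isoK_mul_rpow (Nat.succ_ne_zero n) hm] at this; grind
  · set δ := c' * A ^ 2 with hδdef; have hδ1 : δ ≤ δ₀ := by
      have : c' ≤ δ₀ / 8 := min_le_left _ _; have : A ^ 2 ≤ 4 := by nlinarith
      rw [hδdef]
      calc c' * A ^ 2 ≤ δ₀ / 8 * 4 := by gcongr
        _ ≤ δ₀ := by linarith
    obtain ⟨x, hx⟩ := h E hE hp hf (fun y y' _ hy => by
      rw [show y = y' from by ext k; exact hy k (by simp)]) δ (by positivity : 0 < δ) hδ1 hcon.le
    have h4 := asym_le (x := x) hE hf (radB_pos (n + 1) hm) (by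
      rw [volume_ball_radB (Nat.succ_ne_zero n) hm x, measureReal_def, ofReal_toReal hf])
    rw [← hA, le_div_iff₀ hm] at h4; have h5 : A ≤ 2 * (C * √δ) := by by_contra h6; nlinarith
    have h6 : √δ ≤ A / (2 * √2 * C) := by
      rw [sqrt_le_left (by positivity), hδdef, div_pow, mul_pow, mul_pow, sq_sqrt two_pos.le]
      calc c' * A ^ 2 ≤ 1 / (8 * C ^ 2) * A ^ 2 := by gcongr; exact min_le_right _ _
        _ = _ := by ring
    have h7 : 2 * (C * √δ) ≤ A / √2 := by
      calc 2 * (C * √δ) ≤ 2 * (C * (A / (2 * √2 * C))) := by gcongr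
        _ = A / √2 := by field_simp
    have h8 : A / √2 < A := div_lt_self h0 (by rw [lt_sqrt one_pos.le]; norm_num); linarith

lemma volume_inter_lower {T L : Set ℝ} (hL : ∀ t ∈ L, volume (T ∩ Iio t) = 0) (hl : IsLowerSet L) :
    volume (T ∩ L) = 0 := by
  have hsub : T ∩ L ⊆ (⋃ q ∈ {q : ℚ | (q : ℝ) ∈ L}, T ∩ Iio (q : ℝ)) ∪
      {t | t ∈ L ∧ ∀ s ∈ L, s ≤ t} := by
    rintro t ⟨hT, ht⟩; by_cases h : ∀ s ∈ L, s ≤ t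
    · exact Or.inr ⟨ht, h⟩
    · push Not at h
      obtain ⟨s, hs, hts⟩ := h; obtain ⟨q, h1, h2⟩ := exists_rat_btwn hts
      left; rw [Set.mem_iUnion₂]; exact ⟨q, hl h2.le hs, hT, h1⟩
  refine measure_mono_null hsub (measure_union_null ?_ ?_)
  · simp_all
  · refine Set.Subsingleton.measure_zero ?_ _; intro s hs t ht; grind

open Pointwise in
lemma volume_inter_upper {T L : Set ℝ} (hL : ∀ t ∈ L, volume (T ∩ Ioi t) = 0) (hl : IsUpperSet L) :
    volume (T ∩ L) = 0 := by
  rw [← Measure.measure_neg, Set.inter_neg]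
  refine volume_inter_lower (fun t ht => ?_) fun a b h ha => hl (neg_le_neg h) ha
  rw [← Measure.measure_neg, Set.inter_neg, neg_neg]; simpa using hL _ ht

/-- A set on the line containing almost every point between two of its parts is an interval. -/
lemma ae_interval {T : Set ℝ} (h0 : 0 < volume T) (hf : volume T ≠ ⊤)
    (h : ∀ᵐ t : ℝ, 0 < volume (T ∩ Iio t) → 0 < volume (T ∩ Ioi t) → t ∈ T) :
    ∃ a b : ℝ, a < b ∧ volume T = ofReal (b - a) ∧ ∀ᵐ t : ℝ, t ∈ T → t ∈ Ioo a b := by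
  set S : Set ℝ := {t | 0 < volume (T ∩ Iio t) ∧ 0 < volume (T ∩ Ioi t)} with hS
  have hord : S.OrdConnected := by
    refine ⟨fun s hs t ht x hx => ⟨hs.1.trans_le (measure_mono ?_), ht.2.trans_le (measure_mono ?_)⟩⟩
    · grind
    · grind
  have hST : ∀ᵐ t : ℝ, t ∈ S → t ∈ T := h.mono fun t ht hts => ht hts.1 hts.2
  have hTS : ∀ᵐ t : ℝ, t ∈ T → t ∈ S := by
    have h1 : volume (T ∩ {t | volume (T ∩ Iio t) = 0}) = 0 :=
      volume_inter_lower (fun t ht => ht) fun s t hst hs =>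
        measure_mono_null (Set.inter_subset_inter_right _ (Set.Iio_subset_Iio hst)) hs
    have h2 : volume (T ∩ {t | volume (T ∩ Ioi t) = 0}) = 0 :=
      volume_inter_upper (fun t ht => ht) fun s t hst hs =>
        measure_mono_null (Set.inter_subset_inter_right _ (Set.Ioi_subset_Ioi hst)) hs
    have h3 := compl_mem_ae_iff.2 h1
    have h4 := compl_mem_ae_iff.2 h2; filter_upwards [h3, h4] with t h5 h6 hT
    exact ⟨pos_iff_ne_zero.2 fun h => h5 ⟨hT, h⟩, pos_iff_ne_zero.2 fun h => h6 ⟨hT, h⟩⟩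
  have hae : S =ᵐ[volume] T := by filter_upwards [hST, hTS] with t h1 h2; exact propext ⟨h1, h2⟩
  have hv : volume S = volume T := measure_congr hae
  have hne : S.Nonempty := nonempty_of_measure_ne_zero (hv ▸ h0.ne')
  obtain ⟨s, hs⟩ := hne; have hba : BddAbove S := by
    by_contra hb; rw [not_bddAbove_iff] at hb; have : Ici s ⊆ S := fun x hx => by
      obtain ⟨y, hy, hxy⟩ := hb x; exact hord.out hs hy ⟨hx, hxy.le⟩
    have := measure_mono (μ := volume) this; simp_all
  have hbb : BddBelow S := by
    by_contra hb; rw [not_bddBelow_iff] at hb; have : Iic s ⊆ S := fun x hx => by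
      obtain ⟨y, hy, hxy⟩ := hb x; exact hord.out hy hs ⟨hxy.le, hx⟩
    have := measure_mono (μ := volume) this; simp_all
  have hS1 : Ioo (sInf S) (sSup S) ⊆ S :=
    IsConnected.Ioo_csInf_csSup_subset ⟨⟨s, hs⟩, hord.isPreconnected⟩ hbb hba
  have hS2 : S ⊆ Icc (sInf S) (sSup S) := subset_Icc_csInf_csSup hbb hba
  have hv1 := measure_mono (μ := volume) hS1
  have hv2 := measure_mono (μ := volume) hS2; rw [volume_Ioo] at hv1
  rw [Real.volume_Icc] at hv2; refine ⟨sInf S, sSup S, ?_, hv ▸ le_antisymm hv2 hv1, ?_⟩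
  · have : 0 < ofReal (sSup S - sInf S) := (hv ▸ h0).trans_le hv2
    linarith [ENNReal.ofReal_pos.1 this]
  · have ha : ∀ᵐ t : ℝ, t ≠ sInf S := by simp [ae_iff]
    have hb : ∀ᵐ t : ℝ, t ≠ sSup S := by simp [ae_iff]
    filter_upwards [hTS, ha, hb] with t h1 h2 h3 h4; grind

lemma isoK_one : isoK 1 = 2 := by
  have h1 : omegaB 1 = 2 := by
    have h2 := volume_consE (n := 0) (E := ball 0 1) measurableSet_ball
    have h3 : ∀ t : ℝ, volume (consE (n := 0) t ⁻¹' ball 0 1) = (Ioo (-1 : ℝ) 1).indicator 1 t := by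
      intro t; rw [slice_ball]; by_cases h : |t| < 1
      · rw [if_pos h, indicator_of_mem (show t ∈ Ioo (-1 : ℝ) 1 from abs_lt.1 h)]
        rw [volume_ball_eu _ (by simp_all : 0 < √(1 ^ 2 - t ^ 2)), omegaB_zero]; simp
      · rw [if_neg h, indicator_of_notMem (show t ∉ Ioo (-1 : ℝ) 1 from fun hh => h (abs_lt.2 hh))]; simp
    simp_rw [h3] at h2; rw [lintegral_indicator_one measurableSet_Ioo, volume_Ioo] at h2
    rw [omegaB, h2, toReal_ofReal (by norm_num)]; norm_num
  rw [isoK, h1]; norm_num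

/-- The quantitative isoperimetric inequality on the line. -/
lemma isoQ_one : IsoQ 1 (1 / 4) := by
  intro E hE hp hf; rw [isoK_one]; simp only [Nat.cast_one, sub_self, zero_div, rpow_zero, mul_one]
  have hA2 := asym_le_two one_ne_zero hE hp hf
  have hA0 : 0 ≤ asym 1 E := asym_nonneg E; by_cases hper : ofReal 4 ≤ per E
  · refine (ofReal_le_ofReal ?_).trans hper; nlinarith
  rw [not_le] at hper
  set T : Set ℝ := {t | consE t (0 : Eu 0) ∈ E} with hT; have hTm : MeasurableSet T :=
    (continuous_consE.comp (Continuous.prodMk continuous_id continuous_const)).measurable hE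
  have hslice : ∀ t : ℝ, volume (consE (n := 0) t ⁻¹' E) = T.indicator 1 t := by
    intro t; by_cases h : t ∈ T
    · have e1 : consE (n := 0) t ⁻¹' E = univ :=
        Set.eq_univ_of_forall fun y => by rw [Subsingleton.elim y 0]; exact h
      have e2 : ball (0 : Eu 0) 1 = univ := by ext x; simp [Subsingleton.elim x 0]
      rw [indicator_of_mem h, e1, ← e2, volume_ball_eu _ one_pos, omegaB_zero]; simp
    · have e1 : consE (n := 0) t ⁻¹' E = ∅ :=
        Set.eq_empty_of_forall_notMem fun y => by rw [Subsingleton.elim y 0]; exact h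
      simp_all
  have hvol : volume E = volume T := by
    rw [volume_consE hE]; simp_rw [hslice]; rw [lintegral_indicator_one hTm]
  have hTf : volume T ≠ ⊤ := hvol ▸ hf; have hsv : sliceVol E = T.indicator fun _ => (1 : ℝ) := by
    ext t; rw [sliceVol, hslice]; by_cases h : t ∈ T <;> simp [h]
  have hI : ∀ S : Set ℝ, MeasurableSet S → 0 < volume (T ∩ S) → 0 < ∫ t in S, sliceVol E t := by
    intro S hS h; rw [hsv, integral_indicator_const _ hTm, smul_eq_mul, mul_one, measureReal_def,
      restrict_apply hTm]
    exact toReal_pos h.ne' ((measure_mono inter_subset_left).trans_lt hTf.lt_top).ne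
  have hcut : ∀ᵐ t : ℝ, 0 < volume (T ∩ Iio t) → 0 < volume (T ∩ Ioi t) → t ∈ T := by
    filter_upwards [cut_ineq hE hf] with t ht h1 h2
    by_contra hcon; have := ht (hI _ measurableSet_Iio h1) (hI _ measurableSet_Ioi h2)
    rw [hslice, indicator_of_notMem hcon, mul_zero, add_zero, isoK_one] at this
    norm_num at this; norm_num at hper; exact absurd this hper.not_ge
  obtain ⟨a, b, hab, hTv, hTi⟩ := ae_interval (hvol ▸ hp) hTf hcut
  have hR : 0 < (b - a) / 2 := by linarith
  have hω : omegaB 1 = 2 := by have := isoK_one; rw [isoK] at this; simpa using this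
  have hA : asym 1 E ≤ 0 := by
    have h1 := asym_le (x := consE ((a + b) / 2) (0 : Eu 0)) hE hf hR (by
      rw [volume_ball_eu _ hR, hω, hvol, hTv]; congr 1; ring)
    have h2 : volume (E \ ball (consE ((a + b) / 2) (0 : Eu 0)) ((b - a) / 2)) = 0 := by
      rw [volume_consE (hE.diff measurableSet_ball)]
      refine (lintegral_eq_zero_iff' (measurable_volume_slice
        (hE.diff measurableSet_ball)).aemeasurable).2 ?_
      filter_upwards [hTi] with t ht; have : consE (n := 0) t ⁻¹'
          (E \ ball (consE ((a + b) / 2) (0 : Eu 0)) ((b - a) / 2)) = ∅ := by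
        refine Set.eq_empty_of_forall_notMem fun y hy => hy.2 ?_
        have hy1 := hy.1; rw [Subsingleton.elim y 0] at hy1
        obtain ⟨h3, h4⟩ := ht hy1; have h5 := norm_sq_consE (n := 0) (t - (a + b) / 2) (y - 0)
        rw [Subsingleton.elim (y - 0) 0, norm_zero] at h5
        rw [mem_ball, dist_eq_norm, consE_sub, Subsingleton.elim (y - 0) 0]
        refine lt_of_pow_lt_pow_left₀ 2 hR.le ?_; rw [h5]; nlinarith
      rw [this, measure_empty]; rfl
    rw [measureReal_def, h2] at h1; simpa using h1
  have hA' : asym 1 E = 0 := le_antisymm hA hA0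
  have := isoBasic 1 E hE hp hf; rw [isoK_one] at this; simpa [hA'] using this

/-- The quantitative isoperimetric inequality. -/
lemma exists_isoQ : ∀ n : ℕ, n ≠ 0 → ∃ c, 0 < c ∧ IsoQ n c := by
  intro n
  induction n with
  | zero => intro h; exact absurd rfl h
  | succ n ih =>
    intro _; rcases Nat.eq_zero_or_pos n with rfl | hn
    · exact ⟨1 / 4, by norm_num, isoQ_one⟩
    · obtain ⟨c, hc, h⟩ := ih hn.ne'; exact h.succ hn.ne' hc

/-- Nonnegative Lipschitz functions vanishing at infinity. -/
structure Tame (L : ℝ≥0) (f : Eu N → ℝ) : Prop where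
  pos : 0 < L
  lip : LipschitzWith L f
  nonneg : ∀ x, 0 ≤ f x
  tend : Tendsto f (cocompact (Eu N)) (𝓝 0)

/-- Moments of the gradient on superlevel sets. -/
def momE (f : Eu N → ℝ) (k : ℕ) (t : ℝ) : ℝ := ∫ x in {x | t < f x}, ‖fderiv ℝ f x‖ ^ k

lemma Tame.isCompact (hf : Tame L f) (ht : 0 < t) : IsCompact {x | t ≤ f x} := by
  obtain ⟨K, hK, hKs⟩ := mem_cocompact.1 (hf.tend.eventually (gt_mem_nhds ht))
  refine hK.of_isClosed_subset (isClosed_le continuous_const hf.lip.continuous) fun x hx => ?_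
  by_contra hxK
  exact not_lt.2 (show t ≤ f x from hx) (hKs hxK)

lemma Tame.volume_lt_top (hf : Tame L f) (ht : 0 < t) : volume {x | t < f x} < ⊤ :=
  (measure_mono (t := {x | t ≤ f x}) fun _ hx => le_of_lt (show t < _ from hx)).trans_lt (hf.isCompact ht).measure_lt_top

lemma Tame.meas (hf : Tame L f) (t : ℝ) : MeasurableSet {x | t < f x} :=
  (isOpen_lt continuous_const hf.lip.continuous).measurableSet

lemma Tame.norm_fderiv_le (hf : Tame L f) (x : Eu N) : ‖fderiv ℝ f x‖ ≤ L :=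
  norm_fderiv_le_of_lipschitz ℝ hf.lip

lemma Tame.integrableOn (hf : Tame L f) (ht : 0 < t) (k : ℕ) :
    IntegrableOn (fun x => ‖fderiv ℝ f x‖ ^ k) {x | t < f x} := by
  refine Measure.integrableOn_of_bounded (M := (L : ℝ) ^ k) (hf.volume_lt_top ht).ne
    ((measurable_fderiv ℝ f).norm.pow_const k).aestronglyMeasurable (ae_of_all _ fun x => ?_)
  rw [norm_pow, norm_norm]
  exact pow_le_pow_left₀ (norm_nonneg _) (hf.norm_fderiv_le x) k

lemma momE_zero (f : Eu N → ℝ) (t : ℝ) : momE f 0 t = vol {x | t < f x} := by simp [momE]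

/-- Nonnegative combinations of the moments decrease. -/
lemma Tame.antitoneOn (hf : Tame L f) {a b c : ℝ}
    (h : ∀ y : ℝ, 0 ≤ y → y ≤ L → 0 ≤ a + b * y + c * y ^ 2) :
    AntitoneOn (fun t => a * momE f 0 t + b * momE f 1 t + c * momE f 2 t) (Ioi 0) := by
  have e : ∀ t, 0 < t → a * momE f 0 t + b * momE f 1 t + c * momE f 2 t =
      ∫ x in {x | t < f x}, (a + b * ‖fderiv ℝ f x‖ + c * ‖fderiv ℝ f x‖ ^ 2) := by
    intro t ht; have h0 := (hf.integrableOn ht 0).const_mul a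
    have h1 := (hf.integrableOn ht 1).const_mul b; simp only [pow_zero, mul_one, pow_one] at h0 h1
    have := (integral_add (h0.add h1) ((hf.integrableOn ht 2).const_mul c)).trans
      (congrArg (· + _) (integral_add h0 h1))
    simp only [Pi.add_apply] at this
    rw [this]; simp only [integral_const_mul, momE, pow_one, pow_zero]
    congr 2; rw [← integral_const_mul, mul_one]
  intro s hs t ht hst; simp only; rw [e s hs, e t ht]
  refine setIntegral_mono_set ?_ (ae_of_all _ fun x => h _ (norm_nonneg _) (hf.norm_fderiv_le x))
    (HasSubset.Subset.eventuallyLE fun x hx => lt_of_le_of_lt hst hx)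
  have h0 := (hf.integrableOn hs 0).const_mul a
  have h1 := (hf.integrableOn hs 1).const_mul b; simp only [pow_zero, mul_one, pow_one] at h0 h1
  exact (h0.add h1).add ((hf.integrableOn hs 2).const_mul c)

lemma Tame.antitoneOn_momE (hf : Tame L f) {k : ℕ} (hk : k ≤ 2) :
    AntitoneOn (momE f k) (Ioi 0) := by
  interval_cases k
  · simpa using hf.antitoneOn (a := 1) (b := 0) (c := 0) (fun _ _ _ => by simp)
  · simpa using hf.antitoneOn (a := 0) (b := 1) (c := 0) (fun y h _ => by simpa using h)
  · simpa using hf.antitoneOn (a := 0) (b := 0) (c := 1) (fun y h _ => by positivity)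

lemma Tame.ae_diff (hf : Tame L f) {k : ℕ} (hk : k ≤ 2) :
    ∀ᵐ t : ℝ, 0 < t → DifferentiableAt ℝ (momE f k) t := by
  filter_upwards [(hf.antitoneOn_momE hk).neg.ae_differentiableWithinAt_of_mem] with t h ht
  have := (h ht).differentiableAt (Ioi_mem_nhds ht)
  simpa using this.neg

lemma AntitoneOn.deriv_nonpos_of_mem {g : ℝ → ℝ} (hg : AntitoneOn g (Ioi 0))
    (ht : 0 < t) : deriv g t ≤ 0 := by
  rw [← derivWithin_of_mem_nhds (Ioi_mem_nhds ht)]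
  exact hg.derivWithin_nonpos

/-- Derivative form of the Cauchy–Schwarz inequality and of the Lipschitz bound. -/
lemma Tame.deriv_ineq (hf : Tame L f) (ht : 0 < t)
    (h0 : DifferentiableAt ℝ (momE f 0) t) (h1 : DifferentiableAt ℝ (momE f 1) t)
    (h2 : DifferentiableAt ℝ (momE f 2) t) :
    (deriv (momE f 1) t) ^ 2 ≤ deriv (momE f 0) t * deriv (momE f 2) t ∧
      -deriv (momE f 1) t ≤ L * -deriv (momE f 0) t := by
  have key : ∀ {a b c : ℝ}, (∀ y : ℝ, 0 ≤ y → y ≤ L → 0 ≤ a + b * y + c * y ^ 2) →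
      a * deriv (momE f 0) t + b * deriv (momE f 1) t + c * deriv (momE f 2) t ≤ 0 := by
    intro a b c h; have hd := ((h0.hasDerivAt.const_mul a).add (h1.hasDerivAt.const_mul b)).add
      (h2.hasDerivAt.const_mul c)
    rw [← hd.deriv]; exact (hf.antitoneOn h).deriv_nonpos_of_mem ht
  constructor
  · have := discrim_le_zero (a := -deriv (momE f 0) t) (b := 2 * deriv (momE f 1) t)
      (c := -deriv (momE f 2) t) (fun x => by
        have := key (a := x * x) (b := -2 * x) (c := 1) (fun y _ _ => by nlinarith [sq_nonneg (x - y)])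
        linarith)
    rw [discrim] at this; nlinarith
  · have := key (a := L) (b := -1) (c := 0) (fun y _ h => by linarith); linarith

/-- Truncation of `f` between the levels `t` and `t + h`. -/
def clampE (f : Eu N → ℝ) (t h : ℝ) (x : Eu N) : ℝ := min 1 (max 0 (h⁻¹ * (f x - t)))

lemma clampE_of_le {t h : ℝ} (hh : 0 < h) (hx : f x ≤ t) : clampE f t h x = 0 := by
  rw [clampE, max_eq_left (mul_nonpos_of_nonneg_of_nonpos (by positivity) (by linarith))]
  simp

lemma clampE_of_ge {t h : ℝ} (hh : 0 < h) (hx : t + h ≤ f x) : clampE f t h x = 1 := by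
  rw [clampE, min_eq_left]
  refine le_max_of_le_right ?_
  rw [inv_mul_eq_div, le_div_iff₀ hh]
  linarith

lemma clampE_nonneg (t h : ℝ) (x : Eu N) : 0 ≤ clampE f t h x :=
  le_min zero_le_one (le_max_left _ _)

lemma clampE_le_one (t h : ℝ) (x : Eu N) : clampE f t h x ≤ 1 := min_le_left _ _

lemma Tame.adm (hf : Tame L f) {t h : ℝ} (ht : 0 < t) (hh : 0 < h) : Adm (clampE f t h) where
  lip := by
    refine ⟨_, LipschitzWith.const_min (LipschitzWith.const_max
      (LipschitzWith.of_dist_le_mul (K := h⁻¹.toNNReal * L) fun x y => ?_) 0) 1⟩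
    rw [dist_eq, ← mul_sub, abs_mul, sub_sub_sub_cancel_right, abs_of_pos (inv_pos.2 hh),
      NNReal.coe_mul, Real.coe_toNNReal _ (inv_pos.2 hh).le, mul_assoc]
    gcongr; exact hf.lip.dist_le_mul x y
  supp := HasCompactSupport.intro (hf.isCompact ht) fun x hx =>
    clampE_of_le hh (le_of_lt (not_le.1 hx))
  nonneg := clampE_nonneg t h
  le_one := clampE_le_one t h

lemma Tame.enorm_fderiv_clampE_le (hf : Tame L f) {t h : ℝ} (hh : 0 < h) (x : Eu N) :
    ‖fderiv ℝ (clampE f t h) x‖ₑ ≤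
      ({x | t < f x} \ {x | t + h < f x}).indicator (fun x => ofReal h⁻¹ * ‖fderiv ℝ f x‖ₑ) x := by
  have zero : fderiv ℝ (clampE f t h) x = 0 → ‖fderiv ℝ (clampE f t h) x‖ₑ ≤
      ({x | t < f x} \ {x | t + h < f x}).indicator
        (fun x => ofReal h⁻¹ * ‖fderiv ℝ f x‖ₑ) x := fun h0 => by
    rw [h0, ← ofReal_norm, norm_zero, ofReal_zero]; exact zero_le
  rcases le_or_gt (f x) t with h1 | h1
  · refine zero (IsLocalMin.fderiv_eq_zero (.of_forall fun y => ?_))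
    rw [clampE_of_le hh h1]; exact clampE_nonneg t h y
  rcases le_or_gt (t + h) (f x) with h2 | h2
  · refine zero (IsLocalMax.fderiv_eq_zero (.of_forall fun y => ?_))
    rw [clampE_of_ge hh h2]; exact clampE_le_one t h y
  · rw [indicator_of_mem (show x ∈ {x | t < f x} \ {x | t + h < f x} from ⟨h1, not_lt.2 h2.le⟩)]
    have hc := hf.lip.continuous; have e : clampE f t h =ᶠ[𝓝 x] fun y => h⁻¹ * (f y - t) := by
      filter_upwards [(isOpen_lt continuous_const hc).mem_nhds h1,
        (isOpen_lt hc continuous_const).mem_nhds h2] with y hy1 hy2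
      have hy1 : t < f y := hy1; have hy2 : f y < t + h := hy2
      have : 0 ≤ h⁻¹ * (f y - t) := mul_nonneg (inv_pos.2 hh).le (by linarith)
      rw [clampE, max_eq_right this, min_eq_right]; rw [inv_mul_eq_div, div_le_one hh]; linarith
    rw [e.fderiv_eq]; by_cases hd : DifferentiableAt ℝ f x
    · rw [fderiv_const_mul (hd.sub_const t), fderiv_sub_const, enorm_smul,
        Real.enorm_of_nonneg (inv_pos.2 hh).le]
    · rw [fderiv_zero_of_not_differentiableAt, ← ofReal_norm, norm_zero, ofReal_zero]
      · exact zero_le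
      · intro hd'; refine hd ?_; have := (hd'.const_mul h).add_const t
        refine this.congr_of_eventuallyEq (.of_forall fun y => ?_); grind

lemma Tame.gradE_clampE_le (hf : Tame L f) {t h : ℝ} (ht : 0 < t) (hh : 0 < h) :
    gradE (clampE f t h) ≤ ofReal (h⁻¹ * (momE f 1 t - momE f 1 (t + h))) := by
  have hm := (hf.meas t).diff (hf.meas (t + h))
  have hsub : {x | t + h < f x} ⊆ {x | t < f x} := fun x (hx : t + h < f x) =>
    (by linarith : t < f x)
  calc gradE (clampE f t h) ≤ _ := lintegral_mono (hf.enorm_fderiv_clampE_le hh)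
    _ = ofReal h⁻¹ * ∫⁻ x in {x | t < f x} \ {x | t + h < f x}, ‖fderiv ℝ f x‖ₑ := by
      rw [lintegral_indicator hm, lintegral_const_mul' _ _ ofReal_ne_top]
    _ = _ := by
      have hi := hf.integrableOn ht 1
      rw [ofReal_mul (inv_pos.2 hh).le, momE, momE, ← integral_diff (hf.meas _) hi hsub,
        ofReal_integral_eq_lintegral_ofReal (hi.mono_set sdiff_subset)
        (ae_of_all _ fun x => by positivity)]
      simp

lemma Tame.errE_clampE_le (hf : Tame L f) {t h : ℝ} (ht : 0 < t) (hh : 0 < h) :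
    errE (clampE f t h) {x | t < f x} ≤ ofReal (momE f 0 t - momE f 0 (t + h)) := by
  have hm := (hf.meas t).diff (hf.meas (t + h))
  have hsub : {x | t + h < f x} ⊆ {x | t < f x} := fun x (hx : t + h < f x) =>
    (by linarith : t < f x)
  have hv := (hf.volume_lt_top ht).ne
  rw [momE_zero, momE_zero, ← measureReal_sdiff hsub (hf.meas _) hv, measureReal_def, ofReal_toReal
    (measure_ne_top_of_subset sdiff_subset hv), ← lintegral_indicator_one hm]
  refine lintegral_mono fun x => ?_
  by_cases h1 : t < f x
  · by_cases h2 : t + h < f x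
    · rw [clampE_of_ge hh h2.le]; simp [h1]
    · rw [indicator_of_mem (show x ∈ {x | t < f x} \ {x | t + h < f x} from ⟨h1, h2⟩), indicator_of_mem (show x ∈ {x | t < f x} from h1)]
      simp only [Pi.one_apply]
      rw [Real.enorm_eq_ofReal_abs, ← ofReal_one]; refine ofReal_le_ofReal (abs_le.2 ⟨?_, ?_⟩)
      · linarith [clampE_nonneg (f := f) t h x]
      · linarith [clampE_le_one (f := f) t h x]
  · rw [clampE_of_le hh (not_lt.1 h1)]; simp [h1]

lemma Tame.per_le (hf : Tame L f) (ht : 0 < t) (h0 : ContinuousAt (momE f 0) t)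
    (h1 : DifferentiableAt ℝ (momE f 1) t) :
    per {x | t < f x} ≤ ofReal (-deriv (momE f 1) t) := by
  have hs : Tendsto (fun k : ℕ => 1 / ((k : ℝ) + 1)) atTop (𝓝 0) :=
    tendsto_one_div_add_atTop_nhds_zero_nat
  have hp : ∀ k : ℕ, (0 : ℝ) < 1 / ((k : ℝ) + 1) := fun k => by positivity
  have ha : Tendsto (fun k : ℕ => t + 1 / ((k : ℝ) + 1)) atTop (𝓝 t) := by
    simpa using hs.const_add t
  have hd : Tendsto (fun k : ℕ => (1 / ((k : ℝ) + 1))⁻¹ *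
      (momE f 1 t - momE f 1 (t + 1 / ((k : ℝ) + 1)))) atTop (𝓝 (-deriv (momE f 1) t)) := by
    have hs' : Tendsto (fun k : ℕ => 1 / ((k : ℝ) + 1)) atTop (𝓝[≠] 0) :=
      tendsto_nhdsWithin_iff.2 ⟨hs, .of_forall fun k => (hp k).ne'⟩
    have := (h1.hasDerivAt.tendsto_slope_zero.comp hs').neg
    refine this.congr fun k => ?_; simp only [comp_apply, smul_eq_mul]; ring
  refine (per_le_liminf (fun k => hf.adm ht (hp k)) ?_).trans ?_
  · refine tendsto_of_tendsto_of_tendsto_of_le_of_le tendsto_const_nhds ?_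
      (fun _ => zero_le) (fun k => hf.errE_clampE_le ht (hp k))
    have := (h0.tendsto.comp ha).const_sub (momE f 0 t)
    rw [sub_self] at this; simpa using tendsto_ofReal this
  · rw [← (tendsto_ofReal hd).liminf_eq]
    exact liminf_le_liminf (.of_forall fun k => hf.gradE_clampE_le ht (hp k))

lemma lintegral_neg_deriv_le {g : ℝ → ℝ} {B : ℝ≥0∞} (hg : AntitoneOn g (Ioi 0))
    (h0 : ∀ t, 0 < t → 0 ≤ g t) (hB : ∀ t, 0 < t → ofReal (g t) ≤ B) :
    ∫⁻ t in Ioi 0, ofReal (-deriv g t) ≤ B := by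
  have hsub : ∀ n : ℕ, Ioc (1 / ((n : ℝ) + 1)) ((n : ℝ) + 1) ⊆ Ioi 0 := fun n t ht =>
    lt_trans (by positivity) ht.1
  have hle : ∀ n : ℕ, 1 / ((n : ℝ) + 1) ≤ (n : ℝ) + 1 := fun n => by
    have : (0 : ℝ) ≤ n := n.cast_nonneg; rw [div_le_iff₀ (by positivity)]; nlinarith
  have e : Ioi (0 : ℝ) = ⋃ n : ℕ, Ioc (1 / ((n : ℝ) + 1)) ((n : ℝ) + 1) := by
    refine Set.Subset.antisymm (fun t (ht : 0 < t) => ?_) (Set.iUnion_subset hsub)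
    obtain ⟨n, hn⟩ := exists_nat_gt (max t t⁻¹); rw [max_lt_iff] at hn
    refine mem_iUnion.2 ⟨n, ?_, by linarith⟩; rw [one_div]; exact inv_lt_of_inv_lt₀ ht (by linarith)
  rw [e, setLIntegral_iUnion_of_directed]
  · refine iSup_le fun n => ?_; have hp : (0 : ℝ) < 1 / ((n : ℝ) + 1) := by positivity
    have hm : MonotoneOn (-g) (uIcc (1 / ((n : ℝ) + 1)) ((n : ℝ) + 1)) := by
      rw [uIcc_of_le (hle n)]; exact (hg.mono fun t ht => lt_of_lt_of_le hp ht.1).neg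
    have hi := hm.intervalIntegrable_deriv; have hI := hm.intervalIntegral_deriv_mem_uIcc
    rw [uIcc_of_le (sub_nonneg.2 (hm (by simp) (by simp) (hle n))), integral_of_le (hle n)] at hI
    have ed : deriv (-g) = fun t => -deriv g t := by funext t; exact deriv.fun_neg
    rw [intervalIntegrable_iff_integrableOn_Ioc_of_le (hle n)] at hi
    rw [ed] at hi hI; rw [← ofReal_integral_eq_lintegral_ofReal hi]
    · refine (ofReal_le_ofReal ?_).trans (hB _ hp); have := h0 ((n : ℝ) + 1) (by positivity)
      have h2 := hI.2; simp only [Pi.neg_apply] at h2; linarith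
    · filter_upwards [ae_restrict_mem measurableSet_Ioc] with t ht
      simpa using hg.deriv_nonpos_of_mem (hsub n ht)
  · refine directed_of_isDirected_le fun m n hmn => Set.Ioc_subset_Ioc ?_ ?_
    · gcongr
    · gcongr

open Classical in
/-- Integrand of the level-set form of the Dirichlet energy. -/
def kinE {N : ℕ} (f : Eu N → ℝ) (t : ℝ) : ℝ :=
  if DifferentiableAt ℝ (momE f 0) t ∧ deriv (momE f 0) t ≠ 0 then
    momE f 0 t ^ (2 * ((N : ℝ) - 1) / N) / (-deriv (momE f 0) t) else 0

open Classical in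
/-- Integrand of the asymmetry deficit. -/
def defE {N : ℕ} (f : Eu N → ℝ) (t : ℝ) : ℝ :=
  if DifferentiableAt ℝ (momE f 0) t ∧ deriv (momE f 0) t ≠ 0 then
    asym N {x | t < f x} ^ 2 * momE f 0 t ^ (2 * ((N : ℝ) - 1) / N) / (-deriv (momE f 0) t) else 0

lemma momE_nonneg (k : ℕ) (t : ℝ) : 0 ≤ momE f k t := integral_nonneg fun _ => by positivity

lemma Tame.ae_isoK_le (hf : Tame L f) (hc : IsoQ N c) : ∀ᵐ t : ℝ, 0 < t → 0 < momE f 0 t →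
      isoK N * momE f 0 t ^ (((N : ℝ) - 1) / N) * (1 + c * asym N {x | t < f x} ^ 2) ≤
        -deriv (momE f 1) t := by
  filter_upwards [hf.ae_diff (k := 0) (by norm_num), hf.ae_diff (k := 1) (by norm_num)]
    with t h0 h1 ht hμ
  have hv : volume {x | t < f x} ≠ 0 := fun h => by simp_all [momE_zero, measureReal_def]
  have h := (hc _ (hf.meas t) (pos_iff_ne_zero.2 hv) (hf.volume_lt_top ht).ne).trans
    (hf.per_le ht (h0 ht).continuousAt (h1 ht))
  rw [momE_zero]
  have hn : 0 ≤ -deriv (momE f 1) t := by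
    simpa using (hf.antitoneOn_momE (k := 1) (by norm_num)).deriv_nonpos_of_mem ht
  exact (ofReal_le_ofReal_iff hn).1 h

/-- Level-set lower bound for the Dirichlet energy. -/
lemma Tame.dirichlet_ge (hN : 2 ≤ N) (hf : Tame L f) (hc0 : 0 < c) (hc : IsoQ N c) :
    ofReal (isoK N ^ 2) * ((∫⁻ t in Ioi 0, ofReal (kinE f t)) +
      ofReal (2 * c) * ∫⁻ t in Ioi 0, ofReal (defE f t)) ≤
      ∫⁻ x, ‖fderiv ℝ f x‖ₑ ^ 2 := by
  have hN1 : (1 : ℝ) ≤ N := by exact_mod_cast (by omega : 1 ≤ N)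
  rw [← lintegral_const_mul' _ _ ofReal_ne_top]
  refine (mul_le_mul_right (le_lintegral_add _ _) _).trans ?_
  rw [← lintegral_const_mul' _ _ ofReal_ne_top]
  refine le_trans (lintegral_mono_ae ?_) (lintegral_neg_deriv_le (g := momE f 2)
    (hf.antitoneOn_momE le_rfl) (fun t _ => momE_nonneg 2 t) fun t ht => ?_)
  · rw [ae_restrict_iff' measurableSet_Ioi]
    filter_upwards [hf.ae_isoK_le hc, hf.ae_diff (k := 0) (by norm_num),
      hf.ae_diff (k := 1) (by norm_num), hf.ae_diff (k := 2) le_rfl] with t hk h0 h1 h2 ht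
    have ht : 0 < t := ht; obtain ⟨hcs, -⟩ := hf.deriv_ineq ht (h0 ht) (h1 ht) (h2 ht)
    have d0 := (hf.antitoneOn_momE (k := 0) (by norm_num)).deriv_nonpos_of_mem ht
    have d2 := (hf.antitoneOn_momE (k := 2) le_rfl).deriv_nonpos_of_mem ht; simp only [kinE, defE]
    split_ifs with hT
    · have hT2 := hT.2; have ha : 0 < -deriv (momE f 0) t := by grind
      have hA := sq_nonneg (asym N {x | t < f x})
      have hμ := momE_nonneg (f := f) 0 t; have hp := rpow_nonneg hμ (2 * ((N : ℝ) - 1) / N)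
      rw [← ofReal_mul (by positivity), ← ofReal_add (by positivity)
        (by positivity), ← ofReal_mul (by positivity)]
      refine ofReal_le_ofReal ?_
      have e : isoK N ^ 2 * (momE f 0 t ^ (2 * ((N : ℝ) - 1) / N) / (-deriv (momE f 0) t) +
          2 * c * (asym N {x | t < f x} ^ 2 * momE f 0 t ^ (2 * ((N : ℝ) - 1) / N) /
            (-deriv (momE f 0) t))) = isoK N ^ 2 * momE f 0 t ^ (2 * ((N : ℝ) - 1) / N) *
            (1 + 2 * c * asym N {x | t < f x} ^ 2) / (-deriv (momE f 0) t) := by ring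
      rw [e, div_le_iff₀ ha]; rcases hμ.eq_or_lt with h | h
      · rw [← h, zero_rpow (by
          have : (2 : ℝ) ≤ N := by exact_mod_cast hN
          exact (div_pos (by linarith) (by positivity : (0 : ℝ) < N)).ne')]
        simp only [mul_zero, zero_mul]; exact mul_nonneg (by linarith) ha.le
      · have er : momE f 0 t ^ (2 * ((N : ℝ) - 1) / N) = (momE f 0 t ^ (((N : ℝ) - 1) / N)) ^ 2 := by
          rw [← rpow_natCast, ← rpow_mul hμ]; congr 1; push_cast; ring
        rw [er]; set m := momE f 0 t ^ (((N : ℝ) - 1) / N)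
        have hm : 0 ≤ isoK N * m := mul_nonneg (isoK_nonneg N) (rpow_nonneg hμ _)
        have hl : 0 ≤ isoK N * m * (1 + c * asym N {x | t < f x} ^ 2) := by positivity
        have := pow_le_pow_left₀ hl (hk ht h) 2
        have h3 : isoK N ^ 2 * m ^ 2 * (1 + 2 * c * asym N {x | t < f x} ^ 2) ≤
            (isoK N * m * (1 + c * asym N {x | t < f x} ^ 2)) ^ 2 := by
          rw [mul_pow, mul_pow]; gcongr; nlinarith [sq_nonneg (c * asym N {x | t < f x} ^ 2)]
        nlinarith
    · simp
  · rw [momE, ofReal_integral_eq_lintegral_ofReal (hf.integrableOn ht 2)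
      (ae_of_all _ fun x => by positivity)]
    refine (setLIntegral_le_lintegral _ _).trans (le_of_eq ?_); simp_all

/-- The radius of the symmetrized level sets decreases at least with slope `1 / L`. -/
lemma Tame.sub_le_radB (hN : N ≠ 0) (hf : Tame L f) {s t : ℝ} (hs : 0 < s) (hst : s ≤ t)
    (hμ : 0 < momE f 0 t) :
    t - s ≤ L * (radB N (momE f 0 s) - radB N (momE f 0 t)) := by
  obtain ⟨c, hc0, hc⟩ := exists_isoQ N hN
  have hL : (0 : ℝ) < L := hf.pos; have hN0 : (0 : ℝ) < N := by positivity
  have hμs : ∀ r ∈ Icc s t, 0 < momE f 0 r := fun r hr => hμ.trans_le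
    (hf.antitoneOn_momE (k := 0) (by norm_num) (show 0 < r from hs.trans_le hr.1) (show 0 < t from hs.trans_le hst) hr.2)
  have er : ∀ m : ℝ, 0 < m → radB N m = (m / omegaB N) ^ (1 / (N : ℝ)) := fun m hm => by
    rw [radB, kapB, ← inv_rpow (div_pos (omegaB_pos N) hm).le, inv_div]
  have hm : MonotoneOn (fun r => -(momE f 0 r / omegaB N) ^ (1 / (N : ℝ))) (uIcc s t) := by
    rw [uIcc_of_le hst]; intro a ha b hb hab
    have h1 := (hf.antitoneOn_momE (k := 0) (by norm_num)) (show 0 < a from hs.trans_le ha.1) (show 0 < b from hs.trans_le hb.1) hab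
    have := hμs b hb; simp only [neg_le_neg_iff]
    have h2 := omegaB_pos N; exact rpow_le_rpow (by positivity) (by gcongr) (by positivity)
  have hI := hm.intervalIntegral_deriv_mem_uIcc
  have hge : -(momE f 0 s / omegaB N) ^ (1 / (N : ℝ)) ≤ -(momE f 0 t / omegaB N) ^ (1 / (N : ℝ)) :=
    hm (by simp) (by simp) hst
  rw [uIcc_of_le (sub_nonneg.2 hge)] at hI; have hlow : ∫ _ in s..t, 1 / (L : ℝ) ≤
      ∫ r in s..t, deriv (fun r => -(momE f 0 r / omegaB N) ^ (1 / (N : ℝ))) r := by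
    refine intervalIntegral.integral_mono_ae_restrict hst (by simp) hm.intervalIntegrable_deriv ?_
    rw [EventuallyLE, ae_restrict_iff' measurableSet_Icc]
    filter_upwards [hf.ae_isoK_le hc, hf.ae_diff (k := 0) (by norm_num),
      hf.ae_diff (k := 1) (by norm_num), hf.ae_diff (k := 2) le_rfl] with r hk h0 h1 h2 hr
    have hr0 : 0 < r := hs.trans_le hr.1; have hp := hμs r hr
    have hω := omegaB_pos N; obtain ⟨-, hLip⟩ := hf.deriv_ineq hr0 (h0 hr0) (h1 hr0) (h2 hr0)
    have hd := (((h0 hr0).hasDerivAt.div_const (omegaB N)).rpow_const (p := 1 / (N : ℝ))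
      (Or.inl (div_pos hp hω).ne')).neg
    have hd' := hd.deriv; simp only [Pi.neg_def] at hd'
    rw [hd']; have hiso : isoK N * momE f 0 r ^ (((N : ℝ) - 1) / N) ≤ L * -deriv (momE f 0) r := by
      refine le_trans ?_ ((hk hr0 hp).trans hLip)
      have : 0 ≤ isoK N * momE f 0 r ^ (((N : ℝ) - 1) / N) :=
        mul_nonneg (isoK_nonneg N) (rpow_nonneg hp.le _)
      have h3 : 0 ≤ c * asym N {x | r < f x} ^ 2 := by positivity
      nlinarith
    have hq := rpow_pos_of_pos (div_pos hp hω) (1 / (N : ℝ) - 1)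
    have hone : isoK N * momE f 0 r ^ (((N : ℝ) - 1) / N) *
        ((momE f 0 r / omegaB N) ^ (1 / (N : ℝ) - 1) / (N * omegaB N)) = 1 := by
      rw [isoK_mul_rpow hN hp, rpow_sub (div_pos hp hω), rpow_one, ← er _ hp, radB]
      have := kapB_pos N hp; field_simp
    rw [div_le_iff₀ hL]
    calc 1 = isoK N * momE f 0 r ^ (((N : ℝ) - 1) / N) *
        ((momE f 0 r / omegaB N) ^ (1 / (N : ℝ) - 1) / (N * omegaB N)) := hone.symm
      _ ≤ (L * -deriv (momE f 0) r) *
        ((momE f 0 r / omegaB N) ^ (1 / (N : ℝ) - 1) / (N * omegaB N)) := by gcongr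
      _ = _ := by field_simp
  rw [intervalIntegral.integral_const, smul_eq_mul, mul_one_div] at hlow
  rw [er _ (hμs s ⟨le_rfl, hst⟩), er _ hμ]; have := (div_le_iff₀ hL).1 (hlow.trans hI.2); linarith

/-- Nonnegative measurable square-integrable functions. -/
structure SqInt (f : Eu N → ℝ) : Prop where
  meas : Measurable f
  nonneg : ∀ x, 0 ≤ f x
  memLp : MemLp f 2

/-- Levels `t` whose superlevel set is larger than the centred ball through `x`. -/
def lvlE (f : Eu N → ℝ) (x : Eu N) : Set ℝ :=
  {t | 0 < t ∧ volume (ball (0 : Eu N) ‖x‖) < volume {y | t < f y}}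

/-- Symmetric decreasing rearrangement. -/
def starE (f : Eu N → ℝ) (x : Eu N) : ℝ := sSup (lvlE f x)

lemma SqInt.lintegral_lt_top (hf : SqInt f) : ∫⁻ x, ofReal (f x ^ 2) < ⊤ :=
  hf.memLp.integrable_sq.lintegral_lt_top

lemma SqInt.mul_volume_le (hf : SqInt f) (ht : 0 < t) :
    ofReal (t ^ 2) * volume {x | t < f x} ≤ ∫⁻ x, ofReal (f x ^ 2) := by
  refine le_trans (mul_le_mul_right (measure_mono fun x hx => ?_) _)
    (mul_meas_ge_le_lintegral (hf.meas.pow_const 2).ennreal_ofReal _)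
  exact ofReal_le_ofReal (pow_le_pow_left₀ ht.le hx.le 2)

lemma SqInt.volume_lt_top (hf : SqInt f) (ht : 0 < t) : volume {x | t < f x} < ⊤ := by
  by_contra h
  have := hf.mul_volume_le ht
  rw [not_lt_top_iff.1 h, mul_top (by simpa using ht.ne')] at this
  exact absurd hf.lintegral_lt_top (not_lt.2 this)

lemma SqInt.bddAbove (hf : SqInt f) (hx : x ≠ 0) : BddAbove (lvlE f x) := by
  have hv : 0 < volume (ball (0 : Eu N) ‖x‖) := measure_ball_pos _ _ (norm_pos_iff.2 hx)
  have hvt : volume (ball (0 : Eu N) ‖x‖) ≠ ⊤ := measure_ball_lt_top.ne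
  set I := ∫⁻ x, ofReal (f x ^ 2)
  set v := volume (ball (0 : Eu N) ‖x‖)
  refine ⟨max 1 (I / v).toReal, fun t ht => ?_⟩
  by_contra h
  rw [not_le, max_lt_iff] at h
  have h1 : ofReal (t ^ 2) * v ≤ I := (mul_le_mul_right ht.2.le _).trans (hf.mul_volume_le ht.1)
  have h2 : ofReal (t ^ 2) ≤ I / v := (ENNReal.le_div_iff_mul_le (Or.inl hv.ne') (Or.inl hvt)).2 h1
  have h3 : t ^ 2 ≤ (I / v).toReal :=
    (ENNReal.ofReal_le_iff_le_toReal (ENNReal.div_ne_top hf.lintegral_lt_top.ne hv.ne')).1 h2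
  nlinarith

lemma setOf_lt_eq_iUnion (f : Eu N → ℝ) (t : ℝ) :
    {y | t < f y} = ⋃ n : ℕ, {y | t + 1 / ((n : ℝ) + 1) < f y} := by
  ext y
  simp only [mem_setOf_eq, mem_iUnion]
  constructor
  · intro hy; obtain ⟨n, hn⟩ := exists_nat_one_div_lt (sub_pos.2 hy); exact ⟨n, by linarith⟩
  · rintro ⟨n, hn⟩; have : (0 : ℝ) < 1 / ((n : ℝ) + 1) := by positivity
    linarith

lemma exists_lt_of_lt_volume {a : ℝ≥0∞} (h : a < volume {y | t < f y}) :
    ∃ t', t < t' ∧ a < volume {y | t' < f y} := by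
  rw [setOf_lt_eq_iUnion, Monotone.measure_iUnion] at h
  · obtain ⟨n, hn⟩ := lt_iSup_iff.1 h; exact ⟨_, lt_add_of_pos_right t (by positivity), hn⟩
  · intro m n hmn y hy
    have hy : t + 1 / ((m : ℝ) + 1) < f y := hy; have : 1 / ((n : ℝ) + 1) ≤ 1 / ((m : ℝ) + 1) :=
      one_div_le_one_div_of_le (by positivity) (by gcongr)
    grind

lemma lt_starE_iff (hf : Measurable f) (hb : BddAbove (lvlE f x)) (ht : 0 < t) :
    t < starE f x ↔ volume (ball (0 : Eu N) ‖x‖) < volume {y | t < f y} := by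
  constructor
  · intro h; have hne : (lvlE f x).Nonempty := by
      by_contra hne; rw [starE, Set.not_nonempty_iff_eq_empty.1 hne, Real.sSup_empty] at h; linarith
    obtain ⟨t', ht', hlt⟩ := exists_lt_of_lt_csSup hne h
    exact ht'.2.trans_le (measure_mono fun y (hy : t' < f y) => hlt.trans hy)
  · intro h; obtain ⟨t', hlt, ht'⟩ := exists_lt_of_lt_volume h
    exact hlt.trans_le (le_csSup hb ⟨ht.trans hlt, ht'⟩)

lemma starE_nonneg (f : Eu N → ℝ) (x : Eu N) : 0 ≤ starE f x := Real.sSup_nonneg fun _ h => h.1.le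

lemma volume_ball_lt_iff (hN : N ≠ 0) {m : ℝ≥0∞} (hm : m ≠ ⊤) (x : Eu N) :
    volume (ball (0 : Eu N) ‖x‖) < m ↔ x ∈ ball (0 : Eu N) (radB N m.toReal) := by
  rw [mem_ball_zero_iff]
  rcases eq_or_ne m 0 with rfl | h0
  · have : radB N 0 = 0 := by rw [radB, kapB, div_zero, zero_rpow (by positivity), inv_zero]
    simp [this, not_lt.2 (norm_nonneg x)]
  have hp : 0 < m.toReal := toReal_pos h0 hm
  have hr := radB_pos N hp
  have hv := volume_ball_radB hN hp (0 : Eu N)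
  rw [ofReal_toReal hm] at hv
  nth_rewrite 1 [← hv]
  rcases (norm_nonneg x).eq_or_lt with hx | hx
  · rw [← hx, Metric.ball_zero, measure_empty]
    exact ⟨fun _ => hr, fun _ => measure_ball_pos _ _ hr⟩
  · have hω := omegaB_pos N
    rw [volume_ball_eu _ hx, volume_ball_eu _ hr, ENNReal.ofReal_lt_ofReal_iff (by positivity),
      mul_lt_mul_iff_right₀ hω, pow_lt_pow_iff_left₀ hx.le hr.le hN]

lemma volume_setOf_ball_lt (hN : N ≠ 0) {m : ℝ≥0∞} (hm : m ≠ ⊤) :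
    volume {x : Eu N | volume (ball (0 : Eu N) ‖x‖) < m} = m := by
  have e : {x : Eu N | volume (ball (0 : Eu N) ‖x‖) < m} = ball (0 : Eu N) (radB N m.toReal) := by
    ext x; exact volume_ball_lt_iff hN hm x
  rw [e]
  rcases eq_or_ne m 0 with rfl | h0
  · have : radB N 0 = 0 := by rw [radB, kapB, div_zero, zero_rpow (by positivity), inv_zero]
    simp [this]
  · rw [volume_ball_radB hN (toReal_pos h0 hm), ofReal_toReal hm]

lemma SqInt.ae_setOf_eq (hf : SqInt f) (hN : N ≠ 0) (ht : 0 < t) : {x | t < starE f x} =ᵐ[volume]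
      {x : Eu N | volume (ball (0 : Eu N) ‖x‖) < volume {y | t < f y}} := by
  have : Nonempty (Fin N) := ⟨⟨0, Nat.pos_of_ne_zero hN⟩⟩
  have : ∀ᵐ x : Eu N, x ≠ 0 := by rw [ae_iff]; simp
  filter_upwards [this] with x hx
  exact propext (lt_starE_iff hf.meas (hf.bddAbove hx) ht)

/-- Rearrangements are equimeasurable. -/
lemma SqInt.volume_starE (hf : SqInt f) (hN : N ≠ 0) (ht : 0 < t) :
    volume {x | t < starE f x} = volume {x | t < f x} := by
  rw [measure_congr (hf.ae_setOf_eq hN ht), volume_setOf_ball_lt hN (hf.volume_lt_top ht).ne]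

lemma SqInt.measurable_starE (hf : SqInt f) (hN : N ≠ 0) : Measurable (starE f) := by
  have hpos : ∀ t : ℝ, 0 < t → MeasurableSet {x | t < starE f x} := by
    intro t ht; have e : {x | t < starE f x} = ({x | t < starE f x} ∩ {0}) ∪
        (ball (0 : Eu N) (radB N (volume {y | t < f y}).toReal) \ {0}) := by
      ext x; by_cases hx : x = 0
      · simp [hx]
      · rw [Set.mem_union, mem_inter_iff, Set.mem_diff, ← volume_ball_lt_iff hN
          (hf.volume_lt_top ht).ne]
        simp [hx, lt_starE_iff hf.meas (hf.bddAbove hx) ht]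
    rw [e]; exact ((Set.finite_singleton 0).subset Set.inter_subset_right).measurableSet.union
      (measurableSet_ball.diff (measurableSet_singleton 0))
  refine measurable_of_Ioi fun a => ?_
  rcases lt_or_ge a 0 with ha | ha
  · convert MeasurableSet.univ; exact Set.eq_univ_of_forall fun x => ha.trans_le (starE_nonneg f x)
  · rw [show starE f ⁻¹' Ioi a = _ from setOf_lt_eq_iUnion (starE f) a]
    exact MeasurableSet.iUnion fun n => hpos _ (by positivity)

lemma SqInt.lintegral_rpow_starE (hf : SqInt f) (hN : N ≠ 0) {p : ℝ} (hp : 0 < p) :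
    ∫⁻ x, ofReal (starE f x ^ p) = ∫⁻ x, ofReal (f x ^ p) := by
  rw [lintegral_rpow_eq_lintegral_meas_lt_mul _ (ae_of_all _ (starE_nonneg f))
    (hf.measurable_starE hN).aemeasurable hp, lintegral_rpow_eq_lintegral_meas_lt_mul _
    (ae_of_all _ hf.nonneg) hf.meas.aemeasurable hp]
  congr 1
  refine setLIntegral_congr_fun measurableSet_Ioi fun t ht => ?_
  rw [hf.volume_starE hN ht]

lemma SqInt.sqInt_starE (hf : SqInt f) (hN : N ≠ 0) : SqInt (starE f) where
  meas := hf.measurable_starE hN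
  nonneg := starE_nonneg f
  memLp := by
    rw [memLp_two_iff_integrable_sq (hf.measurable_starE hN).aestronglyMeasurable]
    refine ⟨((hf.measurable_starE hN).pow_const 2).aestronglyMeasurable, ?_⟩
    rw [hasFiniteIntegral_iff_ofReal (ae_of_all _ fun x => sq_nonneg _)]
    have := hf.lintegral_rpow_starE hN (p := 2) two_pos
    simp only [rpow_two] at this; rw [this]; exact hf.lintegral_lt_top

lemma lintegral_mul_eq_levels (hf : Measurable f) (hg : Measurable g) :
    ∫⁻ x, ofReal (f x) * ofReal (g x) =
      ∫⁻ s in Ioi 0, ∫⁻ t in Ioi 0, volume ({x | s < f x} ∩ {x | t < g x}) := by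
  have e : ∀ a : ℝ, ofReal a = ∫⁻ s in Ioi 0, (Iio a).indicator 1 s := by
    intro a; rw [lintegral_indicator_one measurableSet_Iio, restrict_apply measurableSet_Iio,
      inter_comm, Set.Ioi_inter_Iio, volume_Ioo, sub_zero]
  have mf : Measurable fun q : Eu N × ℝ => (Iio (f q.1)).indicator (1 : ℝ → ℝ≥0∞) q.2 := by
    have : (fun q : Eu N × ℝ => (Iio (f q.1)).indicator (1 : ℝ → ℝ≥0∞) q.2) =
        {q : Eu N × ℝ | q.2 < f q.1}.indicator 1 := by
      ext q; simp [indicator]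
    rw [this]
    exact measurable_one.indicator (measurableSet_lt measurable_snd (hf.comp measurable_fst))
  have mg : Measurable fun q : Eu N × ℝ => (Iio (g q.1)).indicator (1 : ℝ → ℝ≥0∞) q.2 := by
    have : (fun q : Eu N × ℝ => (Iio (g q.1)).indicator (1 : ℝ → ℝ≥0∞) q.2) =
        {q : Eu N × ℝ | q.2 < g q.1}.indicator 1 := by
      ext q; simp [indicator]
    rw [this]
    exact measurable_one.indicator (measurableSet_lt measurable_snd (hg.comp measurable_fst))
  have m1 : ∀ s, Measurable fun x => (Iio (f x)).indicator (1 : ℝ → ℝ≥0∞) s := fun s =>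
    mf.comp (measurable_id.prodMk measurable_const)
  have m2 : ∀ t, Measurable fun x => (Iio (g x)).indicator (1 : ℝ → ℝ≥0∞) t := fun s =>
    mg.comp (measurable_id.prodMk measurable_const)
  calc ∫⁻ x, ofReal (f x) * ofReal (g x)
      = ∫⁻ x, ∫⁻ s in Ioi 0, (Iio (f x)).indicator 1 s * ofReal (g x) := by
        refine lintegral_congr fun x => ?_; rw [lintegral_mul_const' _ _ ofReal_ne_top, ← e]
    _ = ∫⁻ s in Ioi 0, ∫⁻ x, (Iio (f x)).indicator 1 s * ofReal (g x) :=
        lintegral_lintegral_swap (mf.mul (hg.ennreal_ofReal.comp measurable_fst)).aemeasurable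
    _ = _ := by
      refine lintegral_congr fun s => ?_
      calc ∫⁻ x, (Iio (f x)).indicator 1 s * ofReal (g x)
          = ∫⁻ x, ∫⁻ t in Ioi 0, (Iio (f x)).indicator 1 s * (Iio (g x)).indicator 1 t := by
            refine lintegral_congr fun x => ?_
            rw [lintegral_const_mul' _ _ (by simp only [indicator]; split_ifs <;> simp), ← e]
        _ = ∫⁻ t in Ioi 0, ∫⁻ x, (Iio (f x)).indicator 1 s * (Iio (g x)).indicator 1 t := by
            refine lintegral_lintegral_swap (Measurable.aemeasurable ?_)
            exact ((m1 s).comp measurable_fst).mul mg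
        _ = _ := by
            refine lintegral_congr fun t => ?_
            rw [← lintegral_indicator_one ((measurableSet_lt measurable_const hf).inter
              (measurableSet_lt measurable_const hg))]
            refine lintegral_congr fun x => ?_
            by_cases h1 : s < f x <;> by_cases h2 : t < g x <;> simp [h1, h2]

/-- Hardy–Littlewood inequality. -/
lemma SqInt.lintegral_mul_le_starE (hf : SqInt f) (hg : SqInt g) (hN : N ≠ 0) :
    ∫⁻ x, ofReal (f x) * ofReal (g x) ≤ ∫⁻ x, ofReal (starE f x) * ofReal (starE g x) := by
  rw [lintegral_mul_eq_levels hf.meas hg.meas, lintegral_mul_eq_levels (hf.measurable_starE hN)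
    (hg.measurable_starE hN)]
  refine setLIntegral_mono' measurableSet_Ioi fun s hs => setLIntegral_mono' measurableSet_Ioi
    fun t ht => ?_
  rw [measure_congr ((hf.ae_setOf_eq hN hs).inter (hg.ae_setOf_eq hN ht))]
  have hF := (hf.volume_lt_top hs).ne; have hG := (hg.volume_lt_top ht).ne
  rcases le_total (volume {y | s < f y}) (volume {y | t < g y}) with h | h
  · refine (measure_mono inter_subset_left).trans (((volume_setOf_ball_lt hN hF).ge).trans
      (measure_mono fun x hx => ?_))
    have hx : volume (ball (0 : Eu N) ‖x‖) < volume {y | s < f y} := hx; exact ⟨hx, hx.trans_le h⟩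
  · refine (measure_mono Set.inter_subset_right).trans (((volume_setOf_ball_lt hN hG).ge).trans
      (measure_mono fun x hx => ?_))
    have hx : volume (ball (0 : Eu N) ‖x‖) < volume {y | t < g y} := hx; exact ⟨hx.trans_le h, hx⟩

lemma SqInt.integral_sq_starE (hf : SqInt f) (hN : N ≠ 0) : ∫ x, starE f x ^ 2 = ∫ x, f x ^ 2 := by
  rw [integral_eq_lintegral_of_nonneg_ae (ae_of_all _ fun x => sq_nonneg _)
    ((hf.measurable_starE hN).pow_const 2).aestronglyMeasurable,
    integral_eq_lintegral_of_nonneg_ae (ae_of_all _ fun x => sq_nonneg _)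
    (hf.meas.pow_const 2).aestronglyMeasurable]
  have := hf.lintegral_rpow_starE hN (p := 2) two_pos
  simp only [rpow_two] at this
  rw [this]

/-- Rearrangement is a contraction in `L²`. -/
lemma SqInt.integral_sub_sq_starE_le (hf : SqInt f) (hg : SqInt g) (hN : N ≠ 0) :
    ∫ x, (starE f x - starE g x) ^ 2 ≤ ∫ x, (f x - g x) ^ 2 := by
  have ex : ∀ {a b : Eu N → ℝ}, SqInt a → SqInt b → ∫ x, (a x - b x) ^ 2 =
      (∫ x, a x ^ 2) + (∫ x, b x ^ 2) - 2 * ∫ x, a x * b x := by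
    intro a b ha hb; have h1 := ha.memLp.integrable_sq; have h2 := hb.memLp.integrable_sq
    have h3 : Integrable fun x => a x * b x := ha.memLp.integrable_mul hb.memLp
    have h12 : Integrable fun x => a x ^ 2 + b x ^ 2 := h1.add h2
    rw [← integral_add h1 h2, ← integral_const_mul, ← integral_sub h12 (h3.const_mul 2)]
    congr 1; ext x; ring
  have hm : ∀ {a b : Eu N → ℝ}, SqInt a → SqInt b → ofReal (∫ x, a x * b x) =
      ∫⁻ x, ofReal (a x) * ofReal (b x) := by
    intro a b ha hb; have h3 : Integrable fun x => a x * b x := ha.memLp.integrable_mul hb.memLp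
    rw [ofReal_integral_eq_lintegral_ofReal h3 (ae_of_all _ fun x => mul_nonneg (ha.nonneg x) (hb.nonneg x))]
    exact lintegral_congr fun x => ofReal_mul (ha.nonneg x)
  rw [ex hf hg, ex (hf.sqInt_starE hN) (hg.sqInt_starE hN), hf.integral_sq_starE hN, hg.integral_sq_starE hN]
  have := hf.lintegral_mul_le_starE hg hN
  rw [← hm hf hg, ← hm (hf.sqInt_starE hN) (hg.sqInt_starE hN), ofReal_le_ofReal_iff
    (integral_nonneg fun x => mul_nonneg (starE_nonneg f x) (starE_nonneg g x))] at this
  linarith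

lemma Tame.exists_bound (hf : Tame L f) : ∃ M : ℝ, 0 < M ∧ ∀ x, f x ≤ M := by
  obtain ⟨M, hM⟩ := ((hf.isCompact one_pos).image hf.lip.continuous).bddAbove
  refine ⟨max 1 M, by positivity, fun x => ?_⟩
  rcases le_or_gt 1 (f x) with h | h
  · measurability
  · exact le_max_of_le_left h.le

lemma Tame.bddAbove (hf : Tame L f) (x : Eu N) : BddAbove (lvlE f x) := by
  obtain ⟨M, -, hM⟩ := hf.exists_bound
  refine ⟨M, fun t ht => ?_⟩
  by_contra h
  have : {y | t < f y} = ∅ := by grind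
  have h2 := ht.2
  simp [this] at h2

lemma Tame.lt_starE_iff (hf : Tame L f) (hN : N ≠ 0) (ht : 0 < t) (x : Eu N) :
    t < starE f x ↔ ‖x‖ < radB N (momE f 0 t) := by
  rw [_root_.lt_starE_iff hf.lip.continuous.measurable (hf.bddAbove x) ht,
    volume_ball_lt_iff hN (hf.volume_lt_top ht).ne, mem_ball_zero_iff, momE_zero]
  rfl

lemma Tame.starE_anti (hf : Tame L f) (hN : N ≠ 0) (h : ‖x‖ ≤ ‖y‖) : starE f y ≤ starE f x := by
  refine le_of_forall_lt fun t ht => ?_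
  rcases lt_or_ge 0 t with h0 | h0
  · grind [hf.lt_starE_iff hN h0]
  · obtain ⟨t', ht', ht''⟩ := exists_between ht; rcases lt_or_ge 0 t' with h1 | h1
    · rw [hf.lt_starE_iff hN h1] at ht''
      exact ht'.trans ((hf.lt_starE_iff hN h1 x).2 (h.trans_lt ht''))
    · grind [h1.trans, starE_nonneg]

lemma Tame.starE_sub_le (hf : Tame L f) (hN : N ≠ 0) (h : ‖x‖ ≤ ‖y‖) :
    starE f x - starE f y ≤ L * (‖y‖ - ‖x‖) := by
  by_contra hlt
  rw [not_le] at hlt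
  have hL : (0 : ℝ) ≤ L := L.2
  set ε := (starE f x - starE f y - L * (‖y‖ - ‖x‖)) / 3 with hε
  have hε0 : 0 < ε := by rw [hε]; linarith
  have hy := starE_nonneg f y
  have hs : 0 < starE f y + ε := by linarith
  have hLn : 0 ≤ L * (‖y‖ - ‖x‖) := mul_nonneg hL (by linarith)
  have h1 := (hf.lt_starE_iff hN (by linarith : 0 < starE f x - ε) x).1 (by linarith)
  have h2 := mt (hf.lt_starE_iff hN hs y).2 (by linarith)
  have hμ : 0 < momE f 0 (starE f x - ε) := by
    rcases (momE_nonneg (f := f) 0 (starE f x - ε)).eq_or_lt with h0 | h0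
    · rw [← h0, radB, kapB, div_zero, zero_rpow (by positivity), inv_zero] at h1
      exact absurd h1 (not_lt.2 (norm_nonneg x))
    · exact h0
  have := hf.sub_le_radB hN hs (by linarith : starE f y + ε ≤ starE f x - ε) hμ
  have h3 : radB N (momE f 0 (starE f y + ε)) - radB N (momE f 0 (starE f x - ε)) ≤ ‖y‖ - ‖x‖ := by
    linarith
  have := this.trans (mul_le_mul_of_nonneg_left h3 hL)
  linarith

lemma Tame.tame_starE (hf : Tame L f) (hN : N ≠ 0) : Tame L (starE f) where
  pos := hf.pos
  lip := by
    have : ∀ x y : Eu N, ‖x‖ ≤ ‖y‖ → |starE f x - starE f y| ≤ L * dist x y := by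
      intro x y h; rw [abs_of_nonneg (sub_nonneg.2 (hf.starE_anti hN h))]
      refine (hf.starE_sub_le hN h).trans (mul_le_mul_of_nonneg_left ?_ L.2)
      rw [dist_comm, dist_eq_norm]; exact norm_sub_norm_le y x
    refine LipschitzWith.of_dist_le_mul fun x y => ?_; rcases le_total ‖x‖ ‖y‖ with h | h
    · exact this x y h
    · rw [dist_comm, dist_comm x]; exact this y x h
  nonneg := starE_nonneg f
  tend := by
    rw [Metric.tendsto_nhds]
    intro ε hε; refine mem_cocompact.2 ⟨closedBall 0 (radB N (momE f 0 (ε / 2))),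
      isCompact_closedBall _ _, fun x hx => ?_⟩
    rw [Set.mem_compl_iff, mem_closedBall_zero_iff, not_le] at hx
    have := mt (hf.lt_starE_iff hN (half_pos hε) x).1 (not_lt.2 hx.le)
    show dist _ _ < ε; rw [Real.dist_0_eq_abs, abs_of_nonneg (starE_nonneg f x)]; linarith

/-- Profile of the rearrangement. -/
def profE (f : Eu N → ℝ) (e : Eu N) (r : ℝ) : ℝ := starE f (r • e)

variable {e : Eu N}

lemma Tame.profE_norm (hf : Tame L f) (hN : N ≠ 0) (he : ‖e‖ = 1) (x : Eu N) :
    profE f e ‖x‖ = starE f x := by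
  have : ‖‖x‖ • e‖ = ‖x‖ := by rw [norm_smul, he, mul_one, norm_norm]
  exact le_antisymm (hf.starE_anti hN this.ge) (hf.starE_anti hN this.le)

lemma Tame.lt_profE_iff (hf : Tame L f) (hN : N ≠ 0) (he : ‖e‖ = 1) (ht : 0 < t)
    (hr : 0 ≤ r) : t < profE f e r ↔ r < radB N (momE f 0 t) := by
  rw [profE, hf.lt_starE_iff hN ht, norm_smul, he, mul_one, norm_of_nonneg hr]

lemma Tame.lip_profE (hf : Tame L f) (hN : N ≠ 0) (he : ‖e‖ = 1) : LipschitzWith L (profE f e) := by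
  have := (hf.tame_starE hN).lip.comp (LipschitzWith.of_dist_le_mul (K := 1) (f := fun r : ℝ => r • e)
    fun r r' => by
      rw [dist_eq_norm, ← sub_smul, norm_smul, he, mul_one, NNReal.coe_one, one_mul, dist_eq_norm])
  rwa [mul_one] at this

lemma Tame.profE_anti (hf : Tame L f) (hN : N ≠ 0) (he : ‖e‖ = 1) {r r' : ℝ} (hr : 0 ≤ r)
    (h : r ≤ r') : profE f e r' ≤ profE f e r := by
  refine hf.starE_anti hN ?_
  rw [norm_smul, norm_smul, he, mul_one, mul_one, norm_of_nonneg hr, norm_of_nonneg (hr.trans h)]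
  exact h

/-- Strict decrease at points of nonzero slope. -/
lemma Tame.profE_strict (hf : Tame L f) (hN : N ≠ 0) (he : ‖e‖ = 1) (hr : 0 < r) {d : ℝ}
    (hd : HasDerivAt (profE f e) d r) (hd0 : d ≠ 0) :
    d < 0 ∧ (∀ r', 0 ≤ r' → r' < r → profE f e r < profE f e r') ∧
      ∀ r', r < r' → profE f e r' < profE f e r := by
  have hlocal : ∀ r', 0 < r' → profE f e r' = profE f e r → ¬ r' ≠ r := by
    intro r' hr' heq hne
    refine hd0 ?_; have hmem : uIcc r' r ∈ 𝓝[uIcc r' r] r := self_mem_nhdsWithin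
    have hc : ∀ y ∈ uIcc r' r, profE f e y = profE f e r := by
      intro y hy; rcases le_total r' r with h | h
      · rw [uIcc_of_le h] at hy; exact le_antisymm ((hf.profE_anti hN he hr'.le hy.1).trans heq.le)
          (hf.profE_anti hN he (hr'.le.trans hy.1) hy.2)
      · rw [Set.uIcc_of_ge h] at hy; exact le_antisymm (hf.profE_anti hN he hr.le hy.1)
          (heq.ge.trans (hf.profE_anti hN he (hr.le.trans hy.1) hy.2))
    have h1 : HasDerivWithinAt (profE f e) 0 (uIcc r' r) r :=
      (hasDerivWithinAt_const r _ (profE f e r)).congr hc rfl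
    have hu : UniqueDiffWithinAt ℝ (uIcc r' r) r :=
      uniqueDiffOn_Icc (by simpa using hne.symm) _ Set.right_mem_uIcc
    exact hu.eq_deriv _ hd.hasDerivWithinAt h1
  have hR : ∀ r', r < r' → profE f e r' < profE f e r := fun r' h =>
    lt_of_le_of_ne (hf.profE_anti hN he hr.le h.le) fun heq => hlocal r' (hr.trans h) heq h.ne'
  refine ⟨lt_of_le_of_ne ?_ hd0, fun r' h0 h => ?_, hR⟩
  · have ha : AntitoneOn (profE f e) (Ioi 0) := fun a ha b _ hab =>
      hf.profE_anti hN he (le_of_lt ha) hab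
    rw [← hd.deriv]; exact ha.deriv_nonpos_of_mem hr
  · have hm : 0 < (r' + r) / 2 := by linarith
    refine lt_of_lt_of_le ?_ (hf.profE_anti hN he h0 (by linarith : r' ≤ (r' + r) / 2))
    exact lt_of_le_of_ne (hf.profE_anti hN he hm.le (by linarith)) fun heq =>
      hlocal _ hm heq.symm (by linarith)

lemma radB_momE_pow (hN : N ≠ 0) (f : Eu N → ℝ) (t : ℝ) :
    momE f 0 t = omegaB N * radB N (momE f 0 t) ^ N := by
  rcases (momE_nonneg (f := f) 0 t).eq_or_lt with h | h
  · rw [← h, radB, kapB, div_zero, zero_rpow (by positivity), inv_zero, zero_pow hN, mul_zero]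
  · have hω := omegaB_pos N; rw [radB, inv_pow, kapB_pow hN h, inv_div]; field_simp

/-- Derivative of the distribution function through the profile. -/
lemma Tame.hasDerivAt_momE (hf : Tame L f) (hN : N ≠ 0) (he : ‖e‖ = 1) (hr : 0 < r) {d : ℝ}
    (hd : HasDerivAt (profE f e) d r) (hd0 : d ≠ 0) (ht : 0 < profE f e r) :
    radB N (momE f 0 (profE f e r)) = r ∧
      HasDerivAt (momE f 0) (omegaB N * (N * r ^ (N - 1) * d⁻¹)) (profE f e r) := by
  obtain ⟨-, hl, hR⟩ := hf.profE_strict hN he hr hd hd0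
  set t := profE f e r with htdef; set ρ : ℝ → ℝ := fun s => radB N (momE f 0 s) with hρ
  have iff : ∀ {s : ℝ}, 0 < s → ∀ {a : ℝ}, 0 ≤ a → (s < profE f e a ↔ a < ρ s) := fun hs _ ha =>
    hf.lt_profE_iff hN he hs ha
  have hc := (hf.lip_profE hN he).continuous; have hρt : ρ t = r := by grind
  have hcont : ContinuousAt ρ t := by
    rw [Metric.continuousAt_iff']
    intro ε hε; set η := min (ε / 2) (r / 2); have hη : 0 < η := lt_min (half_pos hε) (half_pos hr)
    have hη1 : η ≤ ε / 2 := min_le_left _ _; have hη2 : η ≤ r / 2 := min_le_right _ _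
    filter_upwards [lt_mem_nhds (hR (r + η) (by linarith)),
      gt_mem_nhds (hl (r - η) (by linarith) (by linarith)), lt_mem_nhds ht] with s h1 h2 h3
    rw [hρt, dist_eq, abs_lt]; have h4 := (iff h3 (by linarith)).1 h2
    have h5 : ρ s ≤ r + η := not_lt.1 fun h => lt_asymm h1 ((iff h3 (by linarith)).2 h)
    exact ⟨by linarith, by linarith⟩
  have hinv : ∀ᶠ s in 𝓝 t, profE f e (ρ s) = s := by
    filter_upwards [lt_mem_nhds ht, gt_mem_nhds (hl 0 le_rfl hr)] with s h1 h2
    have hp : 0 < ρ s := (iff h1 le_rfl).1 h2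
    refine le_antisymm (not_lt.1 fun h => lt_irrefl _ ((iff h1 hp.le).1 h)) ?_
    have hcl : ρ s ∈ closure (Ico 0 (ρ s)) := by grind [closure_Ico hp.ne]
    exact closure_minimal (s := Ico 0 (ρ s)) (t := {a | s ≤ profE f e a})
      (fun a ha => ((iff h1 ha.1).2 ha.2).le) (isClosed_le continuous_const hc) hcl
  have hd' : HasDerivAt (profE f e) d (ρ t) := by rw [hρt]; exact hd
  refine ⟨hρt, ?_⟩
  have := ((HasDerivAt.of_local_left_inverse hcont hd' hd0 hinv).pow N).const_mul (omegaB N)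
  rw [hρt] at this
  refine this.congr_of_eventuallyEq (.of_forall fun s => ?_); exact radB_momE_pow hN f s

/-- Radial functions: the gradient is controlled by the slope of the profile. -/
lemma Tame.norm_fderiv_starE_le (hf : Tame L f) (hN : N ≠ 0) (he : ‖e‖ = 1) (hx : x ≠ 0)
    (hd : DifferentiableAt ℝ (starE f) x) :
    DifferentiableAt ℝ (profE f e) ‖x‖ ∧ ‖fderiv ℝ (starE f) x‖ ≤ |deriv (profE f e) ‖x‖| := by
  have hn : 0 < ‖x‖ := norm_pos_iff.2 hx; have hdiff : DifferentiableAt ℝ (profE f e) ‖x‖ := by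
    have h1 : DifferentiableAt ℝ (fun r : ℝ => starE f ((r / ‖x‖) • x)) ‖x‖ := by
      have : DifferentiableAt ℝ (starE f) ((‖x‖ / ‖x‖) • x) := by simp_all
      exact DifferentiableAt.comp (g := starE f) (f := fun r : ℝ => (r / ‖x‖) • x) ‖x‖ this
        ((differentiableAt_id.div_const _).smul_const x)
    refine h1.congr_of_eventuallyEq ?_
    filter_upwards [lt_mem_nhds hn] with r hr; have : ‖(r / ‖x‖) • x‖ = r := by
      rw [norm_smul, norm_div, norm_norm, norm_of_nonneg hr.le, div_mul_cancel₀ _ hn.ne']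
    rw [← hf.profE_norm hN he, this]
  refine ⟨hdiff, ?_⟩
  have hnd : DifferentiableAt ℝ (fun y : Eu N => ‖y‖) x := differentiableAt_id.norm ℝ hx
  have h2 := (hdiff.hasDerivAt.hasFDerivAt.comp x hnd.hasFDerivAt).fderiv
  rw [← (by grind [hf.profE_norm] : starE f = profE f e ∘ fun y => ‖y‖)] at h2
  rw [h2]; refine (ContinuousLinearMap.opNorm_comp_le _ _).trans ?_
  have h3 : ‖fderiv ℝ (fun y : Eu N => ‖y‖) x‖ ≤ 1 := by
    simpa using norm_fderiv_le_of_lipschitz ℝ (C := 1) (lipschitzWith_one_norm (E := Eu N))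
  have h4 : ‖ContinuousLinearMap.toSpanSingleton ℝ (deriv (profE f e) ‖x‖)‖ ≤
      |deriv (profE f e) ‖x‖| := by simp
  calc _ ≤ |deriv (profE f e) ‖x‖| * 1 := mul_le_mul h4 h3 (norm_nonneg _) (abs_nonneg _)
    _ = _ := mul_one _

lemma isoK_sq_mul_rpow (hN : N ≠ 0) (hr : 0 < r) :
    isoK N ^ 2 * (omegaB N * r ^ N) ^ (2 * ((N : ℝ) - 1) / N) =
      (N * omegaB N * r ^ (N - 1)) ^ 2 := by
  have hω := omegaB_pos N
  have hm : 0 < omegaB N * r ^ N := by positivity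
  have er : (omegaB N * r ^ N) ^ (2 * ((N : ℝ) - 1) / N) =
      ((omegaB N * r ^ N) ^ (((N : ℝ) - 1) / N)) ^ 2 := by
    rw [← rpow_natCast (_ ^ _), ← rpow_mul hm.le]; congr 1; push_cast; ring
  have hr' : r = radB N (omegaB N * r ^ N) := eq_radB hN hm hr (volume_ball_eu (0 : Eu N) hr)
  have hk : kapB N (omegaB N * r ^ N) = r⁻¹ := by rw [radB] at hr'; rw [hr', inv_inv, ← hr']
  rw [er, ← mul_pow, isoK_mul_rpow hN hm, hk]
  obtain ⟨m, rfl⟩ : ∃ m, N = m + 1 := ⟨N - 1, by omega⟩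
  grind

lemma Tame.kinE_profE (hf : Tame L f) (hN : N ≠ 0) (he : ‖e‖ = 1) (hr : 0 < r) {d : ℝ}
    (hd : HasDerivAt (profE f e) d r) (hd0 : d ≠ 0) (ht : 0 < profE f e r) :
    isoK N ^ 2 * kinE f (profE f e r) = N * omegaB N * r ^ (N - 1) * |d| := by
  obtain ⟨hρ, hdm⟩ := hf.hasDerivAt_momE hN he hr hd hd0 ht
  have hω := omegaB_pos N
  have hN0 : (0 : ℝ) < N := by positivity
  have hμ : momE f 0 (profE f e r) = omegaB N * r ^ N := by rw [radB_momE_pow hN, hρ]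
  have hne : omegaB N * (N * r ^ (N - 1) * d⁻¹) ≠ 0 := by positivity
  rw [kinE, if_pos ⟨hdm.differentiableAt, by rw [hdm.deriv]; exact hne⟩, hdm.deriv, hμ,
    ← mul_div_assoc, isoK_sq_mul_rpow hN hr, abs_of_neg ((hf.profE_strict hN he hr hd hd0).1)]
  field_simp

/-- Dirichlet energy of the rearrangement above a positive level. -/
lemma Tame.dirichlet_starE_le (hf : Tame L f) (hN : N ≠ 0) (hδ : 0 < δ) :
    ∫⁻ x in {x | δ < starE f x}, ‖fderiv ℝ (starE f) x‖ₑ ^ 2 ≤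
      ofReal (isoK N ^ 2) * ∫⁻ t in Ioi 0, ofReal (kinE f t) := by
  obtain ⟨e, he⟩ : ∃ e : Eu N, ‖e‖ = 1 := ⟨coordE ⟨0, Nat.pos_of_ne_zero hN⟩, by simp [coordE]⟩
  have : Nonempty (Fin N) := ⟨⟨0, Nat.pos_of_ne_zero hN⟩⟩
  have : Nontrivial (Eu N) := ⟨⟨e, 0, fun h => by simp [h] at he⟩⟩
  set φ := profE f e with hφ; have hlip := hf.lip_profE hN he; have hc := hlip.continuous
  set F : ℝ → ℝ := {r | δ < φ r}.indicator (fun r => (deriv φ r) ^ 2) with hF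
  have mF : Measurable F := ((measurable_deriv φ).pow_const 2).indicator
    (isOpen_lt continuous_const hc).measurableSet
  have F0 : ∀ r, 0 ≤ F r := fun r => Set.indicator_nonneg (fun _ _ => sq_nonneg _) r
  have FL : ∀ r, F r ≤ (L : ℝ) ^ 2 := fun r => by
    rw [hF]; by_cases hr : r ∈ {r | δ < φ r}; swap
    · simp_all
    rw [indicator_of_mem hr, ← sq_abs]
    exact pow_le_pow_left₀ (abs_nonneg _) (norm_deriv_le_of_lipschitz hlip) 2
  have hw := hf.tame_starE hN
  have step1 : ∫⁻ x in {x | δ < starE f x}, ‖fderiv ℝ (starE f) x‖ₑ ^ 2 ≤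
      ∫⁻ x : Eu N, ofReal (F ‖x‖) := by
    rw [← lintegral_indicator (hw.meas δ)]
    refine lintegral_mono_ae ?_; have h0 : ∀ᵐ x : Eu N, x ≠ 0 := by rw [ae_iff]; simp
    filter_upwards [hw.lip.ae_differentiableAt, h0] with x hx hx0; by_cases hxd : δ < starE f x
    · have hxd' : ‖x‖ ∈ {r | δ < φ r} := by grind [hf.profE_norm hN he]
      rw [indicator_of_mem (show x ∈ {x | δ < starE f x} from hxd), hF,
        indicator_of_mem hxd', ← sq_abs, ofReal_pow (abs_nonneg _), ← ofReal_norm]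
      exact pow_le_pow_left₀ zero_le (ofReal_le_ofReal (hf.norm_fderiv_starE_le hN he hx0 hx).2) 2
    · simp_all
  have hvi : Integrable fun x : Eu N => F ‖x‖ := by
    have hb : IntegrableOn (fun x : Eu N => F ‖x‖) {x | δ < starE f x} :=
      Measure.integrableOn_of_bounded (M := (L : ℝ) ^ 2) (hw.volume_lt_top hδ).ne
        (mF.comp measurable_norm).aestronglyMeasurable
        (ae_of_all _ fun x => by rw [norm_of_nonneg (F0 _)]; exact FL _)
    refine (integrableOn_iff_integrable_of_support_subset fun x hx => ?_).1 hb
    by_contra hxd; refine hx (indicator_of_notMem ?_ _)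
    show ¬ δ < profE f e ‖x‖; rw [hf.profE_norm hN he]; exact hxd
  have step2 : ∫⁻ x : Eu N, ofReal (F ‖x‖) ≤
      ∫⁻ r in Ioi 0, ofReal (N * omegaB N * r ^ (N - 1) * F r) := by
    rw [← ofReal_integral_eq_lintegral_ofReal hvi (ae_of_all _ fun x => F0 _),
      integral_fun_norm_addHaar, finrank_euclideanSpace_fin]
    have eω : vol (ball (0 : Eu N) 1) = omegaB N := by measurability
    rw [eω, nsmul_eq_mul, smul_eq_mul, ← integral_const_mul, ← integral_const_mul]
    have hω := omegaB_pos N; rw [integral_eq_lintegral_of_nonneg_ae]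
    · refine ENNReal.ofReal_toReal_le.trans (le_of_eq ?_)
      refine lintegral_congr fun r => ?_; rw [smul_eq_mul]; congr 1; ring
    · filter_upwards [ae_restrict_mem measurableSet_Ioi] with r hr
      have := F0 r; have hr : 0 < r := hr; simp only [smul_eq_mul, Pi.zero_apply]; positivity
    · fun_prop
  set S : Set ℝ := Ioi 0 ∩ {r | δ < φ r} ∩ {r | DifferentiableAt ℝ φ r} ∩ {r | deriv φ r ≠ 0}
    with hS
  have mS' : MeasurableSet S :=
    ((measurableSet_Ioi.inter (isOpen_lt continuous_const hc).measurableSet).inter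
      (measurableSet_of_differentiableAt ℝ φ)).inter
      ((measurable_deriv φ) (measurableSet_singleton 0).compl)
  have step3 : ∫⁻ r in Ioi 0, ofReal (N * omegaB N * r ^ (N - 1) * F r) ≤
      ∫⁻ r in S, ofReal |deriv φ r| * (ofReal (isoK N ^ 2) * ofReal (kinE f (φ r))) := by
    rw [← lintegral_indicator measurableSet_Ioi, ← lintegral_indicator mS']
    refine lintegral_mono fun r => ?_; by_cases hr : r ∈ S
    · obtain ⟨⟨⟨hr0, hrδ⟩, hrd⟩, hrn⟩ := hr
      have hr0 : 0 < r := hr0; rw [indicator_of_mem (show r ∈ S from ⟨⟨⟨hr0, hrδ⟩, hrd⟩, hrn⟩),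
        indicator_of_mem (show r ∈ Ioi 0 from hr0), ← ofReal_mul (sq_nonneg _),
        ← ofReal_mul (abs_nonneg _),
        hf.kinE_profE hN he hr0 (DifferentiableAt.hasDerivAt hrd) hrn (hδ.trans hrδ), hF,
        indicator_of_mem hrδ, ← sq_abs]
      grind
    · rw [indicator_of_notMem hr]; refine le_of_eq ?_; by_cases hr0 : r ∈ Ioi (0 : ℝ)
      · rw [indicator_of_mem hr0]; have : F r = 0 := by
          by_cases hrδ : r ∈ {r | δ < φ r}
          · rw [hF, indicator_of_mem hrδ]; have : deriv φ r = 0 := by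
              by_contra hne; exact hr ⟨⟨⟨hr0, hrδ⟩, differentiableAt_of_deriv_ne_zero hne⟩, hne⟩
            rw [this]; norm_num
          · rw [hF, indicator_of_notMem hrδ]
        rw [this, mul_zero, ofReal_zero]
      · rw [indicator_of_notMem hr0]
  have hinj : Set.InjOn φ S := by
    have : ∀ a ∈ S, ∀ b, a < b → φ b < φ a := fun a ha b hab =>
      (hf.profE_strict hN he ha.1.1.1 (DifferentiableAt.hasDerivAt ha.1.2) ha.2).2.2 b hab
    intro a ha b hb hab; rcases lt_trichotomy a b with h | h | h
    · exact absurd hab (this a ha b h).ne'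
    · exact h
    · exact absurd hab (this b hb a h).ne
  have step4 := lintegral_image_eq_lintegral_abs_deriv_mul mS'
    (fun r hr => (DifferentiableAt.hasDerivAt (f := φ) hr.1.2).hasDerivWithinAt) hinj
    (fun t => ofReal (isoK N ^ 2) * ofReal (kinE f t))
  refine step1.trans (step2.trans (step3.trans ?_))
  rw [← step4, ← lintegral_const_mul' _ _ ofReal_ne_top]; refine lintegral_mono_set ?_; grind

/-- Square integrable functions on Euclidean space. -/
abbrev L2 (N : ℕ) := Lp ℝ 2 (volume : Measure (Eu N))

variable {k l : Eu N → ℝ}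

/-- Translation on `L²`. -/
def tau (y : Eu N) : L2 N →ₗᵢ[ℝ] L2 N :=
  Lp.compMeasurePreservingₗᵢ ℝ (fun x => x + y) (measurePreserving_add_right volume y)

lemma coeFn_tau (y : Eu N) (v : L2 N) : tau y v =ᵐ[volume] fun x => v (x + y) :=
  Lp.coeFn_compMeasurePreserving v (measurePreserving_add_right volume y)

lemma continuous_tau (v : L2 N) : Continuous fun y => tau y v :=
  Continuous.compMeasurePreservingLp (g := fun y => ⟨fun x => x + y, by fun_prop⟩) continuous_const
    (ContinuousMap.continuous_of_continuous_uncurry _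
      (show Continuous fun p : Eu N × Eu N => p.2 + p.1 by fun_prop))
    (fun y => measurePreserving_add_right volume y) (by simp)

lemma tau_tau (a b : Eu N) (v : L2 N) : tau a (tau b v) = tau (a + b) v := by
  apply Lp.ext
  have h := (measurePreserving_add_right volume a).quasiMeasurePreserving.ae_eq_comp (coeFn_tau b v)
  filter_upwards [coeFn_tau a (tau b v), coeFn_tau (a + b) v, h] with x h1 h2 h3
  rw [h1, h2]
  simpa [add_assoc] using h3

lemma tau_zero (v : L2 N) : tau 0 v = v := by
  apply Lp.ext
  filter_upwards [coeFn_tau 0 v] with x h1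
  rw [h1, add_zero]

lemma inner_tau_left (y : Eu N) (w v : L2 N) : ⟪tau y w, v⟫ = ⟪w, tau (-y) v⟫ := by
  conv_lhs => rw [← tau_zero v, ← add_neg_cancel y, ← tau_tau, LinearIsometry.inner_map_map]

lemma MeasureTheory.Integrable.smul_bounded {E : Type*} [NormedAddCommGroup E] [NormedSpace ℝ E] {c : Eu N → E} {B : ℝ}
    (hk : Integrable k) (hc : Continuous c) (hB : ∀ y, ‖c y‖ ≤ B) :
    Integrable fun y => k y • c y := by
  refine (hk.norm.mul_const B).mono' (hk.aestronglyMeasurable.smul hc.aestronglyMeasurable)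
    (ae_of_all _ fun y => ?_)
  rw [norm_smul]
  gcongr; exact hB y

lemma integrable_smul_tau (hk : Integrable k) (v : L2 N) : Integrable fun y => k y • tau y v :=
  hk.smul_bounded (continuous_tau v) fun y => ((tau y).norm_map v).le

/-- Convolution operators on `L²`, as superpositions of translations. -/
def convL (k : Eu N → ℝ) (v : L2 N) : L2 N := ∫ y, k y • tau y v

lemma norm_convL_le (hk : Integrable k) (v : L2 N) : ‖convL k v‖ ≤ (∫ y, |k y|) * ‖v‖ := by
  refine (norm_integral_le_integral_norm _).trans_eq ?_
  rw [← integral_mul_const]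
  simp [norm_smul]

lemma inner_convL (hk : Integrable k) (w v : L2 N) : ⟪w, convL k v⟫ = ∫ y, k y * ⟪w, tau y v⟫ := by
  rw [convL, ← integral_inner (integrable_smul_tau hk v)]
  simp [inner_smul_right]

lemma inner_convL_left (hk : Integrable k) (he : ∀ y, k (-y) = k y) (w v : L2 N) :
    ⟪convL k w, v⟫ = ⟪w, convL k v⟫ := by
  rw [real_inner_comm, inner_convL hk, inner_convL hk, ← integral_neg_eq_self]
  refine integral_congr_ae (ae_of_all _ fun y => ?_)
  simp only [he]
  rw [real_inner_comm, inner_tau_left, neg_neg]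

lemma convL_sub (hk : Integrable k) (v w : L2 N) : convL k (v - w) = convL k v - convL k w := by
  simp only [convL, map_sub, smul_sub]
  exact integral_sub (integrable_smul_tau hk v) (integrable_smul_tau hk w)

lemma tau_convL (hk : Integrable k) (a : Eu N) (v : L2 N) :
    tau a (convL k v) = convL k (tau a v) := by
  rw [convL, ← LinearIsometry.coe_toContinuousLinearMap,
    ← ContinuousLinearMap.integral_comp_comm _ (integrable_smul_tau hk v)]
  refine integral_congr_ae (ae_of_all _ fun y => ?_)
  simp [tau_tau, add_comm]

lemma convL_comm (hk : Integrable k) (hl : Integrable l) (v : L2 N) :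
    convL k (convL l v) = convL l (convL k v) := by
  have ex : ∀ {k l : Eu N → ℝ}, Integrable l →
      convL k (convL l v) = ∫ x, ∫ y, (k x * l y) • tau (x + y) v := by
    intro k l hl
    refine integral_congr_ae (ae_of_all _ fun x => ?_); show k x • tau x (convL l v) = _
    rw [tau_convL hl, convL, ← integral_smul]; simp [mul_smul, tau_tau, add_comm]
  rw [ex hl, ex hk, integral_integral_swap]
  · simp [mul_comm, add_comm]
  · refine ((hk.mul_prod hl).norm.mul_const ‖v‖).mono' ((hk.mul_prod hl).aestronglyMeasurable.smul
      ((continuous_tau v).comp (continuous_fst.add continuous_snd)).aestronglyMeasurable)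
      (ae_of_all _ fun p => ?_)
    simp [uncurry, norm_smul]

/-- The squared Gagliardo seminorm on `L²`. -/
def gagL (s : ℝ) (v : L2 N) : ℝ≥0∞ := ∫⁻ y, ofReal (‖tau y v - v‖ ^ 2 / ‖y‖ ^ (N + 2 * s))

lemma gagL_convL_le (hk : Integrable k) (h1 : ∫ y, |k y| ≤ 1) (v : L2 N) :
    gagL s (convL k v) ≤ gagL s v := by
  refine lintegral_mono fun y => ofReal_le_ofReal (div_le_div_of_nonneg_right
    (pow_le_pow_left₀ (norm_nonneg _) ?_ 2) (rpow_nonneg (norm_nonneg _) _))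
  rw [tau_convL hk, ← convL_sub hk]
  exact (norm_convL_le hk _).trans (mul_le_of_le_one_left (norm_nonneg _) h1)

lemma norm_sq_toLp (hf : MemLp f 2) : ‖hf.toLp f‖ ^ 2 = ∫ x, f x ^ 2 := by
  rw [← real_inner_self_eq_norm_sq, L2.inner_def]
  refine integral_congr_ae ?_
  filter_upwards [hf.coeFn_toLp] with x hx
  simp [hx, sq]

lemma tau_toLp (hf : MemLp f 2) (y : Eu N) :
    tau y (hf.toLp f) = (hf.comp_measurePreserving (measurePreserving_add_right volume y)).toLp _ :=
  rfl

lemma gagliardoSq_eq_gagL (hm : Measurable f) (hf : MemLp f 2) :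
    gagliardoSq N s f = gagL s (hf.toLp f) := by
  have h1 : gagliardoSq N s f = ∫⁻ x, ∫⁻ y, ofReal ((f (x + y) - f x) ^ 2 / ‖y‖ ^ (N + 2 * s)) := by
    refine lintegral_congr fun x => ?_
    rw [← lintegral_add_left_eq_self _ x]; simp [abs_sub_comm (f x)]
  rw [h1, lintegral_lintegral_swap (by fun_prop)]
  refine lintegral_congr fun y => ?_
  have hg := (hf.comp_measurePreserving (measurePreserving_add_right volume y)).sub hf
  rw [tau_toLp, ← MemLp.toLp_sub, norm_sq_toLp hg, ← integral_div,
    ofReal_integral_eq_lintegral_ofReal (hg.integrable_sq.div_const _) (ae_of_all _ fun x => by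
      positivity)]
  rfl

lemma coeFn_convL (hk : Integrable k) (he : ∀ y, k (-y) = k y) (v : L2 N) :
    convL k v =ᵐ[volume] fun x => ∫ y, k (x - y) * v y := by
  have hv := Lp.stronglyMeasurable v
  have hx : ∀ x, ∫ y, k (x - y) * v y = ∫ y, k y * v (x + y) := fun x => by
    rw [← integral_add_left_eq_self _ x]; simp [he]
  have hF : ∀ A : Set (Eu N), MeasurableSet A → volume A < ⊤ →
      Integrable (fun p : Eu N × Eu N => k p.2 * v (p.1 + p.2)) ((volume.restrict A).prod volume) := by
    intro A hA hAf; have hmm : AEStronglyMeasurable (fun p : Eu N × Eu N => k p.2 * v (p.1 + p.2))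
        ((volume.restrict A).prod volume) :=
      hk.aestronglyMeasurable.comp_snd.mul (hv.comp_measurable (by fun_prop)).aestronglyMeasurable
    have hi : ∀ y, Integrable (fun x => v (x + y)) (volume.restrict A) := fun y => by
      have hi := ((Lp.memLp v).comp_measurePreserving (measurePreserving_add_right volume y)).restrict A
      have : IsFiniteMeasure (volume.restrict A) := ⟨by simpa using hAf⟩
      exact hi.integrable (by norm_num)
    rw [integrable_prod_iff' hmm]; refine ⟨ae_of_all _ fun y => (hi y).const_mul (k y), ?_⟩
    obtain ⟨C, hC⟩ : ∃ C : ℝ, ∀ y, ∫ x in A, ‖v (x + y)‖ ≤ C := by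
      refine ⟨vol A + ‖v‖ ^ 2, fun y => ?_⟩; have h2 : Integrable fun x => v (x + y) ^ 2 :=
        ((Lp.memLp v).comp_measurePreserving (measurePreserving_add_right volume y)).integrable_sq
      have : IsFiniteMeasure (volume.restrict A) := ⟨by simpa using hAf⟩
      calc ∫ x in A, ‖v (x + y)‖ ≤ ∫ x in A, (1 + (v (x + y)) ^ 2) := by
            refine integral_mono (hi y).norm ((integrable_const _).add h2.integrableOn) fun x => ?_
            simp only [norm_eq_abs]
            nlinarith [sq_nonneg (|v (x + y)| - 1), sq_abs (v (x + y)), abs_nonneg (v (x + y))]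
        _ = vol A + ∫ x in A, (v (x + y)) ^ 2 := by
            rw [integral_add (integrable_const _) h2.integrableOn]; simp
        _ ≤ vol A + ∫ x, (v (x + y)) ^ 2 := by
            refine add_le_add_right (setIntegral_le_integral h2 (ae_of_all _ fun x => sq_nonneg _)) _
        _ = _ := by
            rw [← (tau y).norm_map v, ← real_inner_self_eq_norm_sq, L2.inner_def]; congr 1
            refine integral_congr_ae ?_; filter_upwards [coeFn_tau y v] with x hx; simp [hx, sq]
    refine (hk.norm.mul_const C).mono' hmm.norm.prod_swap.integral_prod_right' (ae_of_all _ fun y => ?_)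
    simp only [norm_mul, integral_const_mul]
    rw [norm_norm, norm_of_nonneg (integral_nonneg fun x => norm_nonneg _)]; gcongr; exact hC y
  simp only [hx]
  refine ae_eq_of_forall_setIntegral_eq_of_sigmaFinite (fun A hA hAf => ?_) (fun A hA hAf => ?_) fun A hA hAf => ?_
  · have : IsFiniteMeasure (volume.restrict A) := ⟨by simpa using hAf⟩
    exact ((Lp.memLp (convL k v)).restrict A).integrable (by norm_num)
  · exact (hF A hA hAf).integral_prod_left
  · have e : ∀ w : L2 N, ∫ x in A, w x = ⟪indicatorConstLp 2 hA hAf.ne (1 : ℝ), w⟫ := fun w => by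
      rw [L2.inner_indicatorConstLp_one]
    rw [e, inner_convL hk, integral_integral_swap (hF A hA hAf)]
    refine integral_congr_ae (ae_of_all _ fun y => ?_); simp only [← e]
    rw [integral_const_mul, setIntegral_congr_ae hA ((coeFn_tau y v).mono fun x hx _ => hx)]

variable {a : ℝ}

/-- Powers of `z² + |x|²`. -/
def qK (a z : ℝ) (x : Eu N) : ℝ := (z ^ 2 + ‖x‖ ^ 2) ^ (-a)

/-- Half the homogeneity of the Gagliardo kernel. -/
def pE (N : ℕ) (s : ℝ) : ℝ := (N + 2 * s) / 2

lemma qK_pos (hz : 0 < z) (x : Eu N) : 0 < qK a z x := by unfold qK; positivity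

lemma mul_qK_succ (hz : 0 < z) (x : Eu N) : (z ^ 2 + ‖x‖ ^ 2) * qK (a + 1) z x = qK a z x := by
  unfold qK
  rw [show -a = 1 + -(a + 1) by ring, rpow_add (by positivity : 0 < z ^ 2 + ‖x‖ ^ 2), rpow_one]

lemma sq_mul_qK_succ_le (hz : 0 < z) (x : Eu N) : z ^ 2 * qK (a + 1) z x ≤ qK a z x := by
  rw [← mul_qK_succ (a := a) hz]
  nlinarith [mul_nonneg (sq_nonneg ‖x‖) (qK_pos (a := a + 1) hz x).le]

lemma norm_sq_mul_qK_succ_le (hz : 0 < z) (x : Eu N) : ‖x‖ ^ 2 * qK (a + 1) z x ≤ qK a z x := by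
  rw [← mul_qK_succ (a := a) hz]
  nlinarith [mul_nonneg (sq_nonneg z) (qK_pos (a := a + 1) hz x).le]

lemma norm_mul_qK_succ_le (hz : 0 < z) (x : Eu N) : ‖x‖ * qK (a + 1) z x ≤ z⁻¹ * qK a z x := by
  rw [← mul_qK_succ (a := a) hz, ← mul_assoc]
  refine mul_le_mul_of_nonneg_right ?_ (qK_pos hz x).le
  rw [inv_mul_eq_div, le_div_iff₀ hz]
  nlinarith [sq_nonneg (‖x‖ - z)]

lemma qK_anti (ha : 0 ≤ a) {z' : ℝ} (hz : 0 < z) (h : z ≤ z') (x : Eu N) : qK a z' x ≤ qK a z x :=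
  Real.rpow_le_rpow_of_nonpos (by positivity) (by gcongr) (by linarith)

lemma continuous_qK (hz : 0 < z) : Continuous (qK a z : Eu N → ℝ) :=
  (by fun_prop : Continuous fun x : Eu N => z ^ 2 + ‖x‖ ^ 2).rpow_const
    fun x => Or.inl (by positivity)

lemma hasDerivAt_qK (hz : 0 < z) (x : Eu N) :
    HasDerivAt (fun z => qK a z x) (-(2 * a * z * qK (a + 1) z x)) z := by
  have h : HasDerivAt (fun z : ℝ => z ^ 2 + ‖x‖ ^ 2) (2 * z) z := by
    simpa using (hasDerivAt_pow 2 z).add_const (‖x‖ ^ 2)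
  have := h.rpow_const (p := -a) (Or.inl (by positivity))
  refine this.congr_deriv ?_
  rw [qK, show -(a + 1) = -a - 1 by ring]
  ring

lemma hasDerivAt_inner_line (e x : Eu N) (t : ℝ) :
    HasDerivAt (fun t : ℝ => ⟪x - t • e, e⟫) (-‖e‖ ^ 2) t := by
  have h := ((hasDerivAt_id t).mul_const (‖e‖ ^ 2)).const_sub ⟪x, e⟫
  refine (h.congr_of_eventuallyEq (.of_forall fun t => ?_)).congr_deriv (by simp)
  simp [inner_sub_left, real_inner_smul_left]

lemma hasDerivAt_qK_line (hz : 0 < z) (e x : Eu N) (t : ℝ) :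
    HasDerivAt (fun t : ℝ => qK a z (x - t • e)) (2 * a * ⟪x - t • e, e⟫ * qK (a + 1) z (x - t • e)) t := by
  have h0 : HasDerivAt (fun t : ℝ => x - t • e) (-e) t := by
    simpa using ((hasDerivAt_id t).smul_const e).const_sub x
  have := (h0.norm_sq.const_add (z ^ 2)).rpow_const (p := -a) (Or.inl (by positivity))
  refine this.congr_deriv ?_
  rw [qK, show -(a + 1) = -a - 1 by ring, inner_neg_right]
  ring

lemma qK_line_le (ha : 0 ≤ a) (hz : 0 < z) (hy : ‖y‖ ≤ z / 2) :
    qK a z (x - y) ≤ 2 ^ a * qK a z x := by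
  have h1 : ‖x‖ ≤ ‖x - y‖ + ‖y‖ := by simpa using norm_add_le (x - y) y
  have h2 : z ^ 2 + ‖x‖ ^ 2 ≤ 2 * (z ^ 2 + ‖x - y‖ ^ 2) := by
    nlinarith [norm_nonneg x, norm_nonneg y, norm_nonneg (x - y), sq_nonneg (‖x - y‖ - ‖y‖)]
  have h3 : 0 < z ^ 2 + ‖x - y‖ ^ 2 := by positivity
  calc qK a z (x - y) = 2 ^ a * (2 * (z ^ 2 + ‖x - y‖ ^ 2)) ^ (-a) := by
        rw [mul_rpow two_pos.le h3.le, ← mul_assoc, ← rpow_add two_pos]; simp [qK]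
    _ ≤ _ := by gcongr; exact Real.rpow_le_rpow_of_nonpos (by positivity) h2 (by linarith)

lemma qK_scale (hz : 0 < z) (x : Eu N) : qK a z x = z ^ (-(2 * a)) * qK a 1 (z⁻¹ • x) := by
  have : z ^ 2 + ‖x‖ ^ 2 = z ^ (2 : ℝ) * (1 ^ 2 + ‖z⁻¹ • x‖ ^ 2) := by
    rw [norm_smul, norm_inv, norm_of_nonneg hz.le, rpow_two]; field_simp
  unfold qK
  rw [this, mul_rpow (by positivity) (by positivity), ← rpow_mul hz.le]
  congr 2
  ring

lemma neg_pE : -(N + 2 * s) / 2 = -pE N s := by unfold pE; ring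

lemma pE_pos (hs : 0 < s) : 0 < pE N s := by unfold pE; positivity

lemma betaC_eq : betaC N s = (∫ x : Eu N, qK (pE N s) 1 x)⁻¹ := by
  simp only [betaC, qK, neg_pE, one_pow]

lemma integrable_qK_one (hs : 0 < s) : Integrable (qK (pE N s) 1 : Eu N → ℝ) := by
  have := integrable_rpow_neg_one_add_norm_sq (E := Eu N) (μ := volume) (r := (N : ℝ) + 2 * s)
    (by simp; linarith)
  refine this.congr (ae_of_all _ fun x => ?_)
  simp only [qK, neg_pE, one_pow]

lemma betaC_pos (hs : 0 < s) : 0 < betaC N s := by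
  rw [betaC_eq, inv_pos]
  exact integral_pos_of_integrable_nonneg_nonzero (continuous_qK one_pos) (integrable_qK_one hs)
    (fun x => (qK_pos one_pos x).le) (qK_pos one_pos (0 : Eu N)).ne'

lemma integrable_qK (hs : 0 < s) (hz : 0 < z) : Integrable (qK (pE N s) z : Eu N → ℝ) := by
  have := ((integrable_qK_one (N := N) hs).comp_smul (inv_ne_zero hz.ne')).const_mul (z ^ (-(2 * pE N s)))
  exact this.congr (ae_of_all _ fun x => (qK_scale hz x).symm)

lemma integral_qK (hz : 0 < z) : ∫ x : Eu N, qK (pE N s) z x = z ^ (-(2 * s)) * (betaC N s)⁻¹ := by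
  simp_rw [qK_scale hz]
  rw [integral_const_mul, Measure.integral_comp_inv_smul_of_nonneg _ _ hz.le, betaC_eq, inv_inv, smul_eq_mul,
    ← mul_assoc, finrank_euclideanSpace_fin, ← rpow_natCast, ← rpow_add hz]
  congr 2
  unfold pE
  ring

lemma poisson_eq (x : Eu N) : poisson N s z x = betaC N s * z ^ (2 * s) * qK (pE N s) z x := by
  simp only [poisson, qK, neg_pE]

lemma integral_poisson (hs : 0 < s) (hz : 0 < z) : ∫ x : Eu N, poisson N s z x = 1 := by
  simp_rw [poisson_eq]
  rw [integral_const_mul, integral_qK hz, rpow_neg hz.le]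
  have := betaC_pos (N := N) hs
  have := rpow_pos_of_pos hz (2 * s)
  field_simp

lemma poisson_pos (hs : 0 < s) (hz : 0 < z) (x : Eu N) : 0 < poisson N s z x := by
  rw [poisson_eq]
  have := betaC_pos (N := N) hs
  have := qK_pos (a := pE N s) hz x
  positivity

/-- The weighted `z`-derivative of the Poisson kernel. -/
def gK (N : ℕ) (s z : ℝ) (x : Eu N) : ℝ :=
  betaC N s * (2 * s * qK (pE N s) z x - 2 * pE N s * (z ^ 2 * qK (pE N s + 1) z x))

/-- The first derivatives of the Poisson kernel. -/
def dP (s z : ℝ) (e x : Eu N) : ℝ :=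
  -(betaC N s * z ^ (2 * s) * (2 * pE N s * (⟪x, e⟫ * qK (pE N s + 1) z x)))

/-- The second derivatives of the Poisson kernel. -/
def ddP (s z : ℝ) (e x : Eu N) : ℝ :=
  betaC N s * z ^ (2 * s) * (4 * pE N s * (pE N s + 1) * (⟪x, e⟫ ^ 2 * qK (pE N s + 2) z x)
    - 2 * pE N s * (‖e‖ ^ 2 * qK (pE N s + 1) z x))

lemma continuous_poisson (hz : 0 < z) : Continuous (poisson N s z) := by
  simp_rw [funext (poisson_eq (N := N) (s := s) (z := z))]
  exact continuous_const.mul (continuous_qK hz)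

lemma continuous_gK (hz : 0 < z) : Continuous (gK N s z) := by
  have h1 := continuous_qK (N := N) (a := pE N s) hz
  have h2 := continuous_qK (N := N) (a := pE N s + 1) hz
  unfold gK
  fun_prop

lemma continuous_dP (hz : 0 < z) (e : Eu N) : Continuous (dP s z e) := by
  have h2 := continuous_qK (N := N) (a := pE N s + 1) hz
  unfold dP
  fun_prop

lemma continuous_ddP (hz : 0 < z) (e : Eu N) : Continuous (ddP s z e) := by
  have h1 := continuous_qK (N := N) (a := pE N s + 2) hz
  have h2 := continuous_qK (N := N) (a := pE N s + 1) hz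
  unfold ddP
  fun_prop

lemma poisson_neg (x : Eu N) : poisson N s z (-x) = poisson N s z x := by simp [poisson]

lemma abs_gK_le (hs : 0 < s) (hz : 0 < z) (x : Eu N) :
    |gK N s z x| ≤ betaC N s * (2 * s + 2 * pE N s) * qK (pE N s) z x := by
  have hb := betaC_pos (N := N) hs
  have hp := pE_pos (N := N) hs
  have h1 := qK_pos (a := pE N s) hz x
  have h2 := sq_mul_qK_succ_le (a := pE N s) hz x
  have h3 : 0 ≤ z ^ 2 * qK (pE N s + 1) z x := mul_nonneg (sq_nonneg z) (qK_pos hz x).le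
  unfold gK
  rw [abs_mul, abs_of_pos hb, mul_assoc (betaC N s)]
  gcongr
  rw [abs_le]
  constructor <;> nlinarith [mul_nonneg hp.le h3, mul_le_mul_of_nonneg_left h2 hp.le, mul_pos hs h1, mul_pos hp h1]

lemma abs_dP_le (hs : 0 < s) (hz : 0 < z) (e x : Eu N) :
    |dP s z e x| ≤ betaC N s * z ^ (2 * s) * (2 * pE N s * (‖e‖ * z⁻¹)) * qK (pE N s) z x := by
  have hb := betaC_pos (N := N) hs
  have hp := pE_pos (N := N) hs
  have hq := qK_pos (a := pE N s + 1) hz x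
  have h2 := norm_mul_qK_succ_le (a := pE N s) hz x
  have h3 := abs_real_inner_le_norm x e
  have hz' := rpow_pos_of_pos hz (2 * s)
  unfold dP
  rw [abs_neg, abs_mul, abs_of_pos (mul_pos hb hz'), abs_mul, abs_mul ⟪x, e⟫, abs_of_pos hq, abs_of_pos (by positivity : 0 < 2 * pE N s),
    mul_assoc (betaC N s * z ^ (2 * s)), mul_assoc (2 * pE N s)]
  refine mul_le_mul_of_nonneg_left (mul_le_mul_of_nonneg_left ?_ (by positivity)) (by positivity)
  calc |⟪x, e⟫| * qK (pE N s + 1) z x ≤ (‖x‖ * ‖e‖) * qK (pE N s + 1) z x := by gcongr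
    _ = ‖e‖ * (‖x‖ * qK (pE N s + 1) z x) := by ring
    _ ≤ ‖e‖ * (z⁻¹ * qK (pE N s) z x) := by gcongr
    _ = _ := by ring

lemma abs_ddP_le (hs : 0 < s) (hz : 0 < z) (e x : Eu N) :
    |ddP s z e x| ≤ betaC N s * z ^ (2 * s) * ((4 * pE N s * (pE N s + 1) + 2 * pE N s) *
      (‖e‖ ^ 2 * (z ^ 2)⁻¹)) * qK (pE N s) z x := by
  have hb := betaC_pos (N := N) hs
  have hp := pE_pos (N := N) hs
  have hq := qK_pos (a := pE N s + 1) hz x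
  have hq2 := qK_pos (a := pE N s + 2) hz x
  have h1 : qK (pE N s + 1) z x ≤ (z ^ 2)⁻¹ * qK (pE N s) z x := by
    rw [inv_mul_eq_div, le_div_iff₀ (by positivity), mul_comm]; exact sq_mul_qK_succ_le hz x
  have h2 := norm_sq_mul_qK_succ_le (a := pE N s + 1) hz x
  rw [add_assoc, one_add_one_eq_two] at h2
  have h3 : ⟪x, e⟫ ^ 2 ≤ (‖x‖ * ‖e‖) ^ 2 := sq_le_sq' (by linarith [abs_le.1 (abs_real_inner_le_norm x e)]) (real_inner_le_norm x e)
  have h4 : ⟪x, e⟫ ^ 2 * qK (pE N s + 2) z x ≤ ‖e‖ ^ 2 * ((z ^ 2)⁻¹ * qK (pE N s) z x) := by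
    nlinarith
  have h5 : ‖e‖ ^ 2 * qK (pE N s + 1) z x ≤ ‖e‖ ^ 2 * ((z ^ 2)⁻¹ * qK (pE N s) z x) := by gcongr
  have hz' := rpow_pos_of_pos hz (2 * s)
  unfold ddP
  rw [abs_mul, abs_of_pos (mul_pos hb hz'), mul_assoc (betaC N s * z ^ (2 * s))]
  refine mul_le_mul_of_nonneg_left ((abs_sub _ _).trans ?_) (by positivity)
  rw [abs_of_nonneg (by positivity), abs_of_nonneg (by positivity)]
  calc _ ≤ 4 * pE N s * (pE N s + 1) * (‖e‖ ^ 2 * ((z ^ 2)⁻¹ * qK (pE N s) z x)) +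
        2 * pE N s * (‖e‖ ^ 2 * ((z ^ 2)⁻¹ * qK (pE N s) z x)) := by gcongr
    _ = _ := by ring

section KernelDeriv

variable {E : Type*} [NormedAddCommGroup E] [NormedSpace ℝ E]
  {c : Eu N → E} {B C : ℝ} {k k' : Eu N → ℝ}

lemma integrable_of_le_qK (hs : 0 < s) (hz : 0 < z) (hk : Continuous k)
    (hC : ∀ x, |k x| ≤ C * qK (pE N s) z x) : Integrable k :=
  ((integrable_qK hs hz).const_mul C).mono' hk.aestronglyMeasurable (ae_of_all _ hC)

lemma hasDerivAt_integral_kernel {κ κ' : ℝ → Eu N → ℝ} {C : ℝ → ℝ} (hs : 0 < s) (hz : 0 < z)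
    (hc : Continuous c) (hB : ∀ y, ‖c y‖ ≤ B) (hκ : ∀ z, 0 < z → Continuous (κ z))
    (hi : Integrable (κ z)) (hκ' : ∀ z, 0 < z → Continuous (κ' z))
    (hd : ∀ z, 0 < z → ∀ y, HasDerivAt (fun z => κ z y) (κ' z y) z)
    (hC : ContinuousAt C z) (hb : ∀ z, 0 < z → ∀ y, |κ' z y| ≤ C z * qK (pE N s) z y) :
    HasDerivAt (fun z => ∫ y, κ z y • c y) (∫ y, κ' z y • c y) z := by
  have hn : {w | z / 2 < w ∧ C w < C z + 1} ∈ 𝓝 z :=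
    (lt_mem_nhds (half_lt_self hz)).and (hC.eventually (gt_mem_nhds (lt_add_one _)))
  refine (hasDerivAt_integral_of_dominated_loc_of_deriv_le (F := fun z y => κ z y • c y)
    (F' := fun z y => κ' z y • c y) (bound := fun y => (|C z + 1| * qK (pE N s) (z / 2) y) * B) hn
    ?_ (hi.smul_bounded hc hB) ((hκ' z hz).smul hc).aestronglyMeasurable
    (ae_of_all _ fun y w hw => ?_) (((integrable_qK hs (half_pos hz)).const_mul _).mul_const _)
    (ae_of_all _ fun y w hw => (hd w ((half_pos hz).trans hw.1) y).smul_const _)).2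
  · filter_upwards [lt_mem_nhds hz] with w hw; exact ((hκ w hw).smul hc).aestronglyMeasurable
  · rw [norm_smul]; have hw0 : 0 < w := (half_pos hz).trans hw.1
    refine mul_le_mul ((hb w hw0 y).trans ?_) (hB y) (norm_nonneg _)
      (mul_nonneg (abs_nonneg _) (qK_pos (half_pos hz) y).le)
    exact mul_le_mul (hw.2.le.trans (le_abs_self _)) (qK_anti (pE_pos hs).le (half_pos hz) hw.1.le y)
      (qK_pos hw0 y).le (abs_nonneg _)

lemma tau_convL_eq (k : Eu N → ℝ) (hk : Integrable k) (a : Eu N) (v : L2 N) :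
    tau a (convL k v) = ∫ y, k (y - a) • tau y v := by
  rw [tau_convL hk, convL, ← integral_add_right_eq_self (fun y => k (y - a) • tau y v) a]
  simp [tau_tau]

/-- Differentiability of translates of a smoothed function. -/
lemma hasDerivAt_tau_convL (hs : 0 < s) (hz : 0 < z) (e : Eu N) (hk : Continuous k) (hi : Integrable k)
    (hk' : Continuous k') (hd : ∀ x t, HasDerivAt (fun t : ℝ => k (x - t • e)) (-k' (x - t • e)) t)
    (hC0 : 0 ≤ C) (hC : ∀ x, |k' x| ≤ C * qK (pE N s) z x) (v : L2 N) :
    HasDerivAt (fun t : ℝ => tau (t • e) (convL k v)) (-convL k' v) 0 := by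
  have hc := continuous_tau v; have hδ : 0 < z / 2 / (‖e‖ + 1) := by positivity
  simp only [tau_convL_eq k hi]
  have := (hasDerivAt_integral_of_dominated_loc_of_deriv_le (F := fun (t : ℝ) y => k (y - t • e) • tau y v)
    (F' := fun t y => (-k' (y - t • e)) • tau y v) (x₀ := (0 : ℝ))
    (bound := fun y => (C * (2 ^ pE N s * qK (pE N s) z y)) * ‖v‖) (Metric.ball_mem_nhds 0 hδ)
    (.of_forall fun t => ((hk.comp (by fun_prop)).smul hc).aestronglyMeasurable)
    (by simpa using integrable_smul_tau hi v) (((hk'.comp (by fun_prop)).neg).smul hc).aestronglyMeasurable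
    (ae_of_all _ fun y t ht => ?_) ((((integrable_qK hs hz).const_mul _).const_mul _).mul_const _)
    (ae_of_all _ fun y t ht => (hd y t).smul_const _)).2
  · simp_all [convL, zero_smul, sub_zero, neg_smul, integral_neg]
  · rw [norm_smul, LinearIsometry.norm_map, norm_neg]
    refine mul_le_mul_of_nonneg_right ((hC _).trans (mul_le_mul_of_nonneg_left
      (qK_line_le (pE_pos hs).le hz ?_) hC0)) (norm_nonneg _)
    rw [mem_ball_zero_iff, lt_div_iff₀ (by positivity)] at ht
    rw [norm_smul]; nlinarith [norm_nonneg t]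

lemma integrable_poisson (hs : 0 < s) (hz : 0 < z) : Integrable (poisson N s z) := by
  simp_rw [funext (poisson_eq (N := N) (s := s) (z := z))]
  exact (integrable_qK hs hz).const_mul _

lemma integrable_gK (hs : 0 < s) (hz : 0 < z) : Integrable (gK N s z) :=
  integrable_of_le_qK hs hz (continuous_gK hz) (abs_gK_le hs hz)

lemma integrable_dP (hs : 0 < s) (hz : 0 < z) (e : Eu N) : Integrable (dP s z e) :=
  integrable_of_le_qK hs hz (continuous_dP hz e) (abs_dP_le hs hz e)

lemma integrable_ddP (hs : 0 < s) (hz : 0 < z) (e : Eu N) : Integrable (ddP s z e) :=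
  integrable_of_le_qK hs hz (continuous_ddP hz e) (abs_ddP_le hs hz e)

lemma hasDerivAt_tau_poisson (hs : 0 < s) (hz : 0 < z) (e : Eu N) (v : L2 N) :
    HasDerivAt (fun t : ℝ => tau (t • e) (convL (poisson N s z) v)) (-convL (dP s z e) v) 0 := by
  have hb := betaC_pos (N := N) hs
  have hp := pE_pos (N := N) hs
  refine hasDerivAt_tau_convL hs hz e (continuous_poisson hz) (integrable_poisson hs hz)
    (continuous_dP hz e) (fun x t => ?_) (by positivity) (abs_dP_le hs hz e) v
  simp_rw [funext (poisson_eq (N := N) (s := s) (z := z))]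
  refine ((hasDerivAt_qK_line hz e x t).const_mul _).congr_deriv ?_
  simp only [dP]
  ring

lemma hasDerivAt_tau_dP (hs : 0 < s) (hz : 0 < z) (e : Eu N) (v : L2 N) :
    HasDerivAt (fun t : ℝ => tau (t • e) (convL (dP s z e) v)) (-convL (ddP s z e) v) 0 := by
  have hb := betaC_pos (N := N) hs
  have hp := pE_pos (N := N) hs
  refine hasDerivAt_tau_convL hs hz e (continuous_dP hz e) (integrable_dP hs hz e)
    (continuous_ddP hz e) (fun x t => ?_) (by positivity) (abs_ddP_le hs hz e) v
  have := (((hasDerivAt_inner_line e x t).mul (hasDerivAt_qK_line (a := pE N s + 1) hz e x t)).const_mul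
    (2 * pE N s)).const_mul (betaC N s * z ^ (2 * s))
  refine this.neg.congr_deriv ?_
  simp only [ddP]
  grind

lemma sum_inner_coordE (x : Eu N) : ∑ i, ⟪x, coordE i⟫ ^ 2 = ‖x‖ ^ 2 := by
  rw [EuclideanSpace.norm_sq_eq]
  simp [inner_coordE]

/-- The horizontal Laplacian of the Poisson kernel. -/
def lapP (N : ℕ) (s z : ℝ) (x : Eu N) : ℝ := ∑ i, ddP s z (coordE i) x

lemma lapP_eq (x : Eu N) : lapP N s z x = betaC N s * z ^ (2 * s) *
    (4 * pE N s * (pE N s + 1) * (‖x‖ ^ 2 * qK (pE N s + 2) z x) - 2 * pE N s * (N * qK (pE N s + 1) z x)) := by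
  simp only [lapP, ddP]
  rw [← Finset.mul_sum, Finset.sum_sub_distrib, ← Finset.mul_sum, ← Finset.sum_mul, sum_inner_coordE]
  simp [coordE]
  left
  ring

lemma hasDerivAt_gK (hz : 0 < z) (x : Eu N) :
    HasDerivAt (fun z => gK N s z x) (-(z ^ (1 - 2 * s) * lapP N s z x)) z := by
  have h := (((hasDerivAt_qK (a := pE N s) hz x).const_mul (2 * s)).sub
    (((hasDerivAt_pow 2 z).mul (hasDerivAt_qK (a := pE N s + 1) hz x)).const_mul (2 * pE N s))).const_mul (betaC N s)
  refine h.congr_deriv ?_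
  have h2 : z ^ (1 - 2 * s) * z ^ (2 * s) = z := by rw [← rpow_add hz]; simp
  have h3 : (N : ℝ) = 2 * pE N s - 2 * s := by unfold pE; ring
  rw [lapP_eq, ← (mul_qK_succ (a := pE N s + 1) hz x), h3, show pE N s + 1 + 1 = pE N s + 2 by ring]
  generalize pE N s = p at *
  generalize qK (p + 2) z x = q
  grind

lemma continuous_lapP (hz : 0 < z) : Continuous (lapP N s z) :=
  continuous_finset_sum _ fun i _ => continuous_ddP hz _

lemma hasDerivAt_poisson (hz : 0 < z) (x : Eu N) :
    HasDerivAt (fun z => poisson N s z x) (z ^ (2 * s - 1) * gK N s z x) z := by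
  simp_rw [poisson_eq]
  have h := ((Real.hasDerivAt_rpow_const (p := 2 * s) (Or.inl hz.ne')).const_mul (betaC N s)).mul
    (hasDerivAt_qK (a := pE N s) hz x)
  refine h.congr_deriv ?_
  rw [(by rw [← Real.rpow_add_one hz.ne']; simp : z ^ (2 * s) = z ^ (2 * s - 1) * z), gK]
  ring

lemma hasDerivAt_integral_poisson (hs : 0 < s) (hz : 0 < z) (hc : Continuous c) (hB : ∀ y, ‖c y‖ ≤ B) :
    HasDerivAt (fun z => ∫ y, poisson N s z y • c y) (∫ y, (z ^ (2 * s - 1) * gK N s z y) • c y) z := by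
  refine hasDerivAt_integral_kernel (κ' := fun z y => z ^ (2 * s - 1) * gK N s z y) (C := fun z => z ^ (2 * s - 1) * (betaC N s * (2 * s + 2 * pE N s)))
    hs hz hc hB (fun z hz => continuous_poisson hz)
    (integrable_poisson hs hz) (fun z hz => continuous_const.mul (continuous_gK hz))
    (fun z hz y => hasDerivAt_poisson hz y) ?_ fun z hz y => ?_
  · exact (Real.continuousAt_rpow_const _ _ (Or.inl hz.ne')).mul continuousAt_const
  · rw [abs_mul, abs_of_pos (rpow_pos_of_pos hz _), mul_assoc]; gcongr; exact abs_gK_le hs hz y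

lemma hasDerivAt_convL_poisson (hs : 0 < s) (hz : 0 < z) (v : L2 N) :
    HasDerivAt (fun z => convL (poisson N s z) v) (z ^ (2 * s - 1) • convL (gK N s z) v) z := by
  have := hasDerivAt_integral_poisson hs hz (continuous_tau v) (B := ‖v‖)
    fun y => ((tau y).norm_map v).le
  refine this.congr_deriv ?_
  simp only [mul_smul, convL]
  rw [integral_smul]

lemma integral_gK (hs : 0 < s) (hz : 0 < z) : ∫ x : Eu N, gK N s z x = 0 := by
  have h1 := hasDerivAt_integral_poisson (N := N) (c := fun _ => (1 : ℝ)) hs hz continuous_const (B := 1) (by simp)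
  have h2 := h1.unique ((hasDerivAt_const z (1 : ℝ)).congr_of_eventuallyEq (by
    filter_upwards [lt_mem_nhds hz] with w hw; simpa using integral_poisson hs hw))
  simp only [smul_eq_mul, mul_one] at h2
  rw [integral_const_mul] at h2
  exact (mul_eq_zero.1 h2).resolve_left (by positivity)

lemma hasDerivAt_convL_gK (hs : 0 < s) (hz : 0 < z) (v : L2 N) :
    HasDerivAt (fun z => convL (gK N s z) v) (-(z ^ (1 - 2 * s) • convL (lapP N s z) v)) z := by
  have hb := betaC_pos (N := N) hs
  have hp := pE_pos (N := N) hs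
  have := hasDerivAt_integral_kernel (c := fun y => tau y v) (B := ‖v‖) (κ := gK N s)
    (κ' := fun z y => -(z ^ (1 - 2 * s) * lapP N s z y))
    (C := fun z => z ^ (1 - 2 * s) * (N * (betaC N s * z ^ (2 * s) * ((4 * pE N s * (pE N s + 1) + 2 * pE N s) * (z ^ 2)⁻¹))))
    hs hz (continuous_tau v) (fun y => ((tau y).norm_map v).le) (fun z hz => continuous_gK hz)
    (integrable_gK hs hz) (fun z hz => (continuous_const.mul (continuous_lapP hz)).neg)
    (fun z hz y => hasDerivAt_gK hz y) ?_ fun z hz y => ?_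
  · simp_all [neg_smul, mul_smul, convL, integral_neg, integral_smul]
  · have h1 := Real.continuousAt_rpow_const z (1 - 2 * s) (Or.inl hz.ne')
    have h2 := Real.continuousAt_rpow_const z (2 * s) (Or.inl hz.ne')
    have h3 : ContinuousAt (fun z : ℝ => (z ^ 2)⁻¹) z := (continuousAt_id.pow 2).inv₀ (pow_ne_zero 2 hz.ne')
    exact h1.mul (continuousAt_const.mul ((continuousAt_const.mul h2).mul (continuousAt_const.mul h3)))
  · have hz' := rpow_pos_of_pos hz (1 - 2 * s); rw [abs_neg, abs_mul, abs_of_pos hz', mul_assoc]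
    refine mul_le_mul_of_nonneg_left ((Finset.abs_sum_le_sum_abs _ _).trans
      ((Finset.sum_le_sum fun i _ => abs_ddP_le hs hz (coordE i) y).trans_eq ?_)) hz'.le
    simp [coordE]; ring

end KernelDeriv

lemma inner_deriv_tau {e : Eu N} {w w' x x' : L2 N} (hw : HasDerivAt (fun t : ℝ => tau (t • e) w) w' 0)
    (hx : HasDerivAt (fun t : ℝ => tau (t • e) x) x' 0) : ⟪w, x'⟫ = -⟪w', x⟫ := by
  have h1 := ((hasDerivAt_const (0 : ℝ) w).inner ℝ hx)
  have hn : HasDerivAt (fun t : ℝ => tau ((-t) • e) w) (-w') 0 := by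
    have := HasDerivAt.scomp (0 : ℝ) (by simpa using hw) (hasDerivAt_neg (0 : ℝ))
    simpa [comp_def] using this
  have h3 : (fun t : ℝ => ⟪w, tau (t • e) x⟫) = fun t : ℝ => ⟪tau ((-t) • e) w, x⟫ := by
    ext t; rw [inner_tau_left, neg_smul, neg_neg]
  rw [h3] at h1
  simpa using h1.unique (hn.inner ℝ (hasDerivAt_const (0 : ℝ) x))

lemma convL_lapP (hs : 0 < s) (hz : 0 < z) (v : L2 N) :
    convL (lapP N s z) v = ∑ i, convL (ddP s z (coordE i)) v := by
  simp only [convL, lapP, Finset.sum_smul]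
  exact integral_finset_sum _ fun i _ => integrable_smul_tau (integrable_ddP hs hz _) v

lemma sum_norm_sq_dP (hs : 0 < s) (hz : 0 < z) (v : L2 N) :
    ∑ i, ‖convL (dP s z (coordE i)) v‖ ^ 2 = -⟪convL (poisson N s z) v, convL (lapP N s z) v⟫ := by
  rw [convL_lapP hs hz, inner_sum, ← Finset.sum_neg_distrib]
  refine Finset.sum_congr rfl fun i _ => ?_
  have := inner_deriv_tau (hasDerivAt_tau_poisson hs hz (coordE i) v) (hasDerivAt_tau_dP hs hz (coordE i) v)
  simp_all

/-- Step sizes for difference quotients. -/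
def stepN (n : ℕ) : ℝ := 1 / ((n : ℝ) + 1)

lemma stepN_pos (n : ℕ) : 0 < stepN n := by unfold stepN; positivity

lemma tendsto_stepN : Tendsto stepN atTop (𝓝[≠] 0) :=
  tendsto_nhdsWithin_iff.2 ⟨tendsto_one_div_add_atTop_nhds_zero_nat, .of_forall fun n => (stepN_pos n).ne'⟩

lemma norm_sq_quot (hf : MemLp f 2 (volume : Measure (Eu N))) (t : ℝ) (e : Eu N) :
    ‖t⁻¹ • (tau (t • e) (hf.toLp f) - hf.toLp f)‖ ^ 2 = ∫ x, (t⁻¹ * (f (x + t • e) - f x)) ^ 2 ∧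
    Integrable fun x => (t⁻¹ * (f (x + t • e) - f x)) ^ 2 := by
  have hg := ((hf.comp_measurePreserving (measurePreserving_add_right volume (t • e))).sub hf).const_smul t⁻¹
  rw [tau_toLp, ← MemLp.toLp_sub, ← MemLp.toLp_const_smul, norm_sq_toLp hg]
  exact ⟨rfl, hg.integrable_sq⟩

lemma tendsto_quot (h : DifferentiableAt ℝ f x) (e : Eu N) :
    Tendsto (fun n => (stepN n)⁻¹ * (f (x + stepN n • e) - f x)) atTop (𝓝 (fderiv ℝ f x e)) := by
  have := (h.hasFDerivAt.hasLineDerivAt e).tendsto_slope_zero.comp tendsto_stepN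
  simpa [comp_def] using this

lemma sum_fderiv_sq (T : Eu N →L[ℝ] ℝ) : ∑ i, T (coordE i) ^ 2 = ‖T‖ ^ 2 := by
  have h : ∀ x, T x = ⟪x, (InnerProductSpace.toDual ℝ (Eu N)).symm T⟫ := fun x => by
    rw [real_inner_comm, InnerProductSpace.toDual_symm_apply]
  simp only [h]
  rw [← (InnerProductSpace.toDual ℝ (Eu N)).symm.norm_map T, ← sum_inner_coordE]
  simp only [real_inner_comm]

lemma lintegral_fderiv_sq_le (hL : LipschitzWith L f) (hf : MemLp f 2) {w : Fin N → L2 N}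
    (hw : ∀ i, HasDerivAt (fun t : ℝ => tau (t • coordE i) (hf.toLp f)) (w i) 0) :
    ∫⁻ x, ‖fderiv ℝ f x‖ₑ ^ 2 ≤ ofReal (∑ i, ‖w i‖ ^ 2) := by
  have hmq : ∀ n i, Measurable fun x => ofReal (((stepN n)⁻¹ * (f (x + stepN n • coordE i) - f x)) ^ 2) := by
    intro n i; have := hL.continuous
    exact (by fun_prop : Continuous fun x => ((stepN n)⁻¹ * (f (x + stepN n • coordE i) - f x)) ^ 2).measurable.ennreal_ofReal
  have h1 : ∀ x, ‖fderiv ℝ f x‖ₑ ^ 2 = ∑ i, ofReal (fderiv ℝ f x (coordE i) ^ 2) := fun x => by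
    rw [← ENNReal.ofReal_sum_of_nonneg (fun i _ => sq_nonneg _), sum_fderiv_sq, ← ofReal_norm, ofReal_pow (norm_nonneg _)]
  simp_rw [h1]
  rw [lintegral_finset_sum' _ fun i _ => ((measurable_fderiv_apply_const ℝ f (coordE i)).pow_const 2).ennreal_ofReal.aemeasurable,
    ENNReal.ofReal_sum_of_nonneg fun i _ => sq_nonneg _]
  refine Finset.sum_le_sum fun i _ => ?_
  have hlim : Tendsto (fun n => ofReal (‖(stepN n)⁻¹ • (tau (stepN n • coordE i) (hf.toLp f) - hf.toLp f)‖ ^ 2))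
      atTop (𝓝 (ofReal (‖w i‖ ^ 2))) := by
    have := (hw i).tendsto_slope_zero.comp tendsto_stepN
    refine tendsto_ofReal ((this.norm.pow 2).congr fun n => ?_); simp [tau_zero]
  rw [← hlim.liminf_eq]
  refine (lintegral_mono_ae ?_).trans ((lintegral_liminf_le (u := atTop) fun n => hmq n i).trans_eq ?_)
  · filter_upwards [hL.ae_differentiableAt] with x hx
    exact ((tendsto_ofReal ((tendsto_quot hx (coordE i)).pow 2)).liminf_eq).ge
  · congr 1; ext n
    rw [(norm_sq_quot hf _ _).1, ofReal_integral_eq_lintegral_ofReal (norm_sq_quot hf _ _).2 (ae_of_all _ fun x => sq_nonneg _)]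

lemma sum_inner_deriv_le (hL : LipschitzWith L f) (hf : MemLp f 2) (hcs : HasCompactSupport f) {x x' : Fin N → L2 N}
    (hx : ∀ i, HasDerivAt (fun t : ℝ => tau (t • coordE i) (x i)) (x' i) 0) :
    2 * ⟪hf.toLp f, ∑ i, x' i⟫ ≤ (∫ y, ‖fderiv ℝ f y‖ ^ 2) + ∑ i, ‖x i‖ ^ 2 := by
  obtain ⟨R, hR⟩ := hcs.isCompact.isBounded.subset_closedBall (0 : Eu N)
  have hc := hL.continuous
  have hB : Integrable (fun y => (closedBall (0 : Eu N) (R + 1)).indicator (fun _ => (L : ℝ) ^ 2) y) :=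
    (integrable_indicator_iff measurableSet_closedBall).2 (integrableOn_const (isCompact_closedBall _ _).measure_lt_top.ne)
  have h1 : ∀ i, Tendsto (fun n => ∫ y, ((-stepN n)⁻¹ * (f (y + (-stepN n) • coordE i) - f y)) ^ 2) atTop
      (𝓝 (∫ y, (fderiv ℝ f y (coordE i)) ^ 2)) := by
    intro i
    refine tendsto_integral_of_dominated_convergence _ (fun n => ?_) hB (fun n => ae_of_all _ fun y => ?_) ?_
    · fun_prop
    · have hn := stepN_pos n; have hn1 : stepN n ≤ 1 := by
        unfold stepN; rw [div_le_one (by positivity)]; linarith [n.cast_nonneg (α := ℝ)]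
      have he : ‖(-stepN n) • (coordE i : Eu N)‖ = stepN n := by
        simp [norm_smul, coordE, abs_of_pos hn]
      by_cases hy : y ∈ closedBall (0 : Eu N) (R + 1)
      · rw [indicator_of_mem hy, norm_of_nonneg (sq_nonneg _), sq_le_sq, abs_mul, abs_inv, abs_neg, abs_of_pos hn,
          inv_mul_le_iff₀ hn]
        have := hL.dist_le_mul (y + (-stepN n) • coordE i) y
        rw [dist_eq, dist_eq_norm, add_sub_cancel_left, he] at this; rw [NNReal.abs_eq]; linarith
      · have h0 : ∀ y', R < ‖y'‖ → f y' = 0 := fun y' hy' => by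
          by_contra h
          have := hR (subset_tsupport f h); rw [mem_closedBall_zero_iff] at this; linarith
        rw [mem_closedBall_zero_iff, not_le] at hy
        rw [h0 y (by linarith), h0 (y + (-stepN n) • coordE i) (by
          have := norm_sub_le (y + (-stepN n) • coordE i) ((-stepN n) • coordE i)
          rw [add_sub_cancel_right, he] at this; linarith)]
        simp [Set.indicator_nonneg]
    · filter_upwards [hL.ae_differentiableAt] with y hy; have h := tendsto_quot hy (-coordE i)
      rw [map_neg] at h; simpa [mul_pow, neg_sq] using h.pow 2
  have h2 : ∀ n, 2 * ∑ i, ⟪hf.toLp f, (stepN n)⁻¹ • (tau (stepN n • coordE i) (x i) - x i)⟫ ≤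
      (∑ i, ∫ y, ((-stepN n)⁻¹ * (f (y + (-stepN n) • coordE i) - f y)) ^ 2) + ∑ i, ‖x i‖ ^ 2 := by
    intro n; rw [Finset.mul_sum, ← Finset.sum_add_distrib]
    refine Finset.sum_le_sum fun i _ => ?_; rw [← (norm_sq_quot hf _ _).1]
    have h3 : ⟪hf.toLp f, (stepN n)⁻¹ • (tau (stepN n • coordE i) (x i) - x i)⟫ =
        -⟪(-stepN n)⁻¹ • (tau ((-stepN n) • coordE i) (hf.toLp f) - hf.toLp f), x i⟫ := by
      rw [real_inner_smul_right, real_inner_smul_left, inner_sub_left, inner_sub_right, inner_tau_left, neg_smul, neg_neg, inv_neg]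
      ring
    rw [h3]
    have := abs_real_inner_le_norm ((-stepN n)⁻¹ • (tau ((-stepN n) • coordE i) (hf.toLp f) - hf.toLp f)) (x i)
    nlinarith [neg_abs_le ⟪(-stepN n)⁻¹ • (tau ((-stepN n) • coordE i) (hf.toLp f) - hf.toLp f), x i⟫,
      sq_nonneg (‖(-stepN n)⁻¹ • (tau ((-stepN n) • coordE i) (hf.toLp f) - hf.toLp f)‖ - ‖x i‖)]
  have h4 : Tendsto (fun n => 2 * ∑ i, ⟪hf.toLp f, (stepN n)⁻¹ • (tau (stepN n • coordE i) (x i) - x i)⟫) atTop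
      (𝓝 (2 * ∑ i, ⟪hf.toLp f, x' i⟫)) := by
    refine (tendsto_finset_sum _ fun i _ => ?_).const_mul 2
    have := (hx i).tendsto_slope_zero.comp tendsto_stepN
    refine (tendsto_const_nhds.inner this).congr fun n => ?_; simp [tau_zero]
  rw [inner_sum]
  refine (le_of_tendsto_of_tendsto' h4 ((tendsto_finset_sum _ fun i _ => h1 i).add_const _) h2).trans_eq ?_
  rw [← integral_finset_sum]
  · simp_rw [sum_fderiv_sq]
  · intro i _
    refine hB.mono' ((measurable_fderiv_apply_const ℝ f (coordE i)).pow_const 2).aestronglyMeasurable (ae_of_all _ fun y => ?_)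
    by_cases hy : y ∈ closedBall (0 : Eu N) (R + 1)
    · rw [indicator_of_mem hy, norm_of_nonneg (sq_nonneg _), sq_le_sq, NNReal.abs_eq]
      refine ((fderiv ℝ f y).le_opNorm _).trans ?_
      simpa [coordE] using norm_fderiv_le_of_lipschitz ℝ hL (x₀ := y)
    · have : fderiv ℝ f y = 0 := by
        by_contra h; have h := hR ((tsupport_fderiv_subset ℝ (f := f)) (subset_tsupport _ h))
        exact hy (Metric.closedBall_subset_closedBall (by linarith) h)
      simp [this, hy]

lemma Tame.lipschitz_trunc (hg : Tame L g) (δ : ℝ) : LipschitzWith L fun x => max (g x - δ) 0 :=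
  (LipschitzWith.of_dist_le_mul fun x y => by
    have := hg.lip.dist_le_mul x y; simpa [dist_eq] using this).max_const 0

lemma Tame.hasCompactSupport_trunc (hg : Tame L g) (hδ : 0 < δ) :
    HasCompactSupport fun x => max (g x - δ) 0 := by
  refine HasCompactSupport.of_support_subset_isCompact (hg.isCompact hδ) fun x hx => ?_
  by_contra h
  have h : g x < δ := not_le.1 h
  exact hx (max_eq_right (by linarith))

lemma Tame.integral_fderiv_trunc_le (hg : Tame L g) {δ K : ℝ} (hK0 : 0 ≤ K)
    (hK : ∫⁻ x in {x | δ < g x}, ‖fderiv ℝ g x‖ₑ ^ 2 ≤ ofReal K) :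
    ∫ x, ‖fderiv ℝ (fun x => max (g x - δ) 0) x‖ ^ 2 ≤ K := by
  rw [integral_eq_lintegral_of_nonneg_ae (ae_of_all _ fun x => sq_nonneg _)
    ((measurable_fderiv ℝ _).norm.pow_const 2).aestronglyMeasurable]
  refine ENNReal.toReal_le_of_le_ofReal hK0 (le_trans ?_ hK)
  rw [← lintegral_indicator (hg.meas δ)]
  refine lintegral_mono fun x => ?_
  by_cases hx : δ < g x
  · have h : (fun x => max (g x - δ) 0) =ᶠ[𝓝 x] fun x => g x - δ := by
      filter_upwards [(isOpen_lt continuous_const hg.lip.continuous).mem_nhds hx] with y hy; grind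
    rw [h.fderiv_eq, fderiv_sub_const, indicator_of_mem (show x ∈ {x | δ < g x} from hx),
      ofReal_pow (norm_nonneg _), ofReal_norm]
  · have h : fderiv ℝ (fun x => max (g x - δ) 0) x = 0 := by
      refine IsLocalMin.fderiv_eq_zero (.of_forall fun y => ?_); grind
    simp [h]

lemma SqInt.memLp_trunc (hg : SqInt g) (hδ : 0 < δ) : MemLp (fun x => max (g x - δ) 0) 2 := by
  refine hg.memLp.mono ((hg.meas.sub_const δ).max measurable_const).aestronglyMeasurable (ae_of_all _ fun x => ?_)
  rw [norm_of_nonneg (le_max_right _ _), norm_of_nonneg (hg.nonneg x)]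
  exact max_le (by linarith) (hg.nonneg x)

lemma inner_deriv_le_of_dirichlet (hg : Tame L g) (hq : SqInt g) {K : ℝ} (hK0 : 0 ≤ K)
    (hK : ∀ δ, 0 < δ → ∫⁻ x in {x | δ < g x}, ‖fderiv ℝ g x‖ₑ ^ 2 ≤ ofReal K) {x x' : Fin N → L2 N}
    (hx : ∀ i, HasDerivAt (fun t : ℝ => tau (t • coordE i) (x i)) (x' i) 0) :
    2 * ⟪hq.memLp.toLp g, ∑ i, x' i⟫ ≤ K + ∑ i, ‖x i‖ ^ 2 := by
  have hd : ∀ n, ‖hq.memLp.toLp g - (hq.memLp_trunc (stepN_pos n)).toLp _‖ ^ 2 =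
      ∫ x, (g x - max (g x - stepN n) 0) ^ 2 := fun n => by
    rw [← MemLp.toLp_sub, norm_sq_toLp]; rfl
  have hs : Tendsto stepN atTop (𝓝 0) := tendsto_stepN.mono_right nhdsWithin_le_nhds
  have hlim : Tendsto (fun n => ∫ x, (g x - max (g x - stepN n) 0) ^ 2) atTop (𝓝 (∫ x : Eu N, (0 : ℝ))) := by
    refine tendsto_integral_of_dominated_convergence (fun x => g x ^ 2) (fun n => ?_) hq.memLp.integrable_sq
      (fun n => ae_of_all _ fun x => ?_) (ae_of_all _ fun x => ?_)
    · exact ((hq.meas.sub ((hq.meas.sub_const _).max measurable_const)).pow_const 2).aestronglyMeasurable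
    · have h2 : max (g x - stepN n) 0 ≤ g x := max_le (by linarith [stepN_pos n]) (hq.nonneg x)
      rw [norm_of_nonneg (sq_nonneg _)]
      exact pow_le_pow_left₀ (by linarith) (by linarith [le_max_right (g x - stepN n) 0]) 2
    · have h1 : Tendsto (fun n => (g x - max (g x - stepN n) 0) ^ 2) atTop (𝓝 ((g x - max (g x - 0) 0) ^ 2)) :=
        (tendsto_const_nhds.sub ((tendsto_const_nhds.sub hs).max tendsto_const_nhds)).pow 2
      simpa [max_eq_left (hq.nonneg x)] using h1
  have hW : Tendsto (fun n => (hq.memLp_trunc (stepN_pos n)).toLp _) atTop (𝓝 (hq.memLp.toLp g)) := by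
    rw [tendsto_iff_norm_sub_tendsto_zero]
    have := hlim.sqrt; simp only [integral_zero, Real.sqrt_zero] at this
    refine this.congr fun n => ?_; rw [← hd, sqrt_sq (norm_nonneg _), norm_sub_rev]
  refine le_of_tendsto' ((hW.inner tendsto_const_nhds).const_mul 2) fun n => ?_
  refine (sum_inner_deriv_le (hg.lipschitz_trunc _) (hq.memLp_trunc (stepN_pos n))
    (hg.hasCompactSupport_trunc (stepN_pos n)) hx).trans ?_
  exact add_le_add_left (hg.integral_fderiv_trunc_le hK0 (hK _ (stepN_pos n))) _

/-- The quantitative gain at a fixed height. -/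
lemma defE_le_inner (hN : 2 ≤ N) (hc0 : 0 < c) (hc : IsoQ N c) (hs : 0 < s) (hz : 0 < z) (hf : Tame L f)
    (hq : SqInt f) {u v : L2 N} (hU : hq.memLp.toLp f = convL (poisson N s z) u)
    (hW : MemLp (starE f) 2) {X : ℝ}
    (hX : X = -⟪convL (poisson N s z) u, convL (lapP N s z) u⟫ -
      ⟪convL (poisson N s z) v, convL (lapP N s z) v⟫ + 2 * ⟪hW.toLp _, convL (lapP N s z) v⟫) :
    0 ≤ X ∧ ofReal (isoK N ^ 2) * (ofReal (2 * c) * ∫⁻ t in Ioi 0, ofReal (defE f t)) ≤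
      ofReal X := by
  have hN0 : N ≠ 0 := by lia
  have hDU : ∫⁻ x, ‖fderiv ℝ f x‖ₑ ^ 2 ≤
      ofReal (-⟪convL (poisson N s z) u, convL (lapP N s z) u⟫) := by
    refine (lintegral_fderiv_sq_le hf.lip hq.memLp (w := fun i => -convL (dP s z (coordE i)) u) fun i => ?_).trans_eq ?_
    · rw [hU]; exact hasDerivAt_tau_poisson hs hz _ u
    · simp only [norm_neg, sum_norm_sq_dP hs hz]
  have h1 := (hf.dirichlet_ge hN hc0 hc).trans hDU; rw [mul_add] at h1
  set K := (ofReal (isoK N ^ 2) * ∫⁻ t in Ioi 0, ofReal (kinE f t)).toReal with hKd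
  have hKf : ofReal K = ofReal (isoK N ^ 2) * ∫⁻ t in Ioi 0, ofReal (kinE f t) :=
    ofReal_toReal ((le_self_add.trans h1).trans_lt ofReal_lt_top).ne
  have hK0 : 0 ≤ K := toReal_nonneg
  have hcr := inner_deriv_le_of_dirichlet (hf.tame_starE hN0) (hq.sqInt_starE hN0) hK0
    (fun δ hδ => (hf.dirichlet_starE_le hN0 hδ).trans_eq hKf.symm)
    (fun i => hasDerivAt_tau_dP hs hz (coordE i) v)
  rw [Finset.sum_neg_distrib, ← convL_lapP hs hz, inner_neg_right, sum_norm_sq_dP hs hz] at hcr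
  rw [← hKf] at h1; have hdU : 0 ≤ -⟪convL (poisson N s z) u, convL (lapP N s z) u⟫ := by
    rw [← sum_norm_sq_dP hs hz]; positivity
  have hKU : K ≤ -⟪convL (poisson N s z) u, convL (lapP N s z) u⟫ :=
    (ofReal_le_ofReal_iff hdU).1 (le_self_add.trans h1)
  have hle : -⟪convL (poisson N s z) u, convL (lapP N s z) u⟫ - K ≤ X := by rw [hX]; linarith
  refine ⟨(sub_nonneg.2 hKU).trans hle, le_trans ?_ (ofReal_le_ofReal hle)⟩
  rw [ofReal_sub _ hK0]; exact ENNReal.le_sub_of_add_le_left ofReal_ne_top h1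

variable {u v : L2 N}

/-- The real-valued Gagliardo energy. -/
def gagR (s : ℝ) (v : L2 N) : ℝ := ∫ y, ‖tau y v - v‖ ^ 2 / ‖y‖ ^ (N + 2 * s)

lemma gag_nonneg (v : L2 N) (y : Eu N) : 0 ≤ ‖tau y v - v‖ ^ 2 / ‖y‖ ^ (N + 2 * s) :=
  div_nonneg (sq_nonneg _) (rpow_nonneg (norm_nonneg _) _)

lemma measurable_gag (v : L2 N) : Measurable fun y : Eu N => ‖tau y v - v‖ ^ 2 / ‖y‖ ^ (N + 2 * s) :=
  ((((continuous_tau v).sub continuous_const).norm.pow 2).measurable).div (measurable_norm.pow_const _)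

lemma integrable_gag (h : gagL s v ≠ ⊤) :
    Integrable fun y => ‖tau y v - v‖ ^ 2 / ‖y‖ ^ (N + 2 * s) :=
  (lintegral_ofReal_ne_top_iff_integrable (measurable_gag v).aestronglyMeasurable
    (ae_of_all _ (gag_nonneg v))).1 h

lemma gagL_eq (h : gagL s v ≠ ⊤) : gagL s v = ofReal (gagR s v) :=
  (ofReal_integral_eq_lintegral_ofReal (integrable_gag h) (ae_of_all _ (gag_nonneg v))).symm

lemma gagR_nonneg : 0 ≤ gagR s v := integral_nonneg (gag_nonneg v)

lemma integrable_mul_gag {k : Eu N → ℝ} {m : ℕ} (hk : Integrable k) (v : L2 N) :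
    Integrable fun y => k y * ‖tau y v - v‖ ^ m := by
  refine hk.smul_bounded (((continuous_tau v).sub continuous_const).norm.pow m) (B := (‖v‖ + ‖v‖) ^ m) fun y => ?_
  rw [norm_pow, norm_norm]
  exact pow_le_pow_left₀ (norm_nonneg _) ((norm_sub_le _ _).trans_eq (by rw [(tau y).norm_map])) m

lemma qK_le (hs : 0 < s) (hy : y ≠ 0) : qK (pE N s) z y ≤ (‖y‖ ^ (N + 2 * s))⁻¹ := by
  have h : (‖y‖ ^ (N + 2 * s))⁻¹ = (‖y‖ ^ 2) ^ (-pE N s) := by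
    rw [← rpow_natCast, ← rpow_mul (norm_nonneg _), ← rpow_neg (norm_nonneg _), pE]
    congr 1; push_cast; ring
  rw [h]
  exact Real.rpow_le_rpow_of_nonpos (by positivity) (by nlinarith [sq_nonneg z]) (by linarith [pE_pos (N := N) hs])

lemma qK_mul_le (hs : 0 < s) (y : Eu N) :
    qK (pE N s) z y * ‖tau y v - v‖ ^ 2 ≤ ‖tau y v - v‖ ^ 2 / ‖y‖ ^ (N + 2 * s) := by
  obtain rfl | hy := eq_or_ne y 0
  · simp [tau_zero]
  · rw [div_eq_mul_inv, mul_comm]; gcongr; exact qK_le hs hy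

lemma convL_sub_eq {k : Eu N → ℝ} (hk : Integrable k) (v : L2 N) :
    convL k v - (∫ y, k y) • v = ∫ y, k y • (tau y v - v) := by
  rw [convL, ← integral_smul_const, ← integral_sub (integrable_smul_tau hk v) (hk.smul_const v)]
  simp only [smul_sub]

/-- The rate at which the extension attains its boundary values. -/
lemma norm_convL_poisson_sub_le (hs : 0 < s) (hz : 0 < z) (h : gagL s v ≠ ⊤) :
    ‖convL (poisson N s z) v - v‖ ≤ √(betaC N s * gagR s v) * z ^ s := by
  have hb := betaC_pos (N := N) hs
  have hP := integrable_poisson (N := N) hs hz; have e := convL_sub_eq hP v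
  rw [integral_poisson hs hz, one_smul] at e; have hm := integrable_mul_gag (m := 1) hP v
  have hq := integrable_mul_gag (m := 2) hP v; simp only [pow_one] at hm
  set m := ∫ y, poisson N s z y * ‖tau y v - v‖; have h1 : ‖convL (poisson N s z) v - v‖ ≤ m := by
    rw [e]
    refine (norm_integral_le_integral_norm _).trans_eq (integral_congr_ae (ae_of_all _ fun y => ?_))
    simp [norm_smul, abs_of_pos (poisson_pos hs hz y)]
  have h2 : m ^ 2 ≤ ∫ y, poisson N s z y * ‖tau y v - v‖ ^ 2 := by
    have h0 : 0 ≤ ∫ y, poisson N s z y * (‖tau y v - v‖ - m) ^ 2 :=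
      integral_nonneg fun y => mul_nonneg (poisson_pos hs hz y).le (sq_nonneg _)
    have h3 : (fun y => poisson N s z y * (‖tau y v - v‖ - m) ^ 2) = fun y =>
        (poisson N s z y * ‖tau y v - v‖ ^ 2 - 2 * m * (poisson N s z y * ‖tau y v - v‖)) +
          m ^ 2 * poisson N s z y := by
      ext y; ring
    have hd : Integrable fun y => poisson N s z y * ‖tau y v - v‖ ^ 2 - 2 * m * (poisson N s z y * ‖tau y v - v‖) :=
      hq.sub (hm.const_mul _)
    rw [h3, integral_add hd (hP.const_mul _), integral_sub hq (hm.const_mul _),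
      integral_const_mul, integral_const_mul, integral_poisson hs hz] at h0
    linarith
  have h4 : ∫ y, poisson N s z y * ‖tau y v - v‖ ^ 2 ≤ betaC N s * z ^ (2 * s) * gagR s v := by
    rw [gagR, ← integral_const_mul]
    refine integral_mono hq ((integrable_gag h).const_mul _) fun y => ?_
    simp only [poisson_eq, mul_assoc]; gcongr; exact qK_mul_le hs y
  refine h1.trans ((le_abs_self m).trans (abs_le_of_sq_le_sq ?_ (by positivity)))
  rw [mul_pow, sq_sqrt (mul_nonneg hb.le gagR_nonneg), ← Real.rpow_mul_natCast hz.le]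
  refine (h2.trans h4).trans_eq ?_; rw [mul_comm s]; push_cast; ring

lemma tendsto_convL_gK (hs : 0 < s) (h : gagL s v ≠ ⊤) :
    Tendsto (fun z => z ^ s * ‖convL (gK N s z) v‖) (𝓝[>] 0) (𝓝 0) := by
  have hb := betaC_pos (N := N) hs
  have hp := pE_pos (N := N) hs
  have hz0 : ∀ {a : ℝ}, 0 < a → Tendsto (fun z : ℝ => z ^ a) (𝓝[>] 0) (𝓝 0) := fun {a} ha => by
    simpa [zero_rpow ha.ne'] using
      ((Real.continuousAt_rpow_const 0 a (Or.inr ha.le)).tendsto).mono_left nhdsWithin_le_nhds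
  set c := betaC N s * (2 * s + 2 * pE N s)
  have hc : 0 < c := by positivity
  have hT : ∀ ε > 0, Tendsto (fun z => ∫ y : Eu N, max 0 (z ^ s * (qK (pE N s) z y * ‖tau y v - v‖) -
      ε / 2 * (z ^ (2 * s) * qK (pE N s) z y))) (𝓝[>] 0) (𝓝 0) := fun ε hε => by
    refine LE.le.trans_eq (b := 𝓝 (∫ _ : Eu N, (0 : ℝ))) ?_ (by rw [integral_zero])
    refine tendsto_integral_filter_of_dominated_convergence
      (fun y => 1 / (2 * ε) * (‖tau y v - v‖ ^ 2 / ‖y‖ ^ (N + 2 * s))) ?_ ?_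
      ((integrable_gag h).const_mul _) ?_
    · filter_upwards [self_mem_nhdsWithin] with z hz
      exact (continuous_const.max ((continuous_const.mul ((continuous_qK hz).mul
        ((continuous_tau v).sub continuous_const).norm)).sub
          (continuous_const.mul (continuous_const.mul (continuous_qK hz))))).aestronglyMeasurable
    · filter_upwards [self_mem_nhdsWithin] with z hz
      refine ae_of_all _ fun y => ?_; rw [norm_of_nonneg (le_max_left _ _)]
      refine max_le (mul_nonneg (by positivity) (gag_nonneg v y)) ((le_trans ?_
        (mul_le_mul_of_nonneg_left (qK_mul_le (v := v) (z := z) hs y) (by positivity))))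
      have e : z ^ (2 * s) = (z ^ s) ^ 2 := by
        rw [← Real.rpow_mul_natCast (le_of_lt hz), mul_comm s]; norm_cast
      have h5 : 0 ≤ (ε * z ^ s - ‖tau y v - v‖) ^ 2 / (2 * ε) := by positivity
      have h6 : (ε * z ^ s - ‖tau y v - v‖) ^ 2 / (2 * ε) =
          ε / 2 * (z ^ s) ^ 2 - z ^ s * ‖tau y v - v‖ + 1 / (2 * ε) * ‖tau y v - v‖ ^ 2 := by
        field_simp; ring
      rw [e]; nlinarith [mul_nonneg ((qK_pos (a := pE N s) (N := N) hz y).le) (h6 ▸ h5)]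
    · refine ae_of_all _ fun y => ?_; obtain rfl | hy := eq_or_ne y 0
      · refine tendsto_nhds_of_eventually_eq ?_; filter_upwards [self_mem_nhdsWithin] with z hz
        have hq := (qK_pos (a := pE N s) (N := N) hz 0).le
        have := rpow_nonneg (le_of_lt hz) (2 * s); rw [tau_zero, sub_self, norm_zero]
        exact max_eq_left (by nlinarith [mul_nonneg (mul_nonneg hε.le this) hq])
      · refine squeeze_zero' (g := fun z => z ^ s * ((‖y‖ ^ (N + 2 * s))⁻¹ * ‖tau y v - v‖))
          (.of_forall fun z => le_max_left _ _) ?_ (by simpa using (hz0 hs).mul_const _)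
        filter_upwards [self_mem_nhdsWithin] with z hz
        have hzs := rpow_nonneg (le_of_lt hz) s; have := rpow_nonneg (le_of_lt hz) (2 * s)
        have hq := (qK_pos (a := pE N s) (N := N) hz y).le; have h7 := mul_le_mul_of_nonneg_left
          (mul_le_mul_of_nonneg_right (qK_le (z := z) hs hy) (norm_nonneg (tau y v - v))) hzs
        exact max_le (by positivity) (by nlinarith [mul_nonneg (mul_nonneg hε.le this) hq])
  have hmain : ∀ z > 0, ∀ ε > 0, z ^ s * ‖convL (gK N s z) v‖ ≤ c * (ε / 2 * (betaC N s)⁻¹ +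
      ∫ y : Eu N, max 0 (z ^ s * (qK (pE N s) z y * ‖tau y v - v‖) -
        ε / 2 * (z ^ (2 * s) * qK (pE N s) z y))) := fun z hz ε hε => by
    have e := convL_sub_eq (integrable_gK (N := N) hs hz) v
    rw [integral_gK hs hz, zero_smul, sub_zero] at e; have hq := integrable_qK (N := N) hs hz
    have hm := integrable_mul_gag (m := 1) hq v; simp only [pow_one] at hm
    have h1 : ‖convL (gK N s z) v‖ ≤ ∫ y, c * (qK (pE N s) z y * ‖tau y v - v‖) := by
      rw [e]; refine norm_integral_le_of_norm_le (hm.const_mul _) (ae_of_all _ fun y => ?_)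
      rw [norm_smul, ← mul_assoc]; gcongr; exact abs_gK_le hs hz y
    have h2 : ε / 2 * (betaC N s)⁻¹ = ∫ y : Eu N, ε / 2 * (z ^ (2 * s) * qK (pE N s) z y) := by
      rw [integral_const_mul, integral_const_mul, integral_qK hz, ← mul_assoc (z ^ _), ← rpow_add hz]
      simp
    have i1 := (hm.const_mul (z ^ s)); have i2 := ((hq.const_mul (z ^ (2 * s))).const_mul (ε / 2))
    have i3 : Integrable fun y : Eu N => max 0 (z ^ s * (qK (pE N s) z y * ‖tau y v - v‖) -
        ε / 2 * (z ^ (2 * s) * qK (pE N s) z y)) := (integrable_zero (Eu N) ℝ volume).sup (i1.sub i2)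
    rw [h2, ← integral_add i2 i3]
    refine (mul_le_mul_of_nonneg_left h1 (rpow_nonneg hz.le _)).trans ?_
    rw [integral_const_mul, mul_left_comm, ← integral_const_mul (z ^ s)]
    refine mul_le_mul_of_nonneg_left (integral_mono i1 (i2.add i3) fun y => ?_) hc.le
    have := le_max_right 0 (z ^ s * (qK (pE N s) z y * ‖tau y v - v‖) - ε / 2 * (z ^ (2 * s) * qK (pE N s) z y))
    simp only [Pi.add_apply]; linarith
  rw [Metric.tendsto_nhds]
  intro δ hδ
  have hε : 0 < δ * betaC N s / c := by positivity
  filter_upwards [self_mem_nhdsWithin, (hT _ hε).eventually (gt_mem_nhds (show 0 < δ / (2 * c) by positivity))]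
    with z hz h3
  rw [Real.dist_0_eq_abs, abs_of_nonneg (mul_nonneg (rpow_nonneg (le_of_lt hz) _) (norm_nonneg _))]
  refine (hmain z hz _ hε).trans_lt ((mul_lt_mul_of_pos_left (add_lt_add_right h3 _) hc).trans_eq ?_)
  field_simp
  norm_num

lemma neg_inner_convL_gK (hs : 0 < s) (hz : 0 < z) (v : L2 N) :
    -⟪v, convL (gK N s z) v⟫ = (∫ y, gK N s z y * ‖tau y v - v‖ ^ 2) / 2 := by
  have hg := integrable_gK (N := N) hs hz
  have h1 : ∀ y, gK N s z y * ⟪v, tau y v⟫ = gK N s z y * ‖v‖ ^ 2 - gK N s z y * ‖tau y v - v‖ ^ 2 / 2 := fun y => by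
    rw [norm_sub_sq_real, (tau y).norm_map, real_inner_comm v]; ring
  rw [inner_convL hg, integral_congr_ae (ae_of_all _ h1),
    integral_sub (hg.mul_const _) ((integrable_mul_gag hg v).div_const _), integral_mul_const, integral_gK hs hz,
    integral_div]
  ring

lemma gK_mul_le (hs : 0 < s) (hz : 0 < z) (y : Eu N) :
    gK N s z y * ‖tau y v - v‖ ^ 2 ≤ 2 * s * betaC N s * (‖tau y v - v‖ ^ 2 / ‖y‖ ^ (N + 2 * s)) := by
  have hb := betaC_pos (N := N) hs
  have hp := pE_pos (N := N) hs
  refine le_trans ?_ (mul_le_mul_of_nonneg_left (qK_mul_le (z := z) hs y) (by positivity))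
  rw [← mul_assoc, gK]
  have := (qK_pos (a := pE N s + 1) hz y).le
  have h1 : 0 ≤ betaC N s * (2 * pE N s * (z ^ 2 * qK (pE N s + 1) z y)) := by positivity
  exact mul_le_mul_of_nonneg_right (by linarith) (sq_nonneg _)

lemma neg_inner_convL_gK_le (hs : 0 < s) (hz : 0 < z) (h : gagL s v ≠ ⊤) :
    -⟪v, convL (gK N s z) v⟫ ≤ s * betaC N s * gagR s v := by
  have := integral_mono (integrable_mul_gag (integrable_gK hs hz) v)
    ((integrable_gag h).const_mul (2 * s * betaC N s)) fun y => gK_mul_le hs hz y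
  rw [integral_const_mul] at this
  rw [neg_inner_convL_gK hs hz, gagR]
  linarith

lemma tendsto_neg_inner_convL_gK (hs : 0 < s) (h : gagL s v ≠ ⊤) :
    Tendsto (fun z => -⟪v, convL (gK N s z) v⟫) (𝓝[>] 0) (𝓝 (s * betaC N s * gagR s v)) := by
  have hb := betaC_pos (N := N) hs
  have hp := pE_pos (N := N) hs
  have h1 : Tendsto (fun z => ∫ y, gK N s z y * ‖tau y v - v‖ ^ 2) (𝓝[>] 0)
      (𝓝 (∫ y, 2 * s * betaC N s * (‖tau y v - v‖ ^ 2 / ‖y‖ ^ (N + 2 * s)))) := by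
    refine tendsto_integral_filter_of_dominated_convergence
      (fun y => betaC N s * (2 * s + 2 * pE N s) * (‖tau y v - v‖ ^ 2 / ‖y‖ ^ (N + 2 * s))) ?_ ?_
      ((integrable_gag h).const_mul _) ?_
    · filter_upwards [self_mem_nhdsWithin] with z hz
      exact (integrable_mul_gag (integrable_gK hs hz) v).aestronglyMeasurable
    · filter_upwards [self_mem_nhdsWithin] with z hz
      refine ae_of_all _ fun y => ?_; rw [norm_mul, norm_pow, norm_norm]
      refine (mul_le_mul_of_nonneg_right (abs_gK_le hs hz y) (sq_nonneg _)).trans ?_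
      rw [mul_assoc _ (qK _ _ _)]; gcongr; exact qK_mul_le hs y
    · refine ae_of_all _ fun y => ?_; obtain rfl | hy := eq_or_ne y 0
      · simp [tau_zero]
      · have hy' := norm_pos_iff.2 hy
        have hc : ContinuousAt (fun z => gK N s z y * ‖tau y v - v‖ ^ 2) 0 := by
          unfold gK qK
          fun_prop (disch := first | exact Or.inl (by positivity : (0 : ℝ) ^ 2 + ‖y‖ ^ 2 ≠ 0))
        convert (hc.tendsto.mono_left (nhdsWithin_le_nhds (s := Ioi 0))) using 2
        have h4 : (‖y‖ ^ 2) ^ (-pE N s) = (‖y‖ ^ (N + 2 * s))⁻¹ := by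
          rw [← rpow_natCast, ← rpow_mul hy'.le, ← rpow_neg hy'.le, pE]; congr 1; push_cast; ring
        simp only [gK, qK, ne_eq, OfNat.ofNat_ne_zero, not_false_eq_true, zero_pow, zero_add, zero_mul, mul_zero,
          sub_zero, h4]
        ring
  rw [integral_const_mul] at h1
  refine ((h1.div_const 2).congr' ?_).trans_eq ?_
  · filter_upwards [self_mem_nhdsWithin] with z hz; rw [neg_inner_convL_gK hs hz]
  · rw [gagR]; congr 1; ring

/-- Finiteness of the energy under a Lipschitz bound on translations. -/
lemma gagL_ne_top (hN : N ≠ 0) (hs0 : 0 < s) (hs1 : s < 1) {M : ℝ} (h : ∀ y, ‖tau y v - v‖ ≤ M * ‖y‖) :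
    gagL s v ≠ ⊤ := by
  have : Nonempty (Fin N) := ⟨⟨0, Nat.pos_of_ne_zero hN⟩⟩
  have e : ∀ {y : ℝ} (k : ℝ), 0 < y → y ^ (N - 1) * (y ^ k / y ^ (N + 2 * s)) = y ^ (k - 1 - 2 * s) :=
    fun {y} k hy => by
      rw [← rpow_natCast, ← rpow_sub hy, ← rpow_add hy, Nat.cast_sub (Nat.pos_of_ne_zero hN)]
      congr 1; push_cast; ring
  have h1 : IntegrableOn (fun y : ℝ => y ^ (N - 1) • (min (y ^ (2 : ℝ)) (y ^ (0 : ℝ)) / y ^ (N + 2 * s)))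
      (Ioi 0) := by
    rw [← Set.Ioc_union_Ioi_eq_Ioi zero_le_one]; refine IntegrableOn.union ?_ ?_
    · have := (intervalIntegral.intervalIntegrable_rpow' (a := 0) (b := 1) (r := 2 - 1 - 2 * s) (by linarith)).1
      refine this.congr_fun (fun y hy => ?_) measurableSet_Ioc; dsimp only
      rw [min_eq_left (by rw [rpow_zero]; exact rpow_le_one hy.1.le hy.2 zero_le_two), smul_eq_mul,
        e 2 hy.1]
    · refine (integrableOn_Ioi_rpow_of_lt (a := 0 - 1 - 2 * s) (by linarith) one_pos).congr_fun
        (fun y hy => ?_) measurableSet_Ioi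
      have hy : 1 < y := hy; dsimp only
      rw [min_eq_right (by rw [rpow_zero]; exact Real.one_le_rpow hy.le zero_le_two), smul_eq_mul,
        e 0 (one_pos.trans hy)]
  have h2 := (integrable_fun_norm_addHaar (volume : Measure (Eu N))
    (f := fun y : ℝ => min (y ^ (2 : ℝ)) (y ^ (0 : ℝ)) / y ^ (N + 2 * s))).2 (by simpa using h1)
  refine (lintegral_ofReal_ne_top_iff_integrable (measurable_gag v).aestronglyMeasurable
    (ae_of_all _ (gag_nonneg v))).2 ((h2.const_mul (M ^ 2 + (‖v‖ + ‖v‖) ^ 2)).mono'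
      (measurable_gag v).aestronglyMeasurable (ae_of_all _ fun y => ?_))
  rw [norm_of_nonneg (gag_nonneg v y), ← mul_div_assoc]
  refine div_le_div_of_nonneg_right ?_ (rpow_nonneg (norm_nonneg _) _)
  rw [rpow_zero, rpow_two]; have a1 := pow_le_pow_left₀ (norm_nonneg _) (h y) 2
  have a2 := pow_le_pow_left₀ (norm_nonneg _) ((norm_sub_le (tau y v) v).trans_eq (by rw [(tau y).norm_map])) 2
  obtain hm | hm := min_choice (‖y‖ ^ 2) 1
  · nlinarith
  · rw [hm]; nlinarith [sq_nonneg M]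

lemma gagL_convL_poisson_ne_top (hN : N ≠ 0) (hs0 : 0 < s) (hs1 : s < 1) (hz : 0 < z) (v : L2 N) :
    gagL s (convL (poisson N s z) v) ≠ ⊤ := by
  have hb := betaC_pos (N := N) hs0
  have hp := pE_pos (N := N) hs0
  set w := convL (poisson N s z) v
  have hd : ∀ (e : Eu N) (t : ℝ), HasDerivAt (fun t : ℝ => tau (t • e) w) (tau (t • e) (-convL (dP s z e) v)) t := by
    intro e t; have h0 := hasDerivAt_tau_poisson hs0 hz e v; rw [← sub_self t] at h0
    have h1 := ((tau (t • e)).toContinuousLinearMap.hasFDerivAt).comp_hasDerivAt t (h0.comp_sub_const t t)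
    refine h1.congr_of_eventuallyEq (.of_forall fun r => ?_)
    simp only [comp, LinearIsometry.coe_toContinuousLinearMap]
    rw [tau_tau, ← add_smul, add_sub_cancel]
  refine gagL_ne_top hN hs0 hs1 (M := betaC N s * z ^ (2 * s) * (2 * pE N s * z⁻¹) *
    (∫ x : Eu N, qK (pE N s) z x) * ‖v‖) fun y => ?_
  have h1 := norm_image_sub_le_of_norm_deriv_le_segment_01' (C := ‖convL (dP s z y) v‖)
    (fun t _ => (hd y t).hasDerivWithinAt) (fun t _ => by rw [(tau _).norm_map, norm_neg])
  rw [one_smul, zero_smul, tau_zero] at h1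
  refine (h1.trans (norm_convL_le (integrable_dP hs0 hz y) v)).trans ?_
  have h2 : ∫ x, |dP s z y x| ≤ ∫ x : Eu N, betaC N s * z ^ (2 * s) * (2 * pE N s * (‖y‖ * z⁻¹)) * qK (pE N s) z x :=
    integral_mono (integrable_dP hs0 hz y).abs ((integrable_qK hs0 hz).const_mul _) (abs_dP_le hs0 hz y)
  rw [integral_const_mul] at h2
  refine (mul_le_mul_of_nonneg_right h2 (norm_nonneg _)).trans_eq ?_
  ring

/-- Poisson extensions converge to their boundary values. -/
lemma tendsto_convL_poisson (hs : 0 < s) (v : L2 N) :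
    Tendsto (fun n => convL (poisson N s (stepN n)) v) atTop (𝓝 v) := by
  have hP := integrable_poisson (N := N) hs one_pos
  have hst : Tendsto stepN atTop (𝓝 0) := tendsto_stepN.mono_right nhdsWithin_le_nhds
  have h1 : ∀ n, convL (poisson N s (stepN n)) v = ∫ y, poisson N s 1 y • tau (stepN n • y) v := fun n => by
    have hz := stepN_pos n
    set z := stepN n; have := Measure.integral_comp_inv_smul_of_nonneg (volume : Measure (Eu N))
      (fun y => poisson N s 1 y • tau (z • y) v) hz.le
    rw [← inv_smul_smul₀ (pow_ne_zero (Module.finrank ℝ (Eu N)) hz.ne') (∫ y, poisson N s 1 y • tau (z • y) v),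
      ← this, ← integral_smul]
    refine integral_congr_ae (ae_of_all _ fun y => ?_)
    simp only [smul_inv_smul₀ hz.ne', smul_smul, poisson_eq]
    rw [qK_scale hz y, finrank_euclideanSpace_fin]
    congr 1; rw [show z ^ (-(2 * pE N s)) = (z ^ N)⁻¹ * (z ^ (2 * s))⁻¹ by
      rw [← rpow_natCast, ← rpow_neg hz.le, ← rpow_neg hz.le, ← rpow_add hz, pE]; congr 1; ring]
    have := rpow_pos_of_pos hz (2 * s); simp only [one_rpow]; field_simp
  simp only [h1]; have h2 : v = ∫ y : Eu N, poisson N s 1 y • v := by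
    rw [integral_smul_const, integral_poisson hs one_pos, one_smul]
  conv => enter [3, 1]; rw [h2]
  refine tendsto_integral_of_dominated_convergence (fun y => poisson N s 1 y * ‖v‖) (fun n => ?_)
    (hP.mul_const _) (fun n => ae_of_all _ fun y => ?_) (ae_of_all _ fun y => ?_)
  · exact hP.aestronglyMeasurable.smul ((continuous_tau v).comp (continuous_const_smul _)).aestronglyMeasurable
  · rw [norm_smul, (tau _).norm_map, norm_of_nonneg (poisson_pos hs one_pos y).le]
  · have h4 := ((continuous_tau v).tendsto _).comp (hst.smul_const y)
    rw [zero_smul, tau_zero] at h4; exact h4.const_smul _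

/-- Lower semicontinuity of the energy. -/
lemma gagL_le_of_tendsto {w : ℕ → L2 N} {B : ℝ≥0∞} (h : Tendsto w atTop (𝓝 v)) (hB : ∀ n, gagL s (w n) ≤ B) :
    gagL s v ≤ B := by
  have h1 : gagL s v = ∫⁻ y, liminf (fun n =>
      ofReal (‖tau y (w n) - w n‖ ^ 2 / ‖y‖ ^ (N + 2 * s))) atTop := by
    refine lintegral_congr fun y => (Tendsto.liminf_eq ?_).symm
    exact tendsto_ofReal ((((((tau y).continuous.tendsto v).comp h).sub h).norm.pow 2).div_const _)
  rw [h1]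
  refine (lintegral_liminf_le (u := atTop) fun n => (measurable_gag (w n)).ennreal_ofReal).trans ?_
  exact (liminf_le_liminf (.of_forall hB)).trans_eq (liminf_const _)

lemma abs_inner_convL_gK_le (hs : 0 < s) (hz : 0 < z) (Y v : L2 N) :
    |⟪Y, convL (gK N s z) v⟫| ≤ (2 * s + 2 * pE N s) * z ^ (-(2 * s)) * (‖Y‖ * ‖v‖) := by
  have hb := betaC_pos (N := N) hs
  have h1 := integral_mono (integrable_gK hs hz).abs ((integrable_qK (N := N) hs hz).const_mul _) (abs_gK_le hs hz)
  rw [integral_const_mul, integral_qK hz] at h1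
  refine (abs_real_inner_le_norm _ _).trans ?_
  refine (mul_le_mul_of_nonneg_left ((norm_convL_le (integrable_gK hs hz) v).trans
    (mul_le_mul_of_nonneg_right h1 (norm_nonneg _))) (norm_nonneg _)).trans_eq ?_
  field_simp

/-- Integration over the extension variable of the gain at fixed heights. -/
lemma lintegral_gain_le (hN : N ≠ 0) (hs0 : 0 < s) (hs1 : s < 1) {ε : ℝ} (hε : 0 < ε) {w : L2 N} (hu : gagL s u ≠ ⊤)
    (hv : v = convL (poisson N s ε) w) {v' : L2 N} (hv' : v' = convL (poisson N s ε) v) {W : ℝ → L2 N}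
    (hW : ∀ z > 0, ∀ y > 0, ‖W z - W y‖ ≤ ‖convL (poisson N s z) u - convL (poisson N s y) u‖)
    (hW0 : ∀ z > 0, ‖W z - w‖ ≤ ‖convL (poisson N s z) u - u‖) (hWn : ∀ z > 0, ‖W z‖ ≤ ‖u‖)
    {A : ℝ → ℝ≥0∞} {X : ℝ → ℝ}
    (hX : ∀ z > 0, X z = -⟪convL (poisson N s z) u, convL (lapP N s z) u⟫ -
      ⟪convL (poisson N s z) v', convL (lapP N s z) v'⟫ + 2 * ⟪W z, convL (lapP N s z) v'⟫)
    (hA : ∀ z > 0, 0 ≤ X z ∧ A z ≤ ofReal (X z)) :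
    gagR s v ≤ gagR s u ∧ ∫⁻ z in Ioi 0, ofReal (z ^ (1 - 2 * s)) * A z ≤
      ofReal (s * betaC N s * (gagR s u - gagR s v)) := by
  have hb := betaC_pos (N := N) hs0; have hp := pE_pos (N := N) hs0
  have hvt : gagL s v ≠ ⊤ := hv ▸ gagL_convL_poisson_ne_top hN hs0 hs1 hε w
  have hvt' : gagL s v' ≠ ⊤ := hv' ▸ gagL_convL_poisson_ne_top hN hs0 hs1 hε v
  have hPi := integrable_poisson (N := N) hs0 hε; have hvv : gagR s v' ≤ gagR s v := by
    rw [← ofReal_le_ofReal_iff gagR_nonneg, ← gagL_eq hvt, ← gagL_eq hvt', hv']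
    refine gagL_convL_le hPi (le_of_eq ?_) v
    simp only [abs_of_pos (poisson_pos hs0 hε _), integral_poisson hs0 hε]
  set U : ℝ → L2 N := fun z => convL (poisson N s z) u with hU
  set V : ℝ → L2 N := fun z => convL (poisson N s z) v' with hV
  set gu : ℝ → L2 N := fun z => convL (gK N s z) u
  set gv : ℝ → L2 N := fun z => convL (gK N s z) v'
  have dU : ∀ z > 0, HasDerivAt U (z ^ (2 * s - 1) • gu z) z := fun z hz => hasDerivAt_convL_poisson hs0 hz u
  have dV : ∀ z > 0, HasDerivAt V (z ^ (2 * s - 1) • gv z) z := fun z hz => hasDerivAt_convL_poisson hs0 hz v'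
  have du : ∀ z > 0, HasDerivAt gu (-(z ^ (1 - 2 * s) • convL (lapP N s z) u)) z := fun z hz =>
    hasDerivAt_convL_gK hs0 hz u
  have dv : ∀ z > 0, HasDerivAt gv (-(z ^ (1 - 2 * s) • convL (lapP N s z) v')) z := fun z hz =>
    hasDerivAt_convL_gK hs0 hz v'
  set G : ℝ → ℝ := fun z => -⟪U z, gu z⟫ - ⟪V z, gv z⟫ + 2 * ⟪W z, gv z⟫ with hG
  have hsl : ∀ z > 0, ∃ φ : ℝ → ℝ, ∃ l ≤ -(z ^ (1 - 2 * s) * X z), Tendsto φ (𝓝[>] z) (𝓝 l) ∧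
      ∀ y > z, slope G z y ≤ φ y := by
    intro z hz
    have da := ((((dU z hz).inner ℝ (du z hz)).neg.sub ((dV z hz).inner ℝ (dv z hz))).add
      (((hasDerivAt_const z (W z)).inner ℝ (dv z hz)).const_mul 2))
    refine ⟨fun y => slope (fun z' => -⟪U z', gu z'⟫ - ⟪V z', gv z'⟫ + 2 * ⟪W z, gv z'⟫) z y +
      2 * (‖slope U z y‖ * ‖gv y‖), _, ?_, (((hasDerivAt_iff_tendsto_slope.1 da).mono_left
        (nhdsWithin_mono z fun y hy => ne_of_gt hy)).add
        ((((hasDerivAt_iff_tendsto_slope.1 (dU z hz)).mono_left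
          (nhdsWithin_mono z fun y hy => ne_of_gt hy)).norm.mul
          ((dv z hz).continuousAt.tendsto.mono_left nhdsWithin_le_nhds).norm).const_mul 2)), ?_⟩
    · rw [hX z hz]; have := rpow_nonneg hz.le (2 * s - 1)
      simp only [inner_neg_right, inner_smul_right, inner_smul_left, inner_zero_left, norm_smul,
        norm_of_nonneg this, real_inner_self_eq_norm_sq, RCLike.conj_to_real]
      nlinarith [mul_nonneg this (sq_nonneg (‖gu z‖ - ‖gv z‖))]
    · intro y hy; have hy0 : 0 < y - z := sub_pos.2 hy
      have h1 : ⟪W y - W z, gv y⟫ ≤ ‖U y - U z‖ * ‖gv y‖ := (real_inner_le_norm _ _).trans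
        (mul_le_mul_of_nonneg_right (hW y (hz.trans hy) z hz) (norm_nonneg _))
      rw [inner_sub_left] at h1
      simp only [slope_def_module, norm_smul, norm_inv, norm_of_nonneg hy0.le, hG, smul_eq_mul, inv_mul_eq_div]
      rw [div_mul_eq_mul_div, ← mul_div_assoc, ← add_div]
      exact div_le_div_of_nonneg_right (by linarith) hy0.le
  have hXn : ∀ z > 0, 0 ≤ z ^ (1 - 2 * s) * X z := fun z hz =>
    mul_nonneg (rpow_nonneg (le_of_lt hz) _) (hA z hz).1
  have hWc : ContinuousOn W (Ioi 0) := fun z hz => by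
    rw [ContinuousWithinAt, tendsto_iff_norm_sub_tendsto_zero]
    refine squeeze_zero' (.of_forall fun _ => norm_nonneg _) (eventually_mem_nhdsWithin.mono
      fun y hy => hW y hy z hz) ?_
    rw [← tendsto_iff_norm_sub_tendsto_zero]; exact (dU z hz).continuousAt.continuousWithinAt
  have hGc : ContinuousOn G (Ioi 0) := by
    have c1 : ContinuousOn U (Ioi 0) := fun z hz => (dU z hz).continuousAt.continuousWithinAt
    have c2 : ContinuousOn V (Ioi 0) := fun z hz => (dV z hz).continuousAt.continuousWithinAt
    have c3 : ContinuousOn gu (Ioi 0) := fun z hz => (du z hz).continuousAt.continuousWithinAt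
    have c4 : ContinuousOn gv (Ioi 0) := fun z hz => (dv z hz).continuousAt.continuousWithinAt
    exact ((c1.inner c3).neg.sub (c2.inner c4)).add ((hWc.inner c4).const_mul 2)
  have hGa : AntitoneOn G (Ioi 0) := by
    intro a ha b _ hab
    refine image_le_of_liminf_slope_right_le_deriv_boundary (B := fun _ => G a) (B' := fun _ => 0)
      (hGc.mono fun y hy => lt_of_lt_of_le ha hy.1) le_rfl continuousOn_const
      (fun x _ => hasDerivWithinAt_const _ _ _) (fun x hx r hr => ?_) (Set.right_mem_Icc.2 hab)
    obtain ⟨φ, l, hl, hφ, h⟩ := hsl x (lt_of_lt_of_le ha hx.1)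
    refine Eventually.frequently ?_; filter_upwards [self_mem_nhdsWithin, hφ.eventually (gt_mem_nhds
      (show l < r by linarith [hXn x (lt_of_lt_of_le ha hx.1)]))] with y hy h2
    exact (h y hy).trans_lt h2
  have hnP : ∀ z > 0, ∀ x : L2 N, ‖convL (poisson N s z) x‖ ≤ ‖x‖ := fun z hz x => by
    refine (norm_convL_le (integrable_poisson hs0 hz) x).trans_eq ?_
    simp only [abs_of_pos (poisson_pos hs0 hz _), integral_poisson hs0 hz, one_mul]
  have hG0 : ∀ z > 0, 0 ≤ G z := by
    intro z hz; set c := 2 * s + 2 * pE N s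
    have hlim : Tendsto (fun y : ℝ => -(c * y ^ (-(2 * s)) * (‖u‖ * ‖u‖ + ‖v'‖ * ‖v'‖ + 2 * (‖u‖ * ‖v'‖)))) atTop
        (𝓝 0) := by
      simpa using (((tendsto_rpow_neg_atTop (y := 2 * s) (by positivity)).const_mul c).mul_const
        (‖u‖ * ‖u‖ + ‖v'‖ * ‖v'‖ + 2 * (‖u‖ * ‖v'‖))).neg
    refine le_of_tendsto hlim ?_; filter_upwards [eventually_ge_atTop z] with y hy
    have hy0 : 0 < y := hz.trans_le hy; refine le_trans ?_ (hGa hz hy0 hy)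
    have k : ∀ Y r x : L2 N, ‖Y‖ ≤ ‖r‖ → |⟪Y, convL (gK N s y) x⟫| ≤ c * y ^ (-(2 * s)) * (‖r‖ * ‖x‖) :=
      fun Y r x h => (abs_inner_convL_gK_le hs0 hy0 Y x).trans (mul_le_mul_of_nonneg_left
        (mul_le_mul_of_nonneg_right h (norm_nonneg _)) (by positivity))
    have k1 := abs_le.1 (k (U y) u u (hnP y hy0 u))
    have k2 := abs_le.1 (k (V y) v' v' (hnP y hy0 v'))
    have k3 := abs_le.1 (k (W y) u v' (hWn y hy0)); linarith
  have hGB : ∀ z > 0, G z ≤ s * betaC N s * (gagR s u - gagR s v) := by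
    intro z hz; set a := √(betaC N s * gagR s u); set b := √(betaC N s * gagR s v')
    have hlim := ((((tendsto_neg_inner_convL_gK hs0 hvt).const_mul (-2)).add
      ((tendsto_convL_gK hs0 hu).const_mul a)).add (((tendsto_convL_gK hs0 hvt').const_mul (b + 2 * a)))).const_add
        (s * betaC N s * gagR s u + s * betaC N s * gagR s v')
    refine (ge_of_tendsto hlim ?_).trans (by nlinarith [mul_le_mul_of_nonneg_left hvv (mul_nonneg hs0.le hb.le)])
    filter_upwards [Ioo_mem_nhdsGT hz] with y hy; refine (hGa hy.1 hz hy.2.le).trans ?_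
    have hg := integrable_gK (N := N) hs0 hy.1; have hvg : ⟪w, gv y⟫ = ⟪v, convL (gK N s y) v⟫ := by
      change ⟪w, convL (gK N s y) v'⟫ = _
      rw [hv', convL_comm hg hPi, ← inner_convL_left hPi poisson_neg, ← hv]
    have k : ∀ Y r x : L2 N, ‖Y - r‖ ≤ a * y ^ s → |⟪Y - r, x⟫| ≤ a * (y ^ s * ‖x‖) := fun Y r x h =>
      (abs_real_inner_le_norm _ _).trans ((mul_le_mul_of_nonneg_right h (norm_nonneg _)).trans_eq (mul_assoc _ _ _))
    have hUu := norm_convL_poisson_sub_le hs0 hy.1 hu; have k1 := abs_le.1 (k (U y) u (gu y) hUu)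
    have k2 := abs_le.1 (k (W y) w (gv y) ((hW0 y hy.1).trans hUu))
    have k3 : |⟪V y - v', gv y⟫| ≤ b * (y ^ s * ‖gv y‖) := (abs_real_inner_le_norm _ _).trans
      ((mul_le_mul_of_nonneg_right (norm_convL_poisson_sub_le hs0 hy.1 hvt') (norm_nonneg _)).trans_eq (mul_assoc _ _ _))
    have k3 := abs_le.1 k3
    rw [inner_sub_left] at k1 k2 k3; have e1 := neg_inner_convL_gK_le hs0 hy.1 hu
    have e2 := neg_inner_convL_gK_le hs0 hy.1 hvt'; linarith
  refine ⟨sub_nonneg.1 (nonneg_of_mul_nonneg_right ((hG0 1 one_pos).trans (hGB 1 one_pos)) (mul_pos hs0 hb)), ?_⟩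
  refine le_trans (setLIntegral_mono_ae' measurableSet_Ioi ?_)
    (lintegral_neg_deriv_le hGa hG0 fun z hz => ofReal_le_ofReal (hGB z hz))
  filter_upwards [hGa.neg.ae_differentiableWithinAt_of_mem] with z hd hz; have hz0 : 0 < z := hz
  obtain ⟨φ, l, hl, hφ, h⟩ := hsl z hz; have hd1 : HasDerivAt G (deriv G z) z := by
    have := ((hd hz).differentiableAt (Ioi_mem_nhds hz)).neg
    have e : (-fun x => -G x) = G := neg_neg G; rw [e] at this; exact this.hasDerivAt
  have h2 := le_of_tendsto_of_tendsto ((hasDerivAt_iff_tendsto_slope.1 hd1).mono_left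
    (show 𝓝[>] z ≤ _ from nhdsWithin_mono z fun y hy => ne_of_gt hy)) hφ (eventually_mem_nhdsWithin.mono h)
  refine (mul_le_mul_right (hA z hz).2 _).trans ?_
  rw [← ofReal_mul (rpow_nonneg hz0.le _)]; exact ofReal_le_ofReal (by linarith)

variable {u : Eu N → ℝ}

lemma exists_dist_poisson_le (hs : 0 < s) (hz : 0 < z) :
    ∃ B M : ℝ, 0 < M ∧ (∀ x : Eu N, poisson N s z x ≤ B) ∧
      ∀ x y : Eu N, ‖poisson N s z y - poisson N s z x‖ ≤ M * ‖x - y‖ := by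
  have hb := betaC_pos (N := N) hs
  have hp := pE_pos (N := N) hs
  have hq : ∀ x : Eu N, qK (pE N s) z x ≤ (z ^ 2) ^ (-pE N s) := fun x =>
    Real.rpow_le_rpow_of_nonpos (by positivity) (by nlinarith [sq_nonneg ‖x‖]) (by linarith)
  refine ⟨betaC N s * z ^ (2 * s) * (z ^ 2) ^ (-pE N s),
    betaC N s * z ^ (2 * s) * (2 * pE N s * z⁻¹) * (z ^ 2) ^ (-pE N s), by positivity, fun x => ?_, fun x y => ?_⟩
  · rw [poisson_eq]; gcongr; exact hq x
  · have h := norm_image_sub_le_of_norm_deriv_le_segment_01' (f := fun t : ℝ => poisson N s z (x - t • (x - y)))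
      (f' := fun t => -dP s z (x - y) (x - t • (x - y)))
      (C := betaC N s * z ^ (2 * s) * (2 * pE N s * (‖x - y‖ * z⁻¹)) * (z ^ 2) ^ (-pE N s))
      (fun t _ => by
        simp only [poisson_eq]
        refine (((hasDerivAt_qK_line hz (x - y) x t).const_mul _).congr_deriv ?_).hasDerivWithinAt
        rw [dP]; ring)
      (fun t _ => by
        rw [norm_neg]
        exact (abs_dP_le hs hz _ _).trans (mul_le_mul_of_nonneg_left (hq _) (by positivity)))
    simp only [one_smul, zero_smul, sub_zero, sub_sub_cancel] at h; refine h.trans_eq ?_; ring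

lemma tame_csExt (hs : 0 < s) (hz : 0 < z) (h0 : ∀ x, 0 ≤ u x) (hu : Integrable u) :
    ∃ L, Tame L fun x => csExt N s u x z := by
  obtain ⟨B, M, hM, hB, hL⟩ := exists_dist_poisson_le (N := N) hs hz
  have hm : ∀ x, AEStronglyMeasurable (fun y => poisson N s z (x - y) * u y) := fun x =>
    ((continuous_poisson hz).comp (continuous_const.sub continuous_id)).aestronglyMeasurable.mul hu.1
  have hb : ∀ x y, ‖poisson N s z (x - y) * u y‖ ≤ B * u y := fun x y => by
    rw [norm_of_nonneg (mul_nonneg (poisson_pos hs hz _).le (h0 y))]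
    exact mul_le_mul_of_nonneg_right (hB _) (h0 y)
  have hi : ∀ x, Integrable fun y => poisson N s z (x - y) * u y := fun x =>
    (hu.const_mul B).mono' (hm x) (ae_of_all _ (hb x))
  have hI : 0 ≤ ∫ y, u y := integral_nonneg h0
  have hM' : 0 < M * (∫ y, u y) + 1 := by positivity
  refine ⟨(M * (∫ y, u y) + 1).toNNReal, Real.toNNReal_pos.2 hM', LipschitzWith.of_dist_le_mul fun x y => ?_,
    fun x => integral_nonneg fun y => mul_nonneg (poisson_pos hs hz _).le (h0 y), ?_⟩
  · rw [dist_eq_norm, dist_eq_norm, csExt, csExt, ← integral_sub (hi x) (hi y)]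
    rw [Real.coe_toNNReal _ hM'.le]
    refine (norm_integral_le_of_norm_le (hu.const_mul (M * ‖x - y‖)) (ae_of_all _ fun w => ?_)).trans ?_
    · rw [← sub_mul, norm_mul, norm_of_nonneg (h0 w)]
      refine mul_le_mul_of_nonneg_right ((hL (y - w) (x - w)).trans_eq ?_) (h0 w)
      rw [sub_sub_sub_cancel_right, norm_sub_rev]
    · rw [integral_const_mul]; nlinarith [norm_nonneg (x - y)]
  · have : (cocompact (Eu N)).IsCountablyGenerated := by
      rw [← Metric.cobounded_eq_cocompact, ← comap_norm_atTop]; infer_instance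
    have := tendsto_integral_filter_of_dominated_convergence (l := cocompact (Eu N))
      (F := fun x y => poisson N s z (x - y) * u y) (f := fun _ => (0 : ℝ)) (fun y => B * u y) (.of_forall hm)
      (.of_forall fun x => ae_of_all _ (hb x)) (hu.const_mul B) (ae_of_all _ fun y => ?_)
    · simpa [csExt] using this
    · have h1 : Tendsto (fun x : Eu N => z ^ 2 + ‖x - y‖ ^ 2) (cocompact (Eu N)) atTop :=
        tendsto_atTop_add_const_left _ _ ((tendsto_pow_atTop two_ne_zero).comp (tendsto_norm_cocompact_atTop.comp
          (Homeomorph.subRight y).isClosedEmbedding.tendsto_cocompact))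
      have h2 := ((((tendsto_rpow_neg_atTop (pE_pos (N := N) hs)).comp h1).const_mul
        (betaC N s * z ^ (2 * s))).mul_const (u y))
      rw [mul_zero, zero_mul] at h2; refine h2.congr fun x => ?_; simp only [poisson_eq, qK, comp]

lemma sqInt_csExt (hs : 0 < s) (hz : 0 < z) (hu : Integrable u) (hq : SqInt u) :
    ∃ h : SqInt fun x => csExt N s u x z, h.memLp.toLp _ = convL (poisson N s z) (hq.memLp.toLp u) := by
  have h1 : convL (poisson N s z) (hq.memLp.toLp u) =ᵐ[volume] fun x => csExt N s u x z := by
    filter_upwards [coeFn_convL (integrable_poisson hs hz) poisson_neg (hq.memLp.toLp u)] with x hx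
    rw [hx]; refine integral_congr_ae ?_; filter_upwards [hq.memLp.coeFn_toLp] with y hy; rw [hy]
  obtain ⟨L, hL⟩ := tame_csExt hs hz hq.nonneg hu
  refine ⟨⟨hL.lip.continuous.measurable, hL.nonneg, (memLp_congr_ae h1).1 (Lp.memLp _)⟩, ?_⟩
  exact Lp.ext ((MemLp.coeFn_toLp _).trans h1.symm)

lemma SqInt.norm_toLp_starE_sub_le (hN : N ≠ 0) (hf : SqInt f) (hg : SqInt g) :
    ‖(hf.sqInt_starE hN).memLp.toLp _ - (hg.sqInt_starE hN).memLp.toLp _‖ ≤ ‖hf.memLp.toLp f - hg.memLp.toLp g‖ := by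
  rw [← sq_le_sq₀ (norm_nonneg _) (norm_nonneg _), ← MemLp.toLp_sub, ← MemLp.toLp_sub, norm_sq_toLp, norm_sq_toLp]
  exact hf.integral_sub_sq_starE_le hg hN

/-- Decrease of the energy under rearrangement, with a remainder. -/
lemma gagliardoSq_starE_add_le (hN : 2 ≤ N) (hc0 : 0 < c) (hc : IsoQ N c) (hs0 : 0 < s) (hs1 : s < 1)
    (hu : Integrable u) (hq : SqInt u) (hfin : gagliardoSq N s u ≠ ⊤) :
    gagliardoSq N s (starE u) + ofReal (isoK N ^ 2 * (2 * c) / (s * betaC N s)) *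
      ∫⁻ z in Ioi 0, ofReal (z ^ (1 - 2 * s)) *
        ∫⁻ t in Ioi 0, ofReal (defE (fun x => csExt N s u x z) t) ≤ gagliardoSq N s u := by
  have hN0 : N ≠ 0 := by lia
  have hb := betaC_pos (N := N) hs0; have hw := hq.sqInt_starE hN0
  rw [gagliardoSq_eq_gagL hw.meas hw.memLp, gagliardoSq_eq_gagL hq.meas hq.memLp]
  rw [gagliardoSq_eq_gagL hq.meas hq.memLp] at hfin
  have hf : ∀ z, ∃ h : 0 < z → SqInt fun x => csExt N s u x z, ∀ hz : 0 < z,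
      (h hz).memLp.toLp _ = convL (poisson N s z) (hq.memLp.toLp u) := fun z =>
    ⟨fun hz => (sqInt_csExt hs0 hz hu hq).1, fun hz => (sqInt_csExt hs0 hz hu hq).2⟩
  choose hf hfU using hf
  have hW : ∀ z, ∃ W : L2 N, ∀ hz : 0 < z, W = ((hf z hz).sqInt_starE hN0).memLp.toLp _ := fun z => by
    by_cases hz : 0 < z
    · simp_all
    · exact ⟨0, fun h => absurd h hz⟩
  choose W hW using hW
  set D : ℝ → ℝ≥0∞ := fun z => ∫⁻ t in Ioi 0, ofReal (defE (fun x => csExt N s u x z) t)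
  set κ := isoK N ^ 2 * (2 * c); have hκ : 0 ≤ κ := by positivity
  have key : ∀ n, gagL s (convL (poisson N s (stepN n)) (hw.memLp.toLp _)) ≤ gagL s (hq.memLp.toLp u) -
      ofReal (κ / (s * betaC N s)) * ∫⁻ z in Ioi 0, ofReal (z ^ (1 - 2 * s)) * D z ∧
      ofReal (κ / (s * betaC N s)) * ∫⁻ z in Ioi 0, ofReal (z ^ (1 - 2 * s)) * D z ≤
        gagL s (hq.memLp.toLp u) := by
    intro n; obtain ⟨h1, h2⟩ := lintegral_gain_le hN0 hs0 hs1 (stepN_pos n) hfin rfl rfl (W := W)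
      (A := fun z => ofReal κ * D z) (w := hw.memLp.toLp _)
      (fun z hz y hy => by
        rw [hW z hz, hW y hy, ← hfU z hz, ← hfU y hy]
        exact (hf z hz).norm_toLp_starE_sub_le hN0 (hf y hy))
      (fun z hz => by rw [hW z hz, ← hfU z hz]; exact (hf z hz).norm_toLp_starE_sub_le hN0 hq)
      (fun z hz => by
        have e : ‖W z‖ = ‖convL (poisson N s z) (hq.memLp.toLp u)‖ := by
          rw [hW z hz, ← hfU z hz, ← sq_eq_sq₀ (norm_nonneg _) (norm_nonneg _), norm_sq_toLp, norm_sq_toLp]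
          exact (hf z hz).integral_sq_starE hN0
        rw [e]; refine (norm_convL_le (integrable_poisson hs0 hz) _).trans_eq ?_
        simp only [abs_of_pos (poisson_pos hs0 hz _), integral_poisson hs0 hz, one_mul])
      (fun z _ => rfl)
      (fun z hz => by
        obtain ⟨L, hL⟩ := tame_csExt hs0 hz hq.nonneg hu
        rw [hW z hz, ofReal_mul (sq_nonneg _), mul_assoc]
        exact defE_le_inner hN hc0 hc hs0 hz hL (hf z hz) (hfU z hz) _ rfl)
    have hv := gagL_convL_poisson_ne_top hN0 hs0 hs1 (stepN_pos n) (hw.memLp.toLp _)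
    simp_rw [mul_left_comm _ (ofReal κ)] at h2; rw [lintegral_const_mul' _ _ ofReal_ne_top] at h2
    have h3 : ofReal (κ / (s * betaC N s)) * ∫⁻ z in Ioi 0, ofReal (z ^ (1 - 2 * s)) * D z ≤
        gagL s (hq.memLp.toLp u) - gagL s (convL (poisson N s (stepN n)) (hw.memLp.toLp _)) := by
      rw [gagL_eq hfin, gagL_eq hv, ← ofReal_sub _ gagR_nonneg, div_eq_inv_mul,
        ofReal_mul (by positivity), mul_assoc]
      refine (mul_le_mul_right h2 _).trans_eq ?_
      rw [← ofReal_mul (by positivity), inv_mul_cancel_left₀ (by positivity)]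
    have h4 : gagL s (convL (poisson N s (stepN n)) (hw.memLp.toLp _)) ≤ gagL s (hq.memLp.toLp u) := by
      rw [gagL_eq hfin, gagL_eq hv]; exact ofReal_le_ofReal h1
    exact ⟨ENNReal.le_sub_of_add_le_right ((h3.trans tsub_le_self).trans_lt hfin.lt_top).ne
      (by rw [add_comm]; exact (add_le_add_left h3 _).trans_eq (tsub_add_cancel_of_le h4)), h3.trans tsub_le_self⟩
  exact (add_le_add_left (gagL_le_of_tendsto (tendsto_convL_poisson hs0 _) fun n => (key n).1) _).trans_eq
    (tsub_add_cancel_of_le (key 0).2)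

variable {q : ℝ} {Ω : Set (Eu N)} {φ : Eu N → ℝ}

lemma gagliardoSq_const_mul (c : ℝ) (φ : Eu N → ℝ) :
    gagliardoSq N s (fun x => c * φ x) = ofReal (c ^ 2) * gagliardoSq N s φ := by
  unfold gagliardoSq
  simp_rw [← mul_sub, abs_mul, mul_pow, sq_abs c, mul_div_assoc, ofReal_mul (sq_nonneg c)]
  simp_rw [lintegral_const_mul' _ _ ofReal_ne_top]

lemma bddBelow_sobolev_class : BddBelow { c : ℝ | ∃ u : Eu N → ℝ, ContDiff ℝ (⊤ : ℕ∞) u ∧ HasCompactSupport u ∧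
    tsupport u ⊆ Ω ∧ (∫ x in Ω, |u x| ^ q) = 1 ∧ c = gagliardoSqR N s u } :=
  ⟨0, by rintro _ ⟨u, -, -, -, -, rfl⟩; exact toReal_nonneg⟩

lemma mem_sobolev_class (hq : 0 < q) (h1 : ContDiff ℝ (⊤ : ℕ∞) φ) (h2 : HasCompactSupport φ) (h3 : tsupport φ ⊆ Ω)
    (hm : 0 < ∫ x in Ω, |φ x| ^ q) :
    gagliardoSqR N s φ / (∫ x in Ω, |φ x| ^ q) ^ (2 / q) ∈ { c : ℝ | ∃ u : Eu N → ℝ, ContDiff ℝ (⊤ : ℕ∞) u ∧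
      HasCompactSupport u ∧ tsupport u ⊆ Ω ∧ (∫ x in Ω, |u x| ^ q) = 1 ∧ c = gagliardoSqR N s u } := by
  set m := ∫ x in Ω, |φ x| ^ q with hmd
  have hc : 0 < m ^ (-(1 / q)) := rpow_pos_of_pos hm _
  refine ⟨fun x => m ^ (-(1 / q)) * φ x, contDiff_const.mul h1, h2.mul_left, (closure_mono ?_).trans h3, ?_, ?_⟩
  · simp
  · simp_rw [abs_mul, mul_rpow (abs_nonneg _) (abs_nonneg _)]
    rw [integral_const_mul, abs_of_pos hc, ← rpow_mul hm.le, ← hmd, neg_mul, one_div,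
      inv_mul_cancel₀ hq.ne', Real.rpow_neg_one, inv_mul_cancel₀ hm.ne']
  · unfold gagliardoSqR
    rw [gagliardoSq_const_mul, toReal_mul, toReal_ofReal (sq_nonneg _), ← rpow_natCast,
      ← rpow_mul hm.le, div_eq_inv_mul, ← rpow_neg hm.le]
    congr 2; push_cast; ring

lemma sobolevConst_mul_le (hq : 0 < q) (h1 : ContDiff ℝ (⊤ : ℕ∞) φ) (h2 : HasCompactSupport φ) (h3 : tsupport φ ⊆ Ω)
    (hm : 0 < ∫ x in Ω, |φ x| ^ q) :
    sobolevConst N s q Ω * (∫ x in Ω, |φ x| ^ q) ^ (2 / q) ≤ gagliardoSqR N s φ :=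
  (le_div_iff₀ (rpow_pos_of_pos hm _)).1 (csInf_le bddBelow_sobolev_class (mem_sobolev_class hq h1 h2 h3 hm))

lemma starE_eq_zero {u : Eu N → ℝ} (hu : ∀ᵐ x, x ∉ Ω → u x = 0)
    (hΩ : volume Ω = volume (ball (0 : Eu N) r)) (hx : r ≤ ‖x‖) : starE u x = 0 := by
  have : lvlE u x = ∅ := by
    refine Set.eq_empty_of_forall_notMem fun t ht => ?_; refine absurd ht.2 (not_lt.2 ?_)
    refine le_trans ?_ (hΩ.trans_le (measure_mono (ball_subset_ball hx)))
    refine measure_mono_ae ?_; filter_upwards [hu] with y hy (hty : t < u y)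
    by_contra hn; rw [hy hn] at hty; exact absurd ht.1 hty.not_gt
  rw [starE, this, Real.sSup_empty]

lemma lintegral_comp_dilation {θ : ℝ} (hθ : 0 < θ) (x₀ : Eu N) (F : Eu N → ℝ≥0∞) :
    ∫⁻ x, F (θ⁻¹ • (x - x₀)) = ofReal (θ ^ N) * ∫⁻ x, F x := by
  rw [lintegral_sub_right_eq_self (fun x => F (θ⁻¹ • x))]
  have h := lintegral_map_equiv F (Homeomorph.smulOfNeZero θ⁻¹ (inv_ne_zero hθ.ne') : Eu N ≃ₜ Eu N).toMeasurableEquiv (μ := volume)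
  have h2 : Measure.map (Homeomorph.smulOfNeZero θ⁻¹ (inv_ne_zero hθ.ne') : Eu N ≃ₜ Eu N).toMeasurableEquiv volume =
      ofReal (θ ^ N) • (volume : Measure (Eu N)) := by
    have := Measure.map_addHaar_smul (volume : Measure (Eu N)) (inv_ne_zero hθ.ne')
    rw [finrank_euclideanSpace_fin, inv_pow, inv_inv, abs_of_pos (by positivity)] at this
    exact this
  rw [h2, lintegral_smul_measure] at h
  exact h.symm

lemma gagliardoSq_dilation_le {θ : ℝ} (hθ : 0 < θ) (hθ1 : θ ≤ 1) (hN : 2 * s ≤ N) (x₀ : Eu N) (w : Eu N → ℝ) :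
    gagliardoSq N s (fun x => w (θ⁻¹ • (x - x₀))) ≤ gagliardoSq N s w := by
  have key : ∀ x y : Eu N, ofReal (|w (θ⁻¹ • (x - x₀)) - w (θ⁻¹ • (y - x₀))| ^ 2 / ‖x - y‖ ^ (N + 2 * s)) =
      ofReal (θ ^ (-(N + 2 * s))) * ofReal (|w (θ⁻¹ • (x - x₀)) - w (θ⁻¹ • (y - x₀))| ^ 2 /
        ‖θ⁻¹ • (x - x₀) - θ⁻¹ • (y - x₀)‖ ^ (N + 2 * s)) := by
    intro x y
    rw [← ofReal_mul (by positivity), ← smul_sub, sub_sub_sub_cancel_right, norm_smul, norm_of_nonneg (by positivity),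
      mul_rpow (by positivity) (norm_nonneg _), inv_rpow hθ.le, rpow_neg hθ.le]
    congr 1; have := rpow_pos_of_pos hθ (N + 2 * s); grind
  unfold gagliardoSq
  simp_rw [key, lintegral_const_mul' _ _ ofReal_ne_top]
  have h1 : ∀ x : Eu N, ∫⁻ y, ofReal (|w (θ⁻¹ • (x - x₀)) - w (θ⁻¹ • (y - x₀))| ^ 2 /
        ‖θ⁻¹ • (x - x₀) - θ⁻¹ • (y - x₀)‖ ^ (N + 2 * s)) = ofReal (θ ^ N) *
      (fun x' => ∫⁻ y, ofReal (|w x' - w y| ^ 2 / ‖x' - y‖ ^ (N + 2 * s))) (θ⁻¹ • (x - x₀)) := fun x =>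
    lintegral_comp_dilation hθ x₀ (fun y' => ofReal (|w (θ⁻¹ • (x - x₀)) - w y'| ^ 2 /
        ‖θ⁻¹ • (x - x₀) - y'‖ ^ (N + 2 * s)))
  simp_rw [h1, lintegral_const_mul' _ _ ofReal_ne_top]
  rw [lintegral_comp_dilation hθ x₀ (fun x' => ∫⁻ y, ofReal (|w x' - w y| ^ 2 / ‖x' - y‖ ^ (N + 2 * s))),
    ← mul_assoc, ← mul_assoc, ← ofReal_mul (by positivity), ← ofReal_mul (by positivity)]
  refine (mul_le_mul_left (ofReal_le_one.2 ?_) _).trans_eq (one_mul _)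
  rw [← rpow_natCast, ← rpow_add hθ, ← rpow_add hθ]
  exact rpow_le_one hθ.le hθ1 (by linarith)

lemma exists_mollify {x₀ : Eu N} {ρ r : ℝ} (hm : Measurable g) (hg : MemLp g 2) (hρ : ρ < r)
    (h0 : ∀ x, x ∉ ball x₀ ρ → g x = 0) :
    ∃ φ : ℕ → Eu N → ℝ, (∀ n, ContDiff ℝ (⊤ : ℕ∞) (φ n) ∧ HasCompactSupport (φ n) ∧ tsupport (φ n) ⊆ ball x₀ r ∧
      gagliardoSq N s (φ n) ≤ gagliardoSq N s g) ∧ ∀ᵐ x, Tendsto (fun n => φ n x) atTop (𝓝 (g x)) := by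
  have hd : ∀ n : ℕ, 0 < (r - ρ) / 2 / ((n : ℝ) + 1) := fun n => div_pos (by linarith) (by positivity)
  let k : ℕ → ContDiffBump (0 : Eu N) := fun n =>
    ⟨(r - ρ) / 2 / ((n : ℝ) + 1) / 2, (r - ρ) / 2 / ((n : ℝ) + 1), half_pos (hd n), half_lt_self (hd n)⟩
  have hli : LocallyIntegrable g volume := hg.locallyIntegrable (by norm_num)
  have hk0 : Tendsto (fun n => (k n).rOut) atTop (𝓝 0) := by
    have := (tendsto_one_div_add_atTop_nhds_zero_nat (𝕜 := ℝ)).const_mul ((r - ρ) / 2)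
    simpa [k, div_eq_mul_inv] using this
  refine ⟨fun n => convolution ((k n).normed volume) g (ContinuousLinearMap.lsmul ℝ ℝ) volume, fun n => ?_,
    ContDiffBump.ae_convolution_tendsto_right_of_locallyIntegrable hk0 (K := 2)
      (.of_forall fun n => by simp only [k]; linarith) hli⟩
  have hsm := (k n).hasCompactSupport_normed.contDiff_convolution_left (ContinuousLinearMap.lsmul ℝ ℝ)
    ((k n).contDiff_normed (n := (⊤ : ℕ∞)) (μ := volume)) hli
  have hts : tsupport (convolution ((k n).normed volume) g (ContinuousLinearMap.lsmul ℝ ℝ) volume) ⊆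
      closedBall x₀ ((r - ρ) / 2 + ρ) := by
    refine closure_minimal ((support_convolution_subset _).trans ?_) Metric.isClosed_closedBall
    rintro _ ⟨a, ha, b, hb, rfl⟩; rw [(k n).support_normed_eq, mem_ball_zero_iff] at ha
    have hb : dist b x₀ < ρ := by by_contra h; exact hb (h0 b (by simpa using h))
    rw [mem_closedBall, dist_eq_norm, add_sub_assoc]
    have h1 : (k n).rOut ≤ (r - ρ) / 2 := div_le_self (by linarith) (by linarith [Nat.cast_nonneg (α := ℝ) n])
    rw [dist_eq_norm] at hb; exact (norm_add_le _ _).trans (by linarith)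
  have hae : convL ((k n).normed volume) (hg.toLp g) =ᵐ[volume]
      convolution ((k n).normed volume) g (ContinuousLinearMap.lsmul ℝ ℝ) volume := by
    filter_upwards [coeFn_convL (k n).integrable_normed (k n).normed_neg (hg.toLp g)] with x hx
    rw [hx, convolution_eq_swap]
    refine integral_congr_ae ?_; filter_upwards [hg.coeFn_toLp] with y hy; simp [hy]
  have hmem : MemLp (convolution ((k n).normed volume) g (ContinuousLinearMap.lsmul ℝ ℝ) volume) 2 :=
    (Lp.memLp _).ae_eq hae
  refine ⟨hsm, HasCompactSupport.of_support_subset_isCompact (isCompact_closedBall _ _) (subset_closure.trans hts),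
    hts.trans (Metric.closedBall_subset_ball (by linarith)), ?_⟩
  rw [gagliardoSq_eq_gagL hsm.continuous.measurable hmem, gagliardoSq_eq_gagL hm hg]
  have e : hmem.toLp _ = convL ((k n).normed volume) (hg.toLp g) := by
    refine Lp.ext (hmem.coeFn_toLp.trans hae.symm)
  rw [e]
  refine gagL_convL_le (k n).integrable_normed ?_ _
  simp_rw [abs_of_nonneg ((k n).nonneg_normed _)]
  exact (k n).integral_normed.le

lemma sobolevConst_ball_le {w : Eu N → ℝ} {x₀ : Eu N} (hr : 0 < r) (hq : 0 < q) (hN : 2 * s ≤ N)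
    (hw : SqInt w) (h0 : ∀ x, r ≤ ‖x‖ → w x = 0) (h1 : 1 ≤ ∫⁻ x, ofReal (w x ^ q))
    (hfin : gagliardoSq N s w ≠ ⊤) :
    sobolevConst N s q (ball x₀ r) ≤ gagliardoSqR N s w := by
  by_contra hlt
  rw [not_le] at hlt
  set l := sobolevConst N s q (ball x₀ r)
  set W := gagliardoSqR N s w
  have hW0 : 0 ≤ W := toReal_nonneg
  have hl : 0 < l := hW0.trans_lt hlt
  have key : ∀ θ : ℝ, 0 < θ → θ < 1 → θ ^ N ≤ (W / l) ^ (q / 2) := by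
    intro θ hθ hθ1; have hd : MemLp (fun x => w (θ⁻¹ • (x - x₀))) 2 := by
      have hmm : Measurable fun x => w (θ⁻¹ • (x - x₀)) := hw.meas.comp (by fun_prop)
      rw [memLp_two_iff_integrable_sq hmm.aestronglyMeasurable]
      refine ⟨(hmm.pow_const 2).aestronglyMeasurable, ?_⟩
      rw [hasFiniteIntegral_iff_ofReal (ae_of_all _ fun x => sq_nonneg _),
        lintegral_comp_dilation hθ x₀ fun x => ofReal (w x ^ 2)]
      exact mul_lt_top ofReal_lt_top hw.lintegral_lt_top
    obtain ⟨φ, h2, h3⟩ := exists_mollify (s := s) (ρ := θ * r) (r := r) (x₀ := x₀)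
      (hw.meas.comp (by fun_prop)) hd (by nlinarith) (fun x hx => h0 _ (by
        rw [mem_ball, not_lt, dist_eq_norm] at hx
        rw [norm_smul, norm_of_nonneg (by positivity), ← div_eq_inv_mul, le_div_iff₀ hθ]; linarith))
    have hm : ∀ n, ∫⁻ x, ofReal (|φ n x| ^ q) ≤ ofReal ((W / l) ^ (q / 2)) := by
      intro n; obtain ⟨ha, hb, hc, hg⟩ := h2 n; have hi : Integrable fun x => |φ n x| ^ q := by
        refine Continuous.integrable_of_hasCompactSupport
          (ha.continuous.abs.rpow_const fun _ => Or.inr hq.le) (hb.mono fun x hx h => hx ?_)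
        simp [h, zero_rpow hq.ne']
      have hn : ∀ x, 0 ≤ |φ n x| ^ q := fun x => rpow_nonneg (abs_nonneg _) _
      rw [← ofReal_integral_eq_lintegral_ofReal hi (ae_of_all _ hn)]; refine ofReal_le_ofReal ?_
      rw [← setIntegral_eq_integral_of_forall_compl_eq_zero (s := ball x₀ r) fun x hx => by
        rw [image_eq_zero_of_notMem_tsupport fun h => hx (hc h), abs_zero, zero_rpow hq.ne']]
      have hm0 : 0 ≤ ∫ x in ball x₀ r, |φ n x| ^ q := integral_nonneg hn
      rcases hm0.eq_or_lt with h | h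
      · rw [← h]; positivity
      · have hh := (sobolevConst_mul_le hq ha hb hc h).trans
          (toReal_mono hfin (hg.trans (gagliardoSq_dilation_le hθ hθ1.le hN x₀ w)))
        rw [mul_comm, ← le_div_iff₀ hl] at hh
        have := rpow_le_rpow (rpow_nonneg hm0 _) hh (half_pos hq).le
        rwa [← rpow_mul hm0, show 2 / q * (q / 2) = 1 by field_simp, rpow_one] at this
    have hF := lintegral_liminf_le (u := atTop) (μ := volume) (f := fun n x => ofReal (|φ n x| ^ q)) fun n =>
      (((h2 n).1.continuous.measurable.abs).pow_const q).ennreal_ofReal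
    have e : ∫⁻ x, liminf (fun n => ofReal (|φ n x| ^ q)) atTop =
        ofReal (θ ^ N) * ∫⁻ x, ofReal (w x ^ q) := by
      rw [← lintegral_comp_dilation hθ x₀ fun x => ofReal (w x ^ q)]
      refine lintegral_congr_ae ?_; filter_upwards [h3] with x hx
      rw [(tendsto_ofReal (hx.abs.rpow_const (Or.inr hq.le))).liminf_eq, comp_apply, abs_of_nonneg (hw.nonneg _)]
    rw [e] at hF
    refine (ofReal_le_ofReal_iff (by positivity)).1 (((le_mul_of_one_le_right' h1).trans hF).trans ?_)
    exact (liminf_le_liminf (.of_forall hm)).trans_eq (liminf_const _)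
  have hlt1 : (W / l) ^ (q / 2) < 1 :=
    Real.rpow_lt_one (by positivity) ((div_lt_one hl).2 hlt) (half_pos hq)
  have hlim : Tendsto (fun θ : ℝ => θ ^ N) (𝓝[<] 1) (𝓝 1) := by
    have : ContinuousAt (fun θ : ℝ => θ ^ N) 1 := by fun_prop
    simpa using this.tendsto.mono_left nhdsWithin_le_nhds
  refine absurd (le_of_tendsto hlim ?_) (not_le.2 hlt1)
  filter_upwards [Ioo_mem_nhdsLT (zero_lt_one (α := ℝ))] with θ hθ using key θ hθ.1 hθ.2

lemma exists_lintegral_ge (hN : N ≠ 0) (hs0 : 0 < s) (hq : 0 < q) : ∃ c : ℝ, 0 < c ∧ ∀ φ : Eu N → ℝ, Measurable φ →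
    ∫⁻ x, ofReal (|φ x| ^ q) ≤ 1 → ∀ x, 0 < |φ x| → ofReal (c * |φ x| ^ (2 + 2 * s * q / N)) ≤
      ∫⁻ y, ofReal (|φ x - φ y| ^ 2 / ‖x - y‖ ^ (N + 2 * s)) := by
  have hω := omegaB_pos N
  have hN' : (0 : ℝ) < N := by positivity
  set p := (N : ℝ) + 2 * s with hp
  refine ⟨1 / 8 * omegaB N ^ (p / N) * ((2 * 2 ^ q) ^ (-(2 * s / N))), by positivity, fun φ hφ h1 x hx => ?_⟩
  set t := |φ x| with ht
  set a : ℝ := (2 / t) ^ q with ha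
  have ha0 : 0 < a := by positivity
  have hch : volume {y | t / 2 < |φ y|} ≤ ofReal a := by
    have h := mul_meas_ge_le_lintegral (μ := volume) ((hφ.abs.pow_const q).ennreal_ofReal) (ofReal ((t / 2) ^ q))
    have h2 : ofReal ((t / 2) ^ q) * volume {y | t / 2 < |φ y|} ≤ 1 := by
      refine le_trans (mul_le_mul_right (measure_mono fun y hy => ?_) _) (h.trans h1)
      exact ofReal_le_ofReal (rpow_le_rpow (by positivity) (le_of_lt hy) hq.le)
    have e : ofReal a * ofReal ((t / 2) ^ q) = 1 := by
      rw [← ofReal_mul ha0.le, ha, ← mul_rpow (by positivity) (by positivity),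
        show 2 / t * (t / 2) = 1 by field_simp, one_rpow, ofReal_one]
    calc _ = ofReal a * (ofReal ((t / 2) ^ q) * volume {y | t / 2 < |φ y|}) := by
          rw [← mul_assoc, e, one_mul]
      _ ≤ _ := (mul_le_mul_right h2 _).trans_eq (mul_one _)
  set R := ((2 * a) / omegaB N) ^ (1 / (N : ℝ)) with hR
  have hR0 : 0 < R := by positivity
  have hRv : volume (ball x R) = ofReal (2 * a) := by
    rw [volume_ball_eu x hR0, hR, ← rpow_natCast, ← rpow_mul (by positivity), one_div,
      inv_mul_cancel₀ hN'.ne', rpow_one, mul_div_cancel₀ _ hω.ne']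
  have hms : MeasurableSet {y | t / 2 < |φ y|} := measurableSet_lt measurable_const hφ.abs
  have hA : ofReal a ≤ volume (ball x R \ {y | t / 2 < |φ y|}) := by
    refine le_trans ?_ le_measure_diff; rw [hRv]; refine le_trans ?_ (tsub_le_tsub_left hch _)
    rw [← ofReal_sub _ ha0.le]; exact ofReal_le_ofReal (by linarith)
  have e : 1 / 8 * omegaB N ^ (p / N) * ((2 * 2 ^ q) ^ (-(2 * s / N))) * t ^ (2 + 2 * s * q / N) =
      (t / 2) ^ 2 / R ^ p * a := by
    have e1 : R ^ p = ((2 * a) ^ (p / N)) / omegaB N ^ (p / N) := by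
      rw [hR, ← rpow_mul (by positivity), div_rpow (by positivity) hω.le, one_div_mul_eq_div]
    have e2 : (2 * a) ^ (p / N) = (2 * a) * (2 * a) ^ (2 * s / N) := by
      rw [hp, add_div, div_self hN'.ne', rpow_add (by positivity), rpow_one]
    have e3 : (2 * a) ^ (2 * s / N) = (2 * 2 ^ q) ^ (2 * s / N) / t ^ (2 * s * q / N) := by
      rw [ha, div_rpow zero_le_two hx.le, ← mul_div_assoc, div_rpow (by positivity) (by positivity),
        ← rpow_mul hx.le]
      congr 2; ring
    rw [e1, e2, e3, rpow_add hx, rpow_neg (by positivity), rpow_two]; grind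
  rw [e, ofReal_mul (by positivity)]
  refine (mul_le_mul_right hA _).trans ?_
  rw [← setLIntegral_const]
  refine (setLIntegral_mono' (measurableSet_ball.diff hms) fun y hy => ofReal_le_ofReal ?_).trans
    (setLIntegral_le_lintegral _ _)
  have hy2 : |φ y| ≤ t / 2 := by simpa using hy.2
  have hxy : 0 < ‖x - y‖ := by grind [norm_pos_iff, sub_ne_zero]
  have hyR : ‖x - y‖ ≤ R := by rw [← dist_eq_norm, dist_comm]; exact (mem_ball.1 hy.1).le
  have := abs_sub_abs_le_abs_sub (φ x) (φ y)
  exact div_le_div₀ (sq_nonneg _) (pow_le_pow_left₀ (by positivity) (by linarith) 2) (by positivity)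
    (rpow_le_rpow (norm_nonneg _) hyR (by positivity : 0 < p).le)

lemma exists_gagliardoSq_ge (hN : N ≠ 0) (hs0 : 0 < s) (hq : 0 < q) : ∃ c : ℝ, 0 < c ∧ ∀ φ : Eu N → ℝ, Measurable φ →
    ∫⁻ x, ofReal (|φ x| ^ q) ≤ 1 → ∀ T β : ℝ, 0 < T → β ≤ 2 + 2 * s * q / N →
      ofReal (c * T ^ (2 + 2 * s * q / N - β)) * ∫⁻ x in {x | T ≤ |φ x|}, ofReal (|φ x| ^ β) ≤
        gagliardoSq N s φ := by
  obtain ⟨c, hc, h⟩ := exists_lintegral_ge hN hs0 hq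
  refine ⟨c, hc, fun φ hφ h1 T β hT hβ => ?_⟩
  rw [← lintegral_const_mul' _ _ ofReal_ne_top]
  refine (setLIntegral_mono' (measurableSet_le measurable_const hφ.abs) fun x (hx : T ≤ |φ x|) => ?_).trans
    (setLIntegral_le_lintegral _ _)
  have hx0 : 0 < |φ x| := hT.trans_le hx
  refine le_trans ?_ (h φ hφ h1 x hx0)
  rw [← ofReal_mul (by positivity), mul_assoc]
  refine ofReal_le_ofReal (mul_le_mul_of_nonneg_left ?_ hc.le)
  refine (mul_le_mul_of_nonneg_right (rpow_le_rpow hT.le hx (sub_nonneg.2 hβ)) (by positivity)).trans_eq ?_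
  rw [← rpow_add hx0, sub_add_cancel]

lemma setLIntegral_compl_le {φ : Eu N → ℝ} (hφ : Measurable φ) (h0 : ∀ᵐ x, x ∉ Ω → φ x = 0) (hΩ : MeasurableSet Ω) {T β : ℝ} (hβ : 0 < β) :
    ∫⁻ x in {x | T ≤ |φ x|}ᶜ, ofReal (|φ x| ^ β) ≤ ofReal (T ^ β) * volume Ω := by
  rw [← lintegral_indicator_const hΩ]
  refine le_trans ?_ (setLIntegral_le_lintegral {x | T ≤ |φ x|}ᶜ _)
  refine lintegral_mono_ae ((ae_restrict_iff' (measurableSet_le measurable_const hφ.abs).compl).2 ?_)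
  filter_upwards [h0] with x hx hxT
  by_cases hxΩ : x ∈ Ω
  · rw [indicator_of_mem hxΩ]
    exact ofReal_le_ofReal (rpow_le_rpow (abs_nonneg _) (not_le.1 (show ¬ T ≤ |φ x| from hxT)).le hβ.le)
  · simp [hx hxΩ, zero_rpow hβ.ne']

lemma lintegral_sq_lt_top_of_gagliardoSq (hN : N ≠ 0) (hs0 : 0 < s) (hq : 0 < q) {φ : Eu N → ℝ} (hφ : Measurable φ)
    (h0 : ∀ᵐ x, x ∉ Ω → φ x = 0) (hΩ : MeasurableSet Ω) (hΩf : volume Ω ≠ ⊤) (h1 : ∫⁻ x, ofReal (|φ x| ^ q) ≤ 1)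
    (hfin : gagliardoSq N s φ ≠ ⊤) : ∫⁻ x, ofReal (|φ x| ^ (2 : ℝ)) < ⊤ := by
  obtain ⟨c, hc, h⟩ := exists_gagliardoSq_ge (N := N) hN hs0 hq
  have hb := h φ hφ h1 1 2 one_pos (le_add_of_nonneg_right (by positivity))
  rw [one_rpow, mul_one] at hb
  rw [← lintegral_add_compl _ (measurableSet_le (measurable_const (a := (1 : ℝ))) hφ.abs)]
  refine ENNReal.add_lt_top.2 ⟨?_, (setLIntegral_compl_le hφ h0 hΩ two_pos).trans_lt
    (mul_lt_top ofReal_lt_top hΩf.lt_top)⟩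
  by_contra ht
  rw [not_lt_top_iff.1 ht, mul_top (by simpa using hc)] at hb
  exact hfin (top_le_iff.1 hb)

lemma exists_gagliardoSq_ge_pos (hN : N ≠ 0) (hs0 : 0 < s) (hq : 0 < q) (hqa : q ≤ 2 + 2 * s * q / N)
    (hΩ : MeasurableSet Ω) (hΩ0 : 0 < volume Ω) (hΩf : volume Ω ≠ ⊤) :
    ∃ c : ℝ, 0 < c ∧ ∀ φ : Eu N → ℝ, Measurable φ → (∀ᵐ x, x ∉ Ω → φ x = 0) → ∫⁻ x, ofReal (|φ x| ^ q) = 1 →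
      ofReal c ≤ gagliardoSq N s φ := by
  obtain ⟨c, hc, h⟩ := exists_gagliardoSq_ge (N := N) hN hs0 hq
  have hv : 0 < vol Ω := toReal_pos hΩ0.ne' hΩf
  set T : ℝ := (1 / (2 * vol Ω)) ^ (1 / q) with hT
  refine ⟨c * T ^ (2 + 2 * s * q / N - q) * (1 / 2), by positivity, fun φ hφ h0 h1 => ?_⟩
  refine le_trans ?_ (h φ hφ h1.le T q (by positivity : 0 < T) hqa)
  rw [ofReal_mul (by positivity)]
  refine mul_le_mul_right ?_ _
  have h2 := setLIntegral_compl_le hφ h0 hΩ hq (T := T)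
  rw [hT, ← rpow_mul (by positivity), one_div_mul_cancel hq.ne', rpow_one, ← hT,
    ← ofReal_toReal hΩf, ← ofReal_mul (by positivity)] at h2
  change _ ≤ ofReal (1 / (2 * vol Ω) * vol Ω) at h2
  rw [show 1 / (2 * vol Ω) * vol Ω = 1 / 2 by field_simp] at h2
  rw [← lintegral_add_compl _ (measurableSet_le (measurable_const (a := T)) hφ.abs)] at h1
  by_contra hlt
  rw [not_le] at hlt
  have h3 := (ENNReal.add_lt_add_of_lt_of_le (h2.trans_lt ofReal_lt_top).ne hlt h2).ne
  rw [h1, ← ofReal_add (by norm_num) (by norm_num)] at h3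
  norm_num at h3

lemma gagliardoSq_ne_top_of_smooth (hN : N ≠ 0) (hs0 : 0 < s) (hs1 : s < 1) {φ : Eu N → ℝ} (h1 : ContDiff ℝ (⊤ : ℕ∞) φ)
    (h2 : HasCompactSupport φ) : gagliardoSq N s φ ≠ ⊤ := by
  obtain ⟨L, hL⟩ := h1.lipschitzWith_of_hasCompactSupport h2 (by simp)
  have hm : MemLp φ 2 := h1.continuous.memLp_of_hasCompactSupport h2
  rw [gagliardoSq_eq_gagL h1.continuous.measurable hm]
  refine gagL_ne_top hN hs0 hs1 (M := L * √(2 * vol (tsupport φ))) fun y => ?_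
  have hK : Integrable ((tsupport φ).indicator fun _ => (1 : ℝ)) :=
    (integrable_indicator_iff (isClosed_tsupport φ).measurableSet).2 (integrableOn_const h2.measure_lt_top.ne)
  have hK2 := hK.comp_add_right y
  have hg := (hm.comp_measurePreserving (measurePreserving_add_right volume y)).sub hm
  rw [← sq_le_sq₀ (norm_nonneg _) (by positivity), tau_toLp, ← MemLp.toLp_sub, norm_sq_toLp hg]
  have e : ∫ x, (L : ℝ) ^ 2 * ‖y‖ ^ 2 * ((tsupport φ).indicator (fun _ => (1 : ℝ)) x +
      (tsupport φ).indicator (fun _ => (1 : ℝ)) (x + y)) = (L * √(2 * vol (tsupport φ)) * ‖y‖) ^ 2 := by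
    rw [integral_const_mul, integral_add hK hK2, integral_add_right_eq_self ((tsupport φ).indicator fun _ => (1 : ℝ)),
      integral_indicator_const _ (isClosed_tsupport φ).measurableSet, mul_pow, mul_pow, sq_sqrt (by positivity)]
    simp only [smul_eq_mul]; ring
  rw [← e]
  refine integral_mono hg.integrable_sq ((hK.add hK2).const_mul _) fun x => ?_
  have hx0 : ∀ z, z ∉ tsupport φ → φ z = 0 := fun z hz => image_eq_zero_of_notMem_tsupport hz
  have hd : (φ (x + y) - φ x) ^ 2 ≤ (L : ℝ) ^ 2 * ‖y‖ ^ 2 := by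
    rw [← mul_pow, ← sq_abs]
    have := hL.dist_le_mul (x + y) x; rw [dist_eq, dist_eq_norm, add_sub_cancel_left] at this
    exact pow_le_pow_left₀ (abs_nonneg _) this 2
  change (φ (x + y) - φ x) ^ 2 ≤ _
  by_cases ha : x ∈ tsupport φ <;> by_cases hb : x + y ∈ tsupport φ <;>
    simp only [ha, hb, indicator_of_mem, indicator_of_notMem, not_false_eq_true]
  · nlinarith [sq_nonneg ((L : ℝ) * ‖y‖)]
  · linarith
  · linarith
  · rw [hx0 _ ha, hx0 _ hb]; simp

lemma sobolevConst_pos (hN : N ≠ 0) (hs0 : 0 < s) (hs1 : s < 1) (hq : 0 < q) (hqa : q ≤ 2 + 2 * s * q / N)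
    (hΩ : IsOpen Ω) (hΩ0 : 0 < volume Ω) (hΩf : volume Ω ≠ ⊤) : 0 < sobolevConst N s q Ω := by
  obtain ⟨c, hc, h⟩ := exists_gagliardoSq_ge_pos hN hs0 hq hqa hΩ.measurableSet hΩ0 hΩf
  refine hc.trans_le (le_csInf ?_ ?_)
  · obtain ⟨x, hx⟩ := nonempty_of_measure_ne_zero hΩ0.ne'
    obtain ⟨ε, hε, hb⟩ := Metric.isOpen_iff.1 hΩ x hx
    let φ : ContDiffBump x := ⟨ε / 4, ε / 2, by positivity, by linarith⟩
    have ht : tsupport φ ⊆ Ω := by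
      rw [φ.tsupport_eq]; exact (Metric.closedBall_subset_ball (half_lt_self hε)).trans hb
    refine ⟨_, mem_sobolev_class hq φ.contDiff φ.hasCompactSupport ht ?_⟩
    have hcont : Continuous fun y => |φ y| ^ q := φ.continuous.abs.rpow_const fun _ => Or.inr hq.le
    rw [setIntegral_eq_integral_of_forall_compl_eq_zero fun y hy => by
        rw [image_eq_zero_of_notMem_tsupport fun h => hy (ht h), abs_zero, zero_rpow hq.ne']]
    refine hcont.integral_pos_of_hasCompactSupport_nonneg_nonzero (φ.hasCompactSupport.mono fun y hy h => hy ?_)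
      (fun y => by positivity) (x := x) ?_
    · simp [h, zero_rpow hq.ne']
    · rw [φ.one_of_mem_closedBall (Metric.mem_closedBall_self (by positivity))]; simp
  · rintro _ ⟨φ, h1, h2, h3, h4, rfl⟩
    have h0 : ∀ x, x ∉ Ω → φ x = 0 := fun x hx => image_eq_zero_of_notMem_tsupport fun h => hx (h3 h)
    refine (ENNReal.ofReal_le_iff_le_toReal (gagliardoSq_ne_top_of_smooth hN hs0 hs1 h1 h2)).1
      (h φ h1.continuous.measurable (ae_of_all _ h0) ?_)
    have hi : Integrable fun x => |φ x| ^ q := by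
      refine Continuous.integrable_of_hasCompactSupport
        (h1.continuous.abs.rpow_const fun _ => Or.inr hq.le) (h2.mono fun x hx h => hx ?_)
      simp [h, zero_rpow hq.ne']
    rw [← ofReal_integral_eq_lintegral_ofReal hi (ae_of_all _ fun x => rpow_nonneg (abs_nonneg _) _),
      ← setIntegral_eq_integral_of_forall_compl_eq_zero (s := Ω) fun x hx => by
        rw [h0 x hx, abs_zero, zero_rpow hq.ne'], h4, ofReal_one]

lemma lintegral_rpow_eq_one {q : ℝ} {Ω : Set (Eu N)} {u : Eu N → ℝ} (hΩ : MeasurableSet Ω) (hq : 0 < q)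
    (h0 : ∀ x, 0 ≤ u x) (hz : ∀ᵐ x, x ∉ Ω → u x = 0) (h1 : ∫ x in Ω, u x ^ q = 1) :
    ∫⁻ x, ofReal (u x ^ q) = 1 := by
  have hi : Integrable (fun x => u x ^ q) (volume.restrict Ω) := by
    by_contra h; rw [integral_undef h] at h1; exact zero_ne_one h1
  have hc : ∫⁻ x in Ωᶜ, ofReal (u x ^ q) = 0 := by
    refine (lintegral_congr_ae ((ae_restrict_iff' hΩ.compl).2 ?_)).trans lintegral_zero
    filter_upwards [hz] with x hx hxΩ; rw [hx hxΩ, zero_rpow hq.ne', ofReal_zero]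
  rw [← lintegral_add_compl _ hΩ, hc, add_zero, ← ofReal_integral_eq_lintegral_ofReal hi
    (ae_of_all _ fun x => rpow_nonneg (h0 x) _), h1, ofReal_one]

end

open Classical in
/-- **Enhanced Pólya–Szegő–type estimate** (Proposition 4.5): there is `C₁ = C₁(N,s) > 0`
such that for every admissible `q`, every open bounded `Ω` with a first minimizer `u`, and
every ball `B` with `|B| = |Ω|`,
`λ_{s,q}(Ω) - λ_{s,q}(B) ≥ C₁ ∫₀^∞ z^{1-2s} ∫₀^∞ A(E_{t,z})² μ_z(t)^{2(N-1)/N}/(-μ_z'(t)) dt dz`,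
with the integrand set to `0` where `μ_z` is not differentiable or has vanishing derivative
(and `A(E) = 0` when `|E| = 0`, which holds by definition of `asym`). -/
theorem enhanced_polya_szego
    (N : ℕ) (hN : 2 ≤ N) (s : ℝ) (hs0 : 0 < s) (hs1 : s < 1) :
    ∃ C₁ : ℝ, 0 < C₁ ∧
      ∀ q : ℝ, 1 ≤ q → q < 2 * N / ((N : ℝ) - 2 * s) →
      ∀ Ω : Set (Eu N), IsOpen Ω → Bornology.IsBounded Ω → 0 < volume Ω →
      ∀ u : Eu N → ℝ, IsFirstMinimizer N s q Ω u →
      ∀ (x₀ : Eu N) (r : ℝ), 0 < r → volume (Metric.ball x₀ r) = volume Ω →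
        ENNReal.ofReal (sobolevConst N s q Ω - sobolevConst N s q (Metric.ball x₀ r))
          ≥ ENNReal.ofReal C₁ *
            ∫⁻ z in Set.Ioi (0 : ℝ), ENNReal.ofReal (z ^ (1 - 2 * s)) *
              ∫⁻ t in Set.Ioi (0 : ℝ), ENNReal.ofReal
                (if DifferentiableAt ℝ (distFn N s u z) t ∧ deriv (distFn N s u z) t ≠ 0
                 then asym N {x | t < csExt N s u x z} ^ 2
                    * distFn N s u z t ^ (2 * ((N : ℝ) - 1) / N)
                    / (- deriv (distFn N s u z) t)
                 else 0) := by
  have hN0 : N ≠ 0 := by lia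
  obtain ⟨c, hc0, hc⟩ := exists_isoQ N hN0
  have hb := betaC_pos (N := N) hs0
  have hω := omegaB_pos N
  have hK : 0 < isoK N := mul_pos (by positivity) (rpow_pos_of_pos hω _)
  refine ⟨isoK N ^ 2 * (2 * c) / (s * betaC N s), by positivity, ?_⟩
  intro q hq1 hq2 Ω hΩo hΩb hΩ0 u hu x₀ r hr hvol
  have hq : 0 < q := by linarith
  have hN2 : (2 : ℝ) ≤ N := by exact_mod_cast hN
  have hqa : q ≤ 2 + 2 * s * q / N := by
    have hd : 0 < (N : ℝ) - 2 * s := by linarith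
    rw [lt_div_iff₀ hd] at hq2
    rw [← sub_le_iff_le_add', le_div_iff₀ (by linarith)]
    linarith
  have hΩf : volume Ω ≠ ⊤ := hΩb.measure_lt_top.ne
  obtain ⟨hum, hu0, huz, hu1, hue, -⟩ := hu
  have hlint : ∫⁻ x, ofReal (u x ^ q) = 1 := lintegral_rpow_eq_one hΩo.measurableSet hq hu0 huz hu1
  have hpos := sobolevConst_pos hN0 hs0 hs1 hq hqa hΩo hΩ0 hΩf
  have hfin : gagliardoSq N s u ≠ ⊤ := by
    intro h
    rw [← hue, gagliardoSqR, h] at hpos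
    simp at hpos
  have hl2 := lintegral_sq_lt_top_of_gagliardoSq hN0 hs0 hq hum huz hΩo.measurableSet hΩf
    (by simp_rw [abs_of_nonneg (hu0 _)]; exact hlint.le) hfin
  simp only [rpow_two, sq_abs] at hl2
  have hsq : SqInt u := ⟨hum, hu0, by
    rw [memLp_two_iff_integrable_sq hum.aestronglyMeasurable]
    exact ⟨(hum.pow_const 2).aestronglyMeasurable, (hasFiniteIntegral_iff_ofReal (ae_of_all _ fun x => sq_nonneg _)).2 hl2⟩⟩
  have hvi : Integrable u := by
    have hon : Integrable u (volume.restrict Ω) := by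
      have : IsFiniteMeasure (volume.restrict Ω) := ⟨by simpa using hΩf.lt_top⟩
      exact (hsq.memLp.restrict Ω).integrable (by norm_num)
    refine IntegrableOn.integrable_of_ae_notMem_eq_zero hon huz
  have hmain := gagliardoSq_starE_add_le hN hc0 hc hs0 hs1 hvi hsq hfin
  have hsfin : gagliardoSq N s (starE u) ≠ ⊤ := ((le_self_add.trans hmain).trans_lt hfin.lt_top).ne
  have hball : sobolevConst N s q (ball x₀ r) ≤ gagliardoSqR N s (starE u) := by
    refine sobolevConst_ball_le hr hq (by linarith) (hsq.sqInt_starE hN0) (fun x hx => starE_eq_zero huz ?_ hx)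
      (by rw [hsq.lintegral_rpow_starE hN0 hq, hlint]) hsfin
    rw [← hvol, volume_ball_eu _ hr, volume_ball_eu _ hr]
  refine ge_iff_le.2 (le_trans ?_ (ofReal_le_ofReal (sub_le_sub_left hball _)))
  rw [← hue, gagliardoSqR, gagliardoSqR, ofReal_sub _ toReal_nonneg, ofReal_toReal hfin,
    ofReal_toReal hsfin]
  refine ENNReal.le_sub_of_add_le_left hsfin ?_
  have hdist : ∀ z, distFn N s u z = momE (fun x => csExt N s u x z) 0 := fun z => funext fun t =>
    (momE_zero _ t).symm
  simp_rw [hdist]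
  convert hmain using 10
  simp only [defE]
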